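/- There exists a function h : [0,1] × [0,1] → ℝ with the following two properties. (i) For every fixed pair of reals 0 ≤ u < v ≤ 1, H(x, x^u, x^v)/x converges to h(u, v) as x → ∞. (ii) There is an absolute constant C > 0 such that for all reals x, y, z with 3 ≤ y < z ≤ √x, one has |H(x, y, z) − x · h(log y / log x, log z / log x)| ≤ C · x / ((log y)^δ · (log log y)^{3/2}). -/

import Mathlib

open Filter

/-- `Hcnt x y z` is the number of integers `n` with `1 ≤ n ≤ x` having a divisor `d`
with `y < d < z`. -/
noncomputable def Hcnt (x y z : ℝ) : ℕ :=
  {n : ℕ | 1 ≤ n ∧ (n : ℝ) ≤ x ∧ ∃ d : ℕ, d ∣ n ∧ y < (d : ℝ) ∧ (d : ℝ) < z}.ncard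

/-- The Erdős constant `δ = 1 - (1 + log log 2)/log 2`. -/
noncomputable def erdosDelta : ℝ := 1 - (1 + Real.log (Real.log 2)) / Real.log 2


namespace FF

lemma delta_pos : 0 < erdosDelta := by
  unfold erdosDelta
  have h2 : 0 < Real.log 2 := Real.log_pos (by norm_num)
  have h : Real.log (Real.log 2) < Real.log 2 - 1 :=
    Real.log_lt_sub_one_of_pos h2 (by linarith [Real.log_two_lt_d9])
  rw [sub_pos, div_lt_one h2]; linarith

lemma delta_lt : erdosDelta < 1/8 := by
  unfold erdosDelta
  have h2 : 0 < Real.log 2 := Real.log_pos (by norm_num)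
  have l1 := Real.log_two_gt_d9
  -- log t ≥ -4 (t^{-1/4} - 1) ; use s with s^4 ≥ 1/t
  have h : -(0.3842:ℝ) ≤ Real.log (Real.log 2) := by
    have e : Real.log (Real.log 2) = -(4 * Real.log ((Real.log 2)⁻¹ ^ ((1:ℝ)/4))) := by
      rw [Real.log_rpow (by positivity), Real.log_inv]; ring
    have b : (Real.log 2)⁻¹ ^ ((1:ℝ)/4) ≤ 1.09605 := by
      have : (Real.log 2)⁻¹ ≤ (1.09605:ℝ)^(4:ℝ) := by
        rw [inv_le_comm₀ h2 (by positivity)]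
        refine le_trans ?_ l1.le
        norm_num
      calc _ ≤ ((1.09605:ℝ)^(4:ℝ))^((1:ℝ)/4) := by gcongr
        _ = _ := by rw [← Real.rpow_mul (by norm_num)]; norm_num
    have := Real.log_le_sub_one_of_pos (show 0 < (Real.log 2)⁻¹ ^ ((1:ℝ)/4) by positivity)
    rw [e]; linarith
  have : 0.875 * Real.log 2 < 1 + Real.log (Real.log 2) := by linarith [Real.log_two_lt_d9]
  have : 0.875 < (1 + Real.log (Real.log 2)) / Real.log 2 := by rwa [lt_div_iff₀ h2]
  linarith

end FF

namespace FF
open scoped ENNReal BigOperators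
open Finset Real

local notation "Λ" => ArithmeticFunction.vonMangoldt

/-- Poisson weight of a count vector. -/
noncomputable def pois {ι : Type*} [Fintype ι] (w : ι → ℝ≥0∞) (c : ι → ℕ) : ℝ≥0∞ :=
  ∏ a, w a ^ c a / ((c a).factorial : ℝ≥0∞)

/-- `c + e_a` -/
def bump {ι : Type*} [DecidableEq ι] (a : ι) (c : ι → ℕ) : ι → ℕ := Function.update c a (c a + 1)

lemma bump_inj {ι : Type*} [DecidableEq ι] (a : ι) : Function.Injective (bump a) := by
  intro c c' h
  funext b
  have := congrFun h b
  by_cases hb : b = a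
  · subst hb; simpa [bump] using this
  · simpa [bump, hb] using this

lemma pois_bump {ι : Type*} [Fintype ι] [DecidableEq ι] (w : ι → ℝ≥0∞) (a : ι) (c : ι → ℕ) :
    ((bump a c) a : ℝ≥0∞) * pois w (bump a c) = w a * pois w c := by
  unfold pois
  rw [← Finset.mul_prod_erase univ _ (mem_univ a), ← Finset.mul_prod_erase univ _ (mem_univ a)]
  have h1 : ∏ x ∈ univ.erase a, w x ^ (bump a c) x / (((bump a c) x).factorial : ℝ≥0∞)
      = ∏ x ∈ univ.erase a, w x ^ c x / ((c x).factorial : ℝ≥0∞) := by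
    apply Finset.prod_congr rfl
    intro x hx
    have : x ≠ a := (Finset.mem_erase.1 hx).1
    simp [bump, this]
  rw [h1, ← mul_assoc, ← mul_assoc]
  congr 1
  have h2 : bump a c a = c a + 1 := by simp [bump]
  rw [h2, Nat.factorial_succ, pow_succ, ENNReal.div_eq_inv_mul, ENNReal.div_eq_inv_mul]
  push_cast
  rw [ENNReal.mul_inv (Or.inl (by positivity)) (Or.inl (by finiteness))]
  have : ((c a : ℝ≥0∞) + 1) * ((c a : ℝ≥0∞) + 1)⁻¹ = 1 :=
    ENNReal.mul_inv_cancel (by positivity) (by finiteness)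
  calc ((c a : ℝ≥0∞) + 1) * (((c a : ℝ≥0∞) + 1)⁻¹ * ((c a).factorial : ℝ≥0∞)⁻¹ * (w a ^ c a * w a))
      = (((c a : ℝ≥0∞) + 1) * ((c a : ℝ≥0∞) + 1)⁻¹) * (((c a).factorial : ℝ≥0∞)⁻¹ * (w a ^ c a * w a)) := by ring
    _ = _ := by rw [this]; ring

/-- Mecke identity -/
lemma mecke {ι : Type*} [Fintype ι] [DecidableEq ι] (w : ι → ℝ≥0∞) (a : ι) (F : (ι → ℕ) → ℝ≥0∞) :
    ∑' c, (c a : ℝ≥0∞) * (pois w c * F c) = w a * ∑' c, pois w c * F (bump a c) := by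
  rw [← ENNReal.tsum_mul_left]
  have : ∀ c, w a * (pois w c * F (bump a c)) =
      (fun c => (c a : ℝ≥0∞) * (pois w c * F c)) (bump a c) := by
    intro c
    simp only
    rw [← mul_assoc, ← mul_assoc, pois_bump]
  simp_rw [this]
  refine ((bump_inj a).tsum_eq (f := fun c => (c a : ℝ≥0∞) * (pois w c * F c)) ?_).symm
  intro c hc
  have h0 : c a ≠ 0 := by
    intro h; apply hc; simp [h]
  refine ⟨Function.update c a (c a - 1), ?_⟩
  funext b
  by_cases hb : b = a
  · subst hb; simp [bump]; omega
  · simp [bump, hb]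

/-- number of balls in boxes `< m` -/
def NN {V : ℕ} (c : Fin V → ℕ) (m : ℕ) : ℕ := ∑ l : Fin V, if (l : ℕ) < m then c l else 0

def ustar {V : ℕ} (c : Fin V → ℕ) : ℕ := (range (V+1)).sup (fun m => NN c m - m)

noncomputable def mstar {V : ℕ} (c : Fin V → ℕ) : ℕ :=
  Nat.findGreatest (fun m => NN c m = m + ustar c) V

lemma NN_le_ustar {V : ℕ} (c : Fin V → ℕ) {m : ℕ} (hm : m ≤ V) : NN c m ≤ m + ustar c := by
  have : NN c m - m ≤ ustar c := Finset.le_sup (f := fun m => NN c m - m) (by simp; omega)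
  omega

lemma NN_zero {V : ℕ} (c : Fin V → ℕ) : NN c 0 = 0 := by simp [NN]

lemma ustar_le_iff {V : ℕ} (c : Fin V → ℕ) (u : ℕ) : ustar c ≤ u ↔ ∀ m ≤ V, NN c m ≤ m + u := by
  unfold ustar
  rw [Finset.sup_le_iff]
  constructor
  · intro h m hm; have := h m (by simp; omega); omega
  · intro h m hm; have := h m (by simp at hm; omega); omega

lemma exists_arg {V : ℕ} (c : Fin V → ℕ) : ∃ m ≤ V, NN c m = m + ustar c := by
  by_cases h : ustar c = 0
  · exact ⟨0, by omega, by simp [h, NN_zero]⟩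
  · obtain ⟨m, hm, hm2⟩ := Finset.exists_mem_eq_sup (range (V+1)) (by simp) (fun m => NN c m - m)
    refine ⟨m, by simp at hm; omega, ?_⟩
    have : ustar c = NN c m - m := hm2
    omega

lemma mstar_spec {V : ℕ} (c : Fin V → ℕ) : NN c (mstar c) = mstar c + ustar c := by
  obtain ⟨m, hm, h⟩ := exists_arg c
  exact Nat.findGreatest_spec (P := fun m => NN c m = m + ustar c) hm h

lemma mstar_le {V : ℕ} (c : Fin V → ℕ) : mstar c ≤ V := Nat.findGreatest_le _

lemma lt_of_mstar_lt {V : ℕ} (c : Fin V → ℕ) {m : ℕ} (h : mstar c < m) (hm : m ≤ V) :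
    NN c m < m + ustar c := by
  have := Nat.findGreatest_is_greatest (P := fun m => NN c m = m + ustar c) h hm
  have := NN_le_ustar c hm
  omega

/-- coefficients of `exp (W x) (1 - x)` -/
noncomputable def hh (W : ℝ) (n : ℕ) : ℝ := W ^ n / n.factorial - (if n = 0 then 0 else W ^ (n-1) / (n-1).factorial)

lemma hh_conv0 (W : ℝ) (n : ℕ) :
    ∑ j ∈ range (n+1), W ^ (n - j) / (n-j).factorial / j.factorial = (W+1)^n / n.factorial := by
  rw [add_comm W 1, add_pow, Finset.sum_div]
  apply Finset.sum_congr rfl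
  intro j hj
  simp only [mem_range] at hj
  rw [Nat.cast_choose ℝ (by omega : j ≤ n)]
  have h1 : (n.factorial : ℝ) ≠ 0 := by positivity
  have h2 : (j.factorial : ℝ) ≠ 0 := by positivity
  have h3 : ((n-j).factorial : ℝ) ≠ 0 := by positivity
  field_simp
  simp

lemma hh_conv (W : ℝ) (n : ℕ) :
    ∑ j ∈ range (n+1), hh W (n - j) / j.factorial = hh (W+1) n := by
  unfold hh
  simp_rw [sub_div]
  rw [Finset.sum_sub_distrib, hh_conv0]
  congr 1
  rcases n with _ | n
  · simp
  · rw [Finset.sum_range_succ]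
    simp only [Nat.sub_self, if_true, zero_div, add_zero]
    rw [if_neg (by omega)]
    rw [show n + 1 - 1 = n by omega, ← hh_conv0]
    apply Finset.sum_congr rfl
    intro j hj
    simp only [mem_range] at hj
    rw [if_neg (by omega), show n + 1 - j - 1 = n - j by omega]

lemma hh_nonneg {W : ℝ} {n : ℕ} (h : (n : ℝ) ≤ W) : 0 ≤ hh W n := by
  unfold hh
  rcases n with _ | n
  · simp
  · rw [if_neg (by omega), Nat.factorial_succ, show n + 1 - 1 = n by omega]
    have hW : 0 ≤ W := le_trans (by positivity) h
    have h1 : (0:ℝ) < n.factorial := by positivity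
    have : W ^ (n+1) / ((n+1 : ℕ) * n.factorial : ℕ) - W ^ n / n.factorial
        = W ^ n / n.factorial * (W / (n+1) - 1) := by
      push_cast; field_simp; ring
    rw [this]
    apply mul_nonneg (by positivity)
    rw [sub_nonneg, le_div_iff₀ (by positivity)]
    push_cast at h; linarith

/-- truncated count generating sums -/
noncomputable def QQ (u V k : ℕ) : ℝ≥0∞ :=
  ∑' c : Fin V → ℕ, if (ustar c ≤ u ∧ ∑ l, c l = k) then pois (fun _ => 1) c else 0

lemma NN_snoc_le {V : ℕ} (c : Fin V → ℕ) (j m : ℕ) (hm : m ≤ V) :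
    NN (Fin.snoc c j : Fin (V+1) → ℕ) m = NN c m := by
  unfold NN
  rw [Fin.sum_univ_castSucc]
  simp only [Fin.snoc_castSucc, Fin.snoc_last, Fin.val_castSucc, Fin.val_last]
  rw [if_neg (by omega), add_zero]

lemma NN_top {V : ℕ} (c : Fin V → ℕ) (m : ℕ) (hm : V ≤ m) : NN c m = ∑ l, c l := by
  unfold NN
  apply Finset.sum_congr rfl
  intro l _
  rw [if_pos (by omega)]

lemma QQ_zero_of_lt {u V k : ℕ} (h : V + u < k) : QQ u V k = 0 := by
  unfold QQ
  rw [ENNReal.tsum_eq_zero]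
  intro c
  rw [if_neg]
  rintro ⟨h1, h2⟩
  have := (ustar_le_iff c u).1 h1 V le_rfl
  rw [NN_top c V le_rfl] at this
  omega

lemma QQ_succ (u V k : ℕ) :
    QQ u (V+1) k ≤ ∑ j ∈ range (k+1), QQ u V (k - j) * ((j.factorial : ℝ≥0∞)⁻¹) := by
  unfold QQ
  rw [← (Fin.snocEquiv (fun _ : Fin (V+1) => ℕ)).tsum_eq, ENNReal.tsum_prod']
  have : ∀ j : ℕ, (∑' c : Fin V → ℕ, if (ustar (Fin.snocEquiv (fun _ : Fin (V+1) => ℕ) (j, c)) ≤ u ∧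
      ∑ l, (Fin.snocEquiv (fun _ : Fin (V+1) => ℕ) (j, c)) l = k)
      then pois (fun _ => 1) (Fin.snocEquiv (fun _ : Fin (V+1) => ℕ) (j, c)) else 0) ≤
      if j < k + 1 then QQ u V (k - j) * ((j.factorial : ℝ≥0∞)⁻¹) else 0 := by
    intro j
    split_ifs with hj
    · unfold QQ
      rw [← ENNReal.tsum_mul_right]
      apply ENNReal.tsum_le_tsum
      intro c
      split_ifs with h1 h2 h2
      · simp only [Fin.snocEquiv, Equiv.coe_fn_mk, pois, Fin.prod_univ_castSucc, Fin.snoc_castSucc, Fin.snoc_last]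
        simp
      · exfalso
        apply h2
        simp only [Fin.snocEquiv, Equiv.coe_fn_mk, Fin.sum_univ_castSucc, Fin.snoc_castSucc, Fin.snoc_last] at h1
        refine ⟨?_, by omega⟩
        rw [ustar_le_iff] at h1 ⊢
        intro m hm
        have := h1.1 m (by omega)
        rwa [NN_snoc_le _ _ _ hm] at this
      · simp
      · simp
    · rw [nonpos_iff_eq_zero, ENNReal.tsum_eq_zero]
      intro c
      rw [if_neg]
      rintro ⟨_, h2⟩
      simp only [Fin.snocEquiv, Equiv.coe_fn_mk, Fin.sum_univ_castSucc, Fin.snoc_castSucc, Fin.snoc_last] at h2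
      omega
  refine (ENNReal.tsum_le_tsum this).trans ?_
  rw [tsum_eq_sum (s := range (k+1))]
  · apply Finset.sum_le_sum
    intro j hj
    rw [if_pos (by simpa using hj)]
    rfl
  · intro j hj
    rw [if_neg (by simpa using hj)]

/-- The supersolution bound. -/
lemma QQ_le (u s V k : ℕ) (hs : 1 ≤ s) (hk : k ≤ V + u) :
    QQ u V k ≤ ENNReal.ofReal (hh ((V + (u + 1 + s) : ℕ) : ℝ) (k + s) / hh ((u+1+s : ℕ) : ℝ) s) := by
  have hpos : 0 < hh ((u+1+s : ℕ) : ℝ) s := by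
    unfold hh
    obtain ⟨r, rfl⟩ : ∃ r, s = r + 1 := ⟨s - 1, by omega⟩
    rw [if_neg (by omega), Nat.factorial_succ, show r + 1 - 1 = r by omega]
    have h1 : (0:ℝ) < r.factorial := by positivity
    have : ∀ W : ℝ, W ^ (r+1) / ((r+1 : ℕ) * r.factorial : ℕ) - W ^ r / r.factorial
        = W ^ r / r.factorial * (W / (r+1) - 1) := by
      intro W; push_cast; field_simp; ring
    rw [this]
    apply mul_pos (by positivity)
    rw [sub_pos, lt_div_iff₀ (by positivity)]
    push_cast; linarith [(Nat.cast_nonneg u : (0:ℝ) ≤ u)]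
  induction V generalizing k with
  | zero =>
    rcases k with _ | k
    · unfold QQ
      rw [tsum_eq_single (default : Fin 0 → ℕ) (fun b hb => absurd (Subsingleton.elim _ _) hb)]
      simp only [Nat.zero_add, div_self hpos.ne']
      split_ifs <;> simp [pois]
    · have : QQ u 0 (k+1) = 0 := by
        unfold QQ
        rw [ENNReal.tsum_eq_zero]
        intro c
        rw [if_neg]
        rintro ⟨_, h2⟩
        simp at h2
      rw [this]; exact zero_le
  | succ V ih =>
    refine (QQ_succ u V k).trans ?_
    have h1 : ∀ j ∈ range (k+1), QQ u V (k - j) * ((j.factorial : ℝ≥0∞)⁻¹) ≤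
        ENNReal.ofReal (hh ((V + (u + 1 + s) : ℕ) : ℝ) (k - j + s) / hh ((u+1+s : ℕ) : ℝ) s / j.factorial) := by
      intro j hj
      rw [div_eq_mul_inv _ (j.factorial : ℝ), ENNReal.ofReal_mul', ENNReal.ofReal_inv_of_pos (by positivity), ENNReal.ofReal_natCast]
      · by_cases hkj : k - j ≤ V + u
        · gcongr
          exact ih _ hkj
        · rw [QQ_zero_of_lt (by omega)]; simp
      · positivity
    refine (Finset.sum_le_sum h1).trans ?_
    rw [← ENNReal.ofReal_sum_of_nonneg]
    · apply ENNReal.ofReal_le_ofReal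
      have e : ((V + 1 + (u + 1 + s) : ℕ) : ℝ) = ((V + (u + 1 + s) : ℕ) : ℝ) + 1 := by push_cast; ring
      rw [e, ← hh_conv, Finset.sum_div]
      have hsub : range (k+1) ⊆ range (k + s + 1) := by
        intro x hx; simp at hx ⊢; omega
      calc ∑ j ∈ range (k+1), hh ((V + (u + 1 + s) : ℕ) : ℝ) (k - j + s) / hh ((u+1+s : ℕ) : ℝ) s / j.factorial
          = ∑ j ∈ range (k+1), hh ((V + (u + 1 + s) : ℕ) : ℝ) (k + s - j) / j.factorial / hh ((u+1+s : ℕ) : ℝ) s := by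
            apply Finset.sum_congr rfl
            intro j hj
            simp only [mem_range] at hj
            rw [show k - j + s = k + s - j by omega]; ring
        _ ≤ _ := by
            apply Finset.sum_le_sum_of_subset_of_nonneg hsub
            intro j hj _
            simp at hj
            have : 0 ≤ hh ((V + (u + 1 + s) : ℕ) : ℝ) (k + s - j) := by
              apply hh_nonneg
              exact_mod_cast (by omega)
            positivity
    · intro j hj
      have : 0 ≤ hh ((V + (u + 1 + s) : ℕ) : ℝ) (k - j + s) := by
        apply hh_nonneg
        simp at hj
        exact_mod_cast (by omega)
      positivity

/-- `2 log 2` -/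
noncomputable def al : ℝ := 2 * log 2

lemma al_gt : (1.386 : ℝ) < al := by unfold al; linarith [log_two_gt_d9]
lemma al_lt : al < (1.3864 : ℝ) := by unfold al; linarith [log_two_lt_d9]

lemma pow_div_fact_le (W n : ℕ) (h : n ≤ W) (hW : 1 ≤ W) :
    (W : ℝ) ^ n / n.factorial ≤ (W:ℝ) ^ W / W.factorial := by
  have h1 := Nat.factorial_mul_descFactorial (n := W) (k := W - n) (by omega)
  rw [show W - (W - n) = n by omega] at h1
  have h2 := Nat.descFactorial_le_pow W (W - n)
  rw [div_le_div_iff₀ (by positivity) (by positivity)]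
  have h3 : (W.factorial : ℝ) ≤ n.factorial * (W:ℝ)^(W-n) := by
    rw [← h1]; push_cast
    have : ((W.descFactorial (W - n) : ℕ) : ℝ) ≤ (W:ℝ)^(W-n) := by exact_mod_cast h2
    gcongr
  calc (W:ℝ)^n * W.factorial ≤ (W:ℝ)^n * (n.factorial * (W:ℝ)^(W-n)) := by gcongr
    _ = (W:ℝ)^(n + (W-n)) * n.factorial := by rw [pow_add]; ring
    _ = _ := by rw [show n + (W - n) = W by omega]

lemma stir_low (W : ℕ) (hW : 1 ≤ W) :
    (W:ℝ)^W / W.factorial ≤ exp W / sqrt W := by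
  have h := Stirling.le_factorial_stirling W
  have hW' : (0:ℝ) < W := by exact_mod_cast hW
  have h1 : sqrt W * (W / exp 1)^W ≤ W.factorial := by
    refine le_trans ?_ h
    gcongr
    have := pi_gt_three
    nlinarith
  rw [div_pow, ← exp_nat_mul, mul_one] at h1
  rw [div_le_div_iff₀ (by positivity) (by positivity)]
  have := exp_pos W
  have h2 : sqrt W * ((W:ℝ)^W / exp W) * exp W ≤ W.factorial * exp W := by gcongr
  have h3 : sqrt W * ((W:ℝ)^W / exp W) * exp W = (W:ℝ)^W * sqrt W := by
    field_simp
  linarith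

lemma stir_up (n : ℕ) (hn : 1 ≤ n) :
    (n.factorial : ℝ) ≤ exp 1 * sqrt n * (n / exp 1)^n := by
  have h := Stirling.stirlingSeq'_antitone (Nat.zero_le (n-1))
  simp only [Function.comp] at h
  rw [show Nat.succ (n-1) = n by omega, Stirling.stirlingSeq_one] at h
  unfold Stirling.stirlingSeq at h
  have hn' : (0:ℝ) < n := by exact_mod_cast hn
  rw [div_le_iff₀ (by positivity)] at h
  refine h.trans (le_of_eq ?_)
  rw [sqrt_mul (by norm_num)]
  have : sqrt 2 ≠ 0 := by positivity
  field_simp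

lemma hh_eq (W n : ℕ) (hW : 1 ≤ W) : hh W n = (W:ℝ)^n / n.factorial * (((W:ℝ) - n) / W) := by
  have hW' : (0:ℝ) < W := by exact_mod_cast hW
  unfold hh
  rcases n with _ | n
  · simp; field_simp
  · rw [if_neg (by omega), Nat.factorial_succ, show n + 1 - 1 = n by omega]
    have h1 : (0:ℝ) < n.factorial := by positivity
    push_cast; field_simp; ring

lemma summable_ral : Summable (fun r : ℕ => (r:ℝ) * (al⁻¹)^r) := by
  have h := summable_pow_mul_geometric_of_norm_lt_one 1 (r := al⁻¹) (by
    have := al_gt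
    rw [norm_of_nonneg (by positivity)]
    exact inv_lt_one_of_one_lt₀ (by linarith))
  simpa using h

noncomputable def C1 : ℝ := ∑' r : ℕ, (r:ℝ) * (al⁻¹)^r

lemma C1_nonneg : 0 ≤ C1 := by
  have := al_gt
  exact tsum_nonneg (fun r => by positivity)

lemma sum_al_hh (V u : ℕ) (s : ℕ) :
    ∑ k ∈ range (V+u+1), al^k * hh ((V + (u+1+s) : ℕ) : ℝ) (k+s) ≤
      C1 * al^(V+u+1) * exp ((V + (u+1+s) : ℕ) : ℝ) / (((V + (u+1+s) : ℕ) : ℝ) * sqrt ((V + (u+1+s) : ℕ) : ℝ)) := by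
  have ha := al_gt
  have ha0 : 0 < al := by linarith
  set W := V + (u+1+s) with hWd
  have hW1 : 1 ≤ W := by omega
  have hW' : (0:ℝ) < W := by exact_mod_cast hW1
  have hterm : ∀ k ∈ range (V+u+1), al^k * hh (W:ℝ) (k+s) ≤
      ((V+u+1-k : ℕ) : ℝ) * (al⁻¹)^(V+u+1-k) * (al^(V+u+1) * exp W / (W * sqrt W)) := by
    intro k hk
    simp only [mem_range] at hk
    rw [hh_eq _ _ hW1]
    have e1 : (W:ℝ) - ((k+s : ℕ):ℝ) = ((V+u+1-k : ℕ) : ℝ) := by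
      rw [← Nat.cast_sub (by omega)]; congr 1; omega
    rw [e1]
    have h2 := (pow_div_fact_le W (k+s) (by omega) hW1).trans (stir_low W hW1)
    have e2 : al^k = (al⁻¹)^(V+u+1-k) * al^(V+u+1) := by
      rw [show V + u + 1 = (V+u+1-k) + k by omega, pow_add al, show (V+u+1-k) + k - k = V+u+1-k by omega, ← mul_assoc, ← mul_pow]
      rw [inv_mul_cancel₀ ha0.ne']; simp
    rw [e2]
    calc (al⁻¹)^(V+u+1-k) * al^(V+u+1) * ((W:ℝ) ^ (k+s) / (k+s).factorial * (((V+u+1-k : ℕ) : ℝ) / W))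
        ≤ (al⁻¹)^(V+u+1-k) * al^(V+u+1) * (exp W / sqrt W * (((V+u+1-k : ℕ) : ℝ) / W)) := by gcongr
      _ = _ := by field_simp
  refine (Finset.sum_le_sum hterm).trans ?_
  rw [← Finset.sum_mul]
  have : ∑ k ∈ range (V+u+1), ((V+u+1-k : ℕ) : ℝ) * (al⁻¹)^(V+u+1-k) ≤ C1 := by
    have hinj : ∑ k ∈ range (V+u+1), ((V+u+1-k : ℕ) : ℝ) * (al⁻¹)^(V+u+1-k) =
        ∑ r ∈ (range (V+u+1)).image (fun k => V+u+1-k), (r:ℝ) * (al⁻¹)^r := by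
      rw [Finset.sum_image]
      intro a ha b hb h
      simp at ha hb h; omega
    rw [hinj]
    exact summable_ral.sum_le_tsum _ (fun r _ => by positivity)
  calc _ ≤ C1 * (al^(V+u+1) * exp W / (W * sqrt W)) := by gcongr
    _ = _ := by ring

lemma pois_const {V : ℕ} (a : ℝ≥0∞) (c : Fin V → ℕ) :
    pois (fun _ => a) c = a ^ (∑ l, c l) * pois (fun _ => 1) c := by
  unfold pois
  rw [← Finset.prod_pow_eq_pow_sum, ← Finset.prod_mul_distrib]
  apply Finset.prod_congr rfl
  intro l _
  simp [ENNReal.div_eq_inv_mul, mul_comm]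

/-- summand of the `u`-series -/
noncomputable def uterm (u : ℕ) : ℝ :=
  (1/2)^u * (4 * C1 * ((3*(u+1)).factorial / ((4*(u+1) : ℕ) : ℝ)^(3*(u+1)) * al^(u+1) * exp ((4*(u+1) : ℕ):ℝ)))

lemma uterm_nonneg (u : ℕ) : 0 ≤ uterm u := by
  have := al_gt
  have := C1_nonneg
  unfold uterm
  positivity

noncomputable def rho : ℝ := 27/64 * exp 1 * (al/2)

lemma uterm_le (u : ℕ) : uterm u ≤ 24 * C1 * exp 1 * (((u+1 : ℕ):ℝ)^1 * rho^(u+1)) := by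
  have ha := al_gt
  have hC := C1_nonneg
  unfold uterm
  obtain ⟨t, ht⟩ : ∃ t, t = u + 1 := ⟨_, rfl⟩
  have e1 : (1/2 : ℝ)^u = 2 * (1/2)^t := by rw [ht, pow_succ]; ring
  rw [← ht, e1]
  have ht0 : (0:ℝ) < t := by rw [ht]; positivity
  have ht1 : 1 ≤ t := by omega
  clear e1 ht u
  have h1 := stir_up (3*t) (by omega)
  have h2 : sqrt ((3*t : ℕ):ℝ) ≤ 3 * t := by
    rw [sqrt_le_left (by positivity)]
    push_cast
    have : (1:ℝ) ≤ t := by exact_mod_cast ht1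
    nlinarith
  have h3 : ((3*t).factorial : ℝ) / ((4*t : ℕ):ℝ)^(3*t) ≤ exp 1 * (3 * t) * (27/64 / exp 3)^t := by
    rw [div_le_iff₀ (by positivity)]
    refine h1.trans ?_
    have e : (((3*t:ℕ):ℝ) / exp 1)^(3*t) = (27/64 / exp 3)^t * ((4*t : ℕ):ℝ)^(3*t) := by
      rw [pow_mul, pow_mul, ← mul_pow]
      congr 1
      have : exp 3 = exp 1 ^ 3 := by rw [← exp_nat_mul]; norm_num
      rw [this]
      push_cast
      field_simp; norm_num
    rw [e, ← mul_assoc]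
    gcongr
  have e2 : exp ((4*t:ℕ):ℝ) = exp 4 ^ t := by
    rw [← exp_nat_mul]; congr 1; push_cast; ring
  rw [e2]
  have e5 : rho = (1/2) * (27/64 / exp 3) * al * exp 4 := by
    have : exp 4 = exp 3 * exp 1 := by rw [← exp_add]; norm_num
    have := exp_pos 3
    rw [‹exp 4 = _›]; unfold rho; field_simp
  rw [e5]
  calc 2 * (1/2:ℝ)^t * (4 * C1 * ((3*t).factorial / ((4*t : ℕ) : ℝ)^(3*t) * al^t * exp 4 ^ t))
      ≤ 2 * (1/2:ℝ)^t * (4 * C1 * ((exp 1 * (3 * t) * (27/64 / exp 3)^t) * al^t * exp 4 ^ t)) := by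
        gcongr
    _ = 24 * C1 * exp 1 * ((t:ℝ)^1 * ((1/2) * (27/64 / exp 3) * al * exp 4)^t) := by
      rw [mul_pow _ (exp 4), mul_pow _ al, mul_pow (1/2)]
      generalize (27/64 / exp 3)^t = A
      generalize (1/2:ℝ)^t = B
      generalize al^t = D
      generalize exp 4 ^ t = E
      generalize exp 1 = G
      ring

lemma uterm_summable : Summable uterm := by
  have ha := al_gt
  have ha2 := al_lt
  have he := exp_one_lt_d9
  have hρ0 : 0 < rho := by unfold rho; positivity
  have hρ1 : rho < 1 := by
    unfold rho
    have h0 := exp_pos 1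
    calc 27/64 * exp 1 * (al/2) < 27/64 * 2.72 * (1.3864/2) := by gcongr; linarith
      _ < 1 := by norm_num
  have hs : Summable (fun t : ℕ => 24 * C1 * exp 1 * ((t:ℝ)^1 * rho^t)) := by
    apply Summable.mul_left
    exact summable_pow_mul_geometric_of_norm_lt_one 1 (by rwa [norm_of_nonneg hρ0.le])
  have hs2 : Summable (fun u : ℕ => 24 * C1 * exp 1 * (((u+1:ℕ):ℝ)^1 * rho^(u+1))) :=
    (summable_nat_add_iff (f := fun t : ℕ => 24 * C1 * exp 1 * ((t:ℝ)^1 * rho^t)) 1).2 hs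
  exact Summable.of_nonneg_of_le uterm_nonneg uterm_le hs2

noncomputable def Zst (V : ℕ) : ℝ≥0∞ :=
  ∑' c : Fin V → ℕ, pois (fun _ => ENNReal.ofReal al) c * (2⁻¹)^(ustar c)

lemma trunc_bound (u V : ℕ) (hV : 1 ≤ V) :
    ∑' c : Fin V → ℕ, (if ustar c ≤ u then pois (fun _ => ENNReal.ofReal al) c else 0) ≤
      ENNReal.ofReal (2^u * uterm u * ((al * exp 1)^V / (V * sqrt V))) := by
  have ha := al_gt
  have hC := C1_nonneg
  have hV' : (0:ℝ) < V := by exact_mod_cast hV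
  have h1 : ∀ c : Fin V → ℕ, (if ustar c ≤ u then pois (fun _ => ENNReal.ofReal al) c else 0) ≤
      ∑ k ∈ range (V+u+1), ENNReal.ofReal al ^ k * (if (ustar c ≤ u ∧ ∑ l, c l = k) then pois (fun _ => 1) c else 0) := by
    intro c
    split_ifs with h
    · have hm := (ustar_le_iff c u).1 h V le_rfl
      rw [NN_top c V le_rfl] at hm
      rw [pois_const]
      refine le_trans ?_ (Finset.single_le_sum (fun _ _ => zero_le) (mem_range.2 (by omega : ∑ l, c l < V + u + 1)))
      simp [h]
    · exact zero_le
  refine (ENNReal.tsum_le_tsum h1).trans ?_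
  rw [Summable.tsum_finsetSum (fun _ _ => ENNReal.summable)]
  simp_rw [ENNReal.tsum_mul_left]
  have h2 : ∀ k ∈ range (V+u+1), ENNReal.ofReal al ^ k * (∑' c : Fin V → ℕ, if (ustar c ≤ u ∧ ∑ l, c l = k) then pois (fun _ => 1) c else 0)
      ≤ ENNReal.ofReal (al^k * (hh ((V + (u + 1 + 3*(u+1)) : ℕ) : ℝ) (k + 3*(u+1)) / hh ((u+1+3*(u+1) : ℕ) : ℝ) (3*(u+1)))) := by
    intro k hk
    simp only [mem_range] at hk
    rw [ENNReal.ofReal_mul (by positivity), ENNReal.ofReal_pow (by linarith)]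
    gcongr
    exact QQ_le u (3*(u+1)) V k (by omega) (by omega)
  refine (Finset.sum_le_sum h2).trans ?_
  have hden : 0 ≤ hh ((u+1+3*(u+1) : ℕ) : ℝ) (3*(u+1)) := hh_nonneg (by exact_mod_cast (by omega))
  rw [← ENNReal.ofReal_sum_of_nonneg]
  · apply ENNReal.ofReal_le_ofReal
    simp_rw [← mul_div_assoc]
    rw [← Finset.sum_div]
    refine (div_le_div_of_nonneg_right (sum_al_hh V u (3*(u+1))) hden).trans ?_
    rw [hh_eq _ _ (by omega), show u + 1 + 3*(u+1) = 4*(u+1) by ring]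
    unfold uterm
    set t := u + 1 with ht
    have ht0 : (0:ℝ) < t := by rw [ht]; positivity
    have e1 : (((4*t:ℕ):ℝ) - ((3*t:ℕ):ℝ)) / ((4*t:ℕ):ℝ) = 1/4 := by
      push_cast; field_simp; ring
    rw [e1]
    have e2 : exp ((V + 4*t : ℕ):ℝ) = exp 1 ^ V * exp ((4*t:ℕ):ℝ) := by
      rw [← exp_nat_mul, ← exp_add]; congr 1; push_cast; ring
    rw [e2, show V + u + 1 = V + t by omega, pow_add]
    have h3 : (V:ℝ) * sqrt V ≤ ((V + 4*t : ℕ):ℝ) * sqrt ((V + 4*t : ℕ):ℝ) := by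
      have : (V:ℝ) ≤ ((V + 4*t : ℕ):ℝ) := by exact_mod_cast (by omega)
      gcongr
    calc C1 * (al^V * al^t) * (exp 1 ^ V * exp ((4*t:ℕ):ℝ)) / (((V + 4*t : ℕ):ℝ) * sqrt ((V + 4*t : ℕ):ℝ)) /
          (((4*t:ℕ):ℝ)^(3*t) / ((3*t).factorial) * (1/4))
        ≤ C1 * (al^V * al^t) * (exp 1 ^ V * exp ((4*t:ℕ):ℝ)) / (V * sqrt V) /
          (((4*t:ℕ):ℝ)^(3*t) / ((3*t).factorial) * (1/4)) := by gcongr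
      _ = 2^u * ((1/2)^u * (4 * C1 * ((3*t).factorial / ((4*t : ℕ) : ℝ)^(3*t) * al^t * exp ((4*t : ℕ):ℝ)))) * ((al * exp 1)^V / (V * sqrt V)) := by
        have e3 : (2:ℝ)^u * (1/2)^u = 1 := by rw [← mul_pow]; norm_num
        rw [← mul_assoc ((2:ℝ)^u), e3, mul_pow]
        field_simp
      _ = _ := by rw [mul_div_assoc]
  · intro k hk
    simp only [mem_range] at hk
    have : 0 ≤ hh ((V + (u + 1 + 3*(u+1)) : ℕ) : ℝ) (k + 3*(u+1)) := hh_nonneg (by exact_mod_cast (by omega))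
    positivity

theorem Zst_le : ∃ C : ℝ, 0 ≤ C ∧ ∀ V : ℕ, 1 ≤ V →
    Zst V ≤ ENNReal.ofReal (C * ((al * exp 1)^V / (V * sqrt V))) := by
  have ha := al_gt
  refine ⟨∑' u, uterm u, tsum_nonneg uterm_nonneg, fun V hV => ?_⟩
  unfold Zst
  have h1 : ∀ c : Fin V → ℕ, pois (fun _ => ENNReal.ofReal al) c * (2⁻¹)^(ustar c) ≤
      ∑' u : ℕ, (2⁻¹ : ℝ≥0∞)^u * (if ustar c ≤ u then pois (fun _ => ENNReal.ofReal al) c else 0) := by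
    intro c
    refine le_trans (le_of_eq ?_) (ENNReal.le_tsum (ustar c))
    simp [mul_comm]
  refine (ENNReal.tsum_le_tsum h1).trans ?_
  rw [ENNReal.tsum_comm]
  simp_rw [ENNReal.tsum_mul_left]
  set A : ℝ := (al * exp 1)^V / (V * sqrt V) with hA
  have hA0 : 0 ≤ A := by positivity
  rw [← tsum_mul_right, ENNReal.ofReal_tsum_of_nonneg (fun u => mul_nonneg (uterm_nonneg u) hA0) (uterm_summable.mul_right _)]
  apply ENNReal.tsum_le_tsum
  intro u
  have h2 := trunc_bound u V hV
  calc (2⁻¹ : ℝ≥0∞)^u * _ ≤ (2⁻¹ : ℝ≥0∞)^u * ENNReal.ofReal (2^u * uterm u * A) := by gcongr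
    _ = ENNReal.ofReal ((2⁻¹)^u) * ENNReal.ofReal (2^u * uterm u * A) := by
        congr 1
        rw [ENNReal.ofReal_pow (by norm_num), ENNReal.ofReal_inv_of_pos (by norm_num)]; simp
    _ = ENNReal.ofReal (uterm u * A) := by
        rw [← ENNReal.ofReal_mul (by positivity)]
        congr 1
        have e3 : (2:ℝ)⁻¹^u * 2^u = 1 := by rw [← mul_pow]; norm_num
        calc _ = ((2:ℝ)⁻¹^u * 2^u) * (uterm u * A) := by ring
          _ = _ := by rw [e3, one_mul]
    _ ≤ _ := le_rfl

lemma half_sum_le (M : ℕ) : ∑ l ∈ range M, (2⁻¹ : ℝ≥0∞)^(M - l) ≤ 1 := by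
  induction M with
  | zero => simp
  | succ M ih =>
    rw [Finset.sum_range_succ]
    have : ∑ l ∈ range M, (2⁻¹ : ℝ≥0∞)^(M + 1 - l) = 2⁻¹ * ∑ l ∈ range M, (2⁻¹ : ℝ≥0∞)^(M - l) := by
      rw [Finset.mul_sum]
      apply Finset.sum_congr rfl
      intro l hl
      simp at hl
      rw [show M + 1 - l = (M - l) + 1 by omega, pow_succ, mul_comm]
    rw [this, show M + 1 - M = 1 by omega, pow_one]
    calc (2⁻¹ : ℝ≥0∞) * ∑ l ∈ range M, (2⁻¹ : ℝ≥0∞)^(M - l) + 2⁻¹ ≤ 2⁻¹ * 1 + 2⁻¹ := by gcongr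
      _ = 1 := by rw [mul_one, ENNReal.inv_two_add_inv_two]

lemma half_sum_fin (V M : ℕ) (hM : M ≤ V) :
    ∑ l : Fin V, (if (l:ℕ) < M then (2⁻¹ : ℝ≥0∞)^(M - (l:ℕ)) else 0) ≤ 1 := by
  rw [Fin.sum_univ_eq_sum_range (fun l => if l < M then (2⁻¹ : ℝ≥0∞)^(M - l) else 0) V,
    ← Finset.sum_filter]
  have : (range V).filter (fun l => l < M) = range M := by
    ext x; simp; omega
  rw [this]
  exact half_sum_le M

lemma NN_bump {V : ℕ} (c : Fin V → ℕ) (l : Fin V) (m : ℕ) :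
    NN (bump l c) m = NN c m + if (l:ℕ) < m then 1 else 0 := by
  unfold NN
  rw [← Finset.add_sum_erase univ _ (mem_univ l), ← Finset.add_sum_erase univ (fun l : Fin V => if (l : ℕ) < m then c l else 0) (mem_univ l)]
  have : ∑ x ∈ univ.erase l, (if (x:ℕ) < m then bump l c x else 0) = ∑ x ∈ univ.erase l, (if (x:ℕ) < m then c x else 0) := by
    apply Finset.sum_congr rfl
    intro x hx
    simp [bump, (Finset.mem_erase.1 hx).1]
  rw [this]
  simp only [bump, Function.update_self]
  split_ifs <;> omega

noncomputable def mtwo {V : ℕ} (c : Fin V → ℕ) : ℕ :=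
  Nat.findGreatest (fun m => NN c m + 1 = m + ustar c) V

lemma bump_cases {V : ℕ} (c : Fin V → ℕ) (l : Fin V) (h : (l:ℕ) < mstar (bump l c)) :
    ustar c ≤ ustar (bump l c) ∧ (mstar (bump l c) = mstar c ∨ mstar (bump l c) = mtwo c) := by
  set M := mstar (bump l c) with hM
  have hMV : M ≤ V := mstar_le _
  have h1 := mstar_spec (bump l c)
  rw [← hM, NN_bump, if_pos h] at h1
  have hle : ustar c ≤ ustar (bump l c) := by
    rw [ustar_le_iff]
    intro m hm
    have := NN_le_ustar (bump l c) hm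
    rw [NN_bump] at this
    omega
  refine ⟨hle, ?_⟩
  have h2 : ∀ m, M < m → m ≤ V → NN c m + 1 < m + ustar (bump l c) := by
    intro m hm hm2
    have := lt_of_mstar_lt (bump l c) hm hm2
    rwa [NN_bump, if_pos (by omega)] at this
  have h3 := NN_le_ustar c hMV
  by_cases he : ustar (bump l c) = ustar c
  · right
    symm
    unfold mtwo
    rw [Nat.findGreatest_eq_iff]
    refine ⟨hMV, fun _ => by omega, ?_⟩
    intro n hn hn2 hn3
    have := h2 n hn hn2
    omega
  · left
    symm
    have he2 : ustar (bump l c) = ustar c + 1 := by omega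
    unfold mstar
    rw [Nat.findGreatest_eq_iff]
    refine ⟨hMV, fun _ => by omega, ?_⟩
    intro n hn hn2 hn3
    have := h2 n hn hn2
    omega

theorem strick (V : ℕ) :
    ∑' c : Fin V → ℕ, pois (fun _ => ENNReal.ofReal al) c * ((2⁻¹)^(ustar c) *
      ((2⁻¹)^(mstar c) + ∑ l : Fin V, if (l:ℕ) < mstar c then (c l : ℝ≥0∞) * (2⁻¹)^(mstar c - (l:ℕ)) else 0))
    ≤ (1 + 2 * ENNReal.ofReal al) * Zst V := by
  set G : Fin V → (Fin V → ℕ) → ℝ≥0∞ := fun l c =>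
    if (l:ℕ) < mstar c then (2⁻¹)^(mstar c - (l:ℕ)) * (2⁻¹)^(ustar c) else 0 with hG
  have h1 : ∀ c : Fin V → ℕ, pois (fun _ => ENNReal.ofReal al) c * ((2⁻¹)^(ustar c) *
      ((2⁻¹)^(mstar c) + ∑ l : Fin V, if (l:ℕ) < mstar c then (c l : ℝ≥0∞) * (2⁻¹)^(mstar c - (l:ℕ)) else 0)) ≤
      pois (fun _ => ENNReal.ofReal al) c * (2⁻¹)^(ustar c) +
        ∑ l : Fin V, (c l : ℝ≥0∞) * (pois (fun _ => ENNReal.ofReal al) c * G l c) := by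
    intro c
    rw [mul_add, mul_add]
    apply add_le_add
    · gcongr
      have : (2⁻¹ : ℝ≥0∞)^(mstar c) ≤ 1 := pow_le_one' (by simp) _
      calc (2⁻¹ : ℝ≥0∞)^(ustar c) * (2⁻¹)^(mstar c) ≤ (2⁻¹ : ℝ≥0∞)^(ustar c) * 1 := by gcongr
        _ = _ := mul_one _
    · rw [Finset.mul_sum, Finset.mul_sum]
      apply le_of_eq
      apply Finset.sum_congr rfl
      intro l _
      simp only [hG]
      split_ifs
      · ring
      · simp
  refine (ENNReal.tsum_le_tsum h1).trans ?_
  rw [ENNReal.tsum_add, add_mul, one_mul]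
  apply add_le_add le_rfl
  rw [Summable.tsum_finsetSum (fun _ _ => ENNReal.summable)]
  simp_rw [mecke]
  rw [← Finset.mul_sum, mul_comm (2:ℝ≥0∞), mul_assoc]
  gcongr
  rw [← Summable.tsum_finsetSum (fun _ _ => ENNReal.summable)]
  unfold Zst
  rw [← ENNReal.tsum_mul_left]
  apply ENNReal.tsum_le_tsum
  intro c
  rw [← Finset.mul_sum, ← mul_assoc, mul_comm (2:ℝ≥0∞), mul_assoc]
  gcongr
  have h2 : ∀ l ∈ (univ : Finset (Fin V)), G l (bump l c) ≤
      ((if (l:ℕ) < mstar c then (2⁻¹ : ℝ≥0∞)^(mstar c - (l:ℕ)) else 0) +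
       (if (l:ℕ) < mtwo c then (2⁻¹ : ℝ≥0∞)^(mtwo c - (l:ℕ)) else 0)) * (2⁻¹)^(ustar c) := by
    intro l _
    simp only [hG]
    split_ifs with h
    any_goals exact zero_le
    all_goals
      obtain ⟨h3, h4⟩ := bump_cases c l h
      have h5 : (2⁻¹ : ℝ≥0∞)^(ustar (bump l c)) ≤ (2⁻¹)^(ustar c) :=
        pow_le_pow_right_of_le_one' (by simp) h3
      gcongr
      rcases h4 with h4 | h4 <;> rw [h4] at h ⊢ <;> first | exact le_self_add | exact le_add_self | (exfalso; omega) | simp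
  refine (Finset.sum_le_sum h2).trans ?_
  rw [← Finset.sum_mul, Finset.sum_add_distrib]
  gcongr
  calc _ ≤ (1:ℝ≥0∞) + 1 := add_le_add (half_sum_fin V _ (mstar_le c)) (half_sum_fin V _ (Nat.findGreatest_le _))
    _ = 2 := by norm_num

/-- `∑_{n ≤ N} Λ(n)/n` -/
noncomputable def Lm (N : ℕ) : ℝ := ∑ n ∈ Ioc 0 N, Λ n / n

lemma log_fact (N : ℕ) : log (N.factorial) = ∑ n ∈ Ioc 0 N, Λ n * ((N / n : ℕ) : ℝ) := by
  rw [← ArithmeticFunction.sum_Ioc_mul_zeta_eq_sum, ArithmeticFunction.vonMangoldt_mul_zeta]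
  induction N with
  | zero => simp
  | succ n ih =>
    rw [← Finset.insert_Ioc_right_eq_Ioc_add_one (by omega), Finset.sum_insert (by simp), ← ih, Nat.factorial_succ]
    push_cast
    rw [log_mul (by positivity) (by positivity)]
    simp

lemma Lm_bound : ∃ C : ℝ, 0 < C ∧ ∀ N : ℕ, 1 ≤ N → |Lm N - log N| ≤ C := by
  refine ⟨log 4 + 5, by positivity, fun N hN => ?_⟩
  have hN' : (0:ℝ) < N := by exact_mod_cast hN
  have h1 := log_fact N
  have hpsi : ∑ n ∈ Ioc 0 N, Λ n ≤ (log 4 + 4) * N := by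
    have := Chebyshev.psi_le_const_mul_self (x := (N:ℝ)) (by positivity)
    unfold Chebyshev.psi at this
    simpa using this
  have hup : log (N.factorial) ≤ N * Lm N := by
    rw [h1, Lm, Finset.mul_sum]
    apply Finset.sum_le_sum
    intro n hn
    have : ((N / n : ℕ):ℝ) ≤ (N:ℝ) / n := Nat.cast_div_le
    have h0 : 0 ≤ Λ n := ArithmeticFunction.vonMangoldt_nonneg
    calc Λ n * ((N/n:ℕ):ℝ) ≤ Λ n * ((N:ℝ)/n) := by gcongr
      _ = _ := by ring
  have hlo : N * Lm N - ∑ n ∈ Ioc 0 N, Λ n ≤ log (N.factorial) := by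
    rw [h1, Lm, Finset.mul_sum, ← Finset.sum_sub_distrib]
    apply Finset.sum_le_sum
    intro n hn
    have h0 : 0 ≤ Λ n := ArithmeticFunction.vonMangoldt_nonneg
    have hn' : 0 < n := (Finset.mem_Ioc.1 hn).1
    have : (N:ℝ)/n - 1 ≤ ((N / n : ℕ):ℝ) := by
      rw [sub_le_iff_le_add, div_le_iff₀ (by exact_mod_cast hn')]
      have := Nat.lt_mul_div_succ N hn'
      have h2 : N ≤ (N/n + 1) * n := by nlinarith
      exact_mod_cast h2
    calc N * (Λ n / n) - Λ n = Λ n * ((N:ℝ)/n - 1) := by ring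
      _ ≤ _ := by gcongr
  have hst : N * log N - N ≤ log (N.factorial) := by
    have h := Stirling.le_factorial_stirling N
    have h1 : (N / exp 1)^N ≤ (N.factorial : ℝ) := by
      refine le_trans ?_ h
      apply le_mul_of_one_le_left (by positivity)
      rw [one_le_sqrt]
      have := pi_gt_three
      have : (1:ℝ) ≤ N := by exact_mod_cast hN
      nlinarith
    have h2 := log_le_log (by positivity) h1
    rw [log_pow, log_div (by positivity) (by positivity), log_exp] at h2
    linarith
  have hst2 : log (N.factorial) ≤ N * log N := by
    have : (N.factorial : ℝ) ≤ (N:ℝ)^N := by exact_mod_cast Nat.factorial_le_pow N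
    have h2 := log_le_log (by positivity) this
    rwa [log_pow] at h2
  rw [abs_le]
  have hl4 : 0 ≤ log 4 := log_nonneg (by norm_num)
  constructor
  · have : N * (log N - 1) ≤ N * Lm N := by linarith
    have := le_of_mul_le_mul_left this hN'
    linarith
  · have : N * Lm N ≤ N * (log N + (log 4 + 4)) := by linarith
    have := le_of_mul_le_mul_left this hN'
    linarith

lemma np_summable : Summable (fun n : ℕ => (if n.Prime then 0 else Λ n) / (n:ℝ)) := by
  have h := ArithmeticFunction.vonMangoldt.summable_residueClass_non_primes_div (q := 1) (a := 1)
  refine h.congr (fun n => ?_)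
  congr 1
  have : ArithmeticFunction.vonMangoldt.residueClass (1 : ZMod 1) n = Λ n := by
    unfold ArithmeticFunction.vonMangoldt.residueClass
    apply Set.indicator_of_mem
    simp only [Set.mem_setOf_eq]
    exact Subsingleton.elim _ _
  rw [this]

/-- discrete Abel summation bound -/
lemma abel_bound (E φ : ℕ → ℝ) (B : ℝ) (n N : ℕ) (hnN : n ≤ N)
    (hE : ∀ k, n ≤ k → |E k| ≤ B) (hφ : ∀ k, n < k → φ (k+1) ≤ φ k) (hφ0 : ∀ k, n < k → 0 ≤ φ k) :
    |∑ k ∈ Ioc n N, (E k - E (k-1)) * φ k| ≤ 2 * B * φ (n+1) := by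
  have hB : 0 ≤ B := (abs_nonneg _).trans (hE n le_rfl)
  have key : ∀ N, n ≤ N → |∑ k ∈ Ioc n N, (E k - E (k-1)) * φ k - E N * φ (N+1)| ≤
      B * φ (n+1) + B * (φ (n+1) - φ (N+1)) := by
    intro N hN
    induction N, hN using Nat.le_induction with
    | base =>
      simp only [Ioc_self, sum_empty, zero_sub, abs_neg, sub_self, mul_zero, add_zero, abs_mul]
      rw [abs_of_nonneg (hφ0 _ (by omega))]
      gcongr
      · exact hφ0 _ (by omega)
      · exact hE n le_rfl
    | succ N hN ih =>
      rw [← Finset.insert_Ioc_right_eq_Ioc_add_one hN, Finset.sum_insert (by simp)]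
      have e : (E (N+1) - E (N+1-1)) * φ (N+1) + ∑ k ∈ Ioc n N, (E k - E (k-1)) * φ k - E (N+1) * φ (N+1+1)
          = (∑ k ∈ Ioc n N, (E k - E (k-1)) * φ k - E N * φ (N+1)) + E (N+1) * (φ (N+1) - φ (N+1+1)) := by
        simp only [Nat.add_sub_cancel]; ring
      rw [e]
      refine (abs_add_le _ _).trans ?_
      have h1 : |E (N+1) * (φ (N+1) - φ (N+1+1))| ≤ B * (φ (N+1) - φ (N+1+1)) := by
        rw [abs_mul, abs_of_nonneg (sub_nonneg.2 (hφ _ (by omega)))]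
        have := sub_nonneg.2 (hφ (N+1) (by omega))
        gcongr
        exact hE _ (by omega)
      linarith
  have h := key N hnN
  have h2 : |E N * φ (N+1)| ≤ B * φ (N+1) := by
    rw [abs_mul, abs_of_nonneg (hφ0 (N+1) (by omega))]
    have := hφ0 (N+1) (by omega)
    gcongr
    exact hE _ hnN
  calc _ = |(∑ k ∈ Ioc n N, (E k - E (k-1)) * φ k - E N * φ (N+1)) + E N * φ (N+1)| := by rw [sub_add_cancel]
    _ ≤ _ := abs_add_le _ _
    _ ≤ _ := by linarith

/-- `∑_{k ≤ n} Λ(k)/(k log k)` -/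
noncomputable def Mm (N : ℕ) : ℝ := ∑ n ∈ Ioc 0 N, Λ n / (n * log n)

noncomputable def Dm (N : ℕ) : ℝ := Mm N - log (log N)

lemma loglog_diff (k : ℕ) (hk : 3 ≤ k) :
    |(log k - log (k-1:ℕ)) * (1/log k) - (log (log k) - log (log (k-1:ℕ)))|
    ≤ (1/((k-1:ℕ):ℝ)) * (1/log (k-1:ℕ) - 1/log k) := by
  set a := log (k-1:ℕ) with ha
  set b := log k with hb
  have hk1 : (2:ℝ) ≤ ((k-1:ℕ):ℝ) := by exact_mod_cast (by omega : 2 ≤ k - 1)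
  have hkk : (k:ℝ) = ((k-1:ℕ):ℝ) + 1 := by exact_mod_cast (by omega : k = k - 1 + 1)
  have ha0 : 0 < a := log_pos (by linarith)
  have hab : a ≤ b := log_le_log (by linarith) (by linarith)
  have hb0 : 0 < b := by linarith
  have hd : b - a ≤ 1/((k-1:ℕ):ℝ) := by
    rw [hb, ha, ← log_div (by linarith) (by linarith)]
    refine (log_le_sub_one_of_pos (by positivity)).trans (le_of_eq ?_)
    rw [hkk]; field_simp; ring
  have h1 : log b - log a ≤ (b - a)/a := by
    rw [← log_div hb0.ne' ha0.ne']
    refine (log_le_sub_one_of_pos (by positivity)).trans (le_of_eq ?_)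
    field_simp
  have h2 : (b-a)/b ≤ log b - log a := by
    have := log_le_sub_one_of_pos (x := a/b) (by positivity)
    rw [log_div ha0.ne' hb0.ne'] at this
    have e : (b-a)/b = 1 - a/b := by field_simp
    rw [e]; linarith
  have h3 : (b-a)*(1/a - 1/b) ≤ (1/((k-1:ℕ):ℝ)) * (1/a - 1/b) := by
    have : 0 ≤ 1/a - 1/b := sub_nonneg.2 (one_div_le_one_div_of_le ha0 hab)
    gcongr
  rw [abs_le]
  constructor
  · have : (b-a)*(1/a - 1/b) = (b-a)/a - (b-a)*(1/b) := by ring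
    linarith
  · have : (b-a)*(1/b) = (b-a)/b := by ring
    have : 0 ≤ (b-a)*(1/a - 1/b) := mul_nonneg (by linarith) (sub_nonneg.2 (one_div_le_one_div_of_le ha0 hab))
    linarith

lemma Dm_diff (c0 B : ℝ) (n N : ℕ) (hn : 2 ≤ n) (hnN : n ≤ N)
    (hB : ∀ k, n ≤ k → |Lm k - log k - c0| ≤ B) :
    |Dm N - Dm n| ≤ (2 * B + 1/n) * (1/log n) := by
  have hlog : ∀ k : ℕ, n ≤ k → 0 < log k := fun k hk =>
    log_pos (by exact_mod_cast (by omega))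
  have hmono : ∀ k l : ℕ, n ≤ k → k ≤ l → 1/log l ≤ 1/log k := by
    intro k l hk hl
    apply one_div_le_one_div_of_le (hlog k hk)
    exact log_le_log (by exact_mod_cast (by omega)) (by exact_mod_cast hl)
  have h1 := abel_bound (fun k => Lm k - log k - c0) (fun k => 1/log k) B n N hnN hB
    (fun k hk => hmono k (k+1) hk.le (by omega)) (fun k hk => (one_div_pos.2 (hlog k hk.le)).le)
  have hBn : 0 ≤ B := (abs_nonneg _).trans (hB n le_rfl)
  have h2 : |∑ k ∈ Ioc n N, ((log k - log (k-1:ℕ)) * (1/log k) - (log (log k) - log (log (k-1:ℕ))))| ≤ 1/n * (1/log n) := by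
    refine (Finset.abs_sum_le_sum_abs _ _).trans ?_
    have h3 : ∀ N, n ≤ N → ∑ k ∈ Ioc n N, |(log k - log (k-1:ℕ)) * (1/log k) - (log (log k) - log (log (k-1:ℕ)))| ≤ 1/n * (1/log n - 1/log N) := by
      intro N hN
      induction N, hN using Nat.le_induction with
      | base => simp
      | succ N hN ih =>
        rw [← Finset.insert_Ioc_right_eq_Ioc_add_one hN, Finset.sum_insert (by simp)]
        have h4 := loglog_diff (N+1) (by omega)
        simp only [Nat.add_sub_cancel] at h4 ⊢
        have h5 : (1/(N:ℝ)) * (1/log N - 1/log (N+1:ℕ)) ≤ 1/n * (1/log N - 1/log (N+1:ℕ)) := by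
          have := sub_nonneg.2 (hmono N (N+1) hN (by omega))
          gcongr
        linarith
    refine (h3 N hnN).trans ?_
    have := (one_div_pos.2 (hlog N hnN)).le
    gcongr
    linarith
  have h3 : Dm N - Dm n = ∑ k ∈ Ioc n N, ((Lm k - log k - c0) - (Lm (k-1) - log (k-1:ℕ) - c0)) * (1/log k)
     + ∑ k ∈ Ioc n N, ((log k - log (k-1:ℕ)) * (1/log k) - (log (log k) - log (log (k-1:ℕ)))) := by
    clear h1 h2
    induction N, hnN using Nat.le_induction with
    | base => simp
    | succ N hN ih =>
      have hN1 : n ≤ N := hN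
      rw [← Finset.insert_Ioc_right_eq_Ioc_add_one hN, Finset.sum_insert (by simp), Finset.sum_insert (by simp)]
      have ih' := ih
      · have e1 : Lm (N+1) = Lm N + Λ (N+1) / (N+1:ℕ) := by
          unfold Lm
          rw [← Finset.insert_Ioc_right_eq_Ioc_add_one (by omega), Finset.sum_insert (by simp)]; ring
        have e2 : Mm (N+1) = Mm N + Λ (N+1) / ((N+1:ℕ) * log (N+1:ℕ)) := by
          unfold Mm
          rw [← Finset.insert_Ioc_right_eq_Ioc_add_one (by omega), Finset.sum_insert (by simp)]; ring
        have e3 : Λ (N+1) / ((N+1:ℕ) * log (N+1:ℕ)) = Λ (N+1) / (N+1:ℕ) * (1/log (N+1:ℕ)) := by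
          rw [div_mul_div_comm, mul_one]
        unfold Dm at ih' ⊢
        simp only [Nat.add_sub_cancel]
        rw [e2, e1, e3]
        linear_combination ih'
  rw [h3]
  refine (abs_add_le _ _).trans ?_
  have h5 : 1/log (n+1:ℕ) ≤ 1/log n := hmono n (n+1) le_rfl (by omega)
  have : 2 * B * (1/log (n+1:ℕ)) ≤ 2 * B * (1/log n) := by gcongr
  rw [add_mul]
  linarith

lemma Mm_bound : ∃ C : ℝ, 0 < C ∧ ∀ N : ℕ, 2 ≤ N → |Mm N - log (log N)| ≤ C := by
  obtain ⟨B, hB0, hB⟩ := Lm_bound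
  refine ⟨(2 * B + 1/(2:ℕ)) * (1/log (2:ℕ)) + |Dm 2|, ?_, fun N hN => ?_⟩
  · have : 0 < log (2:ℕ) := log_pos (by norm_num)
    positivity
  · have h := Dm_diff 0 B 2 N le_rfl hN (fun k hk => by simpa using hB k (by omega))
    have : |Dm N| ≤ |Dm N - Dm 2| + |Dm 2| := by
      have := abs_add_le (Dm N - Dm 2) (Dm 2)
      rwa [sub_add_cancel] at this
    change |Dm N| ≤ _
    refine this.trans ?_
    gcongr

noncomputable def Cnp : ℝ := ∑' n : ℕ, (if n.Prime then 0 else Λ n) / (n:ℝ)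

lemma np_sum_le (s : Finset ℕ) : ∑ n ∈ s, (if n.Prime then 0 else Λ n) / (n:ℝ) ≤ Cnp := by
  apply np_summable.sum_le_tsum
  intro n _
  have := ArithmeticFunction.vonMangoldt_nonneg (n := n)
  split_ifs <;> positivity

lemma Cnp_nonneg : 0 ≤ Cnp := by simpa using np_sum_le ∅

lemma sum_inv_prime : ∃ C : ℝ, 0 < C ∧ ∀ N : ℕ, 2 ≤ N →
    |∑ p ∈ (Ioc 0 N).filter Nat.Prime, (1/p : ℝ) - log (log N)| ≤ C := by
  obtain ⟨C, hC, h⟩ := Mm_bound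
  have hl2 : 0 < log 2 := log_pos (by norm_num)
  have hnp := Cnp_nonneg
  refine ⟨C + Cnp / log 2, by positivity, fun N hN => ?_⟩
  have e : Mm N = ∑ p ∈ (Ioc 0 N).filter Nat.Prime, (1/p : ℝ) + ∑ n ∈ Ioc 0 N, (if n.Prime then 0 else Λ n / (n * log n)) := by
    unfold Mm
    rw [Finset.sum_filter, ← Finset.sum_add_distrib]
    apply Finset.sum_congr rfl
    intro n hn
    split_ifs with hp
    · rw [ArithmeticFunction.vonMangoldt_apply_prime hp]
      have : 0 < log n := log_pos (by exact_mod_cast hp.one_lt)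
      have : (0:ℝ) < n := by exact_mod_cast hp.pos
      field_simp; simp
    · simp
  have h1 : 0 ≤ ∑ n ∈ Ioc 0 N, (if n.Prime then 0 else Λ n / (n * log n)) := by
    apply Finset.sum_nonneg
    intro n hn
    have := ArithmeticFunction.vonMangoldt_nonneg (n := n)
    have : 0 ≤ log n := log_natCast_nonneg n
    split_ifs <;> positivity
  have h2 : ∑ n ∈ Ioc 0 N, (if n.Prime then 0 else Λ n / (n * log n)) ≤ Cnp / log 2 := by
    refine le_trans ?_ (div_le_div_of_nonneg_right (np_sum_le (Ioc 0 N)) hl2.le)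
    rw [Finset.sum_div]
    apply Finset.sum_le_sum
    intro n hn
    have h0 := ArithmeticFunction.vonMangoldt_nonneg (n := n)
    split_ifs
    · simp
    · simp only [mem_Ioc] at hn
      rcases Nat.lt_or_ge n 2 with hn2 | hn2
      · have : n = 1 := by omega
        subst this; simp
      · rw [div_div]
        have : log 2 ≤ log n := log_le_log (by norm_num) (by exact_mod_cast hn2)
        have : (0:ℝ) < n := by exact_mod_cast hn.1
        gcongr
  have := abs_le.1 (h N hN)
  rw [abs_le]
  constructor <;> linarith [this.1, this.2, div_nonneg hnp hl2.le]

lemma sum_logp : ∃ C : ℝ, 0 < C ∧ ∀ N : ℕ, 1 ≤ N →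
    ∑ p ∈ (Ioc 0 N).filter Nat.Prime, log p / p ≤ log N + C := by
  obtain ⟨C, hC, h⟩ := Lm_bound
  refine ⟨C, hC, fun N hN => ?_⟩
  have h1 := (abs_le.1 (h N hN)).2
  have : ∑ p ∈ (Ioc 0 N).filter Nat.Prime, log p / p ≤ Lm N := by
    unfold Lm
    rw [Finset.sum_filter]
    apply Finset.sum_le_sum
    intro n hn
    have h0 := ArithmeticFunction.vonMangoldt_nonneg (n := n)
    split_ifs with hp
    · rw [ArithmeticFunction.vonMangoldt_apply_prime hp]
    · positivity
  linarith

lemma cheb_block (A : ℝ) (hA : 0 < A) (s : Finset ℕ) (h : ∀ n ∈ s, A < n ∧ (n:ℝ) ≤ 8 * A) :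
    ∑ n ∈ s, Λ n / n ≤ 8 * (log 4 + 4) := by
  have h1 : ∑ n ∈ s, Λ n ≤ (log 4 + 4) * (8 * A) := by
    refine le_trans ?_ (Chebyshev.psi_le_const_mul_self (x := 8 * A) (by positivity))
    unfold Chebyshev.psi
    apply Finset.sum_le_sum_of_subset_of_nonneg
    · intro n hn
      obtain ⟨h2, h3⟩ := h n hn
      simp only [mem_Ioc]
      refine ⟨by
        rcases Nat.eq_zero_or_pos n with rfl | h
        · simp at h2; linarith
        · exact h, Nat.le_floor h3⟩
    · intros; exact ArithmeticFunction.vonMangoldt_nonneg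
  calc ∑ n ∈ s, Λ n / n ≤ ∑ n ∈ s, Λ n / A := by
        apply Finset.sum_le_sum
        intro n hn
        have h0 := ArithmeticFunction.vonMangoldt_nonneg (n := n)
        have := (h n hn).1
        gcongr
    _ = (∑ n ∈ s, Λ n) / A := by rw [Finset.sum_div]
    _ ≤ (log 4 + 4) * (8 * A) / A := by gcongr
    _ = _ := by field_simp

lemma pow_add_lin (s w : ℝ≥0∞) (k : ℕ) : s^(k+1) + ((k+1:ℕ):ℝ≥0∞) * (w * s^k) ≤ (s+w)^(k+1) := by
  induction k with
  | zero => simp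
  | succ k ih =>
    calc s^(k+1+1) + ((k+1+1:ℕ):ℝ≥0∞) * (w * s^(k+1))
        ≤ s^(k+1+1) + ((k+1+1:ℕ):ℝ≥0∞) * (w * s^(k+1)) + ((k+1:ℕ):ℝ≥0∞) * (w * s^k) * w := le_self_add
      _ = (s^(k+1) + ((k+1:ℕ):ℝ≥0∞) * (w * s^k)) * (s+w) := by push_cast; ring
      _ ≤ (s+w)^(k+1) * (s+w) := by gcongr
      _ = _ := by ring

lemma pow_add_fact (s w : ℝ≥0∞) (k : ℕ) :
    s^(k+1)/((k+1).factorial:ℝ≥0∞) + w * (s^k/(k.factorial:ℝ≥0∞)) ≤ (s+w)^(k+1)/((k+1).factorial:ℝ≥0∞) := by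
  refine le_trans (le_of_eq ?_) (ENNReal.div_le_div_right (pow_add_lin s w k) _)
  rw [ENNReal.add_div]
  congr 1
  have h1 : ((k+1:ℕ):ℝ≥0∞) ≠ 0 := by positivity
  have h2 : ((k+1:ℕ):ℝ≥0∞) ≠ ⊤ := by finiteness
  rw [Nat.factorial_succ, Nat.cast_mul, ENNReal.mul_div_mul_left _ _ h1 h2, mul_div_assoc]

lemma prod_add_lin {ι : Type*} [DecidableEq ι] (t : Finset ι) (x y : ι → ℝ≥0∞) :
    ∏ a ∈ t, x a + ∑ l ∈ t, y l * ∏ a ∈ t.erase l, x a ≤ ∏ a ∈ t, (x a + y a) := by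
  induction t using Finset.induction_on with
  | empty => simp
  | insert b t hb ih =>
    rw [prod_insert hb, prod_insert hb, sum_insert hb, erase_insert hb]
    have : ∑ l ∈ t, y l * ∏ a ∈ (insert b t).erase l, x a = x b * ∑ l ∈ t, y l * ∏ a ∈ t.erase l, x a := by
      rw [mul_sum]
      apply sum_congr rfl
      intro l hl
      have hlb : b ≠ l := fun h => hb (h ▸ hl)
      rw [erase_insert_of_ne hlb, prod_insert (by simp [hb])]
      ring
    rw [this]
    calc x b * ∏ a ∈ t, x a + (y b * ∏ a ∈ t, x a + x b * ∑ l ∈ t, y l * ∏ a ∈ t.erase l, x a)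
        ≤ x b * ∏ a ∈ t, x a + (y b * ∏ a ∈ t, x a + x b * ∑ l ∈ t, y l * ∏ a ∈ t.erase l, x a)
          + y b * ∑ l ∈ t, y l * ∏ a ∈ t.erase l, x a := le_self_add
      _ = (x b + y b) * (∏ a ∈ t, x a + ∑ l ∈ t, y l * ∏ a ∈ t.erase l, x a) := by ring
      _ ≤ _ := by gcongr

lemma pois_add_ge {ι : Type*} [Fintype ι] [DecidableEq ι] (s w : ι → ℝ≥0∞) (c : ι → ℕ) :
    pois s c + ∑ l, (if c l = 0 then 0 else w l * pois s (Function.update c l (c l - 1)))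
      ≤ pois (s + w) c := by
  have h := prod_add_lin univ (fun a => s a ^ c a / ((c a).factorial : ℝ≥0∞))
    (fun a => if c a = 0 then 0 else w a * (s a ^ (c a - 1) / ((c a - 1).factorial : ℝ≥0∞)))
  refine le_trans (le_of_eq ?_) (h.trans ?_)
  · unfold pois
    congr 1
    apply sum_congr rfl
    intro l _
    split_ifs with h0
    · simp
    · rw [← Finset.mul_prod_erase univ _ (mem_univ l), ← mul_assoc]
      simp only [Function.update_self]
      congr 1
      apply prod_congr rfl
      intro x hx
      have : x ≠ l := (mem_erase.1 hx).1
      simp [this]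
  · unfold pois
    apply prod_le_prod'
    intro a _
    rcases hk : c a with _ | k
    · simp
    · simpa using pow_add_fact (s a) (w a) k

lemma pois_add_sum {ι : Type*} [Fintype ι] [DecidableEq ι] (s w : ι → ℝ≥0∞) (Ψ : (ι → ℕ) → ℝ≥0∞) :
    ∑' c, Ψ c * pois s c + ∑ l, w l * ∑' c, Ψ (bump l c) * pois s c ≤ ∑' c, Ψ c * pois (s + w) c := by
  have h1 : ∀ l, w l * ∑' c, Ψ (bump l c) * pois s c =
      ∑' c, Ψ c * (if c l = 0 then 0 else w l * pois s (Function.update c l (c l - 1))) := by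
    intro l
    rw [← ENNReal.tsum_mul_left]
    rw [← (bump_inj l).tsum_eq (f := fun c => Ψ c * (if c l = 0 then 0 else w l * pois s (Function.update c l (c l - 1))))]
    · apply tsum_congr
      intro c
      have e1 : bump l c l = c l + 1 := by simp [bump]
      have e2 : Function.update (bump l c) l (bump l c l - 1) = c := by
        simp [bump]
      rw [e2, e1]; simp; ring
    · intro c hc
      have h0 : c l ≠ 0 := by
        intro h; simp [h] at hc
      refine ⟨Function.update c l (c l - 1), ?_⟩
      funext b
      by_cases hb : b = l
      · subst hb; simp [bump]; omega
      · simp [bump, hb]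
  simp_rw [h1]
  rw [← Summable.tsum_finsetSum (fun _ _ => ENNReal.summable), ← ENNReal.tsum_add]
  apply ENNReal.tsum_le_tsum
  intro c
  rw [← mul_sum, ← mul_add]
  gcongr
  exact pois_add_ge s w c

noncomputable def cnt {V : ℕ} (a : Finset ℕ) (gg : ℕ → Fin V) : Fin V → ℕ := fun l => #{p ∈ a | gg p = l}

lemma cnt_insert {V : ℕ} (a : Finset ℕ) (p : ℕ) (hp : p ∉ a) (gg : ℕ → Fin V) (l : Fin V) :
    cnt (insert p a) (Function.update gg p l) = bump l (cnt a gg) := by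
  have hf : ∀ b, ({q ∈ a | Function.update gg p l q = b} : Finset ℕ) = {q ∈ a | gg q = b} := by
    intro b
    apply filter_congr
    intro q hq
    have : q ≠ p := fun h => hp (h ▸ hq)
    simp [this]
  funext b
  unfold cnt
  rw [filter_insert, hf]
  by_cases hb : b = l
  · subst hb
    simp [bump, hp]
  · have : l ≠ b := fun h => hb h.symm
    simp [bump, hb, this]

theorem claimS {V : ℕ} (W : ℕ → ℝ≥0∞) (W1 : W 1 = 1) (Wm : ∀ m n, Nat.Coprime m n → W (m*n) = W m * W n)
    (ω : ℕ → Fin V → ℝ≥0∞) (ε : ℕ → ℝ≥0∞) (P : Finset ℕ) (hP : ∀ p ∈ P, p.Prime)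
    (hω : ∀ p ∈ P, W p ≤ ∑ l, ω p l) (hε : ∀ p ∈ P, ∑' v : ℕ, W (p^(v+2)) * (2*(v+3)) ≤ ε p) :
    ∀ (F : ℕ → ℝ≥0∞) (Ψ : (Fin V → ℕ) → ℝ≥0∞),
      (∀ p ∈ P, ∀ n v : ℕ, ¬ p ∣ n → F (p^v*n) ≤ 2*(v+1) * F n) →
      (∀ a ⊆ P, ∀ gg : ℕ → Fin V, (∀ p ∈ a, ω p (gg p) ≠ 0) → F (∏ p ∈ a, p) ≤ Ψ (cnt a gg)) →
      (Nonempty (Fin V)) →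
      ∑' n : Nat.factoredNumbers P, W n * F n ≤
        (∏ p ∈ P, (1 + ε p)) * ∑' c, Ψ c * pois (∑ p ∈ P, ω p) c := by
  induction P using Finset.induction_on with
  | empty =>
    intro F Ψ _ hb ⟨l0⟩
    have h0 : cnt (∅ : Finset ℕ) (fun _ => l0) = 0 := by funext l; simp [cnt]
    have h1 : F 1 ≤ Ψ 0 := by
      have := hb ∅ (by simp) (fun _ => l0) (by simp)
      rwa [h0, prod_empty] at this
    rw [prod_empty, one_mul]
    have h2 : ∑' n : Nat.factoredNumbers ∅, W n * F n = W 1 * F 1 := by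
      rw [Nat.factoredNumbers_empty]
      rw [tsum_singleton (f := fun n => W n * F n)]
    rw [h2, W1, one_mul]
    refine le_trans ?_ (ENNReal.le_tsum (0 : Fin V → ℕ))
    simpa [pois] using h1
  | insert p s hps ih =>
    intro F Ψ ha hb hV
    have hp : p.Prime := hP p (mem_insert_self _ _)
    have ih' := ih (fun q hq => hP q (mem_insert_of_mem hq)) (fun q hq => hω q (mem_insert_of_mem hq))
      (fun q hq => hε q (mem_insert_of_mem hq))
    rw [prod_insert hps, sum_insert hps]
    have hcop : ∀ (n : Nat.factoredNumbers s) (e : ℕ), Nat.Coprime (p^e) n := fun n e =>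
      (Nat.Coprime.pow_left e (hp.factoredNumbers_coprime hps n.2))
    have hndvd : ∀ (n : Nat.factoredNumbers s), ¬ p ∣ (n:ℕ) := fun n =>
      (hp.coprime_iff_not_dvd.1 (by simpa using hcop n 1))
    set E := ∏ q ∈ s, (1 + ε q)
    set S0 := ∑' n : Nat.factoredNumbers s, W n * F n with hS0
    have A0 : S0 ≤ E * ∑' c, Ψ c * pois (∑ p ∈ s, ω p) c :=
      ih' F Ψ (fun q hq => ha q (mem_insert_of_mem hq))
        (fun a has gg hgg => hb a (has.trans (subset_insert _ _)) gg hgg) hV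
    have A1 : W p * ∑' n : Nat.factoredNumbers s, W n * F (p * n) ≤
        E * ∑ l, ω p l * ∑' c, Ψ (bump l c) * pois (∑ p ∈ s, ω p) c := by
      calc _ ≤ (∑ l, ω p l) * ∑' n : Nat.factoredNumbers s, W n * F (p * n) := by
            gcongr; exact hω p (mem_insert_self _ _)
        _ = ∑ l, ω p l * ∑' n : Nat.factoredNumbers s, W n * F (p * n) := by rw [sum_mul]
        _ ≤ ∑ l, ω p l * (E * ∑' c, Ψ (bump l c) * pois (∑ p ∈ s, ω p) c) := by
            apply sum_le_sum
            intro l _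
            by_cases hl : ω p l = 0
            · simp [hl]
            gcongr
            apply ih' (fun n => F (p*n)) (fun c => Ψ (bump l c)) _ _ hV
            · intro q hq n v hn
              have hqp : q ≠ p := fun h => hps (h ▸ hq)
              have hq' := hP q (mem_insert_of_mem hq)
              have := ha q (mem_insert_of_mem hq) (p*n) v (by
                rw [hq'.dvd_mul]; push Not
                exact ⟨fun h => hqp ((Nat.prime_dvd_prime_iff_eq hq' hp).1 h), hn⟩)
              calc F (p * (q^v*n)) = F (q^v * (p*n)) := by congr 1; ring
                _ ≤ _ := this
            · intro a has gg hgg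
              have hpa : p ∉ a := fun h => hps (has h)
              have := hb (insert p a) (insert_subset_insert _ has) (Function.update gg p l) (by
                intro q hq
                by_cases hqp : q = p
                · subst hqp; simpa using hl
                · simpa [hqp] using hgg q ((mem_insert.1 hq).resolve_left hqp))
              rw [prod_insert hpa, cnt_insert a p hpa] at this
              exact this
        _ = _ := by rw [mul_sum]; apply sum_congr rfl; intro l _; ring
    have A2 : ∑' v : ℕ, ∑' n : Nat.factoredNumbers s, W (p^(v+2)*n) * F (p^(v+2) * n) ≤ ε p * S0 := by
      calc _ ≤ ∑' v : ℕ, ∑' n : Nat.factoredNumbers s, (W (p^(v+2)) * (2*(v+3))) * (W n * F n) := by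
            apply ENNReal.tsum_le_tsum; intro v
            apply ENNReal.tsum_le_tsum; intro n
            rw [Wm _ _ (hcop n _)]
            calc _ ≤ W (p^(v+2)) * W n * (2*(((v+2:ℕ):ℝ≥0∞)+1) * F n) := by
                  gcongr; exact ha p (mem_insert_self _ _) n (v+2) (hndvd n)
              _ = _ := by push_cast; ring
        _ = (∑' v : ℕ, W (p^(v+2)) * (2*(v+3))) * S0 := by
            simp_rw [ENNReal.tsum_mul_left]
            rw [ENNReal.tsum_mul_right]
        _ ≤ _ := by gcongr; exact hε p (mem_insert_self _ _)
    have key : ∑' n : Nat.factoredNumbers (insert p s), W n * F n =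
        S0 + (W p * ∑' n : Nat.factoredNumbers s, W n * F (p * n) +
          ∑' v : ℕ, ∑' n : Nat.factoredNumbers s, W (p^(v+2)*n) * F (p^(v+2) * n)) := by
      rw [← (Nat.equivProdNatFactoredNumbers hp hps).tsum_eq, ENNReal.tsum_prod']
      simp only [Nat.equivProdNatFactoredNumbers_apply']
      rw [tsum_eq_zero_add' ENNReal.summable, tsum_eq_zero_add' ENNReal.summable]
      simp only [pow_zero, one_mul, zero_add, pow_one]
      congr 2
      rw [← ENNReal.tsum_mul_left]
      apply tsum_congr; intro n
      rw [Wm _ _ (by simpa using hcop n 1), mul_assoc]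
    rw [key]
    have A3 := pois_add_sum (∑ p ∈ s, ω p) (ω p) Ψ
    calc _ ≤ S0 + (E * ∑ l, ω p l * ∑' c, Ψ (bump l c) * pois (∑ p ∈ s, ω p) c + ε p * S0) := by gcongr
      _ = (1 + ε p) * S0 + E * ∑ l, ω p l * ∑' c, Ψ (bump l c) * pois (∑ p ∈ s, ω p) c := by ring
      _ ≤ (1 + ε p) * (E * ∑' c, Ψ c * pois (∑ p ∈ s, ω p) c) +
          (1 + ε p) * (E * ∑ l, ω p l * ∑' c, Ψ (bump l c) * pois (∑ p ∈ s, ω p) c) := by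
          exact add_le_add (mul_le_mul_right A0 _) (le_mul_of_one_le_left' le_self_add)
      _ = (1 + ε p) * E * (∑' c, Ψ c * pois (∑ p ∈ s, ω p) c + ∑ l, ω p l * ∑' c, Ψ (bump l c) * pois (∑ p ∈ s, ω p) c) := by ring
      _ ≤ _ := by rw [add_comm (ω p)]; gcongr

/-- admissible weights -/
structure Wt (g : ℕ → ℝ) : Prop where
  nn : ∀ n, 0 ≤ g n
  one : g 1 = 1
  mul : ∀ m n, Nat.Coprime m n → g (m*n) = g m * g n
  pl : ∀ p : ℕ, p.Prime → 1 ≤ g p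
  pu : ∀ p : ℕ, p.Prime → g p ≤ 2
  pv : ∀ p v : ℕ, p.Prime → 2 ≤ v → g (p^v) ≤ (p:ℝ)^((v:ℝ)/4)
  sm : ∃ C : ℝ, 0 ≤ C ∧ ∀ N : ℕ, ∑ p ∈ (Ioc 0 N).filter Nat.Prime, (g p - 1)/p ≤ C

noncomputable def Wg (g : ℕ → ℝ) (θ : ℝ) (n : ℕ) : ℝ≥0∞ := ENNReal.ofReal (g n * (n:ℝ)^(θ-1))

lemma Wg_one {g} (hg : Wt g) (θ : ℝ) : Wg g θ 1 = 1 := by simp [Wg, hg.one]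

lemma Wg_mul {g} (hg : Wt g) (θ : ℝ) (m n : ℕ) (h : Nat.Coprime m n) : Wg g θ (m*n) = Wg g θ m * Wg g θ n := by
  unfold Wg
  rw [← ENNReal.ofReal_mul (mul_nonneg (hg.nn m) (by positivity)), hg.mul m n h, Nat.cast_mul,
    mul_rpow (by positivity) (by positivity)]
  congr 1; ring

noncomputable def rr : ℝ := (2:ℝ)^(-(5/8):ℝ)
lemma rr_pos : 0 < rr := by unfold rr; positivity
lemma rr_lt : rr < 1 := by unfold rr; exact rpow_lt_one_of_one_lt_of_neg (by norm_num) (by norm_num)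

lemma Ce_summable : Summable (fun v : ℕ => (2*((v:ℝ)+3)) * rr^v) := by
  have h1 := summable_pow_mul_geometric_of_norm_lt_one 1 (r := rr) (by
    rw [norm_of_nonneg rr_pos.le]; exact rr_lt)
  have h0 := summable_geometric_of_lt_one rr_pos.le rr_lt
  have := (h1.mul_left 2).add (h0.mul_left 6)
  refine this.congr (fun v => ?_)
  simp only [pow_one]; ring

noncomputable def Ce : ℝ := ∑' v : ℕ, (2*((v:ℝ)+3)) * rr^v
lemma Ce_nonneg : 0 ≤ Ce := tsum_nonneg (fun v => by have := rr_pos; positivity)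

lemma Wg_pv {g} (hg : Wt g) {θ : ℝ} (hθ : θ ≤ 1/8) (p v : ℕ) (hp : p.Prime) (hv : 2 ≤ v) :
    Wg g θ (p^v) ≤ ENNReal.ofReal ((p:ℝ)^(-(5/4):ℝ) * rr^(v-2)) := by
  obtain ⟨w, rfl⟩ := Nat.exists_eq_add_of_le hv
  apply ENNReal.ofReal_le_ofReal
  have hp2 : (2:ℝ) ≤ p := by exact_mod_cast hp.two_le
  have hp0 : (0:ℝ) < p := by linarith
  calc g (p^(2+w)) * ((p^(2+w):ℕ):ℝ)^(θ-1) ≤ (p:ℝ)^(((2+w:ℕ):ℝ)/4) * ((p^(2+w):ℕ):ℝ)^(θ-1) := by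
        gcongr; exact hg.pv p _ hp hv
    _ = (p:ℝ)^(((2+w:ℕ):ℝ)/4 + ((2+w:ℕ):ℝ)*(θ-1)) := by
        rw [rpow_add hp0]; congr 1
        rw [Nat.cast_pow, ← rpow_natCast, ← rpow_mul hp0.le]
    _ ≤ (p:ℝ)^(-(5/4) + (-(5/8))*(w:ℝ)) := by
        apply rpow_le_rpow_of_exponent_le (by linarith)
        push_cast
        nlinarith [Nat.cast_nonneg (α := ℝ) w]
    _ = (p:ℝ)^(-(5/4):ℝ) * ((p:ℝ)^(-(5/8):ℝ))^w := by
        rw [rpow_add hp0, rpow_mul hp0.le, rpow_natCast]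
    _ ≤ (p:ℝ)^(-(5/4):ℝ) * rr^w := by
        gcongr
        unfold rr
        exact rpow_le_rpow_of_nonpos (by norm_num) hp2 (by norm_num)
    _ = _ := by simp

lemma Wg_eps {g} (hg : Wt g) {θ : ℝ} (hθ : θ ≤ 1/8) (p : ℕ) (hp : p.Prime) :
    ∑' v : ℕ, Wg g θ (p^(v+2)) * (2*(v+3)) ≤ ENNReal.ofReal (Ce * (p:ℝ)^(-(5/4):ℝ)) := by
  calc _ ≤ ∑' v : ℕ, ENNReal.ofReal ((p:ℝ)^(-(5/4):ℝ) * ((2*((v:ℝ)+3)) * rr^v)) := by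
        apply ENNReal.tsum_le_tsum; intro v
        have e : (2*((v:ℝ≥0∞)+3)) = ENNReal.ofReal (2*((v:ℝ)+3)) := by
          rw [ENNReal.ofReal_mul (by norm_num), ENNReal.ofReal_add (by positivity) (by norm_num)]; simp
        rw [e]
        calc _ ≤ ENNReal.ofReal ((p:ℝ)^(-(5/4):ℝ) * rr^v) * ENNReal.ofReal (2*((v:ℝ)+3)) := by
              gcongr; simpa using Wg_pv hg hθ p (v+2) hp (by omega)
          _ = _ := by
              have := rr_pos
              rw [← ENNReal.ofReal_mul (by positivity)]; congr 1; ring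
    _ = ENNReal.ofReal (∑' v : ℕ, ((p:ℝ)^(-(5/4):ℝ) * ((2*((v:ℝ)+3)) * rr^v))) := by
        rw [ENNReal.ofReal_tsum_of_nonneg]
        · intro v; have := rr_pos; positivity
        · exact Ce_summable.mul_left _
    _ = _ := by rw [tsum_mul_left, mul_comm]; rfl

noncomputable def Cz : ℝ := ∑' n : ℕ, (n:ℝ)^(-(5/4):ℝ)
lemma Cz_summable : Summable (fun n : ℕ => (n:ℝ)^(-(5/4):ℝ)) := summable_nat_rpow.2 (by norm_num)

lemma prod_eps_le (P : Finset ℕ) :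
    ∏ p ∈ P, (1 + ENNReal.ofReal (Ce * (p:ℝ)^(-(5/4):ℝ))) ≤ ENNReal.ofReal (exp (Ce * Cz)) := by
  have hc := Ce_nonneg
  calc _ ≤ ∏ p ∈ P, ENNReal.ofReal (exp (Ce * (p:ℝ)^(-(5/4):ℝ))) := by
        apply prod_le_prod'
        intro p _
        rw [← ENNReal.ofReal_one, ← ENNReal.ofReal_add (by norm_num) (by positivity)]
        apply ENNReal.ofReal_le_ofReal
        rw [add_comm]; exact add_one_le_exp _
    _ = ENNReal.ofReal (exp (Ce * ∑ p ∈ P, (p:ℝ)^(-(5/4):ℝ))) := by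
        rw [← ENNReal.ofReal_prod_of_nonneg (fun _ _ => (exp_pos _).le), ← exp_sum, mul_sum]
    _ ≤ _ := by
        apply ENNReal.ofReal_le_ofReal
        gcongr
        exact Cz_summable.sum_le_tsum _ (fun n _ => by positivity)

/-- Euler product upper bound -/
lemma euler_le (W : ℕ → ℝ≥0∞) (W1 : W 1 = 1) (Wm : ∀ m n, Nat.Coprime m n → W (m*n) = W m * W n)
    (P : Finset ℕ) (hP : ∀ p ∈ P, p.Prime) :
    ∑' n : Nat.factoredNumbers P, W n = ∏ p ∈ P, ∑' v : ℕ, W (p^v) := by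
  induction P using Finset.induction_on with
  | empty =>
    rw [Nat.factoredNumbers_empty, tsum_singleton (f := fun n => W n)]; simp [W1]
  | insert p s hps ih =>
    have hp : p.Prime := hP p (mem_insert_self _ _)
    rw [prod_insert hps, ← ih (fun q hq => hP q (mem_insert_of_mem hq))]
    rw [← (Nat.equivProdNatFactoredNumbers hp hps).tsum_eq, ENNReal.tsum_prod', ← ENNReal.tsum_mul_right]
    apply tsum_congr; intro v
    rw [← ENNReal.tsum_mul_left]
    apply tsum_congr; intro n
    rw [Nat.equivProdNatFactoredNumbers_apply']
    exact Wm _ _ (Nat.Coprime.pow_left v (hp.factoredNumbers_coprime hps n.2))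

lemma euler_Wg {g} (hg : Wt g) {θ : ℝ} (hθ : θ ≤ 1/8) (P : Finset ℕ) (hP : ∀ p ∈ P, p.Prime) :
    ∑' n : Nat.factoredNumbers P, Wg g θ n ≤
      ENNReal.ofReal (exp (Ce * Cz + ∑ p ∈ P, g p * (p:ℝ)^(θ-1))) := by
  rw [euler_le _ (Wg_one hg θ) (Wg_mul hg θ) P hP]
  have hc := Ce_nonneg
  calc _ ≤ ∏ p ∈ P, ((1 + ENNReal.ofReal (Ce * (p:ℝ)^(-(5/4):ℝ))) * ENNReal.ofReal (exp (g p * (p:ℝ)^(θ-1)))) := by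
        apply prod_le_prod'
        intro p hp
        have hpp := hP p hp
        rw [tsum_eq_zero_add' ENNReal.summable, tsum_eq_zero_add' ENNReal.summable]
        simp only [pow_zero, zero_add, pow_one, Wg_one hg]
        have h1 : ∑' v : ℕ, Wg g θ (p^(v+1+1)) ≤ ENNReal.ofReal (Ce * (p:ℝ)^(-(5/4):ℝ)) := by
          refine le_trans (ENNReal.tsum_le_tsum fun v => ?_) (Wg_eps hg hθ p hpp)
          refine le_mul_of_one_le_right' ?_
          calc (1:ℝ≥0∞) ≤ 2 * (0 + 3) := by norm_num
            _ ≤ _ := by gcongr; exact zero_le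
        have h2 : 1 + Wg g θ p ≤ ENNReal.ofReal (exp (g p * (p:ℝ)^(θ-1))) := by
          unfold Wg
          have := hg.nn p
          rw [← ENNReal.ofReal_one, ← ENNReal.ofReal_add (by norm_num) (by positivity)]
          apply ENNReal.ofReal_le_ofReal
          rw [add_comm]; exact add_one_le_exp _
        have h3 : (1:ℝ≥0∞) ≤ ENNReal.ofReal (exp (g p * (p:ℝ)^(θ-1))) := le_trans le_self_add h2
        calc _ ≤ 1 + (Wg g θ p + ENNReal.ofReal (Ce * (p:ℝ)^(-(5/4):ℝ))) := by gcongr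
          _ = (1 + Wg g θ p) + ENNReal.ofReal (Ce * (p:ℝ)^(-(5/4):ℝ)) * 1 := by ring
          _ ≤ ENNReal.ofReal (exp (g p * (p:ℝ)^(θ-1))) + ENNReal.ofReal (Ce * (p:ℝ)^(-(5/4):ℝ)) * ENNReal.ofReal (exp (g p * (p:ℝ)^(θ-1))) := by gcongr
          _ = _ := by ring
    _ = (∏ p ∈ P, (1 + ENNReal.ofReal (Ce * (p:ℝ)^(-(5/4):ℝ)))) * ∏ p ∈ P, ENNReal.ofReal (exp (g p * (p:ℝ)^(θ-1))) := by
        rw [prod_mul_distrib]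
    _ ≤ ENNReal.ofReal (exp (Ce * Cz)) * ENNReal.ofReal (exp (∑ p ∈ P, g p * (p:ℝ)^(θ-1))) := by
        gcongr
        · exact prod_eps_le P
        · rw [exp_sum, ENNReal.ofReal_prod_of_nonneg (fun _ _ => (exp_pos _).le)]
    _ = _ := by rw [← ENNReal.ofReal_mul (exp_pos _).le, ← exp_add]

/-- primes up to N -/
def PP (N : ℕ) : Finset ℕ := (Ioc 0 N).filter Nat.Prime
lemma PP_prime {N p : ℕ} (h : p ∈ PP N) : p.Prime := (mem_filter.1 h).2
lemma PP_mem {N p : ℕ} : p ∈ PP N ↔ p ≤ N ∧ p.Prime := by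
  simp [PP]; intro h _; exact h.pos

/-- upper bound of `∑ g(p)/p` over `M < p ≤ N`. -/
lemma sum_g_range {g} (hg : Wt g) : ∃ C : ℝ, 0 ≤ C ∧ ∀ M N : ℕ, 2 ≤ M → M ≤ N →
    ∑ p ∈ PP N \ PP M, g p / p ≤ log (log N) - log (log M) + C := by
  obtain ⟨C1, h1, H1⟩ := sum_inv_prime
  obtain ⟨C2, h2, H2⟩ := hg.sm
  refine ⟨2*C1+C2, by positivity, fun M N hM hMN => ?_⟩
  have hsub : PP M ⊆ PP N := by
    intro p hp; rw [PP_mem] at *; exact ⟨hp.1.trans hMN, hp.2⟩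
  have e : ∑ p ∈ PP N \ PP M, g p / p = ∑ p ∈ PP N \ PP M, (g p - 1) / p + (∑ p ∈ PP N, (1/p:ℝ) - ∑ p ∈ PP M, (1/p:ℝ)) := by
    rw [← sum_sdiff hsub, add_sub_cancel_right, ← sum_add_distrib]
    apply sum_congr rfl; intro p _; ring
  have e2 : ∑ p ∈ PP N \ PP M, (g p - 1) / p ≤ C2 := by
    refine le_trans (sum_le_sum_of_subset_of_nonneg sdiff_subset ?_) (H2 N)
    intro p hp _
    have := hg.pl p (PP_prime hp)
    have : 0 ≤ g p - 1 := by linarith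
    positivity
  have a := abs_le.1 (H1 N (by omega))
  have b := abs_le.1 (H1 M hM)
  rw [e]; unfold PP at *; linarith [a.1, a.2, b.1, b.2]

lemma sum_g_all {g} (hg : Wt g) : ∃ C : ℝ, 0 ≤ C ∧ ∀ N : ℕ, 2 ≤ N →
    ∑ p ∈ PP N, g p / p ≤ log (log N) + C := by
  obtain ⟨C1, h1, H1⟩ := sum_inv_prime
  obtain ⟨C2, h2, H2⟩ := hg.sm
  refine ⟨C1+C2, by positivity, fun N hN => ?_⟩
  have e : ∑ p ∈ PP N, g p / p = ∑ p ∈ PP N, (g p - 1) / p + ∑ p ∈ PP N, (1/p:ℝ) := by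
    rw [← sum_add_distrib]
    apply sum_congr rfl; intro p _; ring
  have a := abs_le.1 (H1 N hN)
  have b := H2 N
  rw [e]; unfold PP at *; linarith [a.1, a.2]

end FF

namespace FF
open Finset Complex

noncomputable def bz (k : ℕ) (s : ℂ) : ℂ :=
  (s-1) * ((k:ℂ)+1)^(-s) + ((k:ℂ)+1+1)^(1-s) - ((k:ℂ)+1)^(1-s)

lemma bz_sum (K : ℕ) (s : ℂ) : ∑ k ∈ range K, bz k s =
    (s-1) * ∑ k ∈ range K, ((k:ℂ)+1)^(-s) + ((K:ℂ)+1)^(1-s) - 1 := by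
  induction K with
  | zero => simp
  | succ K ih =>
    rw [sum_range_succ, sum_range_succ, ih, bz]; push_cast; ring

lemma bz_bound (k : ℕ) (s : ℂ) (hs : 0 < s.re) : ‖bz k s‖ ≤ ‖s-1‖ * ‖s‖ * ((k:ℝ)+1)^(-s.re-1) := by
  have hk : (0:ℝ) < (k:ℝ)+1 := by positivity
  set n : ℝ := (k:ℝ)+1 with hn
  have hd : ∀ (r : ℂ) (x : ℝ), 0 < x → HasDerivAt (fun y : ℝ => (y:ℂ)^r) (r * (x:ℂ)^(r-1)) x := by
    intro r x hx
    have := (HasDerivAt.comp_ofReal (z := x) (e := fun z : ℂ => z^r) (e' := r * (x:ℂ)^(r-1) * 1) ((hasDerivAt_id (x:ℂ)).cpow_const (by simp [Complex.slitPlane, hx])))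
    simpa using this
  have h1 : ∀ x ∈ Set.Icc n (n+1), ‖(x:ℂ)^(-s) - (n:ℂ)^(-s)‖ ≤ (‖s‖ * n^(-s.re-1)) * (x - n) := by
    intro x hx
    have h2 : ∀ y ∈ Set.Icc n (n+1), HasDerivWithinAt (fun y : ℝ => (y:ℂ)^(-s)) ((-s) * (y:ℂ)^(-s-1)) (Set.Icc n (n+1)) y :=
      fun y hy => (hd (-s) y (lt_of_lt_of_le hk hy.1)).hasDerivWithinAt
    have := norm_image_sub_le_of_norm_deriv_le_segment' h2 (C := ‖s‖ * n^(-s.re-1)) ?_ x hx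
    · exact this
    · intro y hy
      have hy0 : 0 < y := lt_of_lt_of_le hk hy.1
      rw [norm_mul, norm_neg, Complex.norm_cpow_eq_rpow_re_of_pos hy0]
      apply mul_le_mul_of_nonneg_left _ (norm_nonneg _)
      simp only [sub_re, neg_re, one_re]
      exact Real.rpow_le_rpow_of_nonpos hk hy.1 (by linarith)
  set B : ℝ := ‖s‖ * n^(-s.re-1) with hB
  have hB0 : 0 ≤ B := by positivity
  have h3 : ∀ y ∈ Set.Icc n (n+1), HasDerivWithinAt (fun y : ℝ => (s-1) * (n:ℂ)^(-s) * (y:ℂ) + (y:ℂ)^(1-s))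
      ((s-1) * (n:ℂ)^(-s) * 1 + (1-s) * (y:ℂ)^(1-s-1)) (Set.Icc n (n+1)) y := by
    intro y hy
    exact ((((hasDerivAt_id (y:ℝ)).ofReal_comp).const_mul _).add (hd (1-s) y (lt_of_lt_of_le hk hy.1))).hasDerivWithinAt
  have h4 := norm_image_sub_le_of_norm_deriv_le_segment' h3 (C := ‖s-1‖ * B) ?_ (n+1) ⟨by linarith, le_rfl⟩
  · have e : bz k s = ((s-1) * (n:ℂ)^(-s) * ((n+1:ℝ):ℂ) + ((n+1:ℝ):ℂ)^(1-s)) - ((s-1) * (n:ℂ)^(-s) * (n:ℂ) + (n:ℂ)^(1-s)) := by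
      rw [bz, hn]; push_cast; ring
    rw [e]
    refine h4.trans (le_of_eq ?_)
    rw [hB]; ring
  · intro y hy
    have e : (s-1) * (n:ℂ)^(-s) * 1 + (1-s) * (y:ℂ)^(1-s-1) = -((s-1) * ((y:ℂ)^(-s) - (n:ℂ)^(-s))) := by
      rw [show (1-s-1:ℂ) = -s by ring]; ring
    rw [e, norm_neg, norm_mul]
    apply mul_le_mul_of_nonneg_left _ (norm_nonneg _)
    refine (h1 y ⟨hy.1, hy.2.le⟩).trans ?_
    have : y - n ≤ 1 := by linarith [hy.2]
    nlinarith

lemma bz_summable_aux {r : ℝ} (hr : 0 < r) : Summable (fun k : ℕ => ((k:ℝ)+1)^(-r-1)) := by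
  have := (summable_nat_add_iff 1).2 (Real.summable_nat_rpow.2 (by linarith : -r-1 < -1))
  simpa using this

lemma bz_summable (s : ℂ) (hs : 0 < s.re) : Summable (fun k => bz k s) :=
  Summable.of_norm_bounded ((bz_summable_aux hs).mul_left (‖s-1‖*‖s‖)) (fun k => bz_bound k s hs)

lemma zeta1_of_one_lt (s : ℂ) (hs : 1 < s.re) : riemannZeta₁ s = 1 + ∑' k, bz k s := by
  have hs1 : s ≠ 1 := by rintro rfl; simp at hs
  have h1 := (bz_summable s (by linarith)).hasSum.tendsto_sum_nat
  have hz : HasSum (fun k : ℕ => ((k:ℂ)+1)^(-s)) (riemannZeta s) := by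
    have hsum : Summable (fun n : ℕ => 1 / (n:ℂ)^s) := Complex.summable_one_div_nat_cpow.2 hs
    have h2 := zeta_eq_tsum_one_div_nat_add_one_cpow hs
    have h3 : Summable (fun n : ℕ => 1 / ((n:ℂ)+1)^s) := by
      have := (summable_nat_add_iff 1).2 hsum
      simpa using this
    rw [h2]
    convert h3.hasSum using 2 with n
    rw [cpow_neg, one_div]
  have h2 := hz.tendsto_sum_nat
  have h3 : Tendsto (fun K : ℕ => ((K:ℂ)+1)^(1-s)) atTop (nhds 0) := by
    rw [tendsto_zero_iff_norm_tendsto_zero]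
    have : ∀ K : ℕ, ‖((K:ℂ)+1)^(1-s)‖ = ((K:ℝ)+1)^(-(s.re-1)) := by
      intro K
      have := Complex.norm_cpow_eq_rpow_re_of_pos (x := (K:ℝ)+1) (by positivity) (1-s)
      push_cast at this
      rw [this]; congr 1; simp
    simp_rw [this]
    exact (tendsto_rpow_neg_atTop (by linarith)).comp (tendsto_atTop_add_const_right _ _ tendsto_natCast_atTop_atTop)
  have h4 : Tendsto (fun K => ∑ k ∈ range K, bz k s) atTop (nhds ((s-1) * riemannZeta s + 0 - 1)) := by
    simp_rw [bz_sum]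
    exact ((h2.const_mul _).add h3).sub_const 1
  have h5 := tendsto_nhds_unique h1 h4
  rw [h5, riemannZeta_eq_inv_sub_mul hs1]
  have := sub_ne_zero.2 hs1
  field_simp; ring

lemma zeta1_eq (s : ℂ) (hs : 1/4 < s.re) : riemannZeta₁ s = 1 + ∑' k, bz k s := by
  set R : ℝ := ‖s‖ + 3 with hR
  set U : Set ℂ := {z | 1/4 < z.re} ∩ Metric.ball 0 R with hU
  have hUo : IsOpen U := (isOpen_lt continuous_const continuous_re).inter Metric.isOpen_ball
  have hUc : Convex ℝ U := (convex_halfSpace_re_gt _).inter (convex_ball _ _)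
  have hb : DifferentiableOn ℂ (fun z => ∑' k, bz k z) U := by
    refine differentiableOn_tsum_of_summable_norm (u := fun k => (R+1)*R * ((k:ℝ)+1)^(-(1/4:ℝ)-1)) ((bz_summable_aux (by norm_num)).mul_left _) ?_ hUo ?_
    · intro k
      apply Differentiable.differentiableOn
      unfold bz
      have h1 : (k:ℂ)+1 ≠ 0 := by exact_mod_cast Nat.succ_ne_zero k
      have h2 : (k:ℂ)+1+1 ≠ 0 := by exact_mod_cast Nat.succ_ne_zero (k+1)
      intro z
      have d1 : DifferentiableAt ℂ (fun z : ℂ => ((k:ℂ)+1)^(-z)) z := (differentiableAt_id.neg).const_cpow (Or.inl h1)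
      have d2 : DifferentiableAt ℂ (fun z : ℂ => ((k:ℂ)+1+1)^(1-z)) z := (differentiableAt_id.const_sub 1).const_cpow (Or.inl h2)
      have d3 : DifferentiableAt ℂ (fun z : ℂ => ((k:ℂ)+1)^(1-z)) z := (differentiableAt_id.const_sub 1).const_cpow (Or.inl h1)
      exact (((differentiableAt_id.sub_const 1).mul d1).add d2).sub d3
    · intro k z hz
      have hz1 : 1/4 < z.re := hz.1
      have hz2 : ‖z‖ < R := by simpa using hz.2
      refine (bz_bound k z (by linarith)).trans ?_
      have : ‖z-1‖ ≤ R+1 := (norm_sub_le _ _).trans (by simp; linarith)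
      gcongr
      · linarith [norm_nonneg s]
  have e : Set.EqOn riemannZeta₁ (fun z => 1 + ∑' k, bz k z) U := by
    refine AnalyticOnNhd.eqOn_of_preconnected_of_eventuallyEq
      (differentiable_riemannZeta₁.differentiableOn.analyticOnNhd hUo) (((differentiableOn_const 1).add hb).analyticOnNhd hUo)
      hUc.isPreconnected (z₀ := 2) ⟨by norm_num, ?_⟩ ?_
    · simp [hR]; linarith [norm_nonneg s]
    · have : {z : ℂ | 1 < z.re} ∈ nhds (2:ℂ) := (isOpen_lt continuous_const continuous_re).mem_nhds (by norm_num)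
      filter_upwards [this] with z hz using zeta1_of_one_lt z hz
  exact e ⟨hs, by simp [hR]⟩

lemma quarter_sum (K : ℕ) : ∑ k ∈ range K, ((k:ℝ)+1)^(-(3/4):ℝ) ≤ 4 * (K:ℝ)^((1:ℝ)/4) := by
  induction K with
  | zero => simp
  | succ K ih =>
    rw [sum_range_succ]
    have hk : (0:ℝ) < (K:ℝ)+1 := by positivity
    have h := rpow_one_add_le_one_add_mul_self (s := -(1/((K:ℝ)+1))) (p := 1/4) (by
      rw [neg_le_neg_iff, div_le_one hk]; linarith [Nat.cast_nonneg (α := ℝ) K]) (by norm_num) (by norm_num)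
    have e : (1 + -(1/((K:ℝ)+1))) = (K:ℝ)/((K:ℝ)+1) := by field_simp; ring
    rw [e, Real.div_rpow (by positivity) hk.le, div_le_iff₀ (by positivity)] at h
    have e2 : ((K:ℝ)+1)^((1:ℝ)/4) = ((K:ℝ)+1) * ((K:ℝ)+1)^(-(3/4):ℝ) := by
      rw [← Real.rpow_one_add' hk.le (by norm_num)]; norm_num
    have e3 : (1/((K:ℝ)+1)) * ((K:ℝ)+1)^((1:ℝ)/4) = ((K:ℝ)+1)^(-(3/4):ℝ) := by rw [e2]; field_simp
    push_cast
    nlinarith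

lemma tail_step (k : ℕ) : ((k:ℝ)+1+1)^(-(7/4):ℝ) ≤ 2 * (((k:ℝ)+1)^(-(3/4):ℝ) - ((k:ℝ)+1+1)^(-(3/4):ℝ)) := by
  have hk : (0:ℝ) < (k:ℝ)+1 := by positivity
  have hk1 : (0:ℝ) < (k:ℝ)+1+1 := by positivity
  set x : ℝ := ((k:ℝ)+1)/((k:ℝ)+1+1) with hx
  have hx0 : 0 < x := by positivity
  have h1 : 1 - 3/4 * (x-1) ≤ x^(-(3/4):ℝ) := by
    rw [Real.rpow_def_of_pos hx0]
    have := Real.add_one_le_exp (Real.log x * -(3/4))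
    have := Real.log_le_sub_one_of_pos hx0
    linarith
  rw [hx, Real.div_rpow hk.le hk1.le, le_div_iff₀ (by positivity)] at h1
  have e2 : ((k:ℝ)+1+1)^(-(3/4):ℝ) = ((k:ℝ)+1+1) * ((k:ℝ)+1+1)^(-(7/4):ℝ) := by
    rw [← Real.rpow_one_add' hk1.le (by norm_num)]; norm_num
  have e3 : (((k:ℝ)+1)/((k:ℝ)+1+1) - 1) * ((k:ℝ)+1+1)^(-(3/4):ℝ) = -((k:ℝ)+1+1)^(-(7/4):ℝ) := by rw [e2]; field_simp; ring
  have : 0 < ((k:ℝ)+1+1)^(-(7/4):ℝ) := by positivity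
  nlinarith

lemma tail_sum (K : ℕ) : ∑' k : ℕ, (((k+(K+1):ℕ):ℝ)+1)^(-(7/4):ℝ) ≤ 2 * ((K:ℝ)+1)^(-(3/4):ℝ) := by
  apply Real.tsum_le_of_sum_range_le (fun _ => by positivity)
  intro n
  have : ∑ k ∈ range n, (((k+(K+1):ℕ):ℝ)+1)^(-(7/4):ℝ) ≤ 2 * (((K:ℝ)+1)^(-(3/4):ℝ) - (((n+K:ℕ):ℝ)+1)^(-(3/4):ℝ)) := by
    induction n with
    | zero => simp
    | succ n ih =>
      rw [sum_range_succ]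
      have := tail_step (n+K)
      push_cast at *
      rw [show (n:ℝ)+(K+1)+1 = n + K+1+1 by ring, show (n:ℝ)+1+K+1 = n+K+1+1 by ring]
      linarith
  have h : 0 < (((n+K:ℕ):ℝ)+1)^(-(3/4):ℝ) := by positivity
  linarith

theorem zeta_bound : ∃ C : ℝ, 0 < C ∧ ∀ s : ℂ, 3/4 ≤ s.re → s.re ≤ 4 → 1 ≤ |s.im| → ‖riemannZeta s‖ ≤ C * |s.im|^((1:ℝ)/4) := by
  refine ⟨100, by norm_num, fun s hs1 hs2 ht => ?_⟩
  have hsne : s ≠ 1 := by rintro rfl; norm_num at ht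
  set t := |s.im| with htdef
  have hs1' : t ≤ ‖s - 1‖ := by simpa [htdef] using abs_im_le_norm (s-1)
  have hsn : ‖s‖ ≤ 5 * t := (norm_le_abs_re_add_abs_im s).trans (by rw [abs_of_nonneg (by linarith)]; linarith)
  have h1 := zeta1_eq s (by linarith)
  set K := ⌊t⌋₊ with hK
  have hK1 : (K:ℝ) ≤ t := Nat.floor_le (by linarith)
  have hK2 : t < (K:ℝ)+1 := Nat.lt_floor_add_one t
  have hsum := bz_summable s (by linarith)
  rw [← hsum.sum_add_tsum_nat_add (K+1), bz_sum] at h1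
  have hz : riemannZeta s = ∑ k ∈ range (K+1), ((k:ℂ)+1)^(-s) + (s-1)⁻¹ * ((((K+1:ℕ):ℂ)+1)^(1-s) + ∑' k, bz (k+(K+1)) s) := by
    rw [riemannZeta_eq_inv_sub_mul hsne, h1]
    have := sub_ne_zero.2 hsne
    field_simp; ring
  have hn : ∀ (k : ℕ) (r : ℂ), ‖((k:ℂ)+1)^r‖ = ((k:ℝ)+1)^r.re := by
    intro k r
    have := Complex.norm_cpow_eq_rpow_re_of_pos (x := (k:ℝ)+1) (by positivity) r
    push_cast at this; exact this
  have b1 : ‖∑ k ∈ range (K+1), ((k:ℂ)+1)^(-s)‖ ≤ 4 * ((K:ℝ)+1)^((1:ℝ)/4) := by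
    refine (norm_sum_le _ _).trans ?_
    have := quarter_sum (K+1)
    push_cast at this
    refine le_trans (sum_le_sum fun k _ => ?_) this
    rw [hn]
    apply Real.rpow_le_rpow_of_exponent_le
    · linarith [Nat.cast_nonneg (α := ℝ) k]
    · simp; linarith
  have b2 : ‖(((K+1:ℕ):ℂ)+1)^(1-s)‖ ≤ t * 3 := by
    rw [hn]
    calc (((K+1:ℕ):ℝ)+1)^(1-s).re ≤ (((K+1:ℕ):ℝ)+1)^(1:ℝ) := by
          apply Real.rpow_le_rpow_of_exponent_le
          · linarith [Nat.cast_nonneg (α := ℝ) (K+1)]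
          · simp; linarith
      _ ≤ _ := by rw [Real.rpow_one]; push_cast; linarith
  have b3 : ‖∑' k, bz (k+(K+1)) s‖ ≤ ‖s-1‖ * ‖s‖ * (2 * ((K:ℝ)+1)^(-(3/4):ℝ)) := by
    have hsm : Summable (fun k : ℕ => (((k+(K+1):ℕ):ℝ)+1)^(-(7/4):ℝ)) := by
      have := (summable_nat_add_iff (K+1)).2 (bz_summable_aux (r := 3/4) (by norm_num))
      norm_num at this ⊢; exact this
    have hb : ∀ k, ‖bz (k+(K+1)) s‖ ≤ ‖s-1‖ * ‖s‖ * (((k+(K+1):ℕ):ℝ)+1)^(-(7/4):ℝ) := by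
      intro k
      refine (bz_bound _ s (by linarith)).trans ?_
      apply mul_le_mul_of_nonneg_left _ (by positivity)
      apply Real.rpow_le_rpow_of_exponent_le
      · linarith [Nat.cast_nonneg (α := ℝ) (k+(K+1))]
      · linarith
    refine (tsum_of_norm_bounded (hsm.mul_left _).hasSum hb).trans ?_
    rw [tsum_mul_left]
    exact mul_le_mul_of_nonneg_left (tail_sum K) (by positivity)
  have hq : ((K:ℝ)+1)^((1:ℝ)/4) ≤ 2 * t^((1:ℝ)/4) := by
    calc ((K:ℝ)+1)^((1:ℝ)/4) ≤ (2*t)^((1:ℝ)/4) := by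
          apply Real.rpow_le_rpow (by positivity) (by linarith) (by norm_num)
      _ = 2^((1:ℝ)/4) * t^((1:ℝ)/4) := Real.mul_rpow (by norm_num) (by linarith)
      _ ≤ 2^(1:ℝ) * t^((1:ℝ)/4) := by
          gcongr <;> norm_num
      _ = _ := by norm_num
  have ht1 : 1 ≤ t^((1:ℝ)/4) := Real.one_le_rpow ht (by norm_num)
  have h3 : t * ((K:ℝ)+1)^(-(3/4):ℝ) ≤ t^((1:ℝ)/4) := by
    calc t * ((K:ℝ)+1)^(-(3/4):ℝ) ≤ t * t^(-(3/4):ℝ) := by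
          apply mul_le_mul_of_nonneg_left _ (by linarith)
          exact Real.rpow_le_rpow_of_nonpos (by linarith) hK2.le (by norm_num)
      _ = _ := by rw [← Real.rpow_one_add' (by linarith) (by norm_num)]; norm_num
  have hpos : 0 < ‖s-1‖ := by linarith
  rw [hz]
  calc _ ≤ ‖∑ k ∈ range (K+1), ((k:ℂ)+1)^(-s)‖ + ‖s-1‖⁻¹ * (‖(((K+1:ℕ):ℂ)+1)^(1-s)‖ + ‖∑' k, bz (k+(K+1)) s‖) := by
        refine (norm_add_le _ _).trans ?_
        rw [norm_mul, norm_inv]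
        gcongr
        exact norm_add_le _ _
    _ ≤ 4 * (2 * t^((1:ℝ)/4)) + ‖s-1‖⁻¹ * (‖s-1‖ * 3 + ‖s-1‖ * ‖s‖ * (2 * ((K:ℝ)+1)^(-(3/4):ℝ))) := by
        have b2' : t*3 ≤ ‖s-1‖*3 := by linarith
        gcongr
        · linarith
        · linarith
    _ = 4 * (2 * t^((1:ℝ)/4)) + (3 + ‖s‖ * (2 * ((K:ℝ)+1)^(-(3/4):ℝ))) := by field_simp
    _ ≤ 4 * (2 * t^((1:ℝ)/4)) + (3 + (5*t) * (2 * ((K:ℝ)+1)^(-(3/4):ℝ))) := by gcongr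
    _ ≤ _ := by linarith

lemma sphere_im {s z : ℂ} {r : ℝ} (hz : z ∈ Metric.sphere s r) : |z.re - s.re| ≤ r ∧ |z.im - s.im| ≤ r := by
  have h : ‖z - s‖ = r := by simpa [dist_eq_norm] using hz
  constructor
  · rw [← h, ← sub_re]; exact abs_re_le_norm _
  · rw [← h, ← sub_im]; exact abs_im_le_norm _

/-- Cauchy estimate step. -/
lemma cauchy_step (f : ℂ → ℂ) (hf : DifferentiableOn ℂ f {1}ᶜ) (C a T : ℝ) (hC : 0 < C) (hT : 1 ≤ T)
    (h : ∀ s : ℂ, a ≤ s.re → s.re ≤ 4 - a → T ≤ |s.im| → ‖f s‖ ≤ C * |s.im|^((1:ℝ)/4)) :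
    ∀ s : ℂ, a + 1/8 ≤ s.re → s.re ≤ 4 - (a + 1/8) → T + 1/8 ≤ |s.im| → ‖deriv f s‖ ≤ (16 * C) * |s.im|^((1:ℝ)/4) := by
  intro s h1 h2 h3
  have := norm_deriv_le_of_forall_mem_sphere_norm_le (f := f) (c := s) (R := 1/8) (C := C * (2 * |s.im|^((1:ℝ)/4))) (by norm_num) ?_ ?_
  · refine this.trans (le_of_eq ?_); ring
  · apply DifferentiableOn.diffContOnCl
    apply hf.mono
    intro z hz
    rw [closure_ball _ (by norm_num)] at hz
    simp only [Set.mem_compl_iff, Set.mem_singleton_iff]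
    rintro rfl
    have : ‖(1:ℂ) - s‖ ≤ 1/8 := by simpa [dist_eq_norm] using hz
    have h4 := (abs_im_le_norm (1 - s)).trans this
    simp at h4
    linarith
  · intro z hz
    obtain ⟨hr, hi⟩ := sphere_im hz
    have hi' := abs_abs_sub_abs_le_abs_sub z.im s.im
    rw [abs_le] at hr
    have hi2 := abs_le.1 (hi'.trans hi)
    refine (h z (by linarith) (by linarith) (by linarith)).trans ?_
    apply mul_le_mul_of_nonneg_left _ hC.le
    calc |z.im|^((1:ℝ)/4) ≤ (2*|s.im|)^((1:ℝ)/4) := Real.rpow_le_rpow (abs_nonneg _) (by linarith) (by norm_num)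
      _ = 2^((1:ℝ)/4) * |s.im|^((1:ℝ)/4) := Real.mul_rpow (by norm_num) (by positivity)
      _ ≤ 2^(1:ℝ) * |s.im|^((1:ℝ)/4) := by gcongr <;> norm_num
      _ = _ := by norm_num

lemma zeta_diff : DifferentiableOn ℂ riemannZeta {1}ᶜ := differentiableOn_riemannZeta
lemma dzeta_diff : DifferentiableOn ℂ (deriv riemannZeta) {1}ᶜ := zeta_diff.deriv isOpen_compl_singleton

lemma zeta_derivs : ∃ C : ℝ, 0 < C ∧ ∀ s : ℂ, 1 ≤ s.re → s.re ≤ 2 → 2 ≤ |s.im| →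
    ‖riemannZeta s‖ ≤ C * |s.im|^((1:ℝ)/4) ∧ ‖deriv riemannZeta s‖ ≤ C * |s.im|^((1:ℝ)/4) ∧
     ‖deriv (deriv riemannZeta) s‖ ≤ C * |s.im|^((1:ℝ)/4) := by
  obtain ⟨C, hC, H⟩ := zeta_bound
  have H0 : ∀ s : ℂ, 3/4 ≤ s.re → s.re ≤ 4 - 3/4 → 1 ≤ |s.im| → ‖riemannZeta s‖ ≤ C * |s.im|^((1:ℝ)/4) :=
    fun s h1 h2 h3 => H s h1 (by linarith) h3
  have H1 := cauchy_step _ zeta_diff C (3/4) 1 hC le_rfl H0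
  have H2 := cauchy_step _ dzeta_diff (16*C) (3/4+1/8) (1+1/8) (by positivity) (by norm_num) H1
  refine ⟨16*(16*C), by positivity, fun s h1 h2 h3 => ⟨?_, ?_, ?_⟩⟩
  · refine (H0 s (by linarith) (by linarith) (by linarith)).trans ?_
    gcongr; linarith
  · refine (H1 s (by linarith) (by linarith) (by linarith)).trans ?_
    gcongr; linarith
  · exact H2 s (by linarith) (by linarith) (by linarith)

lemma zeta_real : ∃ C : ℝ, 0 < C ∧ ∀ x : ℝ, 0 < x → x ≤ 1 → ‖riemannZeta (1+x)‖ ≤ C / x := by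
  have hc : ContinuousOn (fun x : ℝ => ‖riemannZeta₁ (1+x)‖) (Set.Icc 0 1) := by
    apply Continuous.continuousOn
    exact (differentiable_riemannZeta₁.continuous.comp (by fun_prop)).norm
  obtain ⟨C, hC⟩ := isCompact_Icc.bddAbove_image hc
  refine ⟨max C 1, by positivity, fun x h0 h1 => ?_⟩
  have h2 : (1 + (x:ℂ)) ≠ 1 := by simp [h0.ne']
  rw [riemannZeta_eq_inv_sub_mul h2, add_sub_cancel_left, norm_mul, norm_inv, Complex.norm_real, Real.norm_of_nonneg h0.le]
  rw [div_eq_inv_mul]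
  apply mul_le_mul_of_nonneg_left _ (by positivity)
  exact (hC ⟨x, ⟨h0.le, h1⟩, rfl⟩).trans (le_max_left _ _)

lemma zeta_341 (x y : ℝ) (hx : 0 < x) : 1 ≤ ‖riemannZeta (1+x)‖^3 * ‖riemannZeta (1+x+I*y)‖^4 * ‖riemannZeta (1+x+2*I*y)‖ := by
  have := DirichletCharacter.norm_LFunction_product_ge_one (N := 1) (1 : DirichletCharacter ℂ 1) hx y
  rw [DirichletCharacter.LFunctionTrivChar, DirichletCharacter.LFunction_modOne_eq, DirichletCharacter.LFunction_modOne_eq] at this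
  rw [norm_mul, norm_mul, norm_pow, norm_pow] at this
  exact this

lemma zeta_lower : ∃ c : ℝ, 0 < c ∧ ∀ x y : ℝ, 0 < x → x ≤ 1 → 2 ≤ |y| → c / |y| ≤ ‖riemannZeta (1+x+I*y)‖ := by
  obtain ⟨C1, hC1, H1⟩ := zeta_real
  obtain ⟨C2, hC2, H2⟩ := zeta_derivs
  -- first bound
  obtain ⟨q, hq, hq1, hq4⟩ : ∃ q : ℝ, 0 < q ∧ q ≤ 1 ∧ C1^3 * (C2*2) * q^4 ≤ 1 := by
    refine ⟨min 1 (1/(C1^3*(C2*2))), by positivity, min_le_left _ _, ?_⟩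
    set A := C1^3 * (C2*2) with hA
    have hA0 : 0 < A := by positivity
    set q := min 1 (1/A)
    have h0 : 0 < q := by positivity
    have h1 : q ≤ 1 := min_le_left _ _
    have h2 : A * q ≤ 1 := by
      have : q ≤ 1/A := min_le_right _ _
      rw [le_div_iff₀ hA0] at this; linarith
    have : q^4 ≤ q := by
      calc q^4 = q * q^3 := by ring
        _ ≤ q * 1 := by gcongr; exact pow_le_one₀ h0.le h1
        _ = q := by ring
    nlinarith
  have key : ∀ x y : ℝ, 0 < x → x ≤ 1 → 2 ≤ |y| → q^4 * x^3 ≤ ‖riemannZeta (1+x+I*y)‖^4 * |y|^((1:ℝ)/4) := by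
    intro x y hx hx1 hy
    have h := zeta_341 x y hx
    have h1 := H1 x hx hx1
    have h2 := (H2 (1+x+2*I*y) (by simp; linarith) (by simp; linarith) (by
      simp [abs_mul]; linarith)).1
    have him : (1+x+2*I*y : ℂ).im = 2*y := by simp
    rw [him, abs_mul, abs_two, Real.mul_rpow (by norm_num) (by positivity)] at h2
    have h3 : ((2:ℝ))^((1:ℝ)/4) ≤ 2 := by
      calc (2:ℝ)^((1:ℝ)/4) ≤ 2^(1:ℝ) := by gcongr <;> norm_num
        _ = 2 := by norm_num
    set Z := ‖riemannZeta (1+x+I*y)‖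
    have hy4 : 0 ≤ |y|^((1:ℝ)/4) := by positivity
    have h5 : 1 ≤ (C1/x)^3 * Z^4 * (C2 * (2 * |y|^((1:ℝ)/4))) := by
      refine h.trans ?_
      gcongr
      refine h2.trans ?_
      gcongr
    rw [div_pow, div_mul_eq_mul_div, div_mul_eq_mul_div, le_div_iff₀ (by positivity)] at h5
    calc q^4 * x^3 = q^4 * (1 * x^3) := by ring
      _ ≤ q^4 * (C1^3 * Z^4 * (C2 * (2 * |y|^((1:ℝ)/4)))) := by gcongr
      _ = (C1^3 * (C2*2) * q^4) * (Z^4 * |y|^((1:ℝ)/4)) := by ring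
      _ ≤ 1 * (Z^4 * |y|^((1:ℝ)/4)) := by gcongr
      _ = _ := by ring
  set r : ℝ := min 1 (q/(2*C2)) with hr
  have hr0 : 0 < r := by positivity
  have hr1 : r ≤ 1 := min_le_left _ _
  have hr2 : C2 * r ≤ q/2 := by
    have : r ≤ q/(2*C2) := min_le_right _ _
    rw [le_div_iff₀ (by positivity)] at this; linarith
  -- bound at x ≥ x0
  have big : ∀ x y : ℝ, 0 < x → x ≤ 1 → 2 ≤ |y| → r^4 * |y|^(-(5/4):ℝ) ≤ x → q * r^3 / |y| ≤ ‖riemannZeta (1+x+I*y)‖ := by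
    intro x y hx hx1 hy hx0
    have hy0 : 0 < |y| := by linarith
    have h := key x y hx hx1 hy
    have h2 : q^4 * (r^4 * |y|^(-(5/4):ℝ))^3 ≤ ‖riemannZeta (1+x+I*y)‖^4 * |y|^((1:ℝ)/4) := by
      refine le_trans ?_ h; gcongr
    have e : (|y|^(-(5/4):ℝ))^3 = |y|^((1:ℝ)/4) * (1/|y|)^4 := by
      have e1 : (1/|y|)^4 = |y|^(-4:ℝ) := by
        rw [Real.rpow_neg hy0.le, one_div, inv_pow]
        norm_cast
      rw [e1, ← Real.rpow_add hy0, ← Real.rpow_natCast, ← Real.rpow_mul hy0.le]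
      norm_num
    rw [mul_pow, e] at h2
    have h3 : (q * r^3 / |y|)^4 ≤ ‖riemannZeta (1+x+I*y)‖^4 := by
      have hp : 0 < |y|^((1:ℝ)/4) := by positivity
      refine le_of_mul_le_mul_right (le_trans (le_of_eq ?_) h2) hp
      field_simp
    exact le_of_pow_le_pow_left₀ (by norm_num) (norm_nonneg _) h3
  refine ⟨q * r^3 / 2, by positivity, fun x y hx hx1 hy => ?_⟩
  have hy0 : 0 < |y| := by linarith
  have hm : 0 ≤ q * r^3 / |y| := by positivity
  set x0 := r^4 * |y|^(-(5/4):ℝ) with hx0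
  have hx0p : 0 < x0 := by positivity
  have hx01 : x0 ≤ 1 := by
    have h1 : r^4 ≤ 1 := pow_le_one₀ hr0.le hr1
    have h2 : |y|^(-(5/4):ℝ) ≤ 1 := Real.rpow_le_one_of_one_le_of_nonpos (by linarith) (by norm_num)
    calc x0 ≤ 1 * 1 := by rw [hx0]; gcongr
      _ = 1 := by norm_num
  rcases le_total x0 x with h | h
  · refine le_trans ?_ (big x y hx hx1 hy h)
    gcongr
    have : 0 < q * r^3 := by positivity
    linarith
  · have h1 := big x0 y hx0p hx01 hy le_rfl
    have h2 : ‖riemannZeta (1+x0+I*y) - riemannZeta (1+x+I*y)‖ ≤ C2 * |y|^((1:ℝ)/4) * ‖(1+x0+I*y : ℂ) - (1+x+I*y)‖ := by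
      have hcv : Convex ℝ {z : ℂ | 1 ≤ z.re ∧ z.re ≤ 2 ∧ z.im = y} := by
        have e : {z : ℂ | 1 ≤ z.re ∧ z.re ≤ 2 ∧ z.im = y} = ({z : ℂ | 1 ≤ z.re} ∩ {z : ℂ | z.re ≤ 2}) ∩ ({z : ℂ | y ≤ z.im} ∩ {z : ℂ | z.im ≤ y}) := by
          ext z
          simp only [Set.mem_setOf_eq, Set.mem_inter_iff]
          constructor
          · rintro ⟨h1, h2, h3⟩
            exact ⟨⟨h1, h2⟩, h3.ge, h3.le⟩
          · rintro ⟨⟨h1, h2⟩, h3, h4⟩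
            exact ⟨h1, h2, le_antisymm h4 h3⟩
        rw [e]
        exact ((convex_halfSpace_re_ge _).inter (convex_halfSpace_re_le _)).inter ((convex_halfSpace_im_ge _).inter (convex_halfSpace_im_le _))
      refine hcv.norm_image_sub_le_of_norm_deriv_le (f := riemannZeta) (𝕜 := ℂ) ?_ ?_ ?_ ?_
      · intro z hz
        apply differentiableAt_riemannZeta
        rintro rfl
        have := hz.2.2
        simp at this
        rw [← this] at hy; norm_num at hy
      · intro z hz
        have := (H2 z hz.1 hz.2.1 (by rw [hz.2.2]; exact hy)).2.1
        rwa [hz.2.2] at this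
      · simp; constructor <;> linarith
      · simp; constructor <;> linarith
    have h3 : ‖(1+x0+I*y : ℂ) - (1+x+I*y)‖ ≤ x0 := by
      rw [show (1+x0+I*y : ℂ) - (1+x+I*y) = ((x0 - x : ℝ):ℂ) by push_cast; ring, Complex.norm_real, Real.norm_of_nonneg (by linarith)]
      linarith
    have h4 : C2 * |y|^((1:ℝ)/4) * x0 ≤ q * r^3 / 2 / |y| := by
      have e : |y|^((1:ℝ)/4) * |y|^(-(5/4):ℝ) = 1/|y| := by
        rw [← Real.rpow_add hy0, show (1:ℝ)/4 + -(5/4) = -1 by norm_num, Real.rpow_neg_one, one_div]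
      calc C2 * |y|^((1:ℝ)/4) * x0 = (C2 * r) * r^3 * (|y|^((1:ℝ)/4) * |y|^(-(5/4):ℝ)) := by rw [hx0]; ring
        _ ≤ (q/2) * r^3 * (1/|y|) := by rw [e]; gcongr
        _ = _ := by ring
    have h5 := norm_sub_norm_le (riemannZeta (1+x0+I*y)) (riemannZeta (1+x+I*y))
    have h6 : C2 * |y|^((1:ℝ)/4) * ‖(1+x0+I*y : ℂ) - (1+x+I*y)‖ ≤ C2 * |y|^((1:ℝ)/4) * x0 := by gcongr
    have h7 : q * r^3 / |y| = q * r^3 / 2 / |y| + q * r^3 / 2 / |y| := by ring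
    linarith

noncomputable def Qz (s : ℂ) : ℂ := -(deriv riemannZeta₁ (1+s) / riemannZeta₁ (1+s))
noncomputable def Gz (s : ℂ) : ℂ := dslope Qz 0 s
noncomputable def Dz (s : ℂ) : ℂ := deriv riemannZeta (1+s) / riemannZeta (1+s)

lemma zeta1_ne {s : ℂ} (hs : 0 ≤ s.re) : riemannZeta₁ (1+s) ≠ 0 := by
  by_cases h : s = 0
  · simp [h]
  · have h1 : riemannZeta (1+s) ≠ 0 := riemannZeta_ne_zero_of_one_le_re (by simp; exact hs)
    rw [riemannZeta_eq_inv_sub_mul (by simpa using h)] at h1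
    exact right_ne_zero_of_mul h1

lemma Qz_zero : Qz 0 = -(Real.eulerMascheroniConstant : ℂ) := by simp [Qz]

lemma Qz_eq {s : ℂ} (hs : 0 ≤ s.re) (h0 : s ≠ 0) : Qz s = - Dz s - s⁻¹ := by
  have h1 := zeta1_ne hs
  rw [Qz, Dz, deriv_riemannZeta_eq_neg_inv_sub_sq_mul_add (by simpa using h0), riemannZeta_eq_inv_sub_mul (by simpa using h0)]
  simp only [add_sub_cancel_left]
  field_simp
  ring

lemma Gz_eq {s : ℂ} (hs : 0 ≤ s.re) (h0 : s ≠ 0) : Gz s = (- Dz s - s⁻¹ + (Real.eulerMascheroniConstant : ℂ)) / s := by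
  rw [Gz, dslope_of_ne _ h0, slope_def_field, Qz_eq hs h0, Qz_zero]
  simp

def Oz : Set ℂ := {s | riemannZeta₁ (1+s) ≠ 0}

lemma Oz_open : IsOpen Oz := by
  have : Continuous (fun s : ℂ => riemannZeta₁ (1+s)) := differentiable_riemannZeta₁.continuous.comp (by fun_prop)
  exact isOpen_ne_fun this continuous_const

lemma Gz_diff : DifferentiableOn ℂ Gz Oz := by
  have h0 : (0:ℂ) ∈ Oz := zeta1_ne (by simp)
  refine (differentiableOn_dslope (Oz_open.mem_nhds h0)).2 ?_
  have h1 : Differentiable ℂ (fun s : ℂ => riemannZeta₁ (1+s)) := differentiable_riemannZeta₁.comp (by fun_prop)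
  have h2 : Differentiable ℂ (fun s : ℂ => deriv riemannZeta₁ (1+s)) := differentiable_riemannZeta₁.deriv.comp (by fun_prop)
  intro s hs
  exact ((h2 s).div (h1 s) hs).neg.differentiableWithinAt

lemma Gz_compact : ∃ C : ℝ, 0 < C ∧ ∀ s : ℂ, 0 ≤ s.re → s.re ≤ 1 → |s.im| ≤ 2 → ‖Gz s‖ ≤ C ∧ ‖deriv Gz s‖ ≤ C := by
  have hK : IsCompact ((Set.Icc (0:ℝ) 1) ×ℂ (Set.Icc (-2:ℝ) 2)) := isCompact_Icc.reProdIm isCompact_Icc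
  have hsub : ((Set.Icc (0:ℝ) 1) ×ℂ (Set.Icc (-2:ℝ) 2)) ⊆ Oz := by
    intro s hs
    exact zeta1_ne hs.1.1
  obtain ⟨C1, h1⟩ := hK.exists_bound_of_continuousOn (Gz_diff.continuousOn.mono hsub)
  obtain ⟨C2, h2⟩ := hK.exists_bound_of_continuousOn ((Gz_diff.deriv Oz_open).continuousOn.mono hsub)
  refine ⟨max 1 (max C1 C2), by positivity, fun s a b c => ?_⟩
  have hs : s ∈ ((Set.Icc (0:ℝ) 1) ×ℂ (Set.Icc (-2:ℝ) 2)) := by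
    rw [mem_reProdIm]; exact ⟨⟨a, b⟩, abs_le.1 c⟩
  exact ⟨(h1 s hs).trans (by simp), (h2 s hs).trans (by simp)⟩

set_option maxHeartbeats 1000000 in
lemma Gz_bound : ∃ C : ℝ, 0 < C ∧ ∀ s : ℂ, 0 < s.re → s.re ≤ 1 → DifferentiableAt ℂ Gz s ∧ ‖Gz s‖ ≤ C * (1+s.im^2) ∧ ‖deriv Gz s‖ ≤ C * (1+s.im^2) := by
  obtain ⟨C0, hC0, H0⟩ := Gz_compact
  obtain ⟨C1, hC1, H1⟩ := zeta_derivs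
  obtain ⟨c, hc, Hl⟩ := zeta_lower
  set E : ℝ := C1/c with hE
  have hE0 : 0 < E := by positivity
  set g : ℝ := ‖(Real.eulerMascheroniConstant : ℂ)‖ with hg
  have hg0 : 0 ≤ g := norm_nonneg _
  refine ⟨C0 + (E+1+g) + (E + E^2 + 1 + E + 1 + g), by positivity, fun s h1 h2 => ?_⟩
  have hd : DifferentiableAt ℂ Gz s := (Gz_diff s (zeta1_ne h1.le)).differentiableAt (Oz_open.mem_nhds (zeta1_ne h1.le))
  refine ⟨hd, ?_⟩
  rcases le_or_gt (|s.im|) 2 with h3 | h3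
  · obtain ⟨a, b⟩ := H0 s h1.le h2 h3
    have : C0 * 1 ≤ (C0 + (E+1+g) + (E + E^2 + 1 + E + 1 + g)) * (1+s.im^2) := by
      apply mul_le_mul _ _ (by norm_num) (by positivity)
      · have : 0 ≤ (E+1+g) + (E + E^2 + 1 + E + 1 + g) := by positivity
        linarith
      · have := sq_nonneg s.im; linarith
    exact ⟨by linarith, by linarith⟩
  obtain ⟨T, hT⟩ : ∃ T, T = |s.im| := ⟨_, rfl⟩
  have hT2 : 2 < T := hT ▸ h3
  have hT0 : 0 < T := by linarith
  have hsq : s.im^2 = T^2 := by rw [hT, sq_abs]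
  have hsT : T ≤ ‖s‖ := by rw [hT]; exact abs_im_le_norm s
  have hs0 : s ≠ 0 := by rintro rfl; simp at h1
  have hse : (1:ℂ)+s = 1 + s.re + I*s.im := by
    conv_lhs => rw [← re_add_im s]
    ring
  have hlow : c / T ≤ ‖riemannZeta (1+s)‖ := by
    rw [hse, hT]; exact Hl _ _ h1 h2 h3.le
  obtain ⟨b0, b1, b2⟩ := H1 (1+s) (by simp; linarith) (by simp; linarith) (by simp; linarith)
  have him : (1+s).im = s.im := by simp
  rw [him, ← hT] at b0 b1 b2
  have hz : riemannZeta (1+s) ≠ 0 := by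
    intro h; rw [h, norm_zero] at hlow
    have : 0 < c / T := by positivity
    linarith
  have hinv : ‖(riemannZeta (1+s))⁻¹‖ ≤ T / c := by
    rw [norm_inv, ← inv_div]; exact inv_anti₀ (by positivity) hlow
  have hT4 : 0 ≤ T^((1:ℝ)/4) := by positivity
  have hT14 : T^((1:ℝ)/4) * T^((1:ℝ)/4) ≤ T := by
    rw [← Real.rpow_add hT0]
    calc T^((1:ℝ)/4+1/4) ≤ T^(1:ℝ) := Real.rpow_le_rpow_of_exponent_le (by linarith) (by norm_num)
      _ = T := Real.rpow_one _
  have hT1 : T^((1:ℝ)/4) ≤ T := by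
    calc T^((1:ℝ)/4) ≤ T^(1:ℝ) := Real.rpow_le_rpow_of_exponent_le (by linarith) (by norm_num)
      _ = T := Real.rpow_one _
  have hD : ‖Dz s‖ ≤ E * (T^((1:ℝ)/4) * T) := by
    rw [Dz, div_eq_mul_inv, norm_mul]
    calc _ ≤ (C1 * T^((1:ℝ)/4)) * (T/c) := by gcongr
      _ = _ := by rw [hE]; ring
  have hD2 : ‖deriv (deriv riemannZeta) (1+s) / riemannZeta (1+s)‖ ≤ E * (T^((1:ℝ)/4) * T) := by
    rw [div_eq_mul_inv, norm_mul]
    calc _ ≤ (C1 * T^((1:ℝ)/4)) * (T/c) := by gcongr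
      _ = _ := by rw [hE]; ring
  have hsi : ‖s⁻¹‖ ≤ 1/T := by rw [norm_inv, one_div]; exact inv_anti₀ hT0 hsT
  have hT1' : 1/T ≤ 1 := by rw [div_le_one hT0]; linarith
  have hsi1 : ‖s⁻¹‖ ≤ 1 := hsi.trans hT1'
  have hDT : ‖Dz s‖ ≤ E * T^2 := hD.trans (by rw [sq]; gcongr)
  have hDT2 : ‖deriv (deriv riemannZeta) (1+s) / riemannZeta (1+s)‖ ≤ E * T^2 := hD2.trans (by rw [sq]; gcongr)
  have hDsq : ‖Dz s‖^2 * ‖s⁻¹‖ ≤ E^2 * T^2 := by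
    calc ‖Dz s‖^2 * ‖s⁻¹‖ ≤ (E * (T^((1:ℝ)/4) * T))^2 * (1/T) := by gcongr
      _ = E^2 * (T^((1:ℝ)/4) * T^((1:ℝ)/4)) * T := by field_simp
      _ ≤ E^2 * T * T := by gcongr
      _ = _ := by ring
  have hne1 : (1:ℂ) + s ≠ 1 := by simpa using hs0
  have hderD : HasDerivAt Dz (deriv (deriv riemannZeta) (1+s) / riemannZeta (1+s) - (Dz s)^2) s := by
    have e1 : HasDerivAt (fun z : ℂ => riemannZeta (1+z)) (deriv riemannZeta (1+s)) s := by
      have := (differentiableAt_riemannZeta hne1).hasDerivAt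
      exact HasDerivAt.comp_const_add (1:ℂ) s this
    have e2 : HasDerivAt (fun z : ℂ => deriv riemannZeta (1+z)) (deriv (deriv riemannZeta) (1+s)) s := by
      have : DifferentiableAt ℂ (deriv riemannZeta) (1+s) :=
        (dzeta_diff (1+s) hne1).differentiableAt (isOpen_compl_singleton.mem_nhds hne1)
      exact HasDerivAt.comp_const_add (1:ℂ) s this.hasDerivAt
    have e3 : HasDerivAt Dz _ s := e2.div e1 hz
    refine e3.congr_deriv ?_
    simp only [Dz]
    field_simp
  have hder : HasDerivAt Gz (((-(deriv (deriv riemannZeta) (1+s) / riemannZeta (1+s) - (Dz s)^2) - (-(s^2)⁻¹)) * s - (- Dz s - s⁻¹ + (Real.eulerMascheroniConstant : ℂ)) * 1)/s^2) s := by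
    have e := (((hderD.neg.sub (hasDerivAt_inv hs0)).add_const (Real.eulerMascheroniConstant : ℂ)).div (hasDerivAt_id s) hs0)
    refine e.congr_of_eventuallyEq ?_
    have ho : {z : ℂ | 0 < z.re} ∈ nhds s := (isOpen_lt continuous_const continuous_re).mem_nhds h1
    filter_upwards [ho] with z hz
    have hz' : 0 < z.re := hz
    rw [Gz_eq hz'.le (by rintro rfl; simp at hz')]
    rfl
  have hT21 : 1 ≤ T^2 := by nlinarith
  have hP : E * T^2 + 1 + g ≤ (E+1+g)*T^2 := by nlinarith
  constructor
  · rw [Gz_eq h1.le hs0, div_eq_mul_inv, norm_mul, hsq]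
    calc _ ≤ (E * T^2 + 1 + g) * 1 := by
          gcongr
          refine (norm_add_le _ _).trans ?_
          gcongr
          refine (norm_sub_le _ _).trans ?_
          rw [norm_neg]; gcongr
      _ ≤ (E+1+g)*T^2 := by linarith
      _ ≤ _ := by
        have : 0 ≤ C0 + (E + E^2 + 1 + E + 1 + g) := by positivity
        exact mul_le_mul (by linarith) (by linarith) (by positivity) (by positivity)
  · rw [hder.deriv, hsq]
    have e : ((-(deriv (deriv riemannZeta) (1+s) / riemannZeta (1+s) - (Dz s)^2) - (-(s^2)⁻¹)) * s - (- Dz s - s⁻¹ + (Real.eulerMascheroniConstant : ℂ)) * 1)/s^2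
      = -(deriv (deriv riemannZeta) (1+s) / riemannZeta (1+s) * s⁻¹) + (Dz s)^2 * s⁻¹ + s⁻¹ * s⁻¹ * s⁻¹ - (- Dz s - s⁻¹ + (Real.eulerMascheroniConstant : ℂ)) * (s⁻¹ * s⁻¹) := by
      field_simp
      ring
    rw [e]
    have k1 : ‖-(deriv (deriv riemannZeta) (1+s) / riemannZeta (1+s) * s⁻¹)‖ ≤ E * T^2 * 1 := by
      rw [norm_neg, norm_mul]; gcongr
    have k2 : ‖(Dz s)^2 * s⁻¹‖ ≤ E^2*T^2 := by rw [norm_mul, norm_pow]; exact hDsq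
    have k3 : ‖s⁻¹ * s⁻¹ * s⁻¹‖ ≤ 1 * 1 * 1 := by
      rw [norm_mul, norm_mul]; gcongr
    have k4 : ‖(- Dz s - s⁻¹ + (Real.eulerMascheroniConstant : ℂ)) * (s⁻¹ * s⁻¹)‖ ≤ (E * T^2 + 1 + g) * (1*1) := by
      rw [norm_mul, norm_mul]
      gcongr
      refine (norm_add_le _ _).trans ?_
      gcongr
      refine (norm_sub_le _ _).trans ?_
      rw [norm_neg]; gcongr
    refine (norm_sub_le _ _).trans ?_
    have k5 := (norm_add₃_le (a := -(deriv (deriv riemannZeta) (1+s) / riemannZeta (1+s) * s⁻¹)) (b := (Dz s)^2 * s⁻¹) (c := s⁻¹ * s⁻¹ * s⁻¹))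
    have k6 : E * T^2 * 1 + E^2*T^2 + 1*1*1 + (E * T^2 + 1 + g) * (1*1) ≤ (E + E^2 + 1 + E + 1 + g) * T^2 := by
      have : (E + E^2 + 1 + E + 1 + g) * T^2 = E * T^2 + E^2*T^2 + T^2 + (E+1+g)*T^2 := by ring
      linarith
    refine (add_le_add k5 le_rfl).trans (le_trans ?_ (k6.trans ?_))
    · linarith
    · have : 0 ≤ C0 + (E+1+g) := by positivity
      exact mul_le_mul (by linarith) (by linarith) (by positivity) (by positivity)

open MeasureTheory

noncomputable def Rm (u : ℝ) : ℝ := Lm ⌊Real.exp u⌋₊ - u + Real.eulerMascheroniConstant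

lemma Lm_mono : Monotone Lm := by
  intro a b h
  unfold Lm
  apply Finset.sum_le_sum_of_subset_of_nonneg
  · exact Ioc_subset_Ioc_right h
  · intro i _ _; have := ArithmeticFunction.vonMangoldt_nonneg (n := i); positivity

lemma Sm_mono : Monotone (fun u : ℝ => Lm ⌊Real.exp u⌋₊) := by
  intro a b h
  apply Lm_mono
  apply Nat.floor_mono
  exact Real.exp_le_exp.2 h

lemma Rm_meas : Measurable Rm := by
  unfold Rm
  exact (Sm_mono.measurable.sub measurable_id).add_const _

lemma Rm_bound : ∃ B : ℝ, 0 < B ∧ ∀ u : ℝ, 0 ≤ u → |Rm u| ≤ B := by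
  obtain ⟨C, hC, H⟩ := Lm_bound
  refine ⟨C + 1 + |Real.eulerMascheroniConstant|, by positivity, fun u hu => ?_⟩
  have h1 : (1:ℝ) ≤ Real.exp u := by simpa using hu
  have hN : 1 ≤ ⌊Real.exp u⌋₊ := by rwa [Nat.one_le_floor_iff]
  have h2 := H _ hN
  have hN' : (1:ℝ) ≤ ⌊Real.exp u⌋₊ := by exact_mod_cast hN
  have h3 : |Real.log ⌊Real.exp u⌋₊ - u| ≤ 1 := by
    have a : Real.log ⌊Real.exp u⌋₊ ≤ u := by
      rw [Real.log_le_iff_le_exp (by linarith)]; exact Nat.floor_le (Real.exp_pos _).le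
    have b : u ≤ Real.log ⌊Real.exp u⌋₊ + 1 := by
      have e1 : Real.exp u ≤ 2 * ⌊Real.exp u⌋₊ := by
        have := Nat.lt_floor_add_one (Real.exp u); linarith
      have := Real.log_le_log (Real.exp_pos _) e1
      rw [Real.log_exp, Real.log_mul (by norm_num) (by linarith)] at this
      have := Real.log_two_lt_d9
      linarith
    rw [abs_le]; constructor <;> linarith
  have e : Rm u = (Lm ⌊Real.exp u⌋₊ - Real.log ⌊Real.exp u⌋₊) + (Real.log ⌊Real.exp u⌋₊ - u) + Real.eulerMascheroniConstant := by
    unfold Rm; ring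
  rw [e]
  refine (abs_add_three _ _ _).trans ?_
  linarith

lemma exp_int {s : ℂ} (hs : 0 < s.re) : ∫ u in Set.Ioi (0:ℝ), Complex.exp (-s * u) = s⁻¹ := by
  rw [integral_exp_mul_complex_Ioi (by simpa using hs)]
  simp [neg_div_neg_eq]

lemma norm_exp_s (s : ℂ) (u : ℝ) : ‖Complex.exp (-s * u)‖ = Real.exp (-s.re * u) := by
  rw [Complex.norm_exp]; simp

lemma uexp_integrable {s : ℂ} (hs : 0 < s.re) : IntegrableOn (fun u : ℝ => (u:ℂ) * Complex.exp (-s * u)) (Set.Ioi 0) := by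
  have h := integrableOn_rpow_mul_exp_neg_mul_rpow (p := 1) (s := 1) (b := s.re) (by norm_num) (by norm_num) hs
  refine Integrable.mono' h ?_ ?_
  · exact (by fun_prop : Continuous _).aestronglyMeasurable
  · filter_upwards [ae_restrict_mem measurableSet_Ioi] with u hu
    have hu' : (0:ℝ) < u := hu
    rw [norm_mul, norm_exp_s]
    simp [abs_of_pos hu']

lemma uexp_int {s : ℂ} (hs : 0 < s.re) : ∫ u in Set.Ioi (0:ℝ), (u:ℂ) * Complex.exp (-s * u) = (s^2)⁻¹ := by
  have hs0 : s ≠ 0 := by rintro rfl; simp at hs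
  have key := integral_Ioi_of_hasDerivAt_of_tendsto (a := 0) (m := 0)
    (f := fun u : ℝ => -((u:ℂ)/s + (s^2)⁻¹) * Complex.exp (-s * u))
    (f' := fun u : ℝ => (u:ℂ) * Complex.exp (-s * u)) ?_ ?_ (uexp_integrable hs) ?_
  · rw [key]; simp
  · exact (by fun_prop : Continuous _).continuousWithinAt
  · intro u _
    have h1 : HasDerivAt (fun u : ℝ => (u:ℂ)) 1 u := by exact hasDerivAt_id u |>.ofReal_comp
    have h2 : HasDerivAt (fun u : ℝ => Complex.exp (-s * u)) (Complex.exp (-s*u) * (-s * 1)) u := (h1.const_mul (-s)).cexp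
    have h3 := (((h1.div_const s).add_const (s^2)⁻¹).neg).mul h2
    refine h3.congr_deriv ?_
    simp only [Pi.neg_apply]
    field_simp
    ring
  · rw [tendsto_zero_iff_norm_tendsto_zero]
    have g1 : Tendsto (fun u : ℝ => u * Real.exp (-s.re * u)) atTop (nhds 0) := by
      have := (Real.tendsto_pow_mul_exp_neg_atTop_nhds_zero 1).comp (tendsto_id.const_mul_atTop hs)
      have h2 := this.const_mul (s.re)⁻¹
      simp only [mul_zero] at h2
      refine h2.congr (fun u => ?_)
      simp only [Function.comp, id, pow_one]
      field_simp
    have g2 : Tendsto (fun u : ℝ => Real.exp (-s.re * u)) atTop (nhds 0) := by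
      have := Real.tendsto_exp_neg_atTop_nhds_zero.comp (tendsto_id.const_mul_atTop hs)
      refine this.congr (fun u => ?_)
      simp
    have g3 := (g1.mul_const (‖s‖⁻¹)).add (g2.mul_const (‖(s^2)⁻¹‖))
    simp only [zero_mul, add_zero] at g3
    refine squeeze_zero' (Eventually.of_forall fun u => norm_nonneg _) ?_ g3
    filter_upwards [eventually_ge_atTop 0] with u hu
    rw [norm_mul, norm_neg, norm_exp_s]
    calc _ ≤ (u * ‖s‖⁻¹ + ‖(s^2)⁻¹‖) * Real.exp (-s.re * u) := by
          gcongr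
          refine (norm_add_le _ _).trans ?_
          rw [norm_div, Complex.norm_real, Real.norm_of_nonneg hu, div_eq_mul_inv]
      _ = _ := by ring

lemma Rexp_integrable {s : ℂ} (hs : 0 < s.re) : IntegrableOn (fun u : ℝ => (Rm u:ℂ) * Complex.exp (-s * u)) (Set.Ioi 0) := by
  obtain ⟨B, hB, H⟩ := Rm_bound
  have h : IntegrableOn (fun u : ℝ => Complex.exp (-s * u)) (Set.Ioi 0) := integrableOn_exp_mul_complex_Ioi (by simpa using hs) _
  refine Integrable.bdd_mul (c := B) h ?_ ?_
  · exact (Complex.measurable_ofReal.comp Rm_meas).aestronglyMeasurable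
  · filter_upwards [ae_restrict_mem measurableSet_Ioi] with u hu
    rw [Complex.norm_real]; exact H u (le_of_lt hu)

lemma dirichlet_S {s : ℂ} (hs : 0 < s.re) : - Dz s = s * ∫ u in Set.Ioi (0:ℝ), (Lm ⌊Real.exp u⌋₊ : ℂ) * Complex.exp (-s * u) := by
  have h1 : LSeries (fun n => ((ArithmeticFunction.vonMangoldt n / n : ℝ) : ℂ)) s = - Dz s := by
    have := ArithmeticFunction.LSeries_vonMangoldt_eq_deriv_riemannZeta_div (s := 1+s) (by simpa using hs)
    rw [Dz, ← neg_div, ← this, LSeries, LSeries]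
    congr 1; ext n
    rw [LSeries.term_def, LSeries.term_def]
    split_ifs with hn
    · rfl
    · rw [Complex.cpow_add _ _ (by exact_mod_cast hn), cpow_one]
      push_cast
      rw [div_div]
  rw [← h1]
  obtain ⟨C, hC, H⟩ := Lm_bound
  have hI : ∀ n : ℕ, ∑ k ∈ Icc 1 n, (ArithmeticFunction.vonMangoldt k / k : ℝ) = Lm n := by
    intro n; unfold Lm; rfl
  rw [LSeries_eq_mul_integral_of_nonneg (fun n => (ArithmeticFunction.vonMangoldt n / n : ℝ)) (r := s.re/2) (by linarith) (by linarith)]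
  · congr 1
    have himg : Real.exp '' (Set.Ioi 0) = Set.Ioi 1 := by
      ext t; constructor
      · rintro ⟨u, hu, rfl⟩; simpa using hu
      · intro ht
        have ht' : (1:ℝ) < t := ht
        exact ⟨Real.log t, Real.log_pos ht', Real.exp_log (by linarith)⟩
    rw [← himg, integral_image_eq_integral_abs_deriv_smul measurableSet_Ioi (fun x _ => (Real.hasDerivAt_exp x).hasDerivWithinAt) Real.exp_injective.injOn]
    apply setIntegral_congr_fun measurableSet_Ioi
    intro u _
    simp only [Real.abs_exp]
    rw [← hI]
    push_cast
    have e : ((Real.exp u : ℝ):ℂ)^(-(s+1)) * (Real.exp u : ℝ) = Complex.exp (-s * u) := by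
      rw [Complex.cpow_def_of_ne_zero (by exact_mod_cast (Real.exp_pos u).ne'), ← Complex.ofReal_log (Real.exp_pos u).le, Real.log_exp, Complex.ofReal_exp, ← Complex.exp_add]
      congr 1; ring
    rw [← e, Complex.real_smul]; push_cast; ring
  · simp_rw [hI]
    have : (fun n : ℕ => Lm n) =O[atTop] (fun n : ℕ => C + Real.log n) := by
      apply Asymptotics.IsBigO.of_bound 1
      filter_upwards [eventually_ge_atTop 1] with n hn
      have h2 := abs_le.1 (H n hn)
      have h3 : 0 ≤ Real.log n := Real.log_natCast_nonneg n
      have h4 : 0 ≤ Lm n := by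
        have := Lm_mono (Nat.zero_le n); simpa [Lm] using this
      rw [Real.norm_of_nonneg h4, Real.norm_of_nonneg (by positivity)]; linarith
    refine this.trans ?_
    have l1 := (isLittleO_log_rpow_atTop (r := s.re/2) (by linarith)).comp_tendsto tendsto_natCast_atTop_atTop
    have l2 : (fun _ : ℕ => C) =O[atTop] (fun n : ℕ => (n:ℝ)^(s.re/2)) := by
      apply Asymptotics.IsBigO.of_bound C
      filter_upwards [eventually_ge_atTop 1] with n hn
      have : (1:ℝ) ≤ (n:ℝ)^(s.re/2) := Real.one_le_rpow (by exact_mod_cast hn) (by linarith)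
      rw [Real.norm_of_nonneg hC.le, Real.norm_of_nonneg (by positivity)]; nlinarith
    exact l2.add l1.isBigO
  · intro n; have := ArithmeticFunction.vonMangoldt_nonneg (n := n); positivity

lemma laplace_R {s : ℂ} (hs : 0 < s.re) : ∫ u in Set.Ioi (0:ℝ), (Rm u : ℂ) * Complex.exp (-s * u) = Gz s := by
  have hs0 : s ≠ 0 := by rintro rfl; simp at hs
  have i1 := Rexp_integrable hs
  have i2 := uexp_integrable hs
  have i3 : IntegrableOn (fun u : ℝ => Complex.exp (-s * u)) (Set.Ioi 0) := integrableOn_exp_mul_complex_Ioi (by simpa using hs) _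
  have e : ∫ u in Set.Ioi (0:ℝ), (Lm ⌊Real.exp u⌋₊ : ℂ) * Complex.exp (-s * u) =
     (∫ u in Set.Ioi (0:ℝ), (Rm u : ℂ) * Complex.exp (-s * u)) + (∫ u in Set.Ioi (0:ℝ), (u:ℂ) * Complex.exp (-s * u)) - Real.eulerMascheroniConstant * ∫ u in Set.Ioi (0:ℝ), Complex.exp (-s * u) := by
    rw [← integral_add i1 i2, ← integral_const_mul]
    have i4 := i3.const_mul (Real.eulerMascheroniConstant:ℂ)
    have i5 : IntegrableOn (fun u : ℝ => (Rm u:ℂ) * Complex.exp (-s * u) + (u:ℂ) * Complex.exp (-s * u)) (Set.Ioi 0) := i1.add i2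
    rw [← integral_sub i5 i4]
    congr 1; ext u
    simp only [Rm]
    push_cast; ring
  have h := dirichlet_S hs
  rw [e, uexp_int hs, exp_int hs] at h
  rw [Gz_eq hs.le hs0, h]
  field_simp
  ring

lemma gb_bound (b t : ℝ) (hb : 0 < b) (hb1 : b ≤ 1) : (1+t^2)*(2*b*|t|+1)*Real.exp (-b*t^2) ≤ (8/b) * Real.exp (-(b/4)*t^2) := by
  have ht := sq_abs t
  have hx : 0 ≤ b*t^2 := by positivity
  have h1 : 2*b*|t|+1 ≤ 2*(1 + b*t^2/2) := by
    have : 0 ≤ b * (|t|-1)^2 := by positivity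
    nlinarith
  have h2 : (1+t^2) ≤ (4/b)*(1+b*t^2/4) := by
    have : (4/b)*(1+b*t^2/4) = 4/b + t^2 := by field_simp
    rw [this]
    have : 1 ≤ 4/b := by rw [le_div_iff₀ hb]; linarith
    linarith
  have h3 : 1 + b*t^2/2 ≤ Real.exp (b*t^2/2) := by have := Real.add_one_le_exp (b*t^2/2); linarith
  have h4 : 1 + b*t^2/4 ≤ Real.exp (b*t^2/4) := by have := Real.add_one_le_exp (b*t^2/4); linarith
  calc (1+t^2)*(2*b*|t|+1)*Real.exp (-b*t^2) ≤ ((4/b)*Real.exp (b*t^2/4)) * (2*Real.exp (b*t^2/2)) * Real.exp (-b*t^2) := by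
        gcongr
        · exact h2.trans (by gcongr)
        · exact h1.trans (by gcongr)
    _ = (8/b) * (Real.exp (b*t^2/4) * Real.exp (b*t^2/2) * Real.exp (-b*t^2)) := by ring
    _ = _ := by rw [← Real.exp_add, ← Real.exp_add]; ring_nf

lemma norm_gauss (b t : ℝ) : ‖Complex.exp (-(b:ℂ)*(t:ℂ)^2)‖ = Real.exp (-b*t^2) := by
  rw [Complex.norm_exp]; congr 1; simp [← Complex.ofReal_pow]

lemma fourier_side : ∃ C : ℝ, 0 < C ∧ ∀ U b σ : ℝ, 0 < U → 0 < b → b ≤ 1 → 0 < σ → σ ≤ 1 →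
    Integrable (fun t : ℝ => Complex.exp (-(b:ℂ)*(t:ℂ)^2) * Gz (σ + I*t)) ∧
    ‖∫ t : ℝ, (Complex.exp (-(b:ℂ)*(t:ℂ)^2) * Gz (σ + I*t)) * Complex.exp (I*U*t)‖ ≤ C / (b * U) * Real.sqrt (Real.pi/b) := by
  obtain ⟨C, hC, H⟩ := Gz_bound
  refine ⟨C * 8 * 2, by positivity, fun U b σ hU hb hb1 hσ hσ1 => ?_⟩
  have hre : ∀ t : ℝ, ((σ:ℂ) + I*t).re = σ := fun t => by simp
  have him : ∀ t : ℝ, ((σ:ℂ) + I*t).im = t := fun t => by simp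
  have HH : ∀ t : ℝ, DifferentiableAt ℂ Gz (σ+I*t) ∧ ‖Gz (σ+I*t)‖ ≤ C*(1+t^2) ∧ ‖deriv Gz (σ+I*t)‖ ≤ C*(1+t^2) := by
    intro t
    have := H (σ+I*t) (by rw [hre]; exact hσ) (by rw [hre]; exact hσ1)
    rwa [him] at this
  obtain ⟨F, hF⟩ : ∃ F : ℝ → ℂ, F = fun t : ℝ => Complex.exp (-(b:ℂ)*(t:ℂ)^2) * Gz (σ + I*t) := ⟨_, rfl⟩
  have hder : ∀ t : ℝ, HasDerivAt F (Complex.exp (-(b:ℂ)*(t:ℂ)^2) * (-(b:ℂ)*(2*t)) * Gz (σ+I*t) + Complex.exp (-(b:ℂ)*(t:ℂ)^2) * (deriv Gz (σ+I*t) * I)) t := by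
    intro t
    have h1 : HasDerivAt (fun u : ℝ => (u:ℂ)) 1 t := hasDerivAt_id t |>.ofReal_comp
    have h2 : HasDerivAt (fun u : ℝ => Complex.exp (-(b:ℂ)*(u:ℂ)^2)) (Complex.exp (-(b:ℂ)*(t:ℂ)^2) * (-(b:ℂ)*(2*t))) t := by
      have := ((h1.pow 2).const_mul (-(b:ℂ))).cexp
      simpa using this
    have h3 : HasDerivAt (fun u : ℝ => (σ:ℂ)+I*u) I t := by
      simpa using (h1.const_mul I).const_add (σ:ℂ)
    have h4 : HasDerivAt (fun u : ℝ => Gz (σ+I*u)) (deriv Gz (σ+I*t) * I) t := by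
      have := (HH t).1.hasDerivAt.scomp (𝕜' := ℂ) t h3
      simpa [smul_eq_mul, mul_comm, Function.comp_def] using this
    rw [hF]; exact h2.mul h4
  obtain ⟨F', hF'⟩ : ∃ F' : ℝ → ℂ, F' = fun t : ℝ => (Complex.exp (-(b:ℂ)*(t:ℂ)^2) * (-(b:ℂ)*(2*t)) * Gz (σ+I*t) + Complex.exp (-(b:ℂ)*(t:ℂ)^2) * (deriv Gz (σ+I*t) * I)) := ⟨_, rfl⟩
  have hder' : ∀ t, HasDerivAt F (F' t) t := by intro t; rw [hF']; exact hder t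
  have hcont : Continuous F := continuous_iff_continuousAt.2 fun t => (hder' t).continuousAt
  have hmeas : Measurable F' := by
    have : F' = deriv F := by ext t; exact (hder' t).deriv.symm
    rw [this]; exact measurable_deriv F
  have nF : ∀ t, ‖F t‖ ≤ C*((8/b) * Real.exp (-(b/4)*t^2)) := by
    intro t
    rw [hF]; simp only; rw [norm_mul, norm_gauss]
    calc Real.exp (-b*t^2) * ‖Gz (σ+I*t)‖ ≤ Real.exp (-b*t^2) * (C*(1+t^2)) := by gcongr; exact (HH t).2.1
      _ = C * ((1+t^2)*1*Real.exp (-b*t^2)) := by ring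
      _ ≤ C * ((1+t^2)*(2*b*|t|+1)*Real.exp (-b*t^2)) := by
        gcongr
        have : 0 ≤ 2*b*|t| := by positivity
        linarith
      _ ≤ _ := by have := gb_bound b t hb hb1; gcongr
  have nF' : ∀ t, ‖F' t‖ ≤ C*((8/b) * Real.exp (-(b/4)*t^2)) := by
    intro t
    rw [hF']; simp only
    refine (norm_add_le _ _).trans ?_
    have e : ‖-(b:ℂ)*(2*t)‖ = 2*b*|t| := by
      rw [norm_mul, norm_neg, norm_mul, Complex.norm_real, Complex.norm_real, Real.norm_of_nonneg hb.le]; simp; ring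
    have e' : ‖Complex.exp (-(b:ℂ)*(t:ℂ)^2) * (deriv Gz (σ+I*t) * I)‖ = Real.exp (-b*t^2) * ‖deriv Gz (σ+I*t)‖ := by
      rw [norm_mul, norm_gauss, norm_mul, norm_I, mul_one]
    rw [e', norm_mul, norm_mul, e, norm_gauss]
    calc _ ≤ Real.exp (-b*t^2) * (2*b*|t|) * (C*(1+t^2)) + Real.exp (-b*t^2) * (C*(1+t^2)) := by
          gcongr
          · exact (HH t).2.1
          · exact (HH t).2.2
      _ = C * ((1+t^2)*(2*b*|t|+1)*Real.exp (-b*t^2)) := by ring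
      _ ≤ _ := by have := gb_bound b t hb hb1; gcongr
  have hg : Integrable (fun t : ℝ => C*((8/b) * Real.exp (-(b/4)*t^2))) :=
    ((integrable_exp_neg_mul_sq (by positivity : 0 < b/4)).const_mul _).const_mul _
  have iF : Integrable F := hg.mono' hcont.aestronglyMeasurable (Eventually.of_forall nF)
  have iF' : Integrable F' := hg.mono' hmeas.aestronglyMeasurable (Eventually.of_forall nF')
  refine ⟨by rw [← hF]; exact iF, ?_⟩
  have hUc : (U:ℂ) ≠ 0 := by exact_mod_cast hU.ne'
  obtain ⟨v, hv⟩ : ∃ v : ℝ → ℂ, v = fun t : ℝ => Complex.exp (I*U*t) / (I*U) := ⟨_, rfl⟩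
  have hv' : ∀ t : ℝ, HasDerivAt v (Complex.exp (I*U*t)) t := by
    intro t
    have h1 : HasDerivAt (fun u : ℝ => (u:ℂ)) 1 t := hasDerivAt_id t |>.ofReal_comp
    have := ((h1.const_mul (I*U)).cexp).div_const (I*U)
    rw [hv]
    refine this.congr_deriv ?_
    field_simp
  have ne : ∀ t : ℝ, ‖Complex.exp (I*U*t)‖ = 1 := by
    intro t
    rw [show I*U*t = ((U*t : ℝ):ℂ)*I by push_cast; ring, Complex.norm_exp_ofReal_mul_I]
  have nv : ∀ t : ℝ, ‖v t‖ = 1/U := by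
    intro t; rw [hv]; simp only
    rw [norm_div, ne, norm_mul, norm_I, one_mul, Complex.norm_real, Real.norm_of_nonneg hU.le]
  have mv : AEStronglyMeasurable v volume := by
    have : Continuous v := continuous_iff_continuousAt.2 fun t => (hv' t).continuousAt
    exact this.aestronglyMeasurable
  have me : AEStronglyMeasurable (fun t : ℝ => Complex.exp (I*U*t)) volume := (by fun_prop : Continuous _).aestronglyMeasurable
  have key := integral_mul_deriv_eq_deriv_mul_of_integrable (u := F) (v := v) (u' := F') (v' := fun t : ℝ => Complex.exp (I*U*t))
    (fun x _ => hder' x) (fun x _ => hv' x) (iF.mul_bdd (c := 1) me (Eventually.of_forall fun t => (ne t).le))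
    (iF'.mul_bdd (c := 1/U) mv (Eventually.of_forall fun t => (nv t).le))
    (iF.mul_bdd (c := 1/U) mv (Eventually.of_forall fun t => (nv t).le))
  have e0 : ∫ t : ℝ, (Complex.exp (-(b:ℂ)*(t:ℂ)^2) * Gz (σ + I*t)) * Complex.exp (I*U*t) = ∫ t : ℝ, F t * Complex.exp (I*U*t) := by rw [hF]
  rw [e0, key, norm_neg]
  have hle : ‖∫ t : ℝ, F' t * v t‖ ≤ ∫ t : ℝ, C*((8/b) * Real.exp (-(b/4)*t^2)) * (1/U) := by
    apply norm_integral_le_of_norm_le (hg.mul_const _)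
    refine Eventually.of_forall fun t => ?_
    rw [norm_mul, nv]; gcongr; exact nF' t
  refine hle.trans (le_of_eq ?_)
  rw [integral_mul_const, integral_const_mul, integral_const_mul, integral_gaussian]
  have : Real.pi/(b/4) = (2^2) * (Real.pi/b) := by field_simp; norm_num
  rw [this, Real.sqrt_mul (by norm_num), Real.sqrt_sq (by norm_num)]
  field_simp

noncomputable def Rt (u : ℝ) : ℝ := (Set.Ioi (0:ℝ)).indicator Rm u

lemma smooth_sigma : ∃ C : ℝ, 0 < C ∧ ∀ U b σ : ℝ, 0 < U → 0 < b → b ≤ 1 → 0 < σ → σ ≤ 1 →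
    |∫ u in Set.Ioi (0:ℝ), Rm u * Real.exp (-σ*u) * Real.exp (-(1/(4*b))*(U-u)^2)| ≤ C / (b*U) := by
  obtain ⟨C, hC, H⟩ := fourier_side
  refine ⟨C, hC, fun U b σ hU hb hb1 hσ hσ1 => ?_⟩
  obtain ⟨iF, hle⟩ := H U b σ hU hb hb1 hσ hσ1
  have hbc : (b:ℂ) ≠ 0 := by exact_mod_cast hb.ne'
  have hs : 0 < ((σ:ℂ)).re := by simpa using hσ
  have iR := Rexp_integrable hs
  have ig : Integrable (fun t : ℝ => Complex.exp (-(b:ℂ)*(t:ℂ)^2)) := integrable_cexp_neg_mul_sq (by simpa using hb)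
  have iprod := ig.mul_prod iR
  have iprod2 : Integrable (Function.uncurry (fun (t u : ℝ) => Complex.exp (I*(U-u)*t) * (Complex.exp (-(b:ℂ)*(t:ℂ)^2) * ((Rm u:ℂ) * Complex.exp (-σ * u))))) (volume.prod (volume.restrict (Set.Ioi (0:ℝ)))) := by
    refine Integrable.bdd_mul (c := 1) iprod ?_ ?_
    · exact (by fun_prop : Continuous (fun z : ℝ × ℝ => Complex.exp (I*(U-z.2)*z.1))).aestronglyMeasurable
    · refine Eventually.of_forall fun z => ?_
      rw [show I*(U-z.2)*z.1 = (((U-z.2)*z.1 : ℝ):ℂ)*I by push_cast; ring, Complex.norm_exp_ofReal_mul_I]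
  have sw := integral_integral_swap iprod2
  have e1 : ∀ t : ℝ, ∫ u in Set.Ioi (0:ℝ), Complex.exp (I*(U-u)*t) * (Complex.exp (-(b:ℂ)*(t:ℂ)^2) * ((Rm u:ℂ) * Complex.exp (-σ * u))) = (Complex.exp (-(b:ℂ)*(t:ℂ)^2) * Gz (σ + I*t)) * Complex.exp (I*U*t) := by
    intro t
    rw [← laplace_R (s := σ+I*t) (by simpa using hσ), ← integral_const_mul, ← integral_mul_const]
    congr 1; ext u
    have : Complex.exp (I*(U-u)*t) * Complex.exp (-σ*u) = Complex.exp (-(σ+I*t)*u) * Complex.exp (I*U*t) := by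
      rw [← Complex.exp_add, ← Complex.exp_add]; congr 1; ring
    linear_combination (Complex.exp (-(b:ℂ)*(t:ℂ)^2) * (Rm u:ℂ)) * this
  have e2 : ∀ u : ℝ, ∫ t : ℝ, Complex.exp (I*(U-u)*t) * (Complex.exp (-(b:ℂ)*(t:ℂ)^2) * ((Rm u:ℂ) * Complex.exp (-σ * u))) = ((Real.sqrt (Real.pi/b) : ℝ):ℂ) * ((Rm u * Real.exp (-σ*u) * Real.exp (-(1/(4*b))*(U-u)^2) : ℝ) : ℂ) := by
    intro u
    have := fourierIntegral_gaussian (b := b) (by simpa using hb) ((U:ℂ)-u)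
    rw [show (fun t : ℝ => Complex.exp (I*(U-u)*t) * (Complex.exp (-(b:ℂ)*(t:ℂ)^2) * ((Rm u:ℂ) * Complex.exp (-σ * u)))) = fun t : ℝ => (Complex.exp (I*(U-u)*t) * Complex.exp (-(b:ℂ)*(t:ℂ)^2)) * ((Rm u:ℂ) * Complex.exp (-σ * u)) by ext t; ring, integral_mul_const, this]
    have e3 : ((Real.pi:ℂ)/b)^(1/2:ℂ) = ((Real.sqrt (Real.pi/b) : ℝ):ℂ) := by
      rw [Real.sqrt_eq_rpow, Complex.ofReal_cpow (by positivity)]; push_cast; rfl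
    rw [e3]
    push_cast
    rw [show -(1/(4*(b:ℂ)))*((U:ℂ)-u)^2 = -((U:ℂ)-u)^2/(4*b) by ring]
    ring
  simp_rw [e1, e2] at sw
  rw [integral_const_mul, integral_complex_ofReal] at sw
  rw [sw, norm_mul, Complex.norm_real, Complex.norm_real, Real.norm_of_nonneg (by positivity), Real.norm_eq_abs, mul_comm] at hle
  exact le_of_mul_le_mul_right hle (by positivity)

end FF

namespace FF
open Finset MeasureTheory Real

lemma Rt_bound : ∃ B : ℝ, 0 < B ∧ ∀ u : ℝ, |Rt u| ≤ B := by
  obtain ⟨B, hB, H⟩ := Rm_bound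
  refine ⟨B, hB, fun u => ?_⟩
  unfold Rt
  by_cases hu : u ∈ Set.Ioi (0:ℝ)
  · rw [Set.indicator_of_mem hu]; exact H u (le_of_lt hu)
  · rw [Set.indicator_of_notMem hu]; simpa using hB.le

lemma Rt_meas : Measurable Rt := Rm_meas.indicator measurableSet_Ioi

lemma gauss_shift_int (c V : ℝ) (hc : 0 < c) : Integrable (fun u : ℝ => exp (-c*(V-u)^2)) :=
  (integrable_exp_neg_mul_sq hc).comp_sub_left V

lemma gauss_shift (c V : ℝ) : ∫ u : ℝ, exp (-c*(V-u)^2) = sqrt (Real.pi/c) := by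
  rw [integral_sub_left_eq_self (fun u : ℝ => exp (-c*u^2)) volume V, integral_gaussian]

lemma smooth_R : ∃ C : ℝ, 0 < C ∧ ∀ U b : ℝ, 0 < U → 0 < b → b ≤ 1 →
    |∫ u : ℝ, Rt u * exp (-(1/(4*b))*(U-u)^2)| ≤ C / (b*U) := by
  obtain ⟨C, hC, H⟩ := smooth_sigma
  obtain ⟨B, hB, HB⟩ := Rt_bound
  refine ⟨C, hC, fun U b hU hb hb1 => ?_⟩
  have hE : ∀ σ : ℝ, ∫ u in Set.Ioi (0:ℝ), Rm u * exp (-σ*u) * exp (-(1/(4*b))*(U-u)^2)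
      = ∫ u : ℝ, Rt u * exp (-σ*max u 0) * exp (-(1/(4*b))*(U-u)^2) := by
    intro σ
    rw [← integral_indicator measurableSet_Ioi]
    congr 1; ext u
    unfold Rt
    by_cases hu : u ∈ Set.Ioi (0:ℝ)
    · rw [Set.indicator_of_mem hu, Set.indicator_of_mem hu, max_eq_left (le_of_lt hu)]
    · rw [Set.indicator_of_notMem hu, Set.indicator_of_notMem hu]; simp
  have hg := (gauss_shift_int (1/(4*b)) U (by positivity)).const_mul B
  have ht : Tendsto (fun σ : ℝ => ∫ u : ℝ, Rt u * exp (-σ*max u 0) * exp (-(1/(4*b))*(U-u)^2)) (nhdsWithin 0 (Set.Ioi 0))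
      (nhds (∫ u : ℝ, Rt u * exp (-(1/(4*b))*(U-u)^2))) := by
    apply tendsto_integral_filter_of_dominated_convergence (fun u : ℝ => B * exp (-(1/(4*b))*(U-u)^2)) _ _ hg
    · refine Eventually.of_forall fun u => ?_
      have : Continuous (fun σ : ℝ => Rt u * exp (-σ*max u 0) * exp (-(1/(4*b))*(U-u)^2)) := by fun_prop
      have h2 := (this.tendsto 0).mono_left (nhdsWithin_le_nhds (s := Set.Ioi (0:ℝ)))
      simpa using h2
    · refine Eventually.of_forall fun σ => ?_
      have m1 := Rt_meas
      exact (by fun_prop : Measurable (fun u : ℝ => Rt u * exp (-σ*max u 0) * exp (-(1/(4*b))*(U-u)^2))).aestronglyMeasurable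
    · filter_upwards [self_mem_nhdsWithin] with σ hσ
      have hσ' : (0:ℝ) < σ := hσ
      refine Eventually.of_forall fun u => ?_
      rw [norm_eq_abs, abs_mul, abs_mul, abs_exp, abs_exp]
      have : exp (-σ*max u 0) ≤ 1 := by
        rw [exp_le_one_iff]
        have : 0 ≤ σ * max u 0 := by positivity
        linarith
      calc _ ≤ B * 1 * exp (-(1/(4*b))*(U-u)^2) := by gcongr; exact HB u
        _ = _ := by ring
  refine le_of_tendsto ht.abs ?_
  have : Set.Ioc (0:ℝ) 1 ∈ nhdsWithin (0:ℝ) (Set.Ioi 0) := Ioc_mem_nhdsGT (by norm_num)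
  filter_upwards [this] with σ hσ
  rw [← hE]
  exact H U b σ hU hb hb1 hσ.1 hσ.2

lemma unsm (f : ℝ → ℝ) (hf : Measurable f) (b η r B V : ℝ) (hb : 0 < b) (hη : 0 < η) (hB : 0 < B) (hfB : ∀ u, |f u| ≤ B)
   (hr : r ≤ B) (h : ∀ u, |u - V| ≤ η → r ≤ f u) :
   r * sqrt (Real.pi/(1/(4*b))) - 2*B*exp (-(η^2/(8*b))) * sqrt (Real.pi/(1/(8*b))) ≤ ∫ u : ℝ, f u * exp (-(1/(4*b))*(V-u)^2) := by
  have i1 := (gauss_shift_int (1/(4*b)) V (by positivity)).const_mul r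
  have i2 := (gauss_shift_int (1/(8*b)) V (by positivity)).const_mul (2*B*exp (-(η^2/(8*b))))
  have i3 : Integrable (fun u : ℝ => f u * exp (-(1/(4*b))*(V-u)^2)) :=
    (gauss_shift_int (1/(4*b)) V (by positivity)).bdd_mul (c := B) hf.aestronglyMeasurable (Eventually.of_forall hfB)
  rw [← gauss_shift _ V, ← gauss_shift _ V, ← integral_const_mul, ← integral_const_mul, ← integral_sub i1 i2]
  apply integral_mono (i1.sub i2) i3
  intro u
  simp only [Pi.sub_apply]
  have p1 := exp_pos (-(1/(4*b))*(V-u)^2)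
  by_cases hu : |u - V| ≤ η
  · have h1 := mul_le_mul_of_nonneg_right (h u hu) p1.le
    have : 0 ≤ 2*B*exp (-(η^2/(8*b))) * exp (-(1/(8*b))*(V-u)^2) := by positivity
    linarith
  · push Not at hu
    have h2 : η^2 ≤ (V-u)^2 := by
      rw [← sq_abs (V-u), abs_sub_comm]; gcongr
    have h3 : exp (-(1/(4*b))*(V-u)^2) ≤ exp (-(η^2/(8*b))) * exp (-(1/(8*b))*(V-u)^2) := by
      rw [← exp_add, exp_le_exp]
      have e : -(1/(4*b))*(V-u)^2 = -((V-u)^2/(8*b)) + -(1/(8*b))*(V-u)^2 := by field_simp; ring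
      rw [e]
      gcongr
    have h4 := (abs_le.1 (hfB u)).1
    have h5 : (r - f u) * exp (-(1/(4*b))*(V-u)^2) ≤ (2*B) * (exp (-(η^2/(8*b))) * exp (-(1/(8*b))*(V-u)^2)) := by
      calc _ ≤ (2*B) * exp (-(1/(4*b))*(V-u)^2) := by gcongr; linarith
        _ ≤ _ := by gcongr
    linarith

/-- Strong Mertens bound with power-of-log saving. -/
lemma Rm_decay : ∃ C : ℝ, 0 < C ∧ ∀ U : ℝ, 1 ≤ U → |Rm U| ≤ C * U^(-(1/8):ℝ) := by
  obtain ⟨C, hC, H⟩ := smooth_R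
  obtain ⟨B0, hB0, HB0⟩ := Rt_bound
  obtain ⟨B1, hB1, HB1⟩ := Rm_bound
  obtain ⟨B, hBd⟩ : ∃ B, B = B0 + B1 := ⟨_, rfl⟩
  have hB : 0 < B := by rw [hBd]; positivity
  refine ⟨2*B + (2 + 32*B + 2*C), by positivity, fun U hU => ?_⟩
  obtain ⟨η, hη⟩ : ∃ η, η = U^(-(1/8):ℝ) := ⟨_, rfl⟩
  have hU0 : 0 < U := by linarith
  have hη0 : 0 < η := by rw [hη]; positivity
  have hη1 : η ≤ 1 := by rw [hη]; exact rpow_le_one_of_one_le_of_nonpos hU (by norm_num)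
  have hη8 : η^8 * U = 1 := by
    rw [hη, ← rpow_natCast, ← rpow_mul hU0.le]
    norm_num
    rw [rpow_neg_one]; field_simp
  rw [← hη]
  have hRU : |Rm U| ≤ B := (HB1 U hU0.le).trans (by rw [hBd]; linarith)
  rcases lt_or_ge U 2 with h2 | h2
  · have : 1/2 ≤ η := by
      by_contra hlt
      push Not at hlt
      have : η^8 ≤ (1/2)^8 := by gcongr
      nlinarith
    have h3 : 0 ≤ (2 + 32*B + 2*C) * η := by positivity
    nlinarith
  have hRB : ∀ u, |Rt u| ≤ B := fun u => (HB0 u).trans (by rw [hBd]; linarith)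
  have hb : 0 < η^3 := by positivity
  have hb1 : η^3 ≤ 1 := pow_le_one₀ hη0.le hη1
  have mono : ∀ a b : ℝ, a ≤ b → Rm a + a ≤ Rm b + b := by
    intro a b hab
    have := Sm_mono hab
    simp only at this
    unfold Rm; linarith
  -- general conclusion
  have fin : ∀ r V : ℝ, U/2 ≤ V → r * sqrt (Real.pi/(1/(4*η^3))) - 2*B*exp (-(η^2/(8*η^3))) * sqrt (Real.pi/(1/(8*η^3))) ≤ C / (η^3*V) → r ≤ (32*B+2*C)*η := by
    intro r V hV h
    have e1 : sqrt (Real.pi/(1/(8*η^3))) ≤ 2 * sqrt (Real.pi/(1/(4*η^3))) := by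
      rw [show (2:ℝ) * sqrt (Real.pi/(1/(4*η^3))) = sqrt (2^2 * (Real.pi/(1/(4*η^3)))) by
        rw [sqrt_mul (by norm_num), sqrt_sq (by norm_num)]]
      apply sqrt_le_sqrt
      have hp : 0 < Real.pi * η^3 := by positivity
      have : Real.pi/(1/(8*η^3)) = 8*(Real.pi*η^3) := by field_simp
      have : Real.pi/(1/(4*η^3)) = 4*(Real.pi*η^3) := by field_simp
      nlinarith
    have e2 : η^3 ≤ sqrt (Real.pi/(1/(4*η^3))) := by
      apply le_sqrt_of_sq_le
      have : Real.pi/(1/(4*η^3)) = 4*Real.pi*η^3 := by field_simp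
      rw [this]
      have := pi_gt_three
      nlinarith
    have e3 : exp (-(η^2/(8*η^3))) ≤ 8*η := by
      have : η^2/(8*η^3) = 1/(8*η) := by field_simp
      rw [this, exp_neg]
      have h1 : 1/(8*η) ≤ exp (1/(8*η)) := by have := add_one_le_exp (1/(8*η)); linarith
      calc (exp (1/(8*η)))⁻¹ ≤ (1/(8*η))⁻¹ := inv_anti₀ (by positivity) h1
        _ = 8*η := by field_simp
    have e4 : C / (η^3*V) ≤ 2*C*η^5 := by
      have hV0 : 0 < V := by linarith
      rw [div_le_iff₀ (by positivity)]
      have : 1 ≤ 2 * (η^8 * V) := by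
        have : η^8 * (U/2) ≤ η^8 * V := by gcongr
        linarith
      calc C = C * 1 := by ring
        _ ≤ C * (2 * (η^8 * V)) := by gcongr
        _ = _ := by ring
    obtain ⟨S, hS⟩ : ∃ S, S = sqrt (Real.pi/(1/(4*η^3))) := ⟨_, rfl⟩
    rw [← hS] at h e1 e2
    have hS0 : 0 < S := lt_of_lt_of_le hb e2
    have e5 : 2*B*exp (-(η^2/(8*η^3))) * sqrt (Real.pi/(1/(8*η^3))) ≤ 2*B*(8*η)*(2*S) := by gcongr
    have e6 : 2*C*η^5 ≤ 2*C*η*S := by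
      calc 2*C*η^5 = 2*C*η*(η*η^3) := by ring
        _ ≤ 2*C*η*(1*η^3) := by gcongr
        _ ≤ 2*C*η*S := by gcongr; linarith
    have : r * S ≤ ((32*B+2*C)*η) * S := by nlinarith
    exact le_of_mul_le_mul_right this hS0
  have up : Rm U ≤ (2 + 32*B+2*C)*η := by
    have h := unsm Rt Rt_meas (η^3) η (Rm U - 2*η) B (U+η) hb hη0 hB hRB (by have := (abs_le.1 hRU).2; linarith) (by
      intro u hu
      have hu2 := abs_le.1 hu
      have hm := mono U u (by linarith)
      have : Rt u = Rm u := by unfold Rt; exact Set.indicator_of_mem (by simp; linarith) _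
      rw [this]; linarith)
    have := fin _ (U+η) (by linarith) (h.trans ((le_abs_self _).trans (H (U+η) (η^3) (by linarith) hb hb1)))
    linarith
  have lo : -Rm U ≤ (2 + 32*B+2*C)*η := by
    have hη1' : η < 1 := by
      by_contra hh
      push Not at hh
      have : 1 ≤ η^8 := one_le_pow₀ hh
      nlinarith
    have h := unsm (fun u => -Rt u) Rt_meas.neg (η^3) η (-Rm U - 2*η) B (U-η) hb hη0 hB (fun u => by rw [abs_neg]; exact hRB u) (by have := (abs_le.1 hRU).1; linarith) (by
      intro u hu
      have hu2 := abs_le.1 hu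
      have hm := mono u U (by linarith)
      have : Rt u = Rm u := by unfold Rt; exact Set.indicator_of_mem (by simp; linarith) _
      rw [this]; linarith)
    have h3 : ∫ u : ℝ, (-Rt u) * exp (-(1/(4*η^3))*(U-η-u)^2) ≤ C / (η^3*(U-η)) := by
      have := H (U-η) (η^3) (by linarith) hb hb1
      rw [show (fun u : ℝ => (-Rt u) * exp (-(1/(4*η^3))*(U-η-u)^2)) = fun u : ℝ => -(Rt u * exp (-(1/(4*η^3))*(U-η-u)^2)) by ext u; ring, integral_neg]
      exact (neg_le_abs _).trans this
    have := fin _ (U-η) (by linarith) (h.trans h3)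
    linarith
  rw [abs_le]
  have : 0 ≤ 2*B*η := by positivity
  constructor <;> nlinarith

end FF

namespace FF
open scoped ENNReal BigOperators
open Finset Real

local notation "Λ" => ArithmeticFunction.vonMangoldt

/-- decay weight -/
noncomputable def E8 (l : ℝ) : ℝ := (1+l)^(-(1/8):ℝ)

lemma E8_pos {l : ℝ} (hl : 0 ≤ l) : 0 < E8 l := by unfold E8; positivity
lemma E8_le_one {l : ℝ} (hl : 0 ≤ l) : E8 l ≤ 1 := by
  unfold E8; exact rpow_le_one_of_one_le_of_nonpos (by linarith) (by norm_num)
lemma E8_anti {a b : ℝ} (ha : 0 ≤ a) (hab : a ≤ b) : E8 b ≤ E8 a := by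
  unfold E8; exact rpow_le_rpow_of_nonpos (by linarith) (by linarith) (by norm_num)

lemma E8_mul {a b : ℝ} (ha : 0 ≤ a) (hb : 0 ≤ b) : E8 a ≤ E8 (a+b) * (1+b) := by
  have h1 : 1 + (a+b) ≤ (1+a)*(1+b) := by nlinarith
  have h2 : ((1+a)*(1+b))^(-(1/8):ℝ) ≤ E8 (a+b) := by
    unfold E8; exact rpow_le_rpow_of_nonpos (by linarith) h1 (by norm_num)
  rw [mul_rpow (by linarith) (by linarith)] at h2
  have h3 : (1:ℝ) ≤ (1+b)^(-(1/8):ℝ) * (1+b) := by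
    nth_rw 2 [← rpow_one (1+b)]
    rw [← rpow_add (by linarith)]
    exact one_le_rpow (by linarith) (by norm_num)
  have h4 : 0 < E8 a := E8_pos ha
  calc E8 a = E8 a * 1 := by ring
    _ ≤ E8 a * ((1+b)^(-(1/8):ℝ) * (1+b)) := by gcongr
    _ = ((1+a)^(-(1/8):ℝ) * (1+b)^(-(1/8):ℝ)) * (1+b) := by unfold E8; ring
    _ ≤ _ := by gcongr

noncomputable def rk (k : ℕ) : ℝ := Lm k - log k + eulerMascheroniConstant

lemma rk_eq {k : ℕ} (hk : 1 ≤ k) : rk k = Rm (log k) := by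
  unfold rk Rm
  rw [exp_log (by exact_mod_cast hk), Nat.floor_natCast]

lemma rk_bound : ∃ C : ℝ, 0 < C ∧ ∀ k : ℕ, |rk k| ≤ C * E8 (log k) := by
  obtain ⟨C, hC, H⟩ := Rm_decay
  obtain ⟨B, hB, HB⟩ := Rm_bound
  refine ⟨2*C + 2*B + |rk 0|, by positivity, fun k => ?_⟩
  have hl : 0 ≤ log k := log_natCast_nonneg k
  have hE := E8_pos hl
  rcases Nat.eq_zero_or_pos k with rfl | hk
  · have : E8 (log (0:ℕ)) = 1 := by simp [E8]
    rw [this]; have := abs_nonneg (rk 0); linarith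
  rw [rk_eq hk]
  rcases le_or_gt 1 (log k) with h | h
  · have h1 := H _ h
    have h2 : (log k)^(-(1/8):ℝ) ≤ 2 * E8 (log k) := by
      have e : E8 (log k - 1) ≤ E8 (log k - 1 + 1) * (1+1) := E8_mul (by linarith) (by norm_num)
      rw [sub_add_cancel] at e
      have : E8 (log k - 1) = (log k)^(-(1/8):ℝ) := by unfold E8; congr 1; ring
      linarith
    have := abs_nonneg (rk 0)
    nlinarith [mul_nonneg this hE.le, mul_nonneg hB.le hE.le, mul_le_mul_of_nonneg_left h2 hC.le]
  · have h1 := HB _ hl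
    have h2 : 1 ≤ 2 * E8 (log k) := by
      have e : E8 0 ≤ E8 (0 + log k) * (1+log k) := E8_mul le_rfl hl
      rw [zero_add] at e
      have : E8 0 = 1 := by simp [E8]
      nlinarith
    have := abs_nonneg (rk 0)
    nlinarith [mul_nonneg this hE.le, mul_nonneg hC.le hE.le, mul_le_mul_of_nonneg_left h2 hB.le]

lemma TN_bound (N : ℕ) : (N:ℝ) + 1 - 1 ≤ ((N+1:ℕ):ℝ) * log (N+1:ℕ) - ∑ k ∈ range (N+1), log k ∧
   ((N+1:ℕ):ℝ) * log (N+1:ℕ) - ∑ k ∈ range (N+1), log k ≤ N + ∑ k ∈ range N, (1/(k+1:ℝ)) := by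
  induction N with
  | zero => simp
  | succ n ih =>
    rw [Finset.sum_range_succ, Finset.sum_range_succ (fun k : ℕ => (1/(k+1:ℝ)))]
    have hp : (0:ℝ) < n+1 := by positivity
    have hd1 : 1 ≤ ((n:ℝ)+2) * (log (n+2) - log (n+1)) := by
      have := one_sub_inv_le_log_of_pos (x := ((n:ℝ)+2)/(n+1)) (by positivity)
      rw [log_div (by positivity) (by positivity)] at this
      have e : 1 - (((n:ℝ)+2)/(n+1))⁻¹ = 1/(n+2) := by field_simp; ring
      rw [e, div_le_iff₀ (by positivity)] at this
      linarith
    have hd2 : ((n:ℝ)+2) * (log (n+2) - log (n+1)) ≤ 1 + 1/(n+1) := by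
      have := log_le_sub_one_of_pos (x := ((n:ℝ)+2)/(n+1)) (by positivity)
      rw [log_div (by positivity) (by positivity)] at this
      have e : ((n:ℝ)+2)/(n+1) - 1 = 1/(n+1) := by field_simp; ring
      rw [e] at this
      calc ((n:ℝ)+2) * (log (n+2) - log (n+1)) ≤ (n+2) * (1/(n+1)) := by gcongr
        _ = _ := by field_simp; ring
    push_cast at ih ⊢
    have e2 : (n:ℝ)+1+1 = n+2 := by ring
    rw [e2]
    constructor <;> nlinarith [ih.1, ih.2]

lemma TN_bound2 (N : ℕ) (hN : 1 ≤ N) : |(N:ℝ) * log N - ∑ k ∈ range N, log k - N| ≤ 1 + log N := by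
  obtain ⟨n, rfl⟩ : ∃ n, N = n+1 := ⟨N-1, by omega⟩
  obtain ⟨h1, h2⟩ := TN_bound n
  have h3 : ∑ k ∈ range n, (1/(k+1:ℝ)) ≤ 1 + log (n+1:ℕ) := by
    rcases Nat.eq_zero_or_pos n with rfl | hn
    · simp
    have := harmonic_le_one_add_log n
    rw [harmonic] at this
    push_cast at this
    simp only [one_div]
    refine this.trans ?_
    gcongr
    push_cast; linarith
  rw [abs_le]; push_cast at *
  have : 0 ≤ log ((n:ℝ)+1) := log_nonneg (by linarith [(Nat.cast_nonneg n : (0:ℝ) ≤ n)])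
  constructor <;> linarith

noncomputable def psi (N : ℕ) : ℝ := ∑ q ∈ Ioc 0 N, ArithmeticFunction.vonMangoldt q

lemma psi_Lm (N : ℕ) : psi N = N * Lm N - ∑ k ∈ range N, Lm k := by
  induction N with
  | zero => simp [psi]
  | succ n ih =>
    have e1 : psi (n+1) = psi n + ArithmeticFunction.vonMangoldt (n+1) := by
      unfold psi; rw [Finset.sum_Ioc_succ_top (by omega)]
    have e2 : Lm (n+1) = Lm n + ArithmeticFunction.vonMangoldt (n+1) / (n+1:ℕ) := by
      unfold Lm; rw [Finset.sum_Ioc_succ_top (by omega)]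
    rw [e1, ih, Finset.sum_range_succ, e2]
    push_cast
    field_simp
    ring

lemma psi_rk (N : ℕ) : psi N = (N * log N - ∑ k ∈ range N, log k) + N * rk N - ∑ k ∈ range N, rk k := by
  rw [psi_Lm]
  have : ∑ k ∈ range N, rk k = ∑ k ∈ range N, Lm k - ∑ k ∈ range N, log k + N * eulerMascheroniConstant := by
    unfold rk; rw [Finset.sum_add_distrib, Finset.sum_sub_distrib]; simp
  rw [this]; unfold rk; ring

lemma logE8 {N : ℕ} (hN : 1 ≤ N) : 1 + log N ≤ 4 * N * E8 (log N) := by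
  have hl : 0 ≤ log N := log_natCast_nonneg N
  have hN' : (1:ℝ) ≤ N := by exact_mod_cast hN
  have h1 : (1+log N)^2 ≤ 4 * N := by
    have : log N = 2 * log (sqrt N) := by rw [log_sqrt (by linarith)]; ring
    have h2 := log_le_sub_one_of_pos (sqrt_pos.2 (by linarith : (0:ℝ) < N))
    have h3 : 1 + log N ≤ 2 * sqrt N := by linarith
    calc (1+log N)^2 ≤ (2 * sqrt N)^2 := by gcongr
      _ = 4 * (N:ℝ) := by rw [mul_pow, sq_sqrt (by linarith)]; norm_num
  have e : E8 0 ≤ E8 (0 + log N) * (1+log N) := E8_mul le_rfl hl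
  rw [zero_add] at e
  have e0 : E8 0 = 1 := by simp [E8]
  have hE := E8_pos hl
  calc 1 + log N = (1+log N) * 1 := by ring
    _ ≤ (1+log N) * (E8 (log N) * (1+log N)) := by gcongr; linarith
    _ = (1+log N)^2 * E8 (log N) := by ring
    _ ≤ _ := by gcongr

/-- PNT with (weak) saving. -/
lemma psi_bound : ∃ C : ℝ, 0 < C ∧ ∀ t : ℝ, 1 ≤ t → |psi ⌊t⌋₊ - t| ≤ C * t * E8 (log t) := by
  obtain ⟨C, hC, H⟩ := rk_bound
  have key : ∀ N : ℕ, 1 ≤ N → |psi N - N| ≤ (4 + 7*C) * N * E8 (log N) := by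
    intro N hN
    have hl : 0 ≤ log N := log_natCast_nonneg N
    have hE := E8_pos hl
    have hN' : (1:ℝ) ≤ N := by exact_mod_cast hN
    have h1 := TN_bound2 N hN
    have h2 : |∑ k ∈ range N, rk k| ≤ C * (E8 (log N) * (6 * N)) := by
      refine (Finset.abs_sum_le_sum_abs _ _).trans ?_
      have : ∀ k ∈ range N, |rk k| ≤ C * (E8 (log N) * (1 + (log N - log k))) := by
        intro k hk
        refine (H k).trans ?_
        gcongr
        have hlk : log k ≤ log N := by
          rcases Nat.eq_zero_or_pos k with rfl | hk0
          · simpa using hl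
          · exact log_le_log (by exact_mod_cast hk0) (by exact_mod_cast (mem_range.1 hk).le)
        have := E8_mul (a := log k) (b := log N - log k) (log_natCast_nonneg k) (by linarith)
        rwa [add_sub_cancel] at this
      refine (Finset.sum_le_sum this).trans ?_
      rw [← Finset.mul_sum, ← Finset.mul_sum, Finset.sum_add_distrib, Finset.sum_sub_distrib]
      simp only [sum_const, card_range, nsmul_eq_mul, mul_one]
      gcongr
      have h4 := (abs_le.1 h1).2
      have h5 := log_le_sub_one_of_pos (by linarith : (0:ℝ) < N)
      linarith
    have h3 := H N
    have h4 := logE8 hN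
    have e : psi N - N = (N * log N - ∑ k ∈ range N, log k - N) + N * rk N - ∑ k ∈ range N, rk k := by
      rw [psi_rk]; ring
    rw [e]
    refine (abs_sub _ _).trans ?_
    have h6 := abs_add_le ((N:ℝ) * log N - ∑ k ∈ range N, log k - N) (N * rk N)
    have h7 : |(N:ℝ) * rk N| ≤ N * (C * E8 (log N)) := by
      rw [abs_mul, Nat.abs_cast]; gcongr
    nlinarith
  refine ⟨2*(4+7*C) + 4, by positivity, fun t ht => ?_⟩
  have hN : 1 ≤ ⌊t⌋₊ := by rwa [Nat.one_le_floor_iff]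
  have h1 := key _ hN
  have hN' : (1:ℝ) ≤ ⌊t⌋₊ := by exact_mod_cast hN
  have hle : (⌊t⌋₊:ℝ) ≤ t := Nat.floor_le (by linarith)
  have hlt := Nat.lt_floor_add_one t
  have hl : 0 ≤ log t := log_nonneg ht
  have hE := E8_pos hl
  have hlN : 0 ≤ log ⌊t⌋₊ := log_natCast_nonneg _
  have hd : log t - log ⌊t⌋₊ ≤ 1 := by
    have : t ≤ 2 * ⌊t⌋₊ := by linarith
    have := log_le_log (by linarith) this
    rw [log_mul (by norm_num) (by linarith)] at this
    have := log_two_lt_d9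
    linarith
  have hd0 : log ⌊t⌋₊ ≤ log t := log_le_log (by linarith) hle
  have h2 : E8 (log ⌊t⌋₊) ≤ 2 * E8 (log t) := by
    have := E8_mul (a := log ⌊t⌋₊) (b := log t - log ⌊t⌋₊) hlN (by linarith)
    rw [add_sub_cancel] at this
    nlinarith
  have h3 := logE8 hN
  have h4 : 1 ≤ 4 * t * E8 (log t) := by
    have e : E8 0 ≤ E8 (0 + log t) * (1+log t) := E8_mul le_rfl hl
    rw [zero_add] at e
    have e0 : E8 0 = 1 := by simp [E8]
    have := log_le_sub_one_of_pos (by linarith : 0 < t)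
    have : E8 (log t) * (1+log t) ≤ E8 (log t) * (4*t) := by gcongr; linarith
    linarith
  have h5 : |psi ⌊t⌋₊ - t| ≤ |psi ⌊t⌋₊ - ⌊t⌋₊| + 1 := by
    have : psi ⌊t⌋₊ - t = (psi ⌊t⌋₊ - ⌊t⌋₊) + (⌊t⌋₊ - t) := by ring
    rw [this]
    refine (abs_add_le _ _).trans ?_
    have : |(⌊t⌋₊:ℝ) - t| ≤ 1 := by rw [abs_le]; constructor <;> linarith
    linarith
  calc |psi ⌊t⌋₊ - t| ≤ (4+7*C) * t * (2 * E8 (log t)) + 4 * t * E8 (log t) := by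
        refine h5.trans (add_le_add (h1.trans ?_) h4)
        have hEN := (E8_pos hlN).le
        exact mul_le_mul (mul_le_mul_of_nonneg_left hle (by linarith)) h2 hEN (mul_nonneg (by linarith) (by linarith))
    _ = _ := by ring

lemma Dm_lim : ∃ M0 C : ℝ, 0 < C ∧ ∀ N : ℕ, 2 ≤ N → |Dm N - M0| ≤ C * (E8 (log N) / log N) := by
  obtain ⟨C, hC, H⟩ := rk_bound
  have hd : ∀ n N : ℕ, 2 ≤ n → n ≤ N → |Dm N - Dm n| ≤ (2*C+4) * (E8 (log n) / log n) := by
    intro n N hn hnN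
    have hn' : (0:ℝ) < n := by exact_mod_cast (by omega)
    have hln : 0 < log n := log_pos (by exact_mod_cast (by omega))
    have h := Dm_diff (-eulerMascheroniConstant) (C * E8 (log n)) n N hn hnN (by
      intro k hk
      have e : Lm k - log k - -eulerMascheroniConstant = rk k := by unfold rk; ring
      rw [e]
      refine (H k).trans ?_
      gcongr
      exact E8_anti hln.le (log_le_log hn' (by exact_mod_cast hk)))
    refine h.trans ?_
    have h2 : 1/(n:ℝ) ≤ 4 * E8 (log n) := by
      rw [div_le_iff₀ hn']
      have := logE8 (N := n) (by omega)
      linarith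
    calc _ ≤ (2*(C*E8 (log n)) + 4 * E8 (log n)) * (1/log n) := by gcongr
      _ = _ := by ring
  have hlogt : Tendsto (fun n : ℕ => log n) atTop atTop := tendsto_log_atTop.comp tendsto_natCast_atTop_atTop
  have hb0 : Tendsto (fun n : ℕ => (2*C+4) * (E8 (log n) / log n)) atTop (nhds 0) := by
    have : Tendsto (fun n : ℕ => (2*C+4) * (log n)⁻¹) atTop (nhds 0) := by
      have := hlogt.inv_tendsto_atTop.const_mul (2*C+4)
      simpa using this
    refine squeeze_zero' ?_ ?_ this
    · filter_upwards with n
      have := E8_pos (log_natCast_nonneg n); have := log_natCast_nonneg n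
      positivity
    · filter_upwards with n
      have h1 := E8_le_one (log_natCast_nonneg n); have := log_natCast_nonneg n
      rw [div_eq_mul_inv]
      gcongr
      exact mul_le_of_le_one_left (by positivity) h1
  have hc : CauchySeq Dm := by
    apply cauchySeq_of_le_tendsto_0' (fun n => if n < 2 then (|Dm n - Dm 2| + (2*C+4) * (E8 (log (2:ℕ)) / log (2:ℕ))) + |Dm 0 - Dm 1| else (2*C+4) * (E8 (log n) / log n))
    · intro n m hnm
      rw [dist_comm, dist_eq]
      split_ifs with h
      · have hp : 0 ≤ (2*C+4) * (E8 (log (2:ℕ)) / log (2:ℕ)) := by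
          have := E8_pos (log_natCast_nonneg 2); have := log_natCast_nonneg 2
          positivity
        rcases lt_or_ge m 2 with hm | hm
        · have := abs_nonneg (Dm n - Dm 2)
          have h3 := abs_nonneg (Dm 0 - Dm 1)
          have : |Dm m - Dm n| ≤ |Dm 0 - Dm 1| := by
            interval_cases n <;> interval_cases m <;> simp [abs_sub_comm] <;> omega
          linarith
        · have h2 := hd 2 m le_rfl hm
          have h4 := abs_sub_le (Dm m) (Dm 2) (Dm n)
          have h3 := abs_nonneg (Dm 0 - Dm 1)
          rw [abs_sub_comm (Dm 2)] at h4
          linarith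
      · exact hd n m (by omega) hnm
    · refine hb0.congr' ?_
      filter_upwards [eventually_ge_atTop 2] with n hn
      rw [if_neg (by omega)]
  obtain ⟨M0, hM⟩ := cauchySeq_tendsto_of_complete hc
  refine ⟨M0, 2*C+4, by positivity, fun N hN => ?_⟩
  have ht : Tendsto (fun m => |Dm N - Dm m|) atTop (nhds |Dm N - M0|) := (tendsto_const_nhds.sub hM).abs
  refine le_of_tendsto ht ?_
  filter_upwards [eventually_ge_atTop N] with m hm
  rw [abs_sub_comm]; exact hd N m hN hm

/-- number of dyadic scales met by the divisors of `a`. -/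
def Lc (a : ℕ) : ℕ := #((Nat.divisors a).image (Nat.log 2))

lemma log_mul_cases (a b : ℕ) (ha : a ≠ 0) (hb : b ≠ 0) :
    Nat.log 2 (a*b) = Nat.log 2 a + Nat.log 2 b ∨ Nat.log 2 (a*b) = Nat.log 2 a + Nat.log 2 b + 1 := by
  have h1 := Nat.pow_log_le_self 2 ha
  have h2 := Nat.pow_log_le_self 2 hb
  have h3 := Nat.lt_pow_succ_log_self (b := 2) (by norm_num) a
  have h4 := Nat.lt_pow_succ_log_self (b := 2) (by norm_num) b
  have lo : Nat.log 2 a + Nat.log 2 b ≤ Nat.log 2 (a*b) := by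
    apply Nat.le_log_of_pow_le (by norm_num)
    rw [pow_add]; exact Nat.mul_le_mul h1 h2
  have hi : Nat.log 2 (a*b) < Nat.log 2 a + Nat.log 2 b + 2 := by
    apply Nat.log_lt_of_lt_pow (by positivity)
    calc a * b < 2^(Nat.log 2 a).succ * 2^(Nat.log 2 b).succ := by
          apply Nat.mul_lt_mul'' h3 h4
      _ = _ := by rw [← pow_add]; congr 1; omega
  omega

lemma Lc_mul (a b : ℕ) (ha : a ≠ 0) (hb : b ≠ 0) : Lc (a*b) ≤ 2 * #(Nat.divisors b) * Lc a := by
  have hsub : (Nat.divisors (a*b)).image (Nat.log 2) ⊆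
      (((range 2) ×ˢ (Nat.divisors b)) ×ˢ ((Nat.divisors a).image (Nat.log 2))).image
        (fun t => t.2 + Nat.log 2 t.1.2 + t.1.1) := by
    intro k hk
    obtain ⟨d, hd, rfl⟩ := mem_image.1 hk
    obtain ⟨d1, d2, h1, h2, rfl⟩ := (Nat.dvd_mul).1 (Nat.dvd_of_mem_divisors hd)
    have hd1 : d1 ≠ 0 := fun h => ha (by rw [h] at h1; exact zero_dvd_iff.1 h1)
    have hd2 : d2 ≠ 0 := fun h => hb (by rw [h] at h2; exact zero_dvd_iff.1 h2)
    rw [mem_image]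
    rcases log_mul_cases d1 d2 hd1 hd2 with h | h
    · exact ⟨((0,d2),Nat.log 2 d1), by simp [h2, hb, ha]; exact ⟨d1, h1, rfl⟩, by simp [h]⟩
    · exact ⟨((1,d2),Nat.log 2 d1), by simp [h2, hb, ha]; exact ⟨d1, h1, rfl⟩, by simp [h]⟩
  calc Lc (a*b) ≤ _ := card_le_card hsub
    _ ≤ _ := card_image_le
    _ = _ := by simp [Lc]

lemma Lc_le_log (a : ℕ) : Lc a ≤ Nat.log 2 a + 1 := by
  have : (Nat.divisors a).image (Nat.log 2) ⊆ range (Nat.log 2 a + 1) := by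
    intro k hk
    obtain ⟨d, hd, rfl⟩ := mem_image.1 hk
    rw [mem_range]
    exact Nat.lt_succ_of_le (Nat.log_mono_right (Nat.divisor_le hd))
  simpa [Lc] using card_le_card this

lemma Lc_pow (p n v : ℕ) (hp : p.Prime) (hn : ¬ p ∣ n) : Lc (p^v*n) ≤ 2*(v+1)*Lc n := by
  have hn0 : n ≠ 0 := fun h => hn (by simp [h])
  rw [mul_comm]
  refine (Lc_mul n (p^v) hn0 (pow_ne_zero _ hp.ne_zero)).trans ?_
  rw [Nat.divisors_prime_pow hp]; simp

lemma card_divisors_prod (a : Finset ℕ) (ha : ∀ p ∈ a, p.Prime) : #(Nat.divisors (∏ p ∈ a, p)) = 2^#a := by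
  induction a using Finset.induction_on with
  | empty => simp
  | insert p s hps ih =>
    have hp := ha p (mem_insert_self _ _)
    rw [prod_insert hps, Nat.Coprime.card_divisors_mul, ih (fun q hq => ha q (mem_insert_of_mem hq)),
      card_insert_of_notMem hps, hp.divisors, card_pair hp.one_lt.ne, pow_succ]; ring
    apply Nat.Coprime.prod_right
    intro q hq
    exact (Nat.coprime_primes hp (ha q (mem_insert_of_mem hq))).2 (fun h => hps (h ▸ hq))

lemma Lc_sqf {V : ℕ} (B : ℕ) (a : Finset ℕ) (ha : ∀ p ∈ a, p.Prime) (gg : ℕ → Fin V)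
    (hB : ∀ p ∈ a, p ≤ 2^(B*2^(gg p : ℕ))) (m : ℕ) :
    Lc (∏ p ∈ a, p) * 2^(NN (cnt a gg) m) ≤
      2 * 2^(∑ l, cnt a gg l) * (1 + B * ∑ l : Fin V, if (l:ℕ) < m then cnt a gg l * 2^(l:ℕ) else 0) := by
  set lo := a.filter (fun p => (gg p : ℕ) < m)
  set hi := a.filter (fun p => ¬ (gg p : ℕ) < m)
  have hsplit : ∏ p ∈ a, p = (∏ p ∈ lo, p) * ∏ p ∈ hi, p := (prod_filter_mul_prod_filter_not a _ _).symm
  have hcard : #lo + #hi = #a := card_filter_add_card_filter_not _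
  have ck : ∑ l, cnt a gg l = #a := by
    rw [card_eq_sum_card_fiberwise (f := gg) (t := univ) (by simp)]; rfl
  have hlo : ∀ f : Fin V → ℕ, ∑ p ∈ lo, f (gg p) = ∑ l : Fin V, if (l:ℕ) < m then cnt a gg l * f l else 0 := by
    intro f
    rw [sum_filter]
    rw [← sum_fiberwise (s := a) (g := gg)]
    apply sum_congr rfl
    intro l _
    rw [sum_congr rfl (g := fun _ => if (l:ℕ) < m then f l else 0)]
    · rw [sum_const]; simp only [cnt, smul_eq_mul, mul_ite, mul_zero]
    · intro p hp; rw [(mem_filter.1 hp).2]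
  have cN : NN (cnt a gg) m = #lo := by
    have := hlo (fun _ => 1)
    simp only [sum_const, smul_eq_mul, mul_one] at this
    rw [this]; rfl
  have hlop : ∏ p ∈ lo, p ≤ 2^(B * ∑ l : Fin V, if (l:ℕ) < m then cnt a gg l * 2^(l:ℕ) else 0) := by
    rw [← hlo (fun l => 2^(l:ℕ)), mul_sum, ← prod_pow_eq_pow_sum]
    apply prod_le_prod'
    intro p hp; exact hB p (mem_filter.1 hp).1
  have hlo0 : ∏ p ∈ lo, p ≠ 0 := prod_ne_zero_iff.2 (fun p hp => (ha p (mem_filter.1 hp).1).ne_zero)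
  have hhi0 : ∏ p ∈ hi, p ≠ 0 := prod_ne_zero_iff.2 (fun p hp => (ha p (mem_filter.1 hp).1).ne_zero)
  have h1 : Lc (∏ p ∈ a, p) ≤ 2 * 2^#hi * Lc (∏ p ∈ lo, p) := by
    rw [hsplit, ← card_divisors_prod hi (fun p hp => ha p (mem_filter.1 hp).1)]
    exact Lc_mul _ _ hlo0 hhi0
  have h2 : Lc (∏ p ∈ lo, p) ≤ 1 + B * ∑ l : Fin V, if (l:ℕ) < m then cnt a gg l * 2^(l:ℕ) else 0 := by
    refine (Lc_le_log _).trans ?_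
    rw [add_comm]
    gcongr
    exact (Nat.log_mono_right hlop).trans (by rw [Nat.log_pow (by norm_num)])
  rw [ck, cN, ← hcard, pow_add]
  calc _ ≤ (2 * 2^#hi * Lc (∏ p ∈ lo, p)) * 2^#lo := by gcongr
    _ ≤ (2 * 2^#hi * (1 + B * ∑ l : Fin V, if (l:ℕ) < m then cnt a gg l * 2^(l:ℕ) else 0)) * 2^#lo := by gcongr
    _ = _ := by ring

noncomputable def PsiB {V : ℕ} (B : ℕ) (c : Fin V → ℕ) : ℝ≥0∞ :=
  (2 * B * 2^(∑ l, c l)) * ((2⁻¹)^(ustar c) *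
      ((2⁻¹)^(mstar c) + ∑ l : Fin V, if (l:ℕ) < mstar c then (c l : ℝ≥0∞) * (2⁻¹)^(mstar c - (l:ℕ)) else 0))

lemma Lc_PsiB {V : ℕ} (B : ℕ) (hB1 : 1 ≤ B) (a : Finset ℕ) (ha : ∀ p ∈ a, p.Prime) (gg : ℕ → Fin V)
    (hB : ∀ p ∈ a, p ≤ 2^(B*2^(gg p : ℕ))) :
    (Lc (∏ p ∈ a, p) : ℝ≥0∞) ≤ PsiB B (cnt a gg) := by
  have h := Lc_sqf B a ha gg hB (mstar (cnt a gg))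
  rw [mstar_spec] at h
  generalize cnt a gg = c at *
  generalize hm : mstar c = m at *
  generalize hu : ustar c = u at *
  have h' : (Lc (∏ p ∈ a, p) : ℝ≥0∞) * 2^(m+u) ≤
      2 * 2^(∑ l, c l) * (1 + B * ∑ l : Fin V, if (l:ℕ) < m then (c l:ℝ≥0∞) * 2^(l:ℕ) else 0) := by
    exact_mod_cast h
  have i1 : ∀ k : ℕ, (2:ℝ≥0∞)^k * (2⁻¹)^k = 1 := by
    intro k; rw [← mul_pow, ENNReal.mul_inv_cancel (by norm_num) (by norm_num), one_pow]
  calc (Lc (∏ p ∈ a, p) : ℝ≥0∞) = (Lc (∏ p ∈ a, p) : ℝ≥0∞) * 2^(m+u) * (2⁻¹)^(m+u) := by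
        rw [mul_assoc, i1, mul_one]
    _ ≤ (2 * 2^(∑ l, c l) * (1 + B * ∑ l : Fin V, if (l:ℕ) < m then (c l:ℝ≥0∞) * 2^(l:ℕ) else 0)) * (2⁻¹)^(m+u) := by
        gcongr
    _ ≤ (2 * 2^(∑ l, c l) * (B + B * ∑ l : Fin V, if (l:ℕ) < m then (c l:ℝ≥0∞) * 2^(l:ℕ) else 0)) * (2⁻¹)^(m+u) := by
        gcongr; exact_mod_cast hB1
    _ = (2 * B * 2^(∑ l, c l)) * ((2⁻¹)^u * ((2⁻¹)^m + (∑ l : Fin V, if (l:ℕ) < m then (c l:ℝ≥0∞) * 2^(l:ℕ) else 0) * (2⁻¹)^m)) := by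
        rw [pow_add]; ring
    _ = _ := by
        unfold PsiB
        rw [sum_mul, hm, hu]
        congr 3
        apply sum_congr rfl
        intro l _
        split_ifs with hl
        · rw [mul_assoc]; congr 1
          have : m = l + (m - l) := by omega
          conv_lhs => rw [this, pow_add, ← mul_assoc, i1, one_mul]
        · simp

lemma pois_mono {ι : Type*} [Fintype ι] {w w' : ι → ℝ≥0∞} (h : ∀ a, w a ≤ w' a) (c : ι → ℕ) :
    pois w c ≤ pois w' c := by
  unfold pois
  apply prod_le_prod'
  intro a _
  gcongr
  exact h a

theorem T_bound {V : ℕ} (hV : 1 ≤ V) (B : ℕ) (hB1 : 1 ≤ B) (W : ℕ → ℝ≥0∞) (W1 : W 1 = 1)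
    (Wm : ∀ m n, Nat.Coprime m n → W (m*n) = W m * W n)
    (ω : ℕ → Fin V → ℝ≥0∞) (ε : ℕ → ℝ≥0∞) (P : Finset ℕ) (hP : ∀ p ∈ P, p.Prime)
    (hω : ∀ p ∈ P, W p ≤ ∑ l, ω p l) (hε : ∀ p ∈ P, ∑' v : ℕ, W (p^(v+2)) * (2*(v+3)) ≤ ε p)
    (hσ : ∀ l, ∑ p ∈ P, ω p l ≤ ENNReal.ofReal (log 2))
    (hb : ∀ p ∈ P, ∀ l, ω p l ≠ 0 → p ≤ 2^(B*2^(l:ℕ))) :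
    ∑' n : Nat.factoredNumbers P, W n * (Lc n : ℝ≥0∞) ≤
      (∏ p ∈ P, (1 + ε p)) * (2 * B * ((1 + 2 * ENNReal.ofReal al) * Zst V)) := by
  have h := claimS W W1 Wm ω ε P hP hω hε (fun n => (Lc n : ℝ≥0∞)) (PsiB B)
    (fun p hp n v hn => by exact_mod_cast Lc_pow p n v (hP p hp) hn)
    (fun a haP gg hgg => Lc_PsiB B hB1 a (fun p hp => hP p (haP hp)) gg
      (fun p hp => hb p (haP hp) _ (hgg p hp))) ⟨⟨0, hV⟩⟩
  refine h.trans ?_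
  gcongr
  refine le_trans ?_ (mul_le_mul_right (strick V) _)
  rw [← ENNReal.tsum_mul_left]
  apply ENNReal.tsum_le_tsum
  intro c
  calc PsiB B c * pois (∑ p ∈ P, ω p) c ≤ PsiB B c * pois (fun _ => ENNReal.ofReal (log 2)) c := by
        gcongr
        exact pois_mono (fun l => by simpa using hσ l) c
    _ = _ := by
        have e : pois (fun _ => ENNReal.ofReal al) c = 2^(∑ l, c l) * pois (fun _ : Fin V => ENNReal.ofReal (log 2)) c := by
          rw [pois_const, pois_const (ENNReal.ofReal (log 2)), ← mul_assoc, ← mul_pow]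
          congr 2
          unfold al
          rw [ENNReal.ofReal_mul (by norm_num)]; simp
        rw [e]; unfold PsiB; ring

/-- overlap length of `[a,b)` and `[c,d)` -/
noncomputable def ov (a b c d : ℝ) : ℝ := max 0 (min b d - max a c)
noncomputable def clp (c d t : ℝ) : ℝ := min d (max c t)

lemma ov_nonneg (a b c d : ℝ) : 0 ≤ ov a b c d := le_max_left _ _
lemma ov_comm (a b c d : ℝ) : ov a b c d = ov c d a b := by
  unfold ov; rw [min_comm, max_comm a c]
lemma ov_eq {a b c d : ℝ} (hab : a ≤ b) (hcd : c ≤ d) : ov a b c d = clp c d b - clp c d a := by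
  unfold ov clp
  grind
lemma ov_ne {a b c d : ℝ} (h : ov a b c d ≠ 0) : a < d ∧ c < b ∧ a < b ∧ c < d := by
  unfold ov at h
  grind
lemma clp_le {c d t : ℝ} : clp c d t ≤ d := min_le_left _ _
lemma le_clp {c d t : ℝ} (h : c ≤ d) : c ≤ clp c d t := le_min h (le_max_left _ _)
lemma clp_of_ge {c d t : ℝ} (hcd : c ≤ d) (h : d ≤ t) : clp c d t = d := by
  unfold clp; rw [max_eq_right (hcd.trans h), min_eq_left h]
lemma clp_of_le {c d t : ℝ} (hcd : c ≤ d) (h : t ≤ c) : clp c d t = c := by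
  unfold clp; rw [max_eq_left h, min_eq_right hcd]

lemma sum_ov_le {S : ℕ → ℝ} (hS : Monotone S) {c d : ℝ} (hcd : c ≤ d) (N : ℕ) :
    ∑ n ∈ range N, ov (S n) (S (n+1)) c d ≤ d - c := by
  rw [sum_congr rfl (fun n _ => ov_eq (hS (Nat.le_succ n)) hcd)]
  rw [sum_range_sub (fun n => clp c d (S n))]
  have := clp_le (c := c) (d := d) (t := S N)
  have := le_clp hcd (t := S 0)
  linarith

lemma sum_ov_eq {S : ℕ → ℝ} (hS : Monotone S) {c d : ℝ} (hcd : c ≤ d) (N : ℕ) (h0 : S 0 ≤ c) (h1 : d ≤ S N) :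
    ∑ n ∈ range N, ov (S n) (S (n+1)) c d = d - c := by
  rw [sum_congr rfl (fun n _ => ov_eq (hS (Nat.le_succ n)) hcd)]
  rw [sum_range_sub (fun n => clp c d (S n)), clp_of_ge hcd h1, clp_of_le hcd h0]

lemma PP_succ (n : ℕ) (h : (n+1).Prime) : PP (n+1) = insert (n+1) (PP n) := by
  ext p; simp only [PP_mem, mem_insert]
  constructor
  · rintro ⟨h1, h2⟩
    by_cases hp : p = n+1
    · exact Or.inl hp
    · exact Or.inr ⟨by omega, h2⟩
  · rintro (rfl | ⟨h1, h2⟩)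
    · exact ⟨le_rfl, h⟩
    · exact ⟨by omega, h2⟩

lemma PP_mono {m n : ℕ} (h : m ≤ n) : PP m ⊆ PP n := by
  intro p hp; rw [PP_mem] at *; exact ⟨hp.1.trans h, hp.2⟩

noncomputable def SS (g : ℕ → ℝ) (θ : ℝ) (n : ℕ) : ℝ := ∑ p ∈ PP n, g p * (p:ℝ)^(θ-1)

lemma SS_mono {g} (hg : Wt g) (θ : ℝ) : Monotone (SS g θ) := by
  intro m n h
  apply sum_le_sum_of_subset_of_nonneg (PP_mono h)
  intro p _ _
  have := hg.nn p
  positivity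

lemma SS_zero (g : ℕ → ℝ) (θ : ℝ) : SS g θ 0 = 0 := by simp [SS, PP]

lemma SS_prime (g : ℕ → ℝ) (θ : ℝ) (p : ℕ) (hp : p.Prime) :
    SS g θ p - SS g θ (p-1) = g p * (p:ℝ)^(θ-1) := by
  obtain ⟨n, rfl⟩ : ∃ n, p = n+1 := ⟨p-1, by have := hp.pos; omega⟩
  unfold SS
  rw [PP_succ n hp, sum_insert (by simp [PP_mem])]; simp

lemma SS_upper {g} (hg : Wt g) : ∃ C : ℝ, 0 ≤ C ∧ ∀ j N : ℕ, 2 ≤ N → log N ≤ 2^j →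
    SS g ((2^j)⁻¹/8) N ≤ j * log 2 + C := by
  obtain ⟨C1, h1, H1⟩ := sum_inv_prime
  obtain ⟨C2, h2, H2⟩ := hg.sm
  obtain ⟨C3, h3, H3⟩ := sum_logp
  refine ⟨C1 + 2*C2 + (1 + C3), by positivity, fun j N hN hj => ?_⟩
  have hj1 : (1:ℝ) ≤ 2^j := one_le_pow₀ (by norm_num)
  obtain ⟨θ, hθ⟩ : ∃ θ : ℝ, θ = (2^j)⁻¹/8 := ⟨_, rfl⟩
  rw [← hθ]
  have hθ0 : 0 < θ := by rw [hθ]; positivity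
  have hθj : θ * 2^j = 1/8 := by rw [hθ]; field_simp
  have hθ1 : θ ≤ 1/8 := by nlinarith
  have key : ∀ p ∈ PP N, g p * (p:ℝ)^(θ-1) ≤ 2 * ((g p - 1)/p) + 1/p + 2 * θ * (log p/p) := by
    intro p hp
    have hpp := PP_prime hp
    have hp2 : (2:ℝ) ≤ p := by exact_mod_cast hpp.two_le
    have hp0 : (0:ℝ) < p := by linarith
    have hlog : 0 ≤ log p := log_nonneg (by linarith)
    have hlN : log p ≤ 2^j := le_trans (log_le_log hp0 (by exact_mod_cast (PP_mem.1 hp).1)) hj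
    have hx : θ * log p ≤ 1/8 := by rw [← hθj]; gcongr
    have hx0 : 0 ≤ θ * log p := by positivity
    have e : (p:ℝ)^(θ-1) = exp (θ * log p) / p := by
      rw [rpow_sub_one hp0.ne', rpow_def_of_pos hp0, mul_comm]
    have ex := (abs_le.1 (abs_exp_sub_one_sub_id_le (x := θ * log p) (by rw [abs_of_nonneg hx0]; linarith))).2
    have ex2 : exp (θ * log p) ≤ 1 + 2 * (θ * log p) := by nlinarith
    have ex3 : exp (θ * log p) ≤ 2 := by linarith
    have hg1 : 0 ≤ g p - 1 := by linarith [hg.pl p hpp]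
    rw [e]
    have : g p * exp (θ * log p) ≤ 2 * (g p - 1) + 1 + 2 * (θ * log p) := by nlinarith
    calc _ = (g p * exp (θ * log p)) / p := by ring
      _ ≤ (2 * (g p - 1) + 1 + 2 * (θ * log p)) / p := by gcongr
      _ = _ := by ring
  have hlN0 : 0 < log N := log_pos (by exact_mod_cast hN)
  have hll : log (log N) ≤ j * log 2 := by
    rw [← log_pow]; exact log_le_log hlN0 hj
  calc SS g θ N ≤ ∑ p ∈ PP N, (2 * ((g p - 1)/p) + 1/p + 2 * θ * (log p/p)) := sum_le_sum key
    _ = 2 * ∑ p ∈ PP N, (g p - 1)/p + ∑ p ∈ PP N, (1/p : ℝ) + 2 * θ * ∑ p ∈ PP N, log p/p := by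
        rw [sum_add_distrib, sum_add_distrib, mul_sum, mul_sum]
    _ ≤ 2 * C2 + (log (log N) + C1) + 2 * θ * (log N + C3) := by
        have a := (abs_le.1 (H1 N hN)).2
        have b := H2 N
        have c := H3 N (by omega)
        unfold PP
        gcongr
        linarith
    _ ≤ _ := by nlinarith

lemma SS_lower {g} (hg : Wt g) : ∃ B : ℕ, 1 ≤ B ∧ ∀ θ : ℝ, 0 ≤ θ → ∀ p l : ℕ, p.Prime →
    SS g θ (p-1) < (l+1) * log 2 → p ≤ 2^(B*2^l) := by
  obtain ⟨C1, h1, H1⟩ := sum_inv_prime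
  have hl2 : 0 < log 2 := log_pos (by norm_num)
  refine ⟨⌈4 * exp C1 / log 2⌉₊ + 1, by omega, fun θ hθ p l hp h => ?_⟩
  generalize hB : ⌈4 * exp C1 / log 2⌉₊ + 1 = B
  have hBc : 4 * exp C1 ≤ B * log 2 := by
    have := Nat.le_ceil (4 * exp C1 / log 2)
    rw [div_le_iff₀ hl2] at this
    rw [← hB]; push_cast; nlinarith
  rcases hp.eq_two_or_odd' with rfl | hodd
  · calc 2 = 2^1 := rfl
      _ ≤ _ := Nat.pow_le_pow_right (by norm_num) (Nat.mul_pos (by omega) (by positivity))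
  have hp3 : 3 ≤ p := by
    have := hp.two_le
    rcases this.lt_or_eq with h | h
    · exact h
    · rw [← h] at hodd; exact absurd hodd (by decide)
  have low : ∑ q ∈ PP (p-1), (1/q:ℝ) ≤ SS g θ (p-1) := by
    apply sum_le_sum
    intro q hq
    have hqp := PP_prime hq
    have hq1 : (1:ℝ) ≤ q := by exact_mod_cast hqp.one_lt.le
    calc (1/q:ℝ) = 1 * (q:ℝ)^(-1:ℝ) := by rw [rpow_neg_one]; simp
      _ ≤ g q * (q:ℝ)^(θ-1) := by
        apply mul_le_mul (hg.pl q hqp) _ (by positivity) (hg.nn q)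
        exact rpow_le_rpow_of_exponent_le hq1 (by linarith)
  have a := (abs_le.1 (H1 (p-1) (by omega))).1
  have hll : log (log (p-1:ℕ)) < (l+1) * log 2 + C1 := by
    unfold PP at low; linarith
  have hc : ((p-1:ℕ):ℝ) = p - 1 := by rw [Nat.cast_sub (by omega)]; simp
  rw [hc] at hll
  have hp3' : (3:ℝ) ≤ p := by exact_mod_cast hp3
  have hlp : 0 < log (p-1) := log_pos (by linarith)
  have h2 : log (p-1) < 2^(l+1) * exp C1 := by
    calc log (p-1) = exp (log (log (p-1))) := (exp_log hlp).symm
      _ < exp ((l+1) * log 2 + C1) := exp_lt_exp.2 hll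
      _ = _ := by
        rw [exp_add]; congr 1
        have : ((l:ℝ)+1) * log 2 = log (2^(l+1)) := by rw [log_pow]; push_cast; ring
        rw [this, exp_log (by positivity)]
  have h3 : log p ≤ 2 * log (p-1) := by
    have : (p:ℝ) ≤ (p-1)^2 := by nlinarith
    calc log p ≤ log ((p-1)^2) := log_le_log (by linarith) this
      _ = _ := by rw [log_pow]; simp
  have h4 : log p ≤ log (2^(B*2^l)) := by
    rw [log_pow]; push_cast
    have : (2:ℝ)^(l+1) = 2 * 2^l := by ring
    have h5 : (0:ℝ) < 2^l := by positivity
    calc log p ≤ 2 * (2^(l+1) * exp C1) := by linarith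
      _ = 2^l * (4 * exp C1) := by rw [this]; ring
      _ ≤ 2^l * (B * log 2) := by gcongr
      _ = _ := by ring
  have := (log_le_log_iff (by linarith) (by positivity)).1 h4
  exact_mod_cast this

lemma al_e : al * exp 1 = (2:ℝ)^(2 - erdosDelta) := by
  have h2 : 0 < log 2 := log_pos (by norm_num)
  rw [rpow_def_of_pos (by norm_num)]
  have : log 2 * (2 - erdosDelta) = log 2 + (log (log 2) + 1) := by
    unfold erdosDelta; field_simp; ring
  rw [this, exp_add, exp_add, exp_log (by norm_num), exp_log h2]; unfold al; ring

theorem TJ {g} (hg : Wt g) : ∃ C : ℝ, 0 ≤ C ∧ ∀ j N : ℕ, log N ≤ 2^j →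
    ∑' n : Nat.factoredNumbers (PP N), Wg g ((2^j)⁻¹/8) n * (Lc n : ℝ≥0∞) ≤
      ENNReal.ofReal (C * ((2^j:ℝ)^(2-erdosDelta) / (1+(j:ℝ))^((3:ℝ)/2))) := by
  obtain ⟨C1, h1, H1⟩ := SS_upper hg
  obtain ⟨B, hB1, HB⟩ := SS_lower hg
  obtain ⟨C3, h3, H3⟩ := Zst_le
  have hl2 : 0 < log 2 := log_pos (by norm_num)
  obtain ⟨K, hK⟩ : ∃ K : ℕ, K = ⌈C1/log 2⌉₊ + 1 := ⟨_, rfl⟩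
  have hKc : C1 ≤ K * log 2 := by
    have := Nat.le_ceil (C1 / log 2)
    rw [div_le_iff₀ hl2] at this
    rw [hK]; push_cast; nlinarith
  have hal := al_gt
  refine ⟨exp (Ce * Cz) * (2 * B * ((1 + 2 * al) * (C3 * (al * exp 1)^K))), by positivity, fun j N hj => ?_⟩
  obtain ⟨V, hV⟩ : ∃ V : ℕ, V = j + K := ⟨_, rfl⟩
  have hV1 : 1 ≤ V := by omega
  have hj1 : (1:ℝ) ≤ 2^j := one_le_pow₀ (by norm_num)
  obtain ⟨θ, hθ⟩ : ∃ θ : ℝ, θ = (2^j)⁻¹/8 := ⟨_, rfl⟩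
  have hθ0 : 0 < θ := by rw [hθ]; positivity
  have hθ1 : θ ≤ 1/8 := by
    rw [hθ]; gcongr; exact inv_le_one_of_one_le₀ hj1
  have hSS : SS g θ N ≤ V * log 2 := by
    have hp : (0:ℝ) ≤ V * log 2 := by positivity
    rcases le_or_gt 2 N with hN | hN
    · have := H1 j N hN hj
      rw [hθ]; refine this.trans ?_
      rw [hV]; push_cast; linarith
    · have : PP N = ∅ := by
        ext p; simp only [PP_mem, notMem_empty, iff_false]; rintro ⟨h, hp⟩; have := hp.two_le; omega
      unfold SS; rw [this]; simpa using hp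
  rw [← hθ]
  have main := T_bound (V := V) hV1 B hB1 (Wg g θ) (Wg_one hg θ) (Wg_mul hg θ)
    (fun p l => ENNReal.ofReal (ov (SS g θ (p-1)) (SS g θ p) ((l:ℕ) * log 2) (((l:ℕ)+1:ℕ) * log 2)))
    (fun p => ENNReal.ofReal (Ce * (p:ℝ)^(-(5/4):ℝ))) (PP N) (fun p => PP_prime)
    (by
      intro p hp
      rw [← ENNReal.ofReal_sum_of_nonneg (fun _ _ => ov_nonneg _ _ _ _)]
      apply ENNReal.ofReal_le_ofReal
      rw [Fin.sum_univ_eq_sum_range (fun l => ov (SS g θ (p-1)) (SS g θ p) ((l:ℕ) * log 2) (((l:ℕ)+1:ℕ) * log 2)) V]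
      rw [sum_congr rfl (fun l _ => ov_comm _ _ _ _)]
      have mono : Monotone (fun l : ℕ => (l:ℝ) * log 2) := by
        intro a b h; simp only; gcongr
      rw [sum_ov_eq mono (SS_mono hg θ (Nat.sub_le p 1)), SS_prime g θ p (PP_prime hp)]
      · simp only [Nat.cast_zero, zero_mul]
        rw [← SS_zero g θ]; exact SS_mono hg θ (Nat.zero_le _)
      · exact (SS_mono hg θ (PP_mem.1 hp).1).trans hSS)
    (fun p hp => Wg_eps hg hθ1 p (PP_prime hp))
    (by
      intro l
      rw [← ENNReal.ofReal_sum_of_nonneg (fun _ _ => ov_nonneg _ _ _ _)]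
      apply ENNReal.ofReal_le_ofReal
      have hle : (((l:ℕ):ℝ) * log 2) ≤ (((l:ℕ)+1:ℕ):ℝ) * log 2 := by
        gcongr; omega
      have hs := sum_ov_le (SS_mono hg θ) hle N
      calc _ ≤ ∑ n ∈ range N, ov (SS g θ n) (SS g θ (n+1)) (((l:ℕ):ℝ) * log 2) ((((l:ℕ)+1:ℕ):ℝ) * log 2) := by
            have hre : ∑ n ∈ range N, ov (SS g θ n) (SS g θ (n+1)) (((l:ℕ):ℝ) * log 2) ((((l:ℕ)+1:ℕ):ℝ) * log 2) = ∑ n ∈ range N, ov (SS g θ (n+1-1)) (SS g θ (n+1)) (((l:ℕ):ℝ) * log 2) ((((l:ℕ)+1:ℕ):ℝ) * log 2) := by simp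
            rw [hre, ← sum_image (s := range N) (g := fun n => n + 1) (f := fun p => ov (SS g θ (p-1)) (SS g θ p) (((l:ℕ):ℝ) * log 2) ((((l:ℕ)+1:ℕ):ℝ) * log 2)) (by intro a _ b _ h; simpa using h)]
            apply sum_le_sum_of_subset_of_nonneg _ (fun _ _ _ => ov_nonneg _ _ _ _)
            intro p hp
            have := PP_mem.1 hp
            have := this.2.pos
            exact mem_image.2 ⟨p-1, by simp; omega, by omega⟩
        _ ≤ _ := hs
        _ = _ := by push_cast; ring)
    (by
      intro p hp l hl
      apply HB θ hθ0.le p l (PP_prime hp)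
      have hne : ov (SS g θ (p-1)) (SS g θ p) ((l:ℕ) * log 2) (((l:ℕ)+1:ℕ) * log 2) ≠ 0 := by
        intro h; rw [h] at hl; simp at hl
      have := (ov_ne hne).1
      push_cast at this; exact this)
  refine main.trans ?_
  have e1 : 2 * (B:ℝ≥0∞) * ((1 + 2 * ENNReal.ofReal al) * Zst V) ≤
      ENNReal.ofReal (2 * B * ((1 + 2 * al) * (C3 * ((al * exp 1)^V / (V * sqrt V))))) := by
    rw [ENNReal.ofReal_mul (p := 2 * (B:ℝ)) (by positivity), ENNReal.ofReal_mul (p := 1 + 2 * al) (by positivity)]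
    refine mul_le_mul' (le_of_eq ?_) (mul_le_mul' (le_of_eq ?_) (H3 V hV1))
    · rw [ENNReal.ofReal_mul (by norm_num)]; simp
    · rw [ENNReal.ofReal_add (by norm_num) (by positivity), ENNReal.ofReal_mul (by norm_num)]; simp
  refine (mul_le_mul' (prod_eps_le (PP N)) e1).trans ?_
  rw [← ENNReal.ofReal_mul (by positivity)]
  apply ENNReal.ofReal_le_ofReal
  have e2 : (al * exp 1)^V / (V * sqrt V) ≤ (al * exp 1)^K * ((2^j:ℝ)^(2-erdosDelta) / (1+(j:ℝ))^((3:ℝ)/2)) := by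
    have hp : (al * exp 1)^V = (al * exp 1)^K * (2^j:ℝ)^(2-erdosDelta) := by
      rw [hV, pow_add, mul_comm]
      congr 1
      rw [al_e, ← rpow_natCast, ← rpow_natCast, ← rpow_mul (by norm_num), ← rpow_mul (by norm_num), mul_comm]
    rw [hp, mul_div_assoc]
    gcongr
    have hV0 : (0:ℝ) < V := by exact_mod_cast hV1
    calc (1+(j:ℝ))^((3:ℝ)/2) ≤ (V:ℝ)^((3:ℝ)/2) := by
          gcongr; rw [hV]; push_cast
          have : (1:ℝ) ≤ K := by rw [hK]; push_cast; linarith [Nat.cast_nonneg (α := ℝ) ⌈C1/log 2⌉₊]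
          linarith
      _ = V * sqrt V := by
          rw [sqrt_eq_rpow, show (3:ℝ)/2 = 1 + 1/2 by norm_num, rpow_add hV0, rpow_one]
  calc _ ≤ exp (Ce * Cz) * (2 * B * ((1 + 2 * al) * (C3 * ((al * exp 1)^K * ((2^j:ℝ)^(2-erdosDelta) / (1+(j:ℝ))^((3:ℝ)/2)))))) := by
        gcongr
    _ = _ := by ring

noncomputable def Fh (l : ℝ) : ℝ := (1+l)^(-erdosDelta) * (1 + log (1+l))^(-(3/2):ℝ)

lemma Fh_pos {l : ℝ} (hl : 0 ≤ l) : 0 < Fh l := by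
  unfold Fh
  have : 0 ≤ log (1+l) := log_nonneg (by linarith)
  positivity

lemma Fh_anti {l k : ℝ} (hl : 0 ≤ l) (h : l ≤ k) : Fh k ≤ Fh l := by
  unfold Fh
  have h0 : 0 ≤ log (1+l) := log_nonneg (by linarith)
  have h1 : log (1+l) ≤ log (1+k) := log_le_log (by linarith) (by linarith)
  have := delta_pos
  apply mul_le_mul
  · exact rpow_le_rpow_of_nonpos (by linarith) (by linarith) (by linarith)
  · exact rpow_le_rpow_of_nonpos (by linarith) (by linarith) (by norm_num)
  · exact rpow_nonneg (by linarith) _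
  · exact rpow_nonneg (by linarith) _

lemma Fh_le_one {l : ℝ} (hl : 0 ≤ l) : Fh l ≤ 1 := by
  have := Fh_anti le_rfl hl
  simpa [Fh] using this

/-- `Fh (l/4) ≤ 64 Fh l`. -/
lemma Fh_quarter {l : ℝ} (hl : 0 ≤ l) : Fh (l/4) ≤ 64 * Fh l := by
  have h4 : log 4 ≤ 2 := by
    rw [show (4:ℝ) = 2^2 by norm_num, log_pow]; have := log_two_lt_d9; push_cast; linarith
  have hd := delta_pos
  have hd' := delta_lt
  have e1 : (1+l/4)^(-erdosDelta) ≤ 4 * (1+l)^(-erdosDelta) := by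
    calc (1+l/4)^(-erdosDelta) ≤ ((1+l)/4)^(-erdosDelta) :=
          rpow_le_rpow_of_nonpos (by linarith) (by linarith) (by linarith)
      _ = (1+l)^(-erdosDelta) * 4^erdosDelta := by
          rw [div_rpow (by linarith) (by norm_num), rpow_neg (by norm_num : (0:ℝ) ≤ 4)]; field_simp
      _ ≤ (1+l)^(-erdosDelta) * 4^(1:ℝ) := by
          gcongr
          · norm_num
          · linarith
      _ = _ := by rw [rpow_one]; ring
  have h0 : 0 ≤ log (1+l) := log_nonneg (by linarith)
  have h0' : 0 ≤ log (1+l/4) := log_nonneg (by linarith)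
  have e2 : (1+log (1+l/4))^(-(3/2):ℝ) ≤ 16 * (1+log (1+l))^(-(3/2):ℝ) := by
    have : log (1+l) ≤ log (1+l/4) + 2 := by
      have : log (1+l) ≤ log (4 * (1+l/4)) := log_le_log (by linarith) (by linarith)
      rw [log_mul (by norm_num) (by linarith)] at this
      linarith
    calc (1+log (1+l/4))^(-(3/2):ℝ) ≤ ((1+log (1+l))/4)^(-(3/2):ℝ) :=
          rpow_le_rpow_of_nonpos (by linarith) (by linarith) (by norm_num)
      _ = (1+log (1+l))^(-(3/2):ℝ) * 4^((3/2):ℝ) := by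
          rw [div_rpow (by linarith) (by norm_num), rpow_neg (by norm_num : (0:ℝ) ≤ 4)]; field_simp
      _ ≤ (1+log (1+l))^(-(3/2):ℝ) * 4^(2:ℝ) := by
          gcongr <;> norm_num
      _ = _ := by norm_num; ring
  unfold Fh
  calc _ ≤ (4 * (1+l)^(-erdosDelta)) * (16 * (1+log (1+l))^(-(3/2):ℝ)) := by gcongr
    _ = _ := by ring

/-- lower bound -/
lemma Fh_ge {l : ℝ} (hl : 0 ≤ l) (J : ℕ) (hJ : 1 + l ≤ 2^(J+1)) :
    ((2:ℝ)^J)^(-erdosDelta) / (1+(J:ℝ))^((3:ℝ)/2) ≤ 8 * Fh l := by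
  have hd := delta_pos
  have hd' := delta_lt
  have e1 : ((2:ℝ)^J)^(-erdosDelta) ≤ 2 * (1+l)^(-erdosDelta) := by
    have h1 : ((2:ℝ)^(J+1))^(-erdosDelta) ≤ (1+l)^(-erdosDelta) :=
      rpow_le_rpow_of_nonpos (by linarith) hJ (by linarith)
    have h2 : ((2:ℝ)^(J+1))^(-erdosDelta) = ((2:ℝ)^J)^(-erdosDelta) * 2^(-erdosDelta) := by
      rw [pow_succ, mul_rpow (by positivity) (by norm_num)]
    have h3 : (1/2:ℝ) ≤ 2^(-erdosDelta) := by
      calc (1/2:ℝ) = 2^(-1:ℝ) := by rw [rpow_neg_one]; norm_num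
        _ ≤ _ := rpow_le_rpow_of_exponent_le (by norm_num) (by linarith)
    have h4 : (0:ℝ) ≤ ((2:ℝ)^J)^(-erdosDelta) := by positivity
    nlinarith
  have h0 : 0 ≤ log (1+l) := log_nonneg (by linarith)
  have hl2 : log (1+l) ≤ 1 + J := by
    have : log (1+l) ≤ log (2^(J+1)) := log_le_log (by linarith) hJ
    rw [log_pow] at this
    have l2 := log_two_lt_d9
    push_cast at this
    nlinarith [Nat.cast_nonneg (α := ℝ) J]
  have hJ0 : (0:ℝ) < 1 + J := by positivity
  have e2 : ((1+(J:ℝ))^((3:ℝ)/2))⁻¹ ≤ 4 * (1+log (1+l))^(-(3/2):ℝ) := by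
    have h1 : (2*(1+(J:ℝ)))^(-(3/2):ℝ) ≤ (1+log (1+l))^(-(3/2):ℝ) :=
      rpow_le_rpow_of_nonpos (by linarith) (by linarith) (by norm_num)
    rw [mul_rpow (by norm_num) hJ0.le] at h1
    rw [← rpow_neg hJ0.le]
    have h3 : (1/4:ℝ) ≤ 2^(-(3/2):ℝ) := by
      calc (1/4:ℝ) = 2^(-2:ℝ) := by rw [rpow_neg (by norm_num)]; norm_num
        _ ≤ _ := rpow_le_rpow_of_exponent_le (by norm_num) (by norm_num)
    have h4 : (0:ℝ) ≤ (1+(J:ℝ))^(-(3/2):ℝ) := by positivity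
    nlinarith
  rw [div_eq_mul_inv]
  unfold Fh
  calc _ ≤ (2 * (1+l)^(-erdosDelta)) * (4 * (1+log (1+l))^(-(3/2):ℝ)) := by gcongr
    _ = _ := by ring

lemma exists_J {l : ℝ} (hl : 0 ≤ l) : ∃ J : ℕ, (2:ℝ)^J ≤ 1 + l ∧ 1 + l ≤ 2^(J+1) := by
  refine ⟨Nat.log 2 ⌊1+l⌋₊, ?_, ?_⟩
  · have h0 : ⌊1+l⌋₊ ≠ 0 := by
      have := Nat.le_floor (α := ℝ) (n := 1) (a := 1+l) (by push_cast; linarith)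
      omega
    have := Nat.pow_log_le_self 2 h0
    calc (2:ℝ)^(Nat.log 2 ⌊1+l⌋₊) ≤ ⌊1+l⌋₊ := by exact_mod_cast this
      _ ≤ _ := Nat.floor_le (by linarith)
  · have := Nat.lt_pow_succ_log_self (b := 2) (by norm_num) ⌊1+l⌋₊
    have h2 : ⌊1+l⌋₊ + 1 ≤ 2^(Nat.log 2 ⌊1+l⌋₊+1) := this
    calc 1 + l ≤ ⌊1+l⌋₊ + 1 := (Nat.lt_floor_add_one _).le
      _ ≤ _ := by exact_mod_cast h2

noncomputable def jterm (l : ℝ) (j : ℕ) : ℝ :=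
  ((2:ℝ)^j)^(-erdosDelta) / (1+(j:ℝ))^((3:ℝ)/2) * exp (-(l * ((2^j)⁻¹/8)))

lemma jterm_nonneg (l : ℝ) (j : ℕ) : 0 ≤ jterm l j := by unfold jterm; positivity

noncomputable def CJ : ℝ := 24 * 8^4 * exp 1

lemma jterm_low {l : ℝ} (J i : ℕ) (hi : i ≤ J) (hJ : (2:ℝ)^J ≤ 1 + l) :
    jterm l (J-i) ≤ ((2:ℝ)^J)^(-erdosDelta) / (1+(J:ℝ))^((3:ℝ)/2) * (CJ * (1/2)^i) := by
  obtain ⟨j, rfl⟩ := Nat.exists_eq_add_of_le' hi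
  have hd := delta_pos
  have hd' := delta_lt
  simp only [Nat.add_sub_cancel]
  have h2i : (0:ℝ) < 2^i := by positivity
  have e1 : ((2:ℝ)^j)^(-erdosDelta) ≤ ((2:ℝ)^(j+i))^(-erdosDelta) * 2^i := by
    rw [pow_add, mul_rpow (by positivity) (by positivity), mul_assoc]
    refine le_mul_of_one_le_right (by positivity) ?_
    have : (1:ℝ) ≤ 2^i := one_le_pow₀ (by norm_num)
    calc (1:ℝ) ≤ (2^i)^(-erdosDelta+1) := one_le_rpow this (by linarith)
      _ = _ := by rw [rpow_add_one (by positivity)]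
  have e2 : ((1+(j:ℝ))^((3:ℝ)/2))⁻¹ ≤ ((1+((j+i:ℕ):ℝ))^((3:ℝ)/2))⁻¹ * (2^i)^2 := by
    have hii : (1+(i:ℝ)) ≤ 2^i := by
      have : i + 1 ≤ 2^i := Nat.lt_two_pow_self
      have h : ((i+1:ℕ):ℝ) ≤ ((2^i:ℕ):ℝ) := by exact_mod_cast this
      push_cast at h; linarith
    have a : (1+((j+i:ℕ):ℝ)) ≤ (1+(j:ℝ)) * (2^i) := by
      push_cast; nlinarith [Nat.cast_nonneg (α := ℝ) j, Nat.cast_nonneg (α := ℝ) i]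
    have b : (1+((j+i:ℕ):ℝ))^((3:ℝ)/2) ≤ (1+(j:ℝ))^((3:ℝ)/2) * (2^i)^2 := by
      calc _ ≤ ((1+(j:ℝ)) * (2^i))^((3:ℝ)/2) := by gcongr
        _ = (1+(j:ℝ))^((3:ℝ)/2) * (2^i)^((3:ℝ)/2) := by rw [mul_rpow (by positivity) (by positivity)]
        _ ≤ (1+(j:ℝ))^((3:ℝ)/2) * (2^i)^(2:ℝ) := by
            gcongr
            · exact one_le_pow₀ (by norm_num)
            · norm_num
        _ = _ := by rw [rpow_two]
    rw [← div_eq_inv_mul, le_div_iff₀ (by positivity), ← div_eq_inv_mul, div_le_iff₀ (by positivity)]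
    linarith
  have e3 : exp (-(l * ((2^j)⁻¹/8))) ≤ exp 1 * (24 * 8^4 / (2^i)^4) := by
    have hl : (2:ℝ)^i - 1 ≤ l * (2^j)⁻¹ := by
      rw [← div_eq_mul_inv, le_div_iff₀ (by positivity)]
      rw [pow_add] at hJ
      have : (1:ℝ) ≤ 2^j := one_le_pow₀ (by norm_num)
      nlinarith
    calc exp (-(l * ((2^j)⁻¹/8))) ≤ exp (1 + -(2^i/8)) := by
          apply exp_le_exp.2; linarith
      _ = exp 1 * (exp (2^i/8))⁻¹ := by rw [exp_add, exp_neg]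
      _ ≤ exp 1 * (((2^i/8)^4/24))⁻¹ := by
          gcongr
          have := pow_div_factorial_le_exp (x := 2^i/8) (by positivity) 4
          simpa [Nat.factorial] using this
      _ = _ := by congr 1; field_simp
  unfold jterm
  calc ((2:ℝ)^j)^(-erdosDelta) / (1+(j:ℝ))^((3:ℝ)/2) * exp (-(l * ((2^j)⁻¹/8)))
      = ((2:ℝ)^j)^(-erdosDelta) * ((1+(j:ℝ))^((3:ℝ)/2))⁻¹ * exp (-(l * ((2^j)⁻¹/8))) := by rw [div_eq_mul_inv]
    _ ≤ (((2:ℝ)^(j+i))^(-erdosDelta) * 2^i) * (((1+((j+i:ℕ):ℝ))^((3:ℝ)/2))⁻¹ * (2^i)^2) * (exp 1 * (24 * 8^4 / (2^i)^4)) := by gcongr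
    _ = _ := by
      unfold CJ
      rw [div_pow, one_pow]
      field_simp

lemma jterm_high {l : ℝ} (hl : 0 ≤ l) (J i : ℕ) :
    jterm l (i+J) ≤ ((2:ℝ)^J)^(-erdosDelta) / (1+(J:ℝ))^((3:ℝ)/2) * ((2:ℝ)^(-erdosDelta))^i := by
  unfold jterm
  have e1 : ((2:ℝ)^(i+J))^(-erdosDelta) = ((2:ℝ)^J)^(-erdosDelta) * ((2:ℝ)^(-erdosDelta))^i := by
    rw [pow_add, mul_rpow (by positivity) (by positivity), mul_comm]
    congr 1
    rw [← rpow_natCast, ← rpow_natCast, ← rpow_mul (by norm_num), ← rpow_mul (by norm_num), mul_comm]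
  have e2 : (1+(J:ℝ))^((3:ℝ)/2) ≤ (1+((i+J:ℕ):ℝ))^((3:ℝ)/2) := by
    gcongr; simp
  have e3 : exp (-(l * ((2^(i+J))⁻¹/8))) ≤ 1 := by
    apply exp_le_one_iff.2; rw [neg_nonpos]; positivity
  rw [e1]
  calc _ ≤ ((2:ℝ)^J)^(-erdosDelta) * ((2:ℝ)^(-erdosDelta))^i / (1+(J:ℝ))^((3:ℝ)/2) * 1 := by gcongr
    _ = _ := by ring

theorem jsum : ∃ C : ℝ, 0 ≤ C ∧ ∀ l : ℝ, 0 ≤ l → ∑' j : ℕ, ENNReal.ofReal (jterm l j) ≤ ENNReal.ofReal (C * Fh l) := by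
  have hd := delta_pos
  have hr1 : (2:ℝ)^(-erdosDelta) < 1 := rpow_lt_one_of_one_lt_of_neg (by norm_num) (by linarith)
  have hr0 : (0:ℝ) < (2:ℝ)^(-erdosDelta) := by positivity
  have hCJ : 0 < CJ := by unfold CJ; positivity
  have h1r : 0 < 1 - (2:ℝ)^(-erdosDelta) := by linarith
  refine ⟨8 * (CJ * 2 + (1 - (2:ℝ)^(-erdosDelta))⁻¹), by positivity, fun l hl => ?_⟩
  obtain ⟨J, hJ1, hJ2⟩ := exists_J hl
  obtain ⟨A, hA⟩ : ∃ A : ℝ, A = ((2:ℝ)^J)^(-erdosDelta) / (1+(J:ℝ))^((3:ℝ)/2) := ⟨_, rfl⟩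
  have hA0 : 0 ≤ A := by rw [hA]; positivity
  have hAF := Fh_ge hl J hJ2
  rw [← hA] at hAF
  rw [← Summable.sum_add_tsum_nat_add' (k := J) ENNReal.summable]
  have s1 : ∑ j ∈ range J, ENNReal.ofReal (jterm l j) ≤ ENNReal.ofReal (A * (CJ * 2)) := by
    rw [← ENNReal.ofReal_sum_of_nonneg (fun _ _ => jterm_nonneg _ _)]
    apply ENNReal.ofReal_le_ofReal
    calc ∑ j ∈ range J, jterm l j ≤ ∑ j ∈ range J, A * (CJ * (1/2)^(J-j)) := by
          apply sum_le_sum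
          intro j hj
          have hj' := mem_range.1 hj
          have := jterm_low (l := l) J (J-j) (by omega) hJ1
          rw [show J - (J-j) = j by omega, ← hA] at this
          exact this
      _ ≤ A * (CJ * 2) := by
          rw [← mul_sum, ← mul_sum]
          gcongr
          rw [← sum_range_reflect]
          calc ∑ j ∈ range J, (1/2:ℝ)^(J - (J-1-j)) ≤ ∑ j ∈ range J, (1/2:ℝ)^j := by
                apply sum_le_sum
                intro j hj
                have hj' := mem_range.1 hj
                exact pow_le_pow_of_le_one (by norm_num) (by norm_num) (by omega)
            _ ≤ ∑' j : ℕ, (1/2:ℝ)^j := summable_geometric_two.sum_le_tsum _ (fun _ _ => by positivity)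
            _ = 2 := tsum_geometric_two
  have s2 : ∑' i, ENNReal.ofReal (jterm l (i+J)) ≤ ENNReal.ofReal (A * (1 - (2:ℝ)^(-erdosDelta))⁻¹) := by
    have hs := (summable_geometric_of_lt_one hr0.le hr1).mul_left A
    rw [← tsum_geometric_of_lt_one hr0.le hr1, ← tsum_mul_left,
      ENNReal.ofReal_tsum_of_nonneg (fun _ => by positivity) hs]
    apply ENNReal.tsum_le_tsum
    intro i
    apply ENNReal.ofReal_le_ofReal
    rw [hA]; exact jterm_high hl J i
  refine (add_le_add s1 s2).trans ?_
  rw [← ENNReal.ofReal_add (by positivity) (by positivity)]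
  apply ENNReal.ofReal_le_ofReal
  have hF := Fh_pos hl
  calc A * (CJ * 2) + A * (1 - (2:ℝ)^(-erdosDelta))⁻¹ = A * (CJ * 2 + (1 - (2:ℝ)^(-erdosDelta))⁻¹) := by ring
    _ ≤ (8 * Fh l) * (CJ * 2 + (1 - (2:ℝ)^(-erdosDelta))⁻¹) := by gcongr
    _ = _ := by ring

lemma split_lt (p n : ℕ) (hn : n ≠ 0) : ∃ a b : ℕ, n = a * b ∧ (∀ q, q.Prime → q ∣ a → q < p) ∧
    (∀ q, q.Prime → q ∣ b → p ≤ q) := by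
  induction n using Nat.recOnMul with
  | zero => exact absurd rfl hn
  | one => exact ⟨1, 1, rfl, fun q hq h => absurd (Nat.dvd_one.1 h) hq.one_lt.ne',
      fun q hq h => absurd (Nat.dvd_one.1 h) hq.one_lt.ne'⟩
  | prime q hq =>
    by_cases h : q < p
    · exact ⟨q, 1, by simp, fun r hr h' => by rwa [(Nat.prime_dvd_prime_iff_eq hr hq).1 h'],
        fun r hr h => absurd (Nat.dvd_one.1 h) hr.one_lt.ne'⟩
    · exact ⟨1, q, by simp, fun r hr h => absurd (Nat.dvd_one.1 h) hr.one_lt.ne',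
        fun r hr h' => by rw [(Nat.prime_dvd_prime_iff_eq hr hq).1 h']; omega⟩
  | mul x y hx hy =>
    obtain ⟨a, b, h1, h2, h3⟩ := hx (by rintro rfl; simp at hn)
    obtain ⟨c, d, h4, h5, h6⟩ := hy (by rintro rfl; simp at hn)
    refine ⟨a*c, b*d, by rw [h1, h4]; ring, fun q hq h => ?_, fun q hq h => ?_⟩
    · rcases hq.dvd_mul.1 h with h | h
      · exact h2 q hq h
      · exact h5 q hq h
    · rcases hq.dvd_mul.1 h with h | h
      · exact h3 q hq h
      · exact h6 q hq h

lemma decomp (N m d : ℕ) (hm : m ≠ 0) (hmN : m ≤ N) (hd : d ∣ m) (hd1 : 1 < d) :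
    ∃ p a e b : ℕ, m = a * p^e * b ∧ p ∈ PP N ∧ a ∈ Nat.factoredNumbers (PP (p-1)) ∧
      b ∈ Nat.factoredNumbers (PP N \ PP p) ∧ ∃ i ∈ Icc 1 e, ∃ d', d' ∣ a ∧ d = d' * p^i := by
  have hd0 : d ≠ 0 := by omega
  have hne : d.primeFactors.Nonempty := Nat.nonempty_primeFactors.2 hd1
  obtain ⟨p, hpm, hpmax⟩ := d.primeFactors.exists_max_image id hne
  have hp : p.Prime := Nat.prime_of_mem_primeFactors hpm
  have hpd : p ∣ d := Nat.dvd_of_mem_primeFactors hpm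
  obtain ⟨e, m', hpm', hme⟩ := Nat.exists_eq_pow_mul_and_not_dvd hm p hp.one_lt.ne'
  obtain ⟨i, d', hpd', hde⟩ := Nat.exists_eq_pow_mul_and_not_dvd hd0 p hp.one_lt.ne'
  have hm'0 : m' ≠ 0 := by rintro rfl; simp at hpm'
  obtain ⟨a, b, hab, ha, hb⟩ := split_lt p m' hm'0
  have ha0 : a ≠ 0 := by rintro rfl; simp at hab; exact hm'0 hab
  have hb0 : b ≠ 0 := by rintro rfl; simp at hab; exact hm'0 hab
  have hbp : ¬ p ∣ b := fun h => hpm' (hab ▸ Dvd.dvd.mul_left h a)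
  have hle : ∀ q, q ∣ m → q ≤ N := fun q hq => (Nat.le_of_dvd (Nat.pos_of_ne_zero hm) hq).trans hmN
  refine ⟨p, a, e, b, by rw [hme, hab]; ring, PP_mem.2 ⟨hle p (hpd.trans hd), hp⟩, ?_, ?_, i, ?_, d', ?_, by rw [hde]; ring⟩
  · rw [Nat.mem_factoredNumbers']
    intro q hq h
    have := ha q hq h
    exact PP_mem.2 ⟨by omega, hq⟩
  · rw [Nat.mem_factoredNumbers']
    intro q hq h
    have h1 := hb q hq h
    have h2 : q ≠ p := by rintro rfl; exact hbp h
    refine mem_sdiff.2 ⟨PP_mem.2 ⟨hle q ?_, hq⟩, fun hh => ?_⟩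
    · rw [hme, hab]; exact Dvd.dvd.mul_left (Dvd.dvd.mul_left h a) _
    · have := (PP_mem.1 hh).1; omega
  · rw [mem_Icc]
    constructor
    · by_contra hh
      have : i = 0 := by omega
      subst this
      simp at hde
      exact hpd' (hde ▸ hpd)
    · have : p^i ∣ p^e * m' := by rw [← hme]; exact (Dvd.intro d' hde.symm).trans hd
      have h3 : Nat.Coprime (p^i) m' := Nat.Coprime.pow_left _ ((Nat.Prime.coprime_iff_not_dvd hp).2 hpm')
      exact (Nat.pow_dvd_pow_iff_le_right hp.one_lt).1 (h3.dvd_of_dvd_mul_right this)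
  · have h1 : d' ∣ a * (p^e * b) := by
      have : d' ∣ m := (Dvd.intro_left _ hde.symm).trans hd
      rw [hme, hab] at this
      convert this using 1; ring
    refine Nat.Coprime.dvd_of_dvd_mul_right ?_ h1
    have hd'm : ∀ q, q.Prime → q ∣ d' → q < p := by
      intro q hq h
      have h3 : q ∣ d := by rw [hde]; exact Dvd.dvd.mul_left h _
      have h4 := hpmax q (Nat.mem_primeFactors.2 ⟨hq, h3, hd0⟩)
      have : q ≠ p := by rintro rfl; exact hpd' h
      simp at h4; omega
    apply Nat.Coprime.mul_right
    · exact (Nat.Coprime.pow_left _ ((Nat.Prime.coprime_iff_not_dvd hp).2 hpd')).symm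
    · by_contra hh
      obtain ⟨q, hq, h5, h6⟩ := Nat.Prime.not_coprime_iff_dvd.1 hh
      have := hd'm q hq h5
      have := hb q hq h6
      omega

/-- The event for the largest prime. -/
def Ein (Y : ℝ) (p a e : ℕ) : Prop := ∃ i ∈ Icc 1 e, ∃ d', d' ∣ a ∧ Y < ((d' * p^i : ℕ):ℝ) ∧ ((d' * p^i : ℕ):ℝ) ≤ 2*Y

open Classical in
lemma LF_step1 {g} (hg : Wt g) (N : ℕ) (Y : ℝ) (hY : 1 ≤ Y) :
    ENNReal.ofReal (∑ m ∈ (Ioc 0 N).filter (fun m => ∃ d : ℕ, d ∣ m ∧ Y < d ∧ (d:ℝ) ≤ 2*Y), g m / m) ≤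
     ∑ p ∈ PP N, (∑' a : Nat.factoredNumbers (PP (p-1)), ∑' e : ℕ, Wg g 0 a * Wg g 0 (p^e) *
      (if Ein Y p a e then 1 else 0)) * ∑' b : Nat.factoredNumbers (PP N \ PP p), Wg g 0 b := by
  set M := (Ioc 0 N).filter (fun m => ∃ d : ℕ, d ∣ m ∧ Y < d ∧ (d:ℝ) ≤ 2*Y) with hM
  have hex : ∀ m : ℕ, ∃ t : ℕ × ℕ × ℕ × ℕ, m ∈ M → m = t.2.1 * t.1^t.2.2.1 * t.2.2.2 ∧ t.1 ∈ PP N ∧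
      t.2.1 ∈ Nat.factoredNumbers (PP (t.1-1)) ∧ t.2.2.2 ∈ Nat.factoredNumbers (PP N \ PP t.1) ∧ Ein Y t.1 t.2.1 t.2.2.1 := by
    intro m
    by_cases h : m ∈ M
    · obtain ⟨h1, d, h2, h3, h4⟩ := mem_filter.1 h
      rw [mem_Ioc] at h1
      have hd1 : 1 < d := by exact_mod_cast lt_of_le_of_lt hY h3
      obtain ⟨p, a, e, b, h5, h6, h7, h8, i, h9, d', h10, h11⟩ := decomp N m d (by omega) h1.2 h2 hd1
      exact ⟨(p,a,e,b), fun _ => ⟨h5, h6, h7, h8, i, h9, d', h10, by rw [← h11]; exact h3, by rw [← h11]; exact h4⟩⟩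
    · exact ⟨0, fun h' => absurd h' h⟩
  choose t ht using hex
  let F : ℕ × ℕ × ℕ × ℕ → ℝ≥0∞ := fun t => (if t.1 ∈ PP N then 1 else 0) * (((Nat.factoredNumbers (PP (t.1-1))).indicator (fun a =>
      Wg g 0 a * Wg g 0 (t.1^t.2.2.1) * (if Ein Y t.1 a t.2.2.1 then 1 else 0)) t.2.1) *
      ((Nat.factoredNumbers (PP N \ PP t.1)).indicator (fun b => Wg g 0 b) t.2.2.2))
  have hF : ∀ m ∈ M, ENNReal.ofReal (g m / m) = F (t m) := by
    intro m hm
    obtain ⟨h1, h2, h3, h4, h5⟩ := ht m hm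
    simp only [F]
    rw [if_pos h2, Set.indicator_of_mem h3, Set.indicator_of_mem h4, if_pos h5, one_mul, mul_one]
    have hp := PP_prime h2
    have c1 : Nat.Coprime (t m).2.1 ((t m).1^(t m).2.2.1) := by
      apply Nat.Coprime.pow_right
      refine ((Nat.Prime.coprime_iff_not_dvd hp).2 fun h => ?_).symm
      have := (PP_mem.1 (Nat.mem_factoredNumbers'.1 h3 _ hp h)).1
      have := hp.pos; omega
    have c2 : Nat.Coprime ((t m).2.1 * (t m).1^(t m).2.2.1) (t m).2.2.2 := by
      by_contra hh
      obtain ⟨q, hq, h6, h7⟩ := Nat.Prime.not_coprime_iff_dvd.1 hh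
      have h8 := mem_sdiff.1 (Nat.mem_factoredNumbers'.1 h4 _ hq h7)
      apply h8.2
      rcases hq.dvd_mul.1 h6 with h6 | h6
      · have := (PP_mem.1 (Nat.mem_factoredNumbers'.1 h3 _ hq h6)).1
        exact PP_mem.2 ⟨by omega, hq⟩
      · exact PP_mem.2 ⟨Nat.le_of_dvd hp.pos (hq.dvd_of_dvd_pow h6), hq⟩
    rw [← Wg_mul hg 0 _ _ c1, ← Wg_mul hg 0 _ _ c2, ← h1]
    simp only [Wg]
    congr 1
    rw [zero_sub, rpow_neg_one]; rfl
  rw [ENNReal.ofReal_sum_of_nonneg (fun m _ => div_nonneg (hg.nn m) (by positivity)), sum_congr rfl hF]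
  have hinj : Function.Injective (fun m : M => t m) := by
    intro x y h
    have hx := (ht x x.2).1
    have hy := (ht y y.2).1
    simp only at h
    rw [h] at hx
    exact Subtype.ext (hx.trans hy.symm)
  calc ∑ m ∈ M, F (t m) = ∑' m : M, F (t m) := by rw [Finset.tsum_subtype M (fun m => F (t m))]
    _ ≤ ∑' s, F s := ENNReal.tsum_comp_le_tsum_of_injective hinj F
    _ = ∑ p ∈ PP N, ∑' a : ℕ, ∑' e : ℕ, ∑' b : ℕ, F (p, a, e, b) := by
        rw [ENNReal.tsum_prod']
        rw [tsum_eq_sum (s := PP N)]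
        · apply sum_congr rfl; intro p _
          rw [ENNReal.tsum_prod']
          congr 1; ext a
          rw [ENNReal.tsum_prod']
        · intro p hp
          simp [F, hp]
    _ = _ := by
        apply sum_congr rfl; intro p hp
        simp only [F, if_pos hp, one_mul]
        have hh : ∀ a e : ℕ, (∑' b : ℕ, ((Nat.factoredNumbers (PP (p-1))).indicator (fun a => Wg g 0 a * Wg g 0 (p^e) * (if Ein Y p a e then 1 else 0)) a) * ((Nat.factoredNumbers (PP N \ PP p)).indicator (fun b => Wg g 0 b) b)) = _ := fun a e => ENNReal.tsum_mul_left
        simp only [hh, ENNReal.tsum_mul_right]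
        congr 1
        · rw [_root_.tsum_subtype (Nat.factoredNumbers (PP (p-1))) (fun a => ∑' e, Wg g 0 a * Wg g 0 (p^e) * (if Ein Y p a e then 1 else 0))]
          congr 1; ext a
          by_cases ha : a ∈ Nat.factoredNumbers (PP (p-1))
          · simp [Set.indicator_of_mem ha]
          · simp [Set.indicator_of_notMem ha]
        · rw [_root_.tsum_subtype]

lemma LF_step2 {g} (hg : Wt g) : ∃ C : ℝ, 0 ≤ C ∧ ∀ N p : ℕ, p ∈ PP N →
    ∑' b : Nat.factoredNumbers (PP N \ PP p), Wg g 0 b ≤ ENNReal.ofReal (C * (log N / log p)) := by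
  obtain ⟨C, h, H⟩ := sum_g_range hg
  refine ⟨exp (Ce*Cz + C), by positivity, fun N p hp => ?_⟩
  have hpp := PP_prime hp
  have hpN := (PP_mem.1 hp).1
  refine (euler_Wg hg (by norm_num) _ (fun q hq => PP_prime (mem_sdiff.1 hq).1)).trans (ENNReal.ofReal_le_ofReal ?_)
  have h1 := H p N hpp.two_le hpN
  have hlp : 0 < log p := log_pos (by exact_mod_cast hpp.one_lt)
  have hlN : 0 < log N := log_pos (by exact_mod_cast lt_of_lt_of_le hpp.one_lt hpN)
  have e : ∑ q ∈ PP N \ PP p, g q * (q:ℝ)^((0:ℝ)-1) = ∑ q ∈ PP N \ PP p, g q / q := by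
    apply sum_congr rfl; intro q _; rw [zero_sub, rpow_neg_one]; rfl
  rw [e]
  calc exp (Ce*Cz + ∑ q ∈ PP N \ PP p, g q / q) ≤ exp (Ce*Cz + C + (log (log N) - log (log p))) := by
        apply exp_le_exp.2; linarith
    _ = _ := by rw [exp_add, exp_sub, exp_log hlN, exp_log hlp]

noncomputable def th (j : ℕ) : ℝ := (2^j)⁻¹/8
lemma th_pos (j : ℕ) : 0 < th j := by unfold th; positivity
lemma th_le (j : ℕ) : th j ≤ 1/8 := by
  unfold th
  have : ((2:ℝ)^j)⁻¹ ≤ 1 := inv_le_one_of_one_le₀ (one_le_pow₀ (by norm_num))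
  linarith

def clsP (j p : ℕ) : Prop := log p ≤ 2^j ∧ (2:ℝ)^j ≤ 2 * log p

lemma exists_cls (p : ℕ) (hp : 2 ≤ p) : ∃ j, clsP j p := by
  have h : ∃ j : ℕ, log p ≤ 2^j := by
    obtain ⟨n, hn⟩ := pow_unbounded_of_one_lt (log p) (by norm_num : (1:ℝ) < 2)
    exact ⟨n, hn.le⟩
  classical
  refine ⟨Nat.find h, Nat.find_spec h, ?_⟩
  have hl : log 2 ≤ log p := log_le_log (by norm_num) (by exact_mod_cast hp)
  have := log_two_gt_d9
  rcases Nat.eq_zero_or_pos (Nat.find h) with h0 | h0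
  · rw [h0]; norm_num; linarith
  · have h1 := Nat.find_min h (Nat.sub_lt h0 one_pos)
    push Not at h1
    have : (2:ℝ)^(Nat.find h) = 2 * 2^(Nat.find h - 1) := by
      rw [← pow_succ']; congr 1; omega
    rw [this]; linarith

open Classical in
/-- Indicator for the scale `k`. -/
lemma Ein_le (Y : ℝ) (hY : 0 < Y) (p a e : ℕ) (hp : 0 < p) (ha : a ≠ 0) : (if Ein Y p a e then (1:ℝ≥0∞) else 0) ≤
    ∑ k ∈ (Nat.divisors a).image (Nat.log 2), ∑ i ∈ Icc 1 e,
      (if Y/2^(k+1) < (p:ℝ)^i ∧ (p:ℝ)^i ≤ 4 * (Y/2^(k+1)) then 1 else 0) := by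
  split_ifs with h
  · obtain ⟨i, hi, d, hd, h1, h2⟩ := h
    have hd0 : d ≠ 0 := by rintro rfl; exact ha (zero_dvd_iff.1 hd)
    have hk : Nat.log 2 d ∈ (Nat.divisors a).image (Nat.log 2) := mem_image_of_mem _ (Nat.mem_divisors.2 ⟨hd, ha⟩)
    refine le_trans ?_ (single_le_sum (f := fun k => ∑ i ∈ Icc 1 e,
      (if Y/2^(k+1) < (p:ℝ)^i ∧ (p:ℝ)^i ≤ 4 * (Y/2^(k+1)) then (1:ℝ≥0∞) else 0)) (fun _ _ => zero_le) hk)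
    refine le_trans ?_ (single_le_sum (f := fun i =>
      (if Y/2^(Nat.log 2 d+1) < (p:ℝ)^i ∧ (p:ℝ)^i ≤ 4 * (Y/2^(Nat.log 2 d+1)) then (1:ℝ≥0∞) else 0)) (fun _ _ => zero_le) hi)
    rw [if_pos]
    push_cast at h1 h2
    have l1 : (2:ℝ)^(Nat.log 2 d) ≤ d := by exact_mod_cast Nat.pow_log_le_self 2 hd0
    have l2 : (d:ℝ) < 2^(Nat.log 2 d + 1) := by exact_mod_cast Nat.lt_pow_succ_log_self (by norm_num) d
    have hpi : (0:ℝ) < (p:ℝ)^i := by positivity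
    constructor
    · rw [div_lt_iff₀ (by positivity)]
      nlinarith
    · rw [pow_succ, ← mul_div_assoc, le_div_iff₀ (by positivity)]
      nlinarith
  · exact zero_le

open Classical in
lemma R_bound {g} (hg : Wt g) : ∃ C : ℝ, 0 ≤ C ∧ ∀ (j : ℕ) (A : ℝ) (N : ℕ), 0 < A →
    ∑ p ∈ (PP N).filter (clsP j), ENNReal.ofReal (1 / log p) * ∑' e : ℕ, Wg g (th j) (p^e) *
      ∑ i ∈ Icc 1 e, (if A < (p:ℝ)^i ∧ (p:ℝ)^i ≤ 4 * A then 1 else 0) ≤ ENNReal.ofReal (C * (4:ℝ)^(-(j:ℝ))) := by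
  set D : ℝ := ∑' n : ℕ, (n:ℝ)^(-(9/8):ℝ) with hD
  have hDs : Summable (fun n : ℕ => (n:ℝ)^(-(9/8):ℝ)) := summable_nat_rpow.2 (by norm_num)
  have hD0 : 0 ≤ D := tsum_nonneg (fun v => by positivity)
  have hCe := Ce_nonneg
  have hl4 : 0 < log 4 := log_pos (by norm_num)
  refine ⟨4 * (2 * exp (1/8) * (8 * (log 4 + 4)) + 8 * Ce * D), by positivity, fun j A N hA => ?_⟩
  have h4 : (4:ℝ)^(-(j:ℝ)) = ((2:ℝ)^j)⁻¹^2 := by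
    rw [rpow_neg (by norm_num), rpow_natCast, inv_pow, ← pow_mul, mul_comm j 2, pow_mul]; norm_num
  have key : ∀ p ∈ (PP N).filter (clsP j), ENNReal.ofReal (1 / log p) * ∑' e : ℕ, Wg g (th j) (p^e) *
      ∑ i ∈ Icc 1 e, (if A < (p:ℝ)^i ∧ (p:ℝ)^i ≤ 4 * A then 1 else 0) ≤
      ENNReal.ofReal (4 * (4:ℝ)^(-(j:ℝ)) * (2 * exp (1/8) * (if A < (p:ℝ) ∧ (p:ℝ) ≤ 8 * A then ArithmeticFunction.vonMangoldt p / p else 0) + 8 * Ce * (p:ℝ)^(-(9/8):ℝ))) := by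
    intro p hp
    obtain ⟨hpN, hc1, hc2⟩ := mem_filter.1 hp
    have hpp := PP_prime hpN
    have hp0 : (0:ℝ) < p := by exact_mod_cast hpp.pos
    have hlp : 0 < log p := log_pos (by exact_mod_cast hpp.one_lt)
    have hL : 1 / log p ≤ 4 * (4:ℝ)^(-(j:ℝ)) * log p := by
      rw [h4, div_le_iff₀ hlp]
      have : 1 ≤ 2 * log p * ((2:ℝ)^j)⁻¹ := by
        rw [← div_eq_mul_inv, le_div_iff₀ (by positivity)]; linarith
      nlinarith
    have hterm : ∑' e : ℕ, Wg g (th j) (p^e) *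
      ∑ i ∈ Icc 1 e, (if A < (p:ℝ)^i ∧ (p:ℝ)^i ≤ 4 * A then 1 else 0) ≤
       ENNReal.ofReal (2 * exp (1/8) * (if A < (p:ℝ) ∧ (p:ℝ) ≤ 8 * A then (p:ℝ)⁻¹ else 0) + Ce * (p:ℝ)^(-(5/4):ℝ)) := by
      rw [ENNReal.ofReal_add (by split_ifs <;> positivity) (by positivity)]
      rw [tsum_eq_zero_add' ENNReal.summable, tsum_eq_zero_add' ENNReal.summable]
      simp only [zero_add, pow_zero, Icc_self, sum_singleton, pow_one]
      rw [show Icc 1 0 = (∅ : Finset ℕ) by simp, sum_empty, mul_zero, zero_add]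
      apply add_le_add
      · split_ifs with h1 h2 h2
        · rw [mul_one]
          unfold Wg
          apply ENNReal.ofReal_le_ofReal
          rw [rpow_sub_one hp0.ne', div_eq_mul_inv, ← mul_assoc]
          gcongr
          · exact hg.pu p hpp
          · rw [rpow_def_of_pos hp0]
            apply exp_le_exp.2
            unfold th
            calc log p * (((2:ℝ)^j)⁻¹/8) ≤ 2^j * (((2:ℝ)^j)⁻¹/8) := by gcongr
              _ = 1/8 := by field_simp
        · exact absurd ⟨h1.1, by linarith⟩ h2
        · simp
        · simp
      · refine le_trans ?_ (Wg_eps hg (th_le j) p hpp)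
        apply ENNReal.tsum_le_tsum; intro v
        apply mul_le_mul_right
        calc ∑ i ∈ Icc 1 (v+1+1), (if A < (p:ℝ)^i ∧ (p:ℝ)^i ≤ 4 * A then (1:ℝ≥0∞) else 0) ≤ ∑ i ∈ Icc 1 (v+1+1), 1 := by
              apply sum_le_sum; intro i _; split_ifs <;> simp
          _ = ((v+1+1 : ℕ):ℝ≥0∞) := by simp
          _ ≤ ((2*(v+3) : ℕ):ℝ≥0∞) := by exact_mod_cast (by omega)
          _ = _ := by push_cast; ring
    calc _ ≤ ENNReal.ofReal (4 * (4:ℝ)^(-(j:ℝ)) * log p) * ENNReal.ofReal (2 * exp (1/8) * (if A < (p:ℝ) ∧ (p:ℝ) ≤ 8 * A then (p:ℝ)⁻¹ else 0) + Ce * (p:ℝ)^(-(5/4):ℝ)) := by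
          apply mul_le_mul' (ENNReal.ofReal_le_ofReal hL) hterm
      _ = ENNReal.ofReal (4 * (4:ℝ)^(-(j:ℝ)) * log p * (2 * exp (1/8) * (if A < (p:ℝ) ∧ (p:ℝ) ≤ 8 * A then (p:ℝ)⁻¹ else 0) + Ce * (p:ℝ)^(-(5/4):ℝ))) := by
          rw [ENNReal.ofReal_mul (p := 4 * (4:ℝ)^(-(j:ℝ)) * log p) (by positivity)]
      _ ≤ _ := by
          apply ENNReal.ofReal_le_ofReal
          rw [mul_assoc (4 * (4:ℝ)^(-(j:ℝ)))]
          apply mul_le_mul_of_nonneg_left _ (by positivity)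
          rw [mul_add]
          apply add_le_add
          · rw [ArithmeticFunction.vonMangoldt_apply_prime hpp]
            split_ifs
            · apply le_of_eq; ring
            · simp
          · have hl8 : log p ≤ 8 * (p:ℝ)^((1:ℝ)/8) := by
              have := log_le_rpow_div hp0.le (by norm_num : (0:ℝ) < 1/8)
              linarith
            calc log p * (Ce * (p:ℝ)^(-(5/4):ℝ)) ≤ (8 * (p:ℝ)^((1:ℝ)/8)) * (Ce * (p:ℝ)^(-(5/4):ℝ)) := by gcongr
              _ = 8 * Ce * ((p:ℝ)^((1:ℝ)/8) * (p:ℝ)^(-(5/4):ℝ)) := by ring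
              _ = _ := by rw [← rpow_add hp0]; norm_num
  refine (sum_le_sum key).trans ?_
  rw [← ENNReal.ofReal_sum_of_nonneg]
  · apply ENNReal.ofReal_le_ofReal
    rw [← mul_sum, sum_add_distrib, ← mul_sum, ← mul_sum]
    rw [show ∀ x : ℝ, 4 * x * (4:ℝ)^(-(j:ℝ)) = 4 * (4:ℝ)^(-(j:ℝ)) * x from fun x => by ring]
    apply mul_le_mul_of_nonneg_left _ (by positivity)
    apply add_le_add
    · apply mul_le_mul_of_nonneg_left _ (by positivity)
      rw [← sum_filter]
      exact cheb_block A hA _ (fun n hn => (mem_filter.1 hn).2)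
    · apply mul_le_mul_of_nonneg_left _ (by positivity)
      exact hDs.sum_le_tsum _ (fun _ _ => by positivity)
  · intro p hp
    have : 0 ≤ ArithmeticFunction.vonMangoldt p := ArithmeticFunction.vonMangoldt_nonneg
    split_ifs <;> positivity

noncomputable def Nj (j : ℕ) : ℕ := ⌊exp (2^j)⌋₊

lemma Nj_log (j : ℕ) : log (Nj j) ≤ 2^j := by
  have h : (1:ℝ) ≤ Nj j := by
    have : 1 ≤ Nj j := Nat.le_floor (by simpa using one_le_exp (by positivity))
    exact_mod_cast this
  calc log (Nj j) ≤ log (exp (2^j)) := log_le_log (by linarith) (Nat.floor_le (by positivity))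
    _ = _ := log_exp _

lemma cls_le (j p : ℕ) (hp : 0 < p) (h : clsP j p) : p ≤ Nj j := by
  apply Nat.le_floor
  rw [← exp_log (by exact_mod_cast hp : (0:ℝ) < p)]
  exact exp_le_exp.2 h.1

lemma Wg_rankin {g} (hg : Wt g) (θ Y : ℝ) (hθ : 0 ≤ θ) (hY : 1 ≤ Y) (n m : ℕ) (h : Nat.Coprime n m) (hn : Y ≤ ((n*m:ℕ):ℝ)) :
    Wg g 0 n * Wg g 0 m ≤ ENNReal.ofReal (exp (-(log Y * θ))) * (Wg g θ n * Wg g θ m) := by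
  rw [← Wg_mul hg _ _ _ h, ← Wg_mul hg _ _ _ h]
  unfold Wg
  rw [← ENNReal.ofReal_mul (by positivity)]
  apply ENNReal.ofReal_le_ofReal
  have h0 : (0:ℝ) < ((n*m:ℕ):ℝ) := by linarith
  rw [show (0:ℝ) - 1 = -θ + (θ-1) by ring, rpow_add h0 (-θ) (θ-1)]
  have h2 : (((n*m:ℕ):ℝ))^(-θ) ≤ exp (-(log Y * θ)) := by
    rw [rpow_def_of_pos h0]
    apply exp_le_exp.2
    have := log_le_log (by linarith) hn
    nlinarith
  calc g (n*m) * ((((n*m:ℕ):ℝ))^(-θ) * (((n*m:ℕ):ℝ))^(θ-1)) = (((n*m:ℕ):ℝ))^(-θ) * (g (n*m) * (((n*m:ℕ):ℝ))^(θ-1)) := by ring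
    _ ≤ _ := by
      apply mul_le_mul_of_nonneg_right h2
      exact mul_nonneg (hg.nn _) (by positivity)

open Classical in
lemma LF_step3 {g} (hg : Wt g) (j p : ℕ) (hp : p.Prime) (hj : clsP j p) (Y : ℝ) (hY : 1 ≤ Y) :
    ∑' a : Nat.factoredNumbers (PP (p-1)), ∑' e : ℕ, Wg g 0 a * Wg g 0 (p^e) * (if Ein Y p a e then 1 else 0) ≤
     ENNReal.ofReal (exp (-(log Y * th j))) * ∑' a : Nat.factoredNumbers (PP (Nj j)), Wg g (th j) a *
      ∑ k ∈ (Nat.divisors a).image (Nat.log 2), ∑' e : ℕ, Wg g (th j) (p^e) * ∑ i ∈ Icc 1 e,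
       (if Y/2^(k+1) < (p:ℝ)^i ∧ (p:ℝ)^i ≤ 4 * (Y/2^(k+1)) then 1 else 0) := by
  have hsub : Nat.factoredNumbers (PP (p-1)) ⊆ Nat.factoredNumbers (PP (Nj j)) :=
    Nat.factoredNumbers_mono (PP_mono ((Nat.sub_le _ _).trans (cls_le j p hp.pos hj)))
  rw [← ENNReal.tsum_mul_left]
  refine le_trans ?_ (ENNReal.tsum_mono_subtype (fun a : ℕ => ENNReal.ofReal (exp (-(log Y * th j))) * (Wg g (th j) a *
      ∑ k ∈ (Nat.divisors a).image (Nat.log 2), ∑' e : ℕ, Wg g (th j) (p^e) * ∑ i ∈ Icc 1 e,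
       (if Y/2^(k+1) < (p:ℝ)^i ∧ (p:ℝ)^i ≤ 4 * (Y/2^(k+1)) then 1 else 0))) hsub)
  apply ENNReal.tsum_le_tsum
  rintro ⟨a, ha⟩
  simp only
  rw [← Summable.tsum_finsetSum (fun _ _ => ENNReal.summable), ← ENNReal.tsum_mul_left, ← ENNReal.tsum_mul_left]
  apply ENNReal.tsum_le_tsum; intro e
  rw [← mul_sum]
  have ha0 := Nat.ne_zero_of_mem_factoredNumbers ha
  by_cases hE : Ein Y p a e
  · have c1 : Nat.Coprime a (p^e) := by
      apply Nat.Coprime.pow_right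
      refine ((Nat.Prime.coprime_iff_not_dvd hp).2 fun h => ?_).symm
      have := (PP_mem.1 (Nat.mem_factoredNumbers'.1 ha _ hp h)).1
      have := hp.pos; omega
    have hbig : Y ≤ ((a * p^e : ℕ):ℝ) := by
      obtain ⟨i, hi, d, hd, h1, h2⟩ := hE
      refine h1.le.trans ?_
      have : d * p^i ∣ a * p^e := mul_dvd_mul hd (pow_dvd_pow p (mem_Icc.1 hi).2)
      exact_mod_cast Nat.le_of_dvd (Nat.pos_of_ne_zero (mul_ne_zero ha0 (pow_ne_zero _ hp.ne_zero))) this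
    calc _ ≤ (ENNReal.ofReal (exp (-(log Y * th j))) * (Wg g (th j) a * Wg g (th j) (p^e))) *
         ∑ k ∈ (Nat.divisors a).image (Nat.log 2), ∑ i ∈ Icc 1 e,
          (if Y/2^(k+1) < (p:ℝ)^i ∧ (p:ℝ)^i ≤ 4 * (Y/2^(k+1)) then 1 else 0) :=
          mul_le_mul' (Wg_rankin hg _ _ (th_pos j).le hY _ _ c1 hbig) (Ein_le Y (by linarith) p a e hp.pos ha0)
      _ = _ := by ring
  · rw [if_neg hE, mul_zero]; exact zero_le

open Classical in
theorem LF {g} (hg : Wt g) : ∃ C : ℝ, 0 ≤ C ∧ ∀ (N : ℕ) (Y : ℝ), 1 ≤ N → 1 ≤ Y →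
    ∑ m ∈ (Ioc 0 N).filter (fun m => ∃ d : ℕ, d ∣ m ∧ Y < d ∧ (d:ℝ) ≤ 2*Y), g m / m ≤ C * log N * Fh (log Y) := by
  obtain ⟨C1, h1, H1⟩ := LF_step2 hg
  obtain ⟨C2, h2, H2⟩ := R_bound hg
  obtain ⟨C3, h3, H3⟩ := TJ hg
  obtain ⟨C4, h4, H4⟩ := jsum
  refine ⟨C1*C2*C3*C4, by positivity, fun N Y hN hY => ?_⟩
  have hlN : 0 ≤ log N := log_natCast_nonneg N
  have hlY : 0 ≤ log Y := log_nonneg hY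
  have hF := Fh_pos hlY
  rw [← ENNReal.ofReal_le_ofReal_iff (by positivity)]
  refine (LF_step1 hg N Y hY).trans ?_
  let G : ℕ → ℕ → ℕ → ℝ≥0∞ := fun j k p => ∑' e : ℕ, Wg g (th j) (p^e) * ∑ i ∈ Icc 1 e,
       (if Y/2^(k+1) < (p:ℝ)^i ∧ (p:ℝ)^i ≤ 4 * (Y/2^(k+1)) then 1 else 0)
  have hpb : ∀ p ∈ PP N, (∑' a : Nat.factoredNumbers (PP (p-1)), ∑' e : ℕ, Wg g 0 a * Wg g 0 (p^e) *
      (if Ein Y p a e then 1 else 0)) * ∑' b : Nat.factoredNumbers (PP N \ PP p), Wg g 0 b ≤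
      ∑' j : ℕ, (if clsP j p then (ENNReal.ofReal (exp (-(log Y * th j))) * ∑' a : Nat.factoredNumbers (PP (Nj j)), Wg g (th j) a *
      ∑ k ∈ (Nat.divisors a).image (Nat.log 2), G j k p) * (ENNReal.ofReal (C1 * log N) * ENNReal.ofReal (1 / log p)) else 0) := by
    intro p hp
    have hpp := PP_prime hp
    obtain ⟨j, hj⟩ := exists_cls p hpp.two_le
    refine le_trans ?_ (ENNReal.le_tsum j)
    rw [if_pos hj]
    apply mul_le_mul' (LF_step3 hg j p hpp hj Y hY)
    refine (H1 N p hp).trans (le_of_eq ?_)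
    rw [← ENNReal.ofReal_mul (by positivity)]
    congr 1; ring
  refine (sum_le_sum hpb).trans ?_
  rw [← Summable.tsum_finsetSum (fun _ _ => ENNReal.summable)]
  have hjb : ∀ j : ℕ, (∑ p ∈ PP N, (if clsP j p then (ENNReal.ofReal (exp (-(log Y * th j))) * ∑' a : Nat.factoredNumbers (PP (Nj j)), Wg g (th j) a *
      ∑ k ∈ (Nat.divisors a).image (Nat.log 2), G j k p) * (ENNReal.ofReal (C1 * log N) * ENNReal.ofReal (1 / log p)) else 0)) ≤
      ENNReal.ofReal (C1*C2*C3*log N) * ENNReal.ofReal (jterm (log Y) j) := by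
    intro j
    rw [← sum_filter]
    calc _ = ENNReal.ofReal (C1 * log N) * ENNReal.ofReal (exp (-(log Y * th j))) * ∑' a : Nat.factoredNumbers (PP (Nj j)), Wg g (th j) a *
          ∑ k ∈ (Nat.divisors (a:ℕ)).image (Nat.log 2), ∑ p ∈ (PP N).filter (clsP j), ENNReal.ofReal (1 / log p) * G j k p := by
          have : ∀ a : Nat.factoredNumbers (PP (Nj j)), Wg g (th j) a *
            ∑ k ∈ (Nat.divisors (a:ℕ)).image (Nat.log 2), ∑ p ∈ (PP N).filter (clsP j), ENNReal.ofReal (1 / log p) * G j k p =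
             ∑ p ∈ (PP N).filter (clsP j), ENNReal.ofReal (1 / log p) * (Wg g (th j) a * ∑ k ∈ (Nat.divisors (a:ℕ)).image (Nat.log 2), G j k p) := by
            intro a
            rw [sum_comm, mul_sum]
            apply sum_congr rfl; intro p _
            rw [← mul_sum]; ring
          simp_rw [this]
          rw [Summable.tsum_finsetSum (fun _ _ => ENNReal.summable), mul_sum]
          apply sum_congr rfl; intro p _
          rw [ENNReal.tsum_mul_left]; ring
      _ ≤ ENNReal.ofReal (C1 * log N) * ENNReal.ofReal (exp (-(log Y * th j))) * ∑' a : Nat.factoredNumbers (PP (Nj j)), (Wg g (th j) a * (Lc a : ℝ≥0∞)) * ENNReal.ofReal (C2 * (4:ℝ)^(-(j:ℝ))) := by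
          apply mul_le_mul_right
          apply ENNReal.tsum_le_tsum; intro a
          rw [mul_assoc]
          apply mul_le_mul_right
          calc _ ≤ ∑ k ∈ (Nat.divisors (a:ℕ)).image (Nat.log 2), ENNReal.ofReal (C2 * (4:ℝ)^(-(j:ℝ))) :=
                sum_le_sum (fun k _ => H2 j (Y/2^(k+1)) N (by positivity))
            _ = _ := by rw [sum_const, nsmul_eq_mul]; rfl
      _ ≤ ENNReal.ofReal (C1 * log N) * ENNReal.ofReal (exp (-(log Y * th j))) * (ENNReal.ofReal (C3 * ((2^j:ℝ)^(2-erdosDelta) / (1+(j:ℝ))^((3:ℝ)/2))) * ENNReal.ofReal (C2 * (4:ℝ)^(-(j:ℝ)))) := by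
          rw [ENNReal.tsum_mul_right]
          apply mul_le_mul_right
          exact mul_le_mul_left (H3 j (Nj j) (Nj_log j)) _
      _ = _ := by
          rw [← ENNReal.ofReal_mul (by positivity), ← ENNReal.ofReal_mul (by positivity), ← ENNReal.ofReal_mul (by positivity), ← ENNReal.ofReal_mul (by positivity)]
          congr 1
          unfold jterm th
          have e1 : ((2:ℝ)^j)^(2-erdosDelta) * (4:ℝ)^(-(j:ℝ)) = ((2:ℝ)^j)^(-erdosDelta) := by
            have : (4:ℝ)^(-(j:ℝ)) = ((2:ℝ)^j)^(-2:ℝ) := by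
              rw [rpow_neg (by norm_num), rpow_natCast, rpow_neg (by positivity)]
              congr 1
              rw [show (2:ℝ) = ((2:ℕ):ℝ) by norm_num, rpow_natCast, ← pow_mul, mul_comm j 2, pow_mul]; norm_num
            rw [this, ← rpow_add (by positivity)]; congr 1; ring
          rw [← e1]; ring
  refine (ENNReal.tsum_le_tsum hjb).trans ?_
  rw [ENNReal.tsum_mul_left]
  calc _ ≤ ENNReal.ofReal (C1*C2*C3*log N) * ENNReal.ofReal (C4 * Fh (log Y)) := mul_le_mul_right (H4 _ hlY) _
    _ = _ := by
      rw [← ENNReal.ofReal_mul (by positivity)]; congr 1; ring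

/-- Full sum bound. -/
lemma sum_g_log {g} (hg : Wt g) : ∃ C : ℝ, 0 ≤ C ∧ ∀ N : ℕ, 2 ≤ N → ∑ m ∈ Ioc 0 N, g m / m ≤ C * log N := by
  obtain ⟨C, h, H⟩ := sum_g_all hg
  refine ⟨exp (Ce*Cz + C), by positivity, fun N hN => ?_⟩
  have hlN : 0 < log N := log_pos (by exact_mod_cast hN)
  rw [← ENNReal.ofReal_le_ofReal_iff (by positivity), ENNReal.ofReal_sum_of_nonneg (fun m _ => div_nonneg (hg.nn m) (by positivity))]
  calc ∑ m ∈ Ioc 0 N, ENNReal.ofReal (g m / m) ≤ ∑' n : Nat.factoredNumbers (PP N), Wg g 0 n := by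
        rw [_root_.tsum_subtype]
        refine le_trans (le_of_eq (sum_congr rfl fun m hm => ?_)) (ENNReal.sum_le_tsum (Ioc 0 N))
        rw [mem_Ioc] at hm
        rw [Set.indicator_of_mem, Wg, zero_sub, rpow_neg_one]; rfl
        rw [Nat.mem_factoredNumbers_iff_forall_le]
        exact ⟨by omega, fun p hp hpp hpm => PP_mem.2 ⟨hp.trans hm.2, hpp⟩⟩
    _ ≤ _ := euler_Wg hg (by norm_num) _ (fun q hq => PP_prime hq)
    _ ≤ _ := by
        apply ENNReal.ofReal_le_ofReal
        have e : ∑ q ∈ PP N, g q * (q:ℝ)^((0:ℝ)-1) = ∑ q ∈ PP N, g q / q := by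
          apply sum_congr rfl; intro q _; rw [zero_sub, rpow_neg_one]; rfl
        rw [e]
        calc _ ≤ exp (Ce*Cz + C + log (log N)) := by
              apply exp_le_exp.2; linarith [H N hN]
          _ = _ := by rw [exp_add, exp_log hlN]

lemma Fh_ge_sq {l : ℝ} (hl : 0 ≤ l) : 1 ≤ (1+l)^2 * Fh l := by
  have hd := delta_pos
  have hd' := delta_lt
  have h1 : 1 + log (1+l) ≤ 1 + l := by
    have := log_le_sub_one_of_pos (by linarith : 0 < 1 + l); linarith
  have h0 : 0 ≤ log (1+l) := log_nonneg (by linarith)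
  have h2 : (1+l)^(-(3/2):ℝ) ≤ (1 + log (1+l))^(-(3/2):ℝ) :=
    rpow_le_rpow_of_nonpos (by linarith) h1 (by norm_num)
  have h3 : (1+l)^(-(1/2):ℝ) ≤ (1+l)^(-erdosDelta) :=
    rpow_le_rpow_of_exponent_le (by linarith) (by linarith)
  have h4 : (1+l)^2 * ((1+l)^(-(1/2):ℝ) * (1+l)^(-(3/2):ℝ)) = 1 := by
    rw [← rpow_add (by linarith), ← rpow_natCast, ← rpow_add (by linarith)]
    norm_num
  unfold Fh
  refine h4.symm.le.trans ?_
  have : 0 < 1 + l := by linarith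
  apply mul_le_mul_of_nonneg_left _ (by positivity)
  exact mul_le_mul h3 h2 (by positivity) (by positivity)

lemma sq_le_exp {c : ℝ} (hc : 0 < c) : ∃ C : ℝ, 0 < C ∧ ∀ t : ℝ, 0 ≤ t → (1+t)^2 ≤ C * exp (c*t) := by
  obtain ⟨b, hb⟩ : ∃ b, b = min (c/2) 1 := ⟨_, rfl⟩
  have hb0 : 0 < b := by rw [hb]; positivity
  have hb1 : b ≤ 1 := by rw [hb]; exact min_le_right _ _
  have hb2 : b ≤ c/2 := by rw [hb]; exact min_le_left _ _
  refine ⟨(1/b)^2, by positivity, fun t ht => ?_⟩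
  have h1 : 1 + t ≤ (1/b) * exp (b*t) := by
    have := add_one_le_exp (b*t)
    rw [one_div, inv_mul_eq_div, le_div_iff₀ hb0]
    nlinarith
  calc (1+t)^2 ≤ ((1/b) * exp (b*t))^2 := by gcongr
    _ = (1/b)^2 * exp (2*(b*t)) := by rw [mul_pow, ← exp_nat_mul]; norm_num
    _ ≤ _ := by
      have : 2*(b*t) ≤ c*t := by nlinarith
      gcongr

lemma exp_le_Fh {c : ℝ} (hc : 0 < c) : ∃ C : ℝ, 0 < C ∧ ∀ t : ℝ, 0 ≤ t → exp (-(c*t)) ≤ C * Fh t := by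
  obtain ⟨C, hC, H⟩ := sq_le_exp hc
  refine ⟨C, hC, fun t ht => ?_⟩
  have h1 := Fh_ge_sq ht
  have h2 := H t ht
  have h3 := Fh_pos ht
  rw [exp_neg, inv_le_iff_one_le_mul₀ (exp_pos _)]
  have : (1+t)^2 * Fh t ≤ C * exp (c*t) * Fh t := by gcongr
  linarith

lemma geo {c : ℝ} (hc : 0 < c) : ∃ C : ℝ, 0 < C ∧ ∀ a : ℝ, 0 ≤ a → ∀ K : ℕ,
    ∑ k ∈ range K, exp (-(c*|(k:ℝ) * log 2 - a|)) ≤ C := by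
  have ht : 0 < log 2 := log_pos (by norm_num)
  obtain ⟨t, htt⟩ : ∃ t, t = log 2 := ⟨_, rfl⟩
  rw [← htt] at ht ⊢
  obtain ⟨r, hr⟩ : ∃ r, r = exp (-(c*t)) := ⟨_, rfl⟩
  have hr0 : 0 < r := by rw [hr]; positivity
  have hr1 : r < 1 := by rw [hr, exp_lt_one_iff]; nlinarith [mul_pos hc ht]
  have hg : ∀ n, ∑ i ∈ range n, r^i ≤ 1/(1-r) := by
    intro n
    have := (summable_geometric_of_lt_one hr0.le hr1).sum_le_tsum (range n) (fun i _ => by positivity)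
    rwa [tsum_geometric_of_lt_one hr0.le hr1, ← one_div] at this
  have hrp : ∀ n : ℕ, r^n = exp (-(c*(n*t))) := by
    intro n; rw [hr, ← exp_nat_mul]; congr 1; ring
  refine ⟨1/(1-r) + 1/(1-r), by have : 0 < 1 - r := by linarith
                                positivity, fun a ha K => ?_⟩
  obtain ⟨k0, hk0⟩ : ∃ k0, k0 = ⌊a/t⌋₊ := ⟨_, rfl⟩
  have h1 : (k0:ℝ) * t ≤ a := by
    rw [← le_div_iff₀ ht, hk0]; exact Nat.floor_le (by positivity)
  have h2 : a ≤ (k0+1:ℝ) * t := by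
    rw [← div_le_iff₀ ht, hk0]; exact (Nat.lt_floor_add_one _).le
  calc ∑ k ∈ range K, exp (-(c*|(k:ℝ) * t - a|)) ≤ ∑ k ∈ range (k0+1+K), exp (-(c*|(k:ℝ) * t - a|)) := by
        apply sum_le_sum_of_subset_of_nonneg
        · intro k hk; rw [mem_range] at *; omega
        · intros; positivity
    _ = ∑ k ∈ range (k0+1), exp (-(c*|(k:ℝ) * t - a|)) + ∑ k ∈ range K, exp (-(c*|((k0+1+k:ℕ):ℝ) * t - a|)) := sum_range_add _ _ _
    _ ≤ ∑ k ∈ range (k0+1), r^k + ∑ k ∈ range K, r^k := by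
        apply add_le_add
        · rw [← sum_range_reflect (fun k => r^k)]
          apply sum_le_sum
          intro k hk
          rw [mem_range] at hk
          rw [hrp]
          apply exp_le_exp.2
          have hle : (k:ℝ) ≤ k0 := by exact_mod_cast (by omega : k ≤ k0)
          rw [show k0 + 1 - 1 - k = k0 - k by omega, Nat.cast_sub (by omega)]
          have : a - k*t ≤ |(k:ℝ)*t - a| := by rw [abs_sub_comm]; exact le_abs_self _
          nlinarith
        · apply sum_le_sum
          intro k hk
          rw [hrp]
          apply exp_le_exp.2
          push_cast
          have : (k0+1+k:ℝ)*t - a ≤ |(k0+1+k:ℝ)*t - a| := le_abs_self _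
          nlinarith
    _ ≤ _ := add_le_add (hg _) (hg _)

/-- pointwise comparison -/
lemma Fh_shift {c : ℝ} (hc : 0 < c) : ∃ C : ℝ, 0 < C ∧ ∀ e s : ℝ, 0 ≤ e → 0 ≤ s →
    exp (-(c*|s-e|)) * Fh s ≤ C * exp (-((c/2)*|s-e|)) * Fh e := by
  obtain ⟨C, hC, H⟩ := exp_le_Fh (c := c/4) (by positivity)
  refine ⟨64 + C, by positivity, fun e s he hs => ?_⟩
  have hFe := Fh_pos he
  by_cases h : e/4 ≤ s
  · have h1 : Fh s ≤ 64 * Fh e := (Fh_anti (by positivity) h).trans (Fh_quarter he)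
    have h2 : exp (-(c*|s-e|)) ≤ exp (-((c/2)*|s-e|)) := by
      apply exp_le_exp.2; nlinarith [abs_nonneg (s-e), mul_nonneg hc.le (abs_nonneg (s-e))]
    calc _ ≤ exp (-((c/2)*|s-e|)) * (64 * Fh e) := mul_le_mul h2 h1 (Fh_pos hs).le (by positivity)
      _ ≤ _ := by nlinarith [mul_pos (mul_pos hC (exp_pos (-((c/2)*|s-e|)))) hFe]
  · push Not at h
    have h3 : e - s ≤ |s-e| := by rw [abs_sub_comm]; exact le_abs_self _
    have h2 : exp (-(c*|s-e|)) ≤ exp (-((c/2)*|s-e|)) * exp (-((c/4)*e)) := by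
      rw [← exp_add]
      apply exp_le_exp.2; nlinarith
    calc _ ≤ (exp (-((c/2)*|s-e|)) * exp (-((c/4)*e))) * 1 := mul_le_mul h2 (Fh_le_one hs) (Fh_pos hs).le (by positivity)
      _ ≤ (exp (-((c/2)*|s-e|)) * (C * Fh e)) * 1 := by gcongr; exact H e he
      _ ≤ _ := by nlinarith [mul_pos (exp_pos (-((c/2)*|s-e|))) hFe]

lemma win_exists {d : ℕ} (hd : 2 ≤ d) : ∃ k : ℕ, k < d ∧ (2:ℝ)^k < d ∧ (d:ℝ) ≤ 2 * 2^k := by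
  refine ⟨Nat.log 2 (d-1), ?_, ?_, ?_⟩
  · have := Nat.log_lt_self 2 (x := d-1) (by omega); omega
  · have := Nat.pow_log_le_self 2 (x := d-1) (by omega)
    exact_mod_cast (by omega : 2^(Nat.log 2 (d-1)) < d)
  · have := Nat.lt_pow_succ_log_self (b := 2) (by norm_num) (d-1)
    rw [pow_succ] at this
    exact_mod_cast (by omega : d ≤ 2 * 2^(Nat.log 2 (d-1)))

open Classical in
theorem WL {g} (hg : Wt g) {c : ℝ} (hc : 0 < c) : ∃ C : ℝ, 0 ≤ C ∧ ∀ (N : ℕ) (e : ℝ) (φ : ℕ → ℝ), 2 ≤ N → 0 ≤ e →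
    (∀ m, 1 ≤ m → m ≤ N → ∃ d : ℕ, d ∣ m ∧ φ m ≤ exp (-(c*|log d - e|))) →
    ∑ m ∈ Ioc 0 N, g m / m * φ m ≤ C * log N * Fh e := by
  obtain ⟨C1, h1, H1⟩ := LF hg
  obtain ⟨C2, h2, H2⟩ := sum_g_log hg
  obtain ⟨C3, h3, H3⟩ := Fh_shift hc
  obtain ⟨C4, h4, H4⟩ := exp_le_Fh hc
  obtain ⟨C5, h5, H5⟩ := geo (c := c/2) (by positivity)
  refine ⟨C2 * C4 + exp c * C1 * C3 * C5, by positivity, fun N e φ hN he hφ => ?_⟩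
  have hlN : 0 < log N := log_pos (by exact_mod_cast hN)
  have hFe := Fh_pos he
  have ht : 0 < log 2 := log_pos (by norm_num)
  have ht1 : log 2 < 1 := by have := log_two_lt_d9; linarith
  have hgm : ∀ m : ℕ, 0 ≤ g m / m := fun m => div_nonneg (hg.nn m) (by positivity)
  have key : ∀ m ∈ Ioc 0 N, g m / m * φ m ≤ g m / m * exp (-(c*e)) + ∑ k ∈ range N,
      exp c * exp (-(c*|(k:ℝ)*log 2 - e|)) * (if ∃ d : ℕ, d ∣ m ∧ (2:ℝ)^k < d ∧ (d:ℝ) ≤ 2*2^k then g m / m else 0) := by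
    intro m hm
    rw [mem_Ioc] at hm
    obtain ⟨d, hd, hle⟩ := hφ m hm.1 hm.2
    have hsum0 : ∀ k ∈ range N, 0 ≤ exp c * exp (-(c*|(k:ℝ)*log 2 - e|)) * (if ∃ d : ℕ, d ∣ m ∧ (2:ℝ)^k < d ∧ (d:ℝ) ≤ 2*2^k then g m / m else 0) := by
      intro k _
      have := hgm m
      split_ifs <;> positivity
    have hd0 : 0 < d := Nat.pos_of_dvd_of_pos hd hm.1
    by_cases hd1 : d = 1
    · subst hd1
      simp only [Nat.cast_one, log_one, zero_sub, abs_neg, abs_of_nonneg he] at hle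
      have := sum_nonneg hsum0
      have := mul_le_mul_of_nonneg_left hle (hgm m)
      linarith
    · obtain ⟨k, hk, hk1, hk2⟩ := win_exists (by omega : 2 ≤ d)
      have hdm := Nat.le_of_dvd hm.1 hd
      have hs := single_le_sum hsum0 (mem_range.2 (by omega : k < N))
      rw [if_pos ⟨d, hd, hk1, hk2⟩] at hs
      have hl1 : k * log 2 ≤ log d := by
        rw [← log_pow]; exact log_le_log (by positivity) hk1.le
      have hl2 : log d ≤ log 2 + k * log 2 := by
        rw [← log_pow, ← log_mul (by norm_num) (by positivity)]
        exact log_le_log (by exact_mod_cast hd0) hk2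
      have hle2 : φ m ≤ exp c * exp (-(c*|(k:ℝ)*log 2 - e|)) := by
        refine hle.trans ?_
        rw [← exp_add]
        apply exp_le_exp.2
        have : |(k:ℝ)*log 2 - e| ≤ |log d - e| + 1 := by
          rw [abs_le]
          have h1 := neg_abs_le (log d - e)
          have h2 := le_abs_self (log d - e)
          constructor <;> linarith
        nlinarith
      have := mul_le_mul_of_nonneg_left hle2 (hgm m)
      have : 0 ≤ g m / m * exp (-(c*e)) := mul_nonneg (hgm m) (by positivity)
      linarith
  calc ∑ m ∈ Ioc 0 N, g m / m * φ m ≤ _ := sum_le_sum key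
    _ = (∑ m ∈ Ioc 0 N, g m / m) * exp (-(c*e)) + ∑ k ∈ range N,
      exp c * exp (-(c*|(k:ℝ)*log 2 - e|)) * ∑ m ∈ (Ioc 0 N).filter (fun m => ∃ d : ℕ, d ∣ m ∧ (2:ℝ)^k < d ∧ (d:ℝ) ≤ 2*2^k), g m / m := by
        rw [sum_add_distrib, sum_mul, sum_comm]
        congr 1
        apply sum_congr rfl
        intro k _
        rw [← mul_sum, sum_filter]
    _ ≤ (C2 * log N) * (C4 * Fh e) + ∑ k ∈ range N, exp c * (C1 * log N * (C3 * exp (-((c/2)*|(k:ℝ)*log 2 - e|)) * Fh e)) := by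
        apply add_le_add
        · exact mul_le_mul (H2 N hN) (H4 e he) (by positivity) (by positivity)
        · apply sum_le_sum
          intro k _
          have hk0 : 0 ≤ (k:ℝ)*log 2 := by positivity
          have a1 := H1 N (2^k) (by omega) (one_le_pow₀ (by norm_num))
          rw [log_pow] at a1
          have a2 := H3 e ((k:ℝ)*log 2) he hk0
          calc _ ≤ exp c * exp (-(c*|(k:ℝ)*log 2 - e|)) * (C1 * log N * Fh (k*log 2)) :=
                mul_le_mul_of_nonneg_left a1 (by positivity)
            _ = exp c * (C1 * log N * (exp (-(c*|(k:ℝ)*log 2 - e|)) * Fh (k*log 2))) := by ring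
            _ ≤ _ := by gcongr
    _ = (C2 * log N) * (C4 * Fh e) + exp c * C1 * C3 * log N * Fh e * ∑ k ∈ range N, exp (-((c/2)*|(k:ℝ)*log 2 - e|)) := by
        congr 1; rw [mul_sum]; apply sum_congr rfl; intro k _; ring
    _ ≤ (C2 * log N) * (C4 * Fh e) + exp c * C1 * C3 * log N * Fh e * C5 := by
        gcongr; exact H5 e he N
    _ = _ := by ring

/-- closeness of divisors of `m` to `e` -/
noncomputable def Dw (c e : ℝ) (m : ℕ) : ℝ :=
  ((m.divisors.sup (fun d => toNNReal (exp (-(c*|log d - e|)))) : NNReal) : ℝ)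

lemma Dw_nonneg (c e : ℝ) (m : ℕ) : 0 ≤ Dw c e m := NNReal.coe_nonneg _

lemma le_Dw (c e : ℝ) {m d : ℕ} (hm : m ≠ 0) (hd : d ∣ m) : exp (-(c*|log d - e|)) ≤ Dw c e m := by
  unfold Dw
  have := Finset.le_sup (f := fun d : ℕ => toNNReal (exp (-(c*|log d - e|)))) (Nat.mem_divisors.2 ⟨hd, hm⟩)
  have := NNReal.coe_le_coe.2 this
  rwa [coe_toNNReal _ (exp_pos _).le] at this

lemma Dw_attain (c e : ℝ) {m : ℕ} (hm : m ≠ 0) : ∃ d : ℕ, d ∣ m ∧ Dw c e m = exp (-(c*|log d - e|)) := by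
  obtain ⟨d, hd, h⟩ := Finset.exists_mem_eq_sup m.divisors ⟨1, by simp [hm]⟩ (fun d : ℕ => toNNReal (exp (-(c*|log d - e|))))
  refine ⟨d, (Nat.mem_divisors.1 hd).1, ?_⟩
  unfold Dw
  rw [h, coe_toNNReal _ (exp_pos _).le]

lemma WLD {g} (hg : Wt g) {c : ℝ} (hc : 0 < c) : ∃ C : ℝ, 0 ≤ C ∧ ∀ (N : ℕ) (e : ℝ), 2 ≤ N → 0 ≤ e →
    ∑ m ∈ Ioc 0 N, g m / m * Dw c e m ≤ C * log N * Fh e := by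
  obtain ⟨C, hC, H⟩ := WL hg hc
  refine ⟨C, hC, fun N e hN he => H N e _ hN he ?_⟩
  intro m hm _
  obtain ⟨d, h1, h2⟩ := Dw_attain c e (by omega : m ≠ 0)
  exact ⟨d, h1, h2.le⟩

lemma Wt_one : Wt (fun _ => 1) where
  nn := fun _ => by norm_num
  one := rfl
  mul := fun _ _ _ => by norm_num
  pl := fun _ _ => le_rfl
  pu := fun _ _ => by norm_num
  pv := fun p v hp _ => one_le_rpow (by exact_mod_cast hp.one_lt.le) (by positivity)
  sm := ⟨0, le_rfl, fun N => by simp⟩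

lemma E8_sum_step {a h : ℝ} (ha : 0 ≤ a) (hh : 0 ≤ h) :
    (7/8) * h * E8 (a+h) ≤ (1+(a+h))^((7:ℝ)/8) - (1+a)^((7:ℝ)/8) := by
  have hT : 0 < 1 + (a+h) := by linarith
  obtain ⟨T, hTT⟩ : ∃ T, T = 1 + (a+h) := ⟨_, rfl⟩
  unfold E8
  rw [← hTT] at hT ⊢
  have h1 : 1 + a = T * (1 + -(h/T)) := by field_simp; linarith
  have hr : h/T ≤ 1 := by rw [div_le_one hT]; linarith
  have hb := rpow_one_add_le_one_add_mul_self (s := -(h/T)) (by linarith) (p := 7/8) (by norm_num) (by norm_num)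
  have h2 : (1+a)^((7:ℝ)/8) = T^((7:ℝ)/8) * (1 + -(h/T))^((7:ℝ)/8) := by
    rw [h1, mul_rpow hT.le (by linarith)]
  have h3 : T^((7:ℝ)/8) = T^(-(1/8):ℝ) * T := by
    rw [← rpow_add_one hT.ne']; norm_num
  have h4 : 0 < T^((7:ℝ)/8) := by positivity
  rw [h2]
  have h5 := mul_le_mul_of_nonneg_left hb h4.le
  have h6 : T^((7:ℝ)/8) * (7/8 * (h/T)) = (7/8) * h * T^(-(1/8):ℝ) := by
    rw [h3]; field_simp
  nlinarith

lemma E8_sum (x : ℝ) (hx : 1 ≤ x) : ∀ N : ℕ, 1 ≤ N → (N:ℝ) ≤ x →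
    ∑ m ∈ Ioc 0 N, E8 (log (x/m)) / m ≤ 1 + 3 * ((1+log x)^((7:ℝ)/8) - (1+log (x/N))^((7:ℝ)/8)) := by
  intro N hN
  induction N, hN using Nat.le_induction with
  | base =>
    intro _
    simp only [Nat.Ioc_succ_singleton, sum_singleton, Nat.cast_one, div_one, zero_add]
    have := E8_le_one (log_nonneg hx)
    linarith
  | succ n hn ih =>
    intro hnx
    push_cast at hnx
    have hn1 : (1:ℝ) ≤ n := by exact_mod_cast hn
    have ih' := ih (by linarith)
    rw [← Finset.insert_Ioc_right_eq_Ioc_add_one (by omega), sum_insert (by simp)]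
    have e1 : log (x/n) = log (x/(n+1:ℕ)) + (log (n+1:ℕ) - log n) := by
      rw [log_div (by positivity) (by positivity), log_div (by positivity) (by positivity)]; ring
    have ha : 0 ≤ log (x/(n+1:ℕ)) := log_nonneg (by rw [le_div_iff₀ (by positivity)]; push_cast; linarith)
    obtain ⟨a, haa⟩ : ∃ a, a = log (x/(n+1:ℕ)) := ⟨_, rfl⟩
    obtain ⟨h, hh⟩ : ∃ h, h = (log (n+1:ℕ) - log n) := ⟨_, rfl⟩
    have hh1 : 1/((n:ℝ)+1) ≤ h := by
      have := log_le_sub_one_of_pos (x := (n:ℝ)/(n+1)) (by positivity)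
      rw [log_div (by positivity) (by positivity)] at this
      rw [hh]; push_cast
      have e : (n:ℝ)/(n+1) - 1 = -(1/((n:ℝ)+1)) := by field_simp; ring
      linarith
    have hh2 : h ≤ 1 := by
      have := log_le_sub_one_of_pos (x := ((n:ℝ)+1)/n) (by positivity)
      rw [log_div (by positivity) (by positivity)] at this
      rw [hh]; push_cast
      have e : ((n:ℝ)+1)/n - 1 = 1/n := by field_simp; ring
      have : 1/(n:ℝ) ≤ 1 := by rw [div_le_one (by positivity)]; exact hn1
      linarith
    have hh0 : 0 ≤ h := le_trans (by positivity) hh1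
    rw [← haa] at ha
    have s1 := E8_sum_step ha hh0
    have s2 := E8_mul ha hh0
    rw [← hh, ← haa] at e1
    rw [e1] at ih'
    rw [← haa]
    have hE := E8_pos (show 0 ≤ a + h by linarith)
    have s3 : E8 a / ((n+1:ℕ):ℝ) ≤ 2 * h * E8 (a+h) := by
      have : E8 a / ((n+1:ℕ):ℝ) = E8 a * (1/((n:ℝ)+1)) := by push_cast; ring
      rw [this]
      calc E8 a * (1/((n:ℝ)+1)) ≤ (E8 (a+h) * 2) * h := mul_le_mul (by nlinarith) hh1 (by positivity) (by positivity)
        _ = _ := by ring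
    have : 0 ≤ h * E8 (a+h) := by positivity
    linarith

def PU (U : Set ℝ) (m : ℕ) : Prop := ∃ d : ℕ, d ∣ m ∧ log d ∈ U

open Classical in
noncomputable def Bs (U : Set ℝ) (x : ℝ) : ℝ := ∑ m ∈ Ioc 0 ⌊x⌋₊, if PU U m then 1/(m:ℝ) else 0

def US (X a b : ℝ) : Set ℝ := {t | (a < t ∧ t < b) ∨ (X - b < t ∧ t < X - a)}

lemma pairsum (N : ℕ) (F : ℕ → ℕ → ℝ) : ∑ n ∈ Ioc 0 N, ∑ q ∈ n.divisors, F q n = ∑ m ∈ Ioc 0 N, ∑ q ∈ Ioc 0 (N/m), F q (m*q) := by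
  rw [sum_sigma', sum_sigma']
  refine sum_nbij' (fun a => ⟨a.1/a.2, a.2⟩) (fun a => ⟨a.1*a.2, a.2⟩) ?_ ?_ ?_ ?_ ?_
  · rintro ⟨n, q⟩ h
    simp only [mem_sigma, mem_Ioc, Nat.mem_divisors] at h ⊢
    obtain ⟨⟨h1, h2⟩, ⟨k, rfl⟩, h4⟩ := h
    have hq : 0 < q := Nat.pos_of_ne_zero (fun h => by simp [h] at h4)
    have hk : 0 < k := Nat.pos_of_ne_zero (fun h => by simp [h] at h4)
    rw [Nat.mul_div_cancel_left _ hq]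
    refine ⟨⟨hk, ?_⟩, hq, ?_⟩
    · nlinarith
    · rw [Nat.le_div_iff_mul_le hk]; exact h2
  · rintro ⟨m, q⟩ h
    simp only [mem_sigma, mem_Ioc, Nat.mem_divisors] at h ⊢
    obtain ⟨⟨h1, h2⟩, h3, h4⟩ := h
    rw [Nat.le_div_iff_mul_le h1] at h4
    exact ⟨⟨by positivity, by linarith⟩, Dvd.intro_left m rfl, by positivity⟩
  · rintro ⟨n, q⟩ h
    simp only [mem_sigma, mem_Ioc, Nat.mem_divisors] at h ⊢
    simp [Nat.div_mul_cancel h.2.1]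
  · rintro ⟨m, q⟩ h
    simp only [mem_sigma, mem_Ioc] at h ⊢
    simp [Nat.mul_div_cancel _ h.2.1]
  · rintro ⟨n, q⟩ h
    simp only [mem_sigma, mem_Ioc, Nat.mem_divisors] at h ⊢
    simp [Nat.div_mul_cancel h.2.1]

lemma np_part (N : ℕ) : ∑ m ∈ Ioc 0 N, ∑ q ∈ Ioc 0 (N/m), (if q.Prime then 0 else Λ q) ≤ N * Cnp := by
  have : ∑ m ∈ Ioc 0 N, ∑ q ∈ Ioc 0 (N/m), (if q.Prime then 0 else Λ q) = ∑ q ∈ Ioc 0 N, ∑ m ∈ Ioc 0 (N/q), (if q.Prime then 0 else Λ q) := by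
    apply sum_comm'
    intro m q
    simp only [mem_Ioc]
    constructor
    · rintro ⟨⟨h1, h2⟩, h3, h4⟩
      rw [Nat.le_div_iff_mul_le h1] at h4
      refine ⟨⟨h1, ?_⟩, h3, by nlinarith⟩
      rw [Nat.le_div_iff_mul_le h3]; linarith
    · rintro ⟨⟨h1, h2⟩, h3, h4⟩
      rw [Nat.le_div_iff_mul_le h3] at h2
      refine ⟨⟨h1, by nlinarith⟩, h3, ?_⟩
      rw [Nat.le_div_iff_mul_le h1]; linarith
  rw [this]
  refine le_trans ?_ (mul_le_mul_of_nonneg_left (np_sum_le (Ioc 0 N)) (by positivity : (0:ℝ) ≤ N))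
  rw [mul_sum]
  apply sum_le_sum
  intro q _
  rw [sum_const, Nat.card_Ioc, nsmul_eq_mul, Nat.sub_zero]
  have h0 : (0:ℝ) ≤ if q.Prime then 0 else Λ q := by split_ifs; exact le_rfl; exact ArithmeticFunction.vonMangoldt_nonneg
  calc ((N/q:ℕ):ℝ) * _ ≤ ((N:ℝ)/q) * _ := mul_le_mul_of_nonneg_right Nat.cast_div_le h0
    _ = _ := by ring

lemma mismatch1 {x y z : ℝ} (hy : 1 ≤ y) (hyz : y < z) {m p : ℕ} (hm : 1 ≤ m) (hp : p.Prime)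
    (hx : ((m*p:ℕ):ℝ) ≤ x) (h : ¬ ((∃ d : ℕ, d ∣ m*p ∧ y < d ∧ (d:ℝ) < z) ↔ PU (US (log x) (log y) (log z)) m)) :
    ((m*p:ℕ):ℝ) ≤ x * Dw 1 (log x - log z) m ∨ ((m*p:ℕ):ℝ) ≤ x * Dw 1 (log x - log y) m := by
  have hp0 : 0 < p := hp.pos
  have hmp : (0:ℝ) < ((m*p:ℕ):ℝ) := by exact_mod_cast Nat.mul_pos hm hp0
  have hx0 : 0 < x := by linarith
  have hlmp : log ((m*p:ℕ):ℝ) ≤ log x := log_le_log hmp hx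
  have fin : ∀ e : ℝ, ∀ f : ℕ, f ∣ m → |log f - e| ≤ log x - log ((m*p:ℕ):ℝ) → ((m*p:ℕ):ℝ) ≤ x * Dw 1 e m := by
    intro e f hf he
    refine le_trans ?_ (mul_le_mul_of_nonneg_left (le_Dw 1 e (by omega : m ≠ 0) hf) hx0.le)
    rw [one_mul]
    calc ((m*p:ℕ):ℝ) = exp (log x + -(log x - log ((m*p:ℕ):ℝ))) := by
          rw [show log x + -(log x - log ((m*p:ℕ):ℝ)) = log ((m*p:ℕ):ℝ) by ring, exp_log hmp]
      _ = x * exp (-(log x - log ((m*p:ℕ):ℝ))) := by rw [exp_add, exp_log hx0]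
      _ ≤ _ := by gcongr
  have cof : ∀ d f : ℕ, d * f = m * p → log f = log ((m*p:ℕ):ℝ) - log d := by
    intro d f h
    rw [← h] at hmp ⊢
    have hd : d ≠ 0 := by rintro rfl; simp at hmp
    have hf : f ≠ 0 := by rintro rfl; simp at hmp
    push_cast
    rw [log_mul (by exact_mod_cast hd) (by exact_mod_cast hf)]; ring
  by_cases hQ : ∃ d : ℕ, d ∣ m*p ∧ y < d ∧ (d:ℝ) < z
  · have hP : ¬ PU (US (log x) (log y) (log z)) m := fun h' => h ⟨fun _ => h', fun _ => hQ⟩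
    left
    obtain ⟨d, hd, hd1, hd2⟩ := hQ
    have hl1 : log y < log d := log_lt_log (by linarith) hd1
    have hl2 : log d < log z := log_lt_log (by linarith) hd2
    by_cases hdm : d ∣ m
    · exact absurd ⟨d, hdm, Or.inl ⟨hl1, hl2⟩⟩ hP
    · have hpd : p ∣ d := by
        by_contra hpd
        exact hdm (Nat.Coprime.dvd_of_dvd_mul_right ((Nat.Prime.coprime_iff_not_dvd hp).2 hpd).symm hd)
      obtain ⟨d', rfl⟩ := hpd
      have hd' : d' ∣ m := by
        rw [mul_comm m p] at hd
        exact Nat.dvd_of_mul_dvd_mul_left hp0 hd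
      obtain ⟨f, rfl⟩ := hd'
      have hf := cof (p*d') f (by ring)
      apply fin _ f (Dvd.intro_left d' rfl)
      have hnU : ¬ (log x - log z < log f ∧ log f < log x - log y) :=
        fun h => hP ⟨f, Dvd.intro_left d' rfl, Or.inr h⟩
      have : log f ≤ log x - log z := by
        by_contra hc
        push Not at hc
        exact hnU ⟨hc, by linarith⟩
      rw [abs_le]; constructor <;> linarith
  · have hP : PU (US (log x) (log y) (log z)) m := by
      by_contra h'
      exact h ⟨fun a => absurd a hQ, fun a => absurd a h'⟩
    right
    obtain ⟨d, hd, hU⟩ := hP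
    rcases hU with ⟨h1, h2⟩ | ⟨h1, h2⟩
    · exfalso
      apply hQ
      have hd0 : (0:ℝ) < d := by exact_mod_cast Nat.pos_of_dvd_of_pos hd hm
      exact ⟨d, hd.mul_right p, (log_lt_log_iff (by linarith) hd0).1 h1, (log_lt_log_iff hd0 (by linarith)).1 h2⟩
    · apply fin _ d hd
      obtain ⟨k, rfl⟩ := hd
      have hf := cof d (k*p) (by ring)
      have hf0 : (0:ℝ) < ((k*p:ℕ):ℝ) := by
        have : 0 < k := Nat.pos_of_ne_zero (by rintro rfl; simp at hm)
        exact_mod_cast Nat.mul_pos this hp0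
      have : log ((k*p:ℕ):ℝ) ≤ log y := by
        by_contra hc
        push Not at hc
        apply hQ
        exact ⟨k*p, ⟨d, by ring⟩, (log_lt_log_iff (by linarith) hf0).1 hc, (log_lt_log_iff hf0 (by linarith)).1 (by linarith)⟩
      rw [abs_le]; constructor <;> linarith

lemma cheb_le {m N : ℕ} (hm : 1 ≤ m) (t : ℝ) (ht : 0 ≤ t) :
    ∑ q ∈ Ioc 0 N, (if ((m*q:ℕ):ℝ) ≤ t then Λ q else 0) ≤ (log 4 + 4) * (t / m) := by
  have hm0 : (0:ℝ) < m := by exact_mod_cast hm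
  refine le_trans ?_ (Chebyshev.psi_le_const_mul_self (x := t/m) (by positivity))
  unfold Chebyshev.psi
  rw [← sum_filter]
  apply Finset.sum_le_sum_of_subset_of_nonneg
  · intro q hq
    simp only [mem_filter, mem_Ioc] at hq ⊢
    refine ⟨hq.1.1, Nat.le_floor ?_⟩
    rw [le_div_iff₀ hm0]
    have := hq.2
    push_cast at this
    linarith
  · intros; exact ArithmeticFunction.vonMangoldt_nonneg

lemma sum_log_le {x : ℝ} (hx : 2 ≤ x) : ∑ n ∈ Ioc 0 ⌊x⌋₊, (log x - log n) ≤ 3 * x := by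
  obtain ⟨N, hNN⟩ : ∃ N, N = ⌊x⌋₊ := ⟨_, rfl⟩
  rw [← hNN]
  have hN : 1 ≤ N := by rw [hNN]; exact Nat.le_floor (by push_cast; linarith)
  have hNx : (N:ℝ) ≤ x := by rw [hNN]; exact Nat.floor_le (by linarith)
  have hxN : x < N + 1 := by rw [hNN]; exact Nat.lt_floor_add_one x
  have hN1 : (1:ℝ) ≤ N := by exact_mod_cast hN
  have h1 := TN_bound2 N hN
  have h2 : ∑ n ∈ Ioc 0 N, log n = ∑ k ∈ range N, log k + log N := by
    clear * -
    induction N with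
    | zero => simp
    | succ n ih => rw [← Finset.insert_Ioc_right_eq_Ioc_add_one (by omega), sum_insert (by simp), ih, sum_range_succ]; ring
  rw [sum_sub_distrib, sum_const, Nat.card_Ioc, nsmul_eq_mul, h2]
  have h3 := (abs_le.1 h1).2
  have h4 : N * (log x - log N) ≤ 1 := by
    have := log_le_sub_one_of_pos (x := x/N) (by positivity)
    rw [log_div (by positivity) (by positivity)] at this
    have h5 : x/N - 1 ≤ 1/N := by rw [div_sub_one (by positivity)]; gcongr; linarith
    calc N * (log x - log N) ≤ N * (1/N) := by gcongr; linarith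
      _ = 1 := by field_simp
  push_cast
  simp only [Nat.sub_zero]
  linarith

open Classical in
lemma Hcnt_eq {x : ℝ} (hx : 0 ≤ x) (y z : ℝ) : (Hcnt x y z : ℝ) = ∑ n ∈ Ioc 0 ⌊x⌋₊, if (∃ d : ℕ, d ∣ n ∧ y < (d:ℝ) ∧ (d:ℝ) < z) then (1:ℝ) else 0 := by
  rw [← sum_filter, sum_const, nsmul_eq_mul, mul_one]
  congr 1
  unfold Hcnt
  rw [← Set.ncard_coe_finset]
  congr 1
  ext n
  simp only [Set.mem_setOf_eq, coe_filter, mem_Ioc, Nat.le_floor_iff hx]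
  constructor
  · rintro ⟨h1, h2, h3⟩; exact ⟨⟨h1, h2⟩, h3⟩
  · rintro ⟨⟨h1, h2⟩, h3⟩; exact ⟨h1, h2, h3⟩

theorem S1 : ∃ C : ℝ, 0 ≤ C ∧ ∀ x y z : ℝ, 2 ≤ x → 1 ≤ y → y < z → z ≤ x →
    |(Hcnt x y z : ℝ) * log x - x * Bs (US (log x) (log y) (log z)) x| ≤
      C * x * (log x * (Fh (log x - log z) + Fh (log x - log y)) + (1 + log x)^((7:ℝ)/8)) := by
  classical
  obtain ⟨C1, h1, H1⟩ := WLD Wt_one (c := 1) (by norm_num)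
  obtain ⟨C2, h2, H2⟩ := psi_bound
  have hC4 : 0 ≤ log 4 + 4 := by have := log_nonneg (by norm_num : (1:ℝ) ≤ 4); linarith
  obtain ⟨C4, hC4e⟩ : ∃ C4, C4 = log 4 + 4 := ⟨_, rfl⟩
  rw [← hC4e] at hC4
  have hnp := Cnp_nonneg
  refine ⟨3 + Cnp + C4*C1 + 4*C2, by positivity, fun x y z hx hy hyz hzx => ?_⟩
  obtain ⟨N, hNN⟩ : ∃ N, N = ⌊x⌋₊ := ⟨_, rfl⟩
  have hN : 2 ≤ N := by rw [hNN]; exact Nat.le_floor (by push_cast; linarith)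
  have hNx : (N:ℝ) ≤ x := by rw [hNN]; exact Nat.floor_le (by linarith)
  have hN1 : (2:ℝ) ≤ N := by exact_mod_cast hN
  have hX : 0 ≤ log x := log_nonneg (by linarith)
  have hzX : log z ≤ log x := log_le_log (by linarith) hzx
  have hyX : log y ≤ log z := log_le_log (by linarith) hyz.le
  obtain ⟨e1, he1⟩ : ∃ e, e = log x - log z := ⟨_, rfl⟩
  obtain ⟨e2, he2⟩ : ∃ e, e = log x - log y := ⟨_, rfl⟩
  have he10 : 0 ≤ e1 := by linarith
  have he20 : 0 ≤ e2 := by linarith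
  obtain ⟨Q, hQ⟩ : ∃ Q : ℕ → Prop, Q = fun n => ∃ d : ℕ, d ∣ n ∧ y < (d:ℝ) ∧ (d:ℝ) < z := ⟨_, rfl⟩
  obtain ⟨P, hP⟩ : ∃ P : ℕ → Prop, P = PU (US (log x) (log y) (log z)) := ⟨_, rfl⟩
  have hH : (Hcnt x y z : ℝ) = ∑ n ∈ Ioc 0 N, if Q n then (1:ℝ) else 0 := by
    rw [Hcnt_eq (by linarith), hQ, hNN]
  have hB : Bs (US (log x) (log y) (log z)) x = ∑ m ∈ Ioc 0 N, if P m then 1/(m:ℝ) else 0 := by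
    unfold Bs; rw [← hP, ← hNN]
  rw [hH, hB, ← he1, ← he2]
  obtain ⟨T, hT⟩ : ∃ T, T = ∑ n ∈ Ioc 0 N, if Q n then log n else 0 := ⟨_, rfl⟩
  obtain ⟨T', hT'⟩ : ∃ T', T' = ∑ m ∈ Ioc 0 N, if P m then psi (N/m) else 0 := ⟨_, rfl⟩
  -- (a)
  have ha : |(∑ n ∈ Ioc 0 N, if Q n then (1:ℝ) else 0) * log x - T| ≤ 3 * x := by
    rw [hT, sum_mul, ← sum_sub_distrib]
    have hs := sum_log_le hx
    rw [← hNN] at hs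
    refine (abs_sum_le_sum_abs _ _).trans (le_trans (sum_le_sum fun n hn => ?_) hs)
    rw [mem_Ioc] at hn
    have : log n ≤ log x := log_le_log (by exact_mod_cast hn.1) (le_trans (by exact_mod_cast hn.2) hNx)
    split_ifs
    · rw [one_mul, abs_of_nonneg (by linarith)]
    · simp; linarith
  -- (b)
  have hTe : T = ∑ m ∈ Ioc 0 N, ∑ q ∈ Ioc 0 (N/m), if Q (m*q) then Λ q else 0 := by
    rw [← pairsum N (fun q n => if Q n then Λ q else 0), hT]
    apply sum_congr rfl
    intro n _
    split_ifs
    · exact ArithmeticFunction.vonMangoldt_sum.symm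
    · simp
  have hT'e : T' = ∑ m ∈ Ioc 0 N, ∑ q ∈ Ioc 0 (N/m), if P m then Λ q else 0 := by
    rw [hT']
    apply sum_congr rfl
    intro m _
    unfold psi
    split_ifs <;> simp
  have hb : |T - T'| ≤ x * Cnp + C4 * x * (C1 * log x * Fh e1) + C4 * x * (C1 * log x * Fh e2) := by
    have hterm : ∀ m ∈ Ioc 0 N, ∀ q ∈ Ioc 0 (N/m), |(if Q (m*q) then Λ q else 0) - (if P m then Λ q else 0)| ≤
        (if q.Prime then 0 else Λ q) + (if ((m*q:ℕ):ℝ) ≤ x * Dw 1 e1 m then Λ q else 0) + (if ((m*q:ℕ):ℝ) ≤ x * Dw 1 e2 m then Λ q else 0) := by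
      intro m hm q hq
      rw [mem_Ioc] at hm hq
      have hL : 0 ≤ Λ q := ArithmeticFunction.vonMangoldt_nonneg
      have hA : 0 ≤ (if ((m*q:ℕ):ℝ) ≤ x * Dw 1 e1 m then Λ q else 0) := by split_ifs <;> simp [hL]
      have hB : 0 ≤ (if ((m*q:ℕ):ℝ) ≤ x * Dw 1 e2 m then Λ q else 0) := by split_ifs <;> simp [hL]
      have hA' : 0 ≤ (if q.Prime then 0 else Λ q) := by split_ifs <;> simp [hL]
      by_cases hiff : Q (m*q) ↔ P m
      · simp only [hiff, sub_self, abs_zero]; linarith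
      · have hle : |(if Q (m*q) then Λ q else 0) - (if P m then Λ q else 0)| ≤ Λ q := by
          split_ifs <;> simp [abs_of_nonneg hL, hL]
        by_cases hp : q.Prime
        · have hmqN : m*q ≤ N := by
            have := hq.2; rw [Nat.le_div_iff_mul_le hm.1] at this; linarith
          have hmq : ((m*q:ℕ):ℝ) ≤ x := le_trans (by exact_mod_cast hmqN) hNx
          rw [hQ, hP] at hiff
          have := mismatch1 hy hyz hm.1 hp hmq hiff
          rw [← he1, ← he2] at this
          rcases this with h | h
          · rw [if_pos h]; linarith
          · rw [if_pos h]; linarith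
        · rw [if_neg hp]; linarith
    rw [hTe, hT'e, ← sum_sub_distrib]
    have hDsum : ∀ e : ℝ, 0 ≤ e → ∑ m ∈ Ioc 0 N, ∑ q ∈ Ioc 0 (N/m), (if ((m*q:ℕ):ℝ) ≤ x * Dw 1 e m then Λ q else 0) ≤ C4 * x * (C1 * log x * Fh e) := by
      intro e he
      calc _ ≤ ∑ m ∈ Ioc 0 N, C4 * ((x * Dw 1 e m)/m) := by
            apply sum_le_sum
            intro m hm
            rw [hC4e]
            exact cheb_le (mem_Ioc.1 hm).1 _ (mul_nonneg (by linarith) (Dw_nonneg _ _ _))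
        _ = C4 * x * ∑ m ∈ Ioc 0 N, 1 / (m:ℝ) * Dw 1 e m := by
            rw [mul_sum]; apply sum_congr rfl; intro m _; ring
        _ ≤ C4 * x * (C1 * log N * Fh e) := by
            gcongr; exact H1 N e hN he
        _ ≤ _ := by
            have := (Fh_pos he).le
            gcongr
    calc _ ≤ ∑ m ∈ Ioc 0 N, ∑ q ∈ Ioc 0 (N/m), ((if q.Prime then 0 else Λ q) + (if ((m*q:ℕ):ℝ) ≤ x * Dw 1 e1 m then Λ q else 0) + (if ((m*q:ℕ):ℝ) ≤ x * Dw 1 e2 m then Λ q else 0)) := by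
          refine (abs_sum_le_sum_abs _ _).trans (sum_le_sum fun m hm => ?_)
          rw [← sum_sub_distrib]
          exact (abs_sum_le_sum_abs _ _).trans (sum_le_sum (hterm m hm))
      _ ≤ _ := by
          simp only [sum_add_distrib]
          have := np_part N
          have : N * Cnp ≤ x * Cnp := by gcongr
          have := hDsum e1 he10
          have := hDsum e2 he20
          linarith
  -- (c)
  have hc : |T' - x * ∑ m ∈ Ioc 0 N, (if P m then 1/(m:ℝ) else 0)| ≤ C2 * x * (1 + 3 * (1 + log x)^((7:ℝ)/8)) := by
    rw [hT', mul_sum, ← sum_sub_distrib]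
    calc _ ≤ ∑ m ∈ Ioc 0 N, C2 * x * (E8 (log (x/m)) / m) := by
          refine (abs_sum_le_sum_abs _ _).trans (sum_le_sum fun m hm => ?_)
          rw [mem_Ioc] at hm
          have hm0 : (0:ℝ) < m := by exact_mod_cast hm.1
          have hmx : (m:ℝ) ≤ x := le_trans (by exact_mod_cast hm.2) hNx
          have hxm : 1 ≤ x / m := by rw [le_div_iff₀ hm0]; linarith
          have hE := E8_pos (log_nonneg hxm)
          split_ifs
          · have := H2 (x/m) hxm
            rw [Nat.floor_div_natCast, ← hNN] at this
            rw [mul_one_div]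
            calc _ ≤ _ := this
              _ = _ := by ring
          · simp; positivity
      _ = C2 * x * ∑ m ∈ Ioc 0 N, E8 (log (x/m)) / m := by rw [mul_sum]
      _ ≤ _ := by
          have := E8_sum x (by linarith) N (by omega) hNx
          have h0 : 0 ≤ (1+log (x/N))^((7:ℝ)/8) := by
            have : 0 ≤ log (x/N) := log_nonneg (by rw [le_div_iff₀ (by linarith)]; linarith)
            positivity
          apply mul_le_mul_of_nonneg_left _ (by positivity)
          linarith
  obtain ⟨G, hG⟩ : ∃ G, G = (1 + log x)^((7:ℝ)/8) := ⟨_, rfl⟩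
  have hG1 : 1 ≤ G := by rw [hG]; exact one_le_rpow (by linarith) (by norm_num)
  rw [← hG] at hc ⊢
  have tri : ∀ a b c d : ℝ, |a - d| ≤ |a - b| + |b - c| + |c - d| := by
    intro a b c d
    have := abs_sub_le a b d
    have := abs_sub_le b c d
    linarith
  refine (tri _ T T' _).trans ((add_le_add (add_le_add ha hb) hc).trans ?_)
  have hF1 := Fh_pos he10
  have hF2 := Fh_pos he20
  obtain ⟨s, hs⟩ : ∃ s, s = log x * (Fh e1 + Fh e2) := ⟨_, rfl⟩
  have hs0 : 0 ≤ s := by rw [hs]; positivity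
  have hx0 : 0 ≤ x := by linarith
  rw [← hs]
  have expand : x * Cnp + C4 * x * (C1 * log x * Fh e1) + C4 * x * (C1 * log x * Fh e2) = x * Cnp + C4 * C1 * x * s := by rw [hs]; ring
  rw [expand]
  have k1 : x * 1 ≤ x * G := by gcongr
  have k2 : 0 ≤ x * s := by positivity
  have k3 : Cnp * x * 1 ≤ Cnp * x * G := by gcongr
  have k4 : C2 * x * 1 ≤ C2 * x * G := by gcongr
  have k5 : 0 ≤ C4 * C1 * x * G := by positivity
  have k6 : 0 ≤ Cnp * (x * s) := by positivity
  have k7 : 0 ≤ C2 * (x * s) := by positivity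
  nlinarith

theorem tsum_pi_prod {ι : Type*} [Fintype ι] (f : ι → ℕ → ℝ≥0∞) :
    ∑' c : ι → ℕ, ∏ a, f a (c a) = ∏ a, ∑' k, f a k := by
  classical
  revert f
  refine Fintype.induction_empty_option (P := fun ι _ => ∀ f : ι → ℕ → ℝ≥0∞, ∑' c : ι → ℕ, ∏ a, f a (c a) = ∏ a, ∑' k, f a k) ?_ ?_ ?_ ι
  · intro α β _ e h f
    let _ := Fintype.ofEquiv β e.symm
    have := h (fun a => f (e a))
    rw [← Equiv.prod_comp e (fun b => ∑' k, f b k), ← (Equiv.arrowCongr e (Equiv.refl ℕ)).tsum_eq]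
    convert this using 2 with c
    funext c
    rw [← Equiv.prod_comp e]
    · apply prod_congr
      · congr!
      · intro a _
        simp
  · intro f
    rw [tsum_eq_single (fun a => a.elim)]
    · simp
    · intro c hc; exact absurd (funext (fun a => a.elim)) hc
  · intro α _ h f
    rw [← (Equiv.piOptionEquivProd (β := fun _ : Option α => ℕ)).symm.tsum_eq, Fintype.prod_option, ← h, ENNReal.tsum_prod']
    rw [← ENNReal.tsum_mul_right]
    congr 1; funext k
    rw [← ENNReal.tsum_mul_left]
    congr 1; funext c
    rw [Fintype.prod_option]
    simp [Equiv.piOptionEquivProd]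

lemma tsum_exp (w : ℝ≥0∞) (hw : w ≠ ∞) : ∑' k : ℕ, w^k / (k.factorial : ℝ≥0∞) = ENNReal.ofReal (exp w.toReal) := by
  have h : ∀ k : ℕ, w^k / (k.factorial : ℝ≥0∞) = ENNReal.ofReal (w.toReal^k / k.factorial) := by
    intro k
    rw [ENNReal.ofReal_div_of_pos (by positivity), ENNReal.ofReal_pow (by positivity), ENNReal.ofReal_toReal hw, ENNReal.ofReal_natCast]
  simp_rw [h]
  rw [← ENNReal.ofReal_tsum_of_nonneg (fun k => by positivity) (summable_pow_div_factorial _), exp_eq_exp_ℝ, NormedSpace.exp_eq_tsum_div]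

section
variable {ι : Type*} [Fintype ι] [DecidableEq ι]

def np (α : ι → ℕ) (c : ι → ℕ) : ℕ := ∏ a, α a ^ c a

open Classical in
noncomputable def EE (w : ι → ℝ≥0∞) (α : ι → ℕ) (n : ℕ) : ℝ≥0∞ := ∑' c, pois w c * (if np α c = n then 1 else 0)

lemma np_pos {α : ι → ℕ} (h : ∀ a, 1 ≤ α a) (c : ι → ℕ) : 1 ≤ np α c :=
  Nat.one_le_iff_ne_zero.2 (prod_ne_zero_iff.2 fun a _ => pow_ne_zero _ (by have := h a; omega))

lemma np_bump (α : ι → ℕ) (a : ι) (c : ι → ℕ) : np α (bump a c) = α a * np α c := by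
  unfold np
  rw [← mul_prod_erase univ _ (mem_univ a), ← mul_prod_erase univ (fun b => α b ^ c b) (mem_univ a)]
  have : ∏ x ∈ univ.erase a, α x ^ bump a c x = ∏ x ∈ univ.erase a, α x ^ c x := by
    apply prod_congr rfl
    intro b hb
    simp [bump, ne_of_mem_erase hb]
  rw [this]
  simp only [bump, Function.update_self, pow_succ]
  ring

lemma np_log {α : ι → ℕ} (h : ∀ a, 1 ≤ α a) (c : ι → ℕ) : log (np α c) = ∑ a, c a * log (α a) := by
  unfold np
  push_cast
  rw [log_prod]
  · simp
  · intro a _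
    have := h a
    positivity

/-- sums over count vectors through the value -/
lemma tsum_np (w : ι → ℝ≥0∞) (α : ι → ℕ) (Φ : ℕ → ℝ≥0∞) :
    ∑' c, pois w c * Φ (np α c) = ∑' n, Φ n * EE w α n := by
  classical
  unfold EE
  simp_rw [← ENNReal.tsum_mul_left]
  rw [ENNReal.tsum_comm]
  congr 1; funext c
  rw [tsum_eq_single (np α c)]
  · simp [mul_comm]
  · intro n hn
    simp [hn.symm]

lemma EE_rec (w : ι → ℝ≥0∞) {α : ι → ℕ} (h : ∀ a, 1 ≤ α a) (n : ℕ) (hn : 1 ≤ n) :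
    ENNReal.ofReal (log n) * EE w α n = ∑ i ∈ n.divisors, ENNReal.ofReal (log i) * (∑ a with α a = i, w a) * EE w α (n/i) := by
  classical
  have h1 : ENNReal.ofReal (log n) * EE w α n = ∑ a, ENNReal.ofReal (log (α a)) * ∑' c, (c a : ℝ≥0∞) * (pois w c * (if np α c = n then 1 else 0)) := by
    unfold EE
    simp_rw [← ENNReal.tsum_mul_left]
    rw [← Summable.tsum_finsetSum (fun _ _ => ENNReal.summable)]
    congr 1; funext c
    by_cases hc : np α c = n
    · simp only [hc, if_true, mul_one]
      rw [← hc, np_log h, ENNReal.ofReal_sum_of_nonneg (fun a _ => mul_nonneg (by positivity) (log_natCast_nonneg _)), sum_mul]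
      apply sum_congr rfl
      intro a _
      rw [ENNReal.ofReal_mul (by positivity), ENNReal.ofReal_natCast]
      ring
    · simp [hc]
  have h2 : ∀ a, ∑' c, (c a : ℝ≥0∞) * (pois w c * (if np α c = n then 1 else 0)) = w a * (if α a ∣ n then EE w α (n/α a) else 0) := by
    intro a
    rw [mecke w a (fun c => if np α c = n then 1 else 0)]
    congr 1
    have hα := h a
    by_cases hd : α a ∣ n
    · rw [if_pos hd]
      obtain ⟨k, rfl⟩ := hd
      rw [Nat.mul_div_cancel_left _ hα]
      unfold EE
      congr 1; funext c
      rw [np_bump]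
      have : α a * np α c = α a * k ↔ np α c = k := Nat.mul_right_inj (by omega)
      simp [this]
    · rw [if_neg hd]
      have : ∀ c, np α (bump a c) ≠ n := by
        intro c hc; rw [np_bump] at hc; exact hd ⟨_, hc.symm⟩
      simp [this]
  rw [h1]
  simp_rw [h2]
  have h3 : ∀ a, ENNReal.ofReal (log (α a)) * (w a * (if α a ∣ n then EE w α (n/α a) else 0)) =
      ∑ i ∈ n.divisors, if α a = i then ENNReal.ofReal (log i) * w a * EE w α (n/i) else 0 := by
    intro a
    by_cases hd : α a ∣ n
    · rw [if_pos hd, sum_ite_eq, if_pos (Nat.mem_divisors.2 ⟨hd, by omega⟩), mul_assoc]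
    · rw [if_neg hd, sum_ite_eq, if_neg (fun hh => hd (Nat.mem_divisors.1 hh).1)]; simp
  rw [sum_congr rfl (fun a _ => h3 a), sum_comm]
  apply sum_congr rfl
  intro i _
  rw [← sum_filter, mul_sum, sum_mul]

lemma EE_one (w : ι → ℝ≥0∞) {α : ι → ℕ} (h : ∀ a, 1 ≤ α a) (hw : ∀ a, w a ≠ ∞) :
    EE w α 1 = ENNReal.ofReal (exp (∑ a with α a = 1, (w a).toReal)) := by
  classical
  have h1 : ∀ c, pois w c * (if np α c = 1 then 1 else 0) = ∏ a, (w a ^ c a / ((c a).factorial : ℝ≥0∞) * (if α a ^ c a = 1 then 1 else 0)) := by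
    intro c
    rw [prod_mul_distrib]
    unfold pois
    congr 1
    rw [Finset.prod_ite_zero]
    simp only [mem_univ, forall_const, prod_const_one]
    congr 1
    unfold np
    rw [Finset.prod_eq_one_iff]
    simp
  unfold EE
  simp_rw [h1]
  rw [tsum_pi_prod (fun a k => w a ^ k / (k.factorial : ℝ≥0∞) * (if α a ^ k = 1 then 1 else 0))]
  rw [exp_sum, ENNReal.ofReal_prod_of_nonneg (fun _ _ => by positivity), prod_filter]
  apply prod_congr rfl
  intro a _
  by_cases ha : α a = 1
  · simp only [ha, one_pow, if_true, mul_one]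
    exact tsum_exp _ (hw a)
  · rw [if_neg ha, tsum_eq_single 0]
    · simp
    · intro k hk
      have : α a ^ k ≠ 1 := by
        have := h a
        exact (Nat.one_lt_pow hk (by omega)).ne'
      rw [if_neg this, mul_zero]

theorem EE_le (w : ι → ℝ≥0∞) {α : ι → ℕ} (h : ∀ a, 1 ≤ α a) (κ : ℕ → ℝ) (B : ℝ) (hB : 0 ≤ B) (κ1 : κ 1 = 1) (κp : ∀ n, 0 ≤ κ n)
    (κm : ∀ m n, κ (m*n) = κ m * κ n)
    (hw : ∀ i, 2 ≤ i → ∑ a with α a = i, w a ≤ ENNReal.ofReal (Λ i / (i * log i) * κ i))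
    (h1 : EE w α 1 ≤ ENNReal.ofReal B) (n : ℕ) (hn : 1 ≤ n) : EE w α n ≤ ENNReal.ofReal (B * (κ n / n)) := by
  induction n using Nat.strong_induction_on with
  | _ n ih =>
  by_cases hn1 : n = 1
  · subst hn1; simpa [κ1] using h1
  have hln : 0 < log n := log_pos (by exact_mod_cast (by omega : 1 < n))
  have hn0 : (0:ℝ) < n := by exact_mod_cast hn
  have key : ENNReal.ofReal (log n) * EE w α n ≤ ENNReal.ofReal (log n) * ENNReal.ofReal (B * (κ n / n)) := by
    rw [EE_rec w h n hn, ← ENNReal.ofReal_mul hln.le]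
    calc _ ≤ ∑ i ∈ n.divisors, ENNReal.ofReal (Λ i * (B * (κ n / n))) := by
          apply sum_le_sum
          intro i hi
          rw [Nat.mem_divisors] at hi
          obtain ⟨⟨k, rfl⟩, hne⟩ := hi
          have hi0 : i ≠ 0 := by rintro rfl; simp at hne
          have hk0 : k ≠ 0 := by rintro rfl; simp at hne
          by_cases hi1 : i = 1
          · subst hi1; simp
          have hli : 0 < log i := log_pos (by exact_mod_cast (by omega : 1 < i))
          rw [Nat.mul_div_cancel_left _ (by omega)]
          have hk : k < i * k := by
            have : 1 * k < i * k := Nat.mul_lt_mul_of_pos_right (by omega) (by omega)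
            omega
          calc _ ≤ ENNReal.ofReal (log i) * ENNReal.ofReal (Λ i / (i * log i) * κ i) * ENNReal.ofReal (B * (κ k / k)) :=
                mul_le_mul' (mul_le_mul' le_rfl (hw i (by omega))) (ih k hk (by omega))
            _ = _ := by
                have hL : 0 ≤ Λ i := ArithmeticFunction.vonMangoldt_nonneg
                have := κp i
                have := κp k
                rw [← ENNReal.ofReal_mul hli.le, ← ENNReal.ofReal_mul (by positivity), κm]
                congr 1
                push_cast
                have : (i:ℝ) ≠ 0 := by exact_mod_cast hi0
                have : (k:ℝ) ≠ 0 := by exact_mod_cast hk0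
                field_simp
      _ = _ := by
          have := κp n
          rw [← ENNReal.ofReal_sum_of_nonneg (fun i _ => mul_nonneg ArithmeticFunction.vonMangoldt_nonneg (by positivity)), ← sum_mul, ArithmeticFunction.vonMangoldt_sum]
  exact (ENNReal.mul_le_mul_iff_right (by simpa using hln) ENNReal.ofReal_ne_top).1 key

theorem EE_eq (w : ι → ℝ≥0∞) {α : ι → ℕ} (h : ∀ a, 1 ≤ α a) (B : ℝ) (hB : 0 ≤ B) (R : ℕ)
    (hw : ∀ i, 2 ≤ i → i ≤ R → ∑ a with α a = i, w a = ENNReal.ofReal (Λ i / (i * log i)))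
    (h1 : EE w α 1 = ENNReal.ofReal B) (n : ℕ) (hn : 1 ≤ n) (hR : n ≤ R) : EE w α n = ENNReal.ofReal (B * (1 / n)) := by
  induction n using Nat.strong_induction_on with
  | _ n ih =>
  by_cases hn1 : n = 1
  · subst hn1; simpa using h1
  have hln : 0 < log n := log_pos (by exact_mod_cast (by omega : 1 < n))
  have hn0 : (0:ℝ) < n := by exact_mod_cast hn
  have key : ENNReal.ofReal (log n) * EE w α n = ENNReal.ofReal (log n) * ENNReal.ofReal (B * (1 / n)) := by
    rw [EE_rec w h n hn, ← ENNReal.ofReal_mul hln.le]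
    calc _ = ∑ i ∈ n.divisors, ENNReal.ofReal (Λ i * (B * (1 / n))) := by
          apply sum_congr rfl
          intro i hi
          rw [Nat.mem_divisors] at hi
          obtain ⟨⟨k, rfl⟩, hne⟩ := hi
          have hi0 : i ≠ 0 := by rintro rfl; simp at hne
          have hk0 : k ≠ 0 := by rintro rfl; simp at hne
          by_cases hi1 : i = 1
          · subst hi1; simp
          have hli : 0 < log i := log_pos (by exact_mod_cast (by omega : 1 < i))
          rw [Nat.mul_div_cancel_left _ (by omega)]
          have hk : k < i * k := by
            have : 1 * k < i * k := Nat.mul_lt_mul_of_pos_right (by omega) (by omega)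
            omega
          have hik : i ≤ i * k := Nat.le_mul_of_pos_right i (by omega)
          rw [hw i (by omega) (by omega), ih k hk (by omega) (by omega)]
          have hL : 0 ≤ Λ i := ArithmeticFunction.vonMangoldt_nonneg
          rw [← ENNReal.ofReal_mul hli.le, ← ENNReal.ofReal_mul (by positivity)]
          congr 1
          push_cast
          have : (i:ℝ) ≠ 0 := by exact_mod_cast hi0
          have : (k:ℝ) ≠ 0 := by exact_mod_cast hk0
          field_simp
      _ = _ := by
          rw [← ENNReal.ofReal_sum_of_nonneg (fun i _ => mul_nonneg ArithmeticFunction.vonMangoldt_nonneg (by positivity)), ← sum_mul, ArithmeticFunction.vonMangoldt_sum]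
  exact (ENNReal.mul_right_inj (by simpa using hln) ENNReal.ofReal_ne_top).1 key
end

lemma Mm_succ (n : ℕ) : Mm (n+1) = Mm n + Λ (n+1) / ((n+1:ℕ) * log (n+1:ℕ)) := by
  unfold Mm
  rw [← Finset.insert_Ioc_right_eq_Ioc_add_one (by omega), sum_insert (by simp)]; ring

lemma Mm_mono : Monotone Mm := by
  apply monotone_nat_of_le_succ
  intro n
  rw [Mm_succ]
  have : 0 ≤ Λ (n+1) / ((n+1:ℕ) * log (n+1:ℕ)) :=
    div_nonneg ArithmeticFunction.vonMangoldt_nonneg (mul_nonneg (by positivity) (log_natCast_nonneg _))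
  linarith

lemma Mm_zero : Mm 0 = 0 := by simp [Mm]
lemma Mm_one : Mm 1 = 0 := by simp [Mm]

lemma Mm_unbdd (B : ℝ) : ∃ N : ℕ, B ≤ Mm N := by
  obtain ⟨C, hC, H⟩ := Mm_bound
  have h1 : Tendsto (fun N : ℕ => log (log N)) atTop atTop :=
    tendsto_log_atTop.comp (tendsto_log_atTop.comp tendsto_natCast_atTop_atTop)
  obtain ⟨N, hN1, hN2⟩ := ((h1.eventually_ge_atTop (B+C)).and (eventually_ge_atTop 2)).exists
  refine ⟨N, ?_⟩
  have := (abs_le.1 (H N hN2)).1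
  linarith

noncomputable def ep (t : ℝ) : ℝ := E8 t / t

lemma ep_pos {t : ℝ} (ht : 0 < t) : 0 < ep t := div_pos (E8_pos ht.le) ht
lemma ep_anti {s t : ℝ} (hs : 0 < s) (h : s ≤ t) : ep t ≤ ep s :=
  div_le_div₀ (E8_pos hs.le).le (E8_anti hs.le h) hs h

lemma ep_two {t : ℝ} (ht : log 2 ≤ t) : ep t ≤ 2 := by
  have h2 := log_two_gt_d9
  have h0 : 0 < t := by linarith
  unfold ep
  rw [div_le_iff₀ h0]
  have := E8_le_one h0.le
  linarith

lemma ep_scale {t q : ℝ} (ht : 0 < t) (hq : 1 ≤ q) : ep (t/q) ≤ q^2 * ep t := by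
  have hq0 : 0 < q := by linarith
  unfold ep
  have h1 : E8 (t/q) ≤ q * E8 t := by
    unfold E8
    have h2 : (1+t)/q ≤ 1 + t/q := by
      rw [add_div]; gcongr
      rw [div_le_one hq0]; exact hq
    calc (1+t/q)^(-(1/8):ℝ) ≤ ((1+t)/q)^(-(1/8):ℝ) := rpow_le_rpow_of_nonpos (by positivity) h2 (by norm_num)
      _ = q^((1/8):ℝ) * (1+t)^(-(1/8):ℝ) := by
          rw [div_rpow (by positivity) (by positivity), rpow_neg hq0.le, div_inv_eq_mul]; ring
      _ ≤ q^(1:ℝ) * (1+t)^(-(1/8):ℝ) := by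
          exact mul_le_mul_of_nonneg_right (rpow_le_rpow_of_exponent_le hq (by norm_num)) (by positivity)
      _ = _ := by rw [rpow_one]
  calc E8 (t/q) / (t/q) ≤ (q * E8 t) / (t/q) := by gcongr
    _ = _ := by field_simp

lemma abs_sub_le_log {a b D q : ℝ} (ha : 0 < a) (hb : 0 < b) (hq : 1 ≤ q) (hbq : b ≤ a * q) (h : |log a - log b| ≤ D) :
    |a - b| ≤ a * q * D := by
  have hD := (abs_nonneg _).trans h
  rw [abs_le] at h ⊢
  have h1 := log_le_sub_one_of_pos (div_pos hb ha)
  have h2 := log_le_sub_one_of_pos (div_pos ha hb)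
  rw [log_div hb.ne' ha.ne'] at h1
  rw [log_div ha.ne' hb.ne'] at h2
  have e1 : a - b ≤ a * D := by
    have : 1 - D ≤ b / a := by linarith
    rw [le_div_iff₀ ha] at this; linarith
  have e2 : b - a ≤ b * D := by
    have : 1 - D ≤ a / b := by linarith
    rw [le_div_iff₀ hb] at this; linarith
  have e3 : b * D ≤ a * q * D := by gcongr
  have e4 : a * D ≤ a * q * D := by
    have : a ≤ a * q := by nlinarith
    gcongr
  constructor <;> linarith

/-- two-sided approximation of `Mm` near `n` -/
lemma Mm_near : ∃ M0 K : ℝ, 0 < K ∧ ∀ n : ℕ, 1 ≤ n →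
    |Mm (n+1) - log (log (n+1:ℕ)) - M0| ≤ K * ep (log (n+1:ℕ)) ∧
    |Mm n - log (log (n+1:ℕ)) - M0| ≤ K * ep (log (n+1:ℕ)) := by
  obtain ⟨M0, C, hC, H⟩ := Dm_lim
  refine ⟨M0, C + 4, by positivity, fun n hn => ?_⟩
  have h1 := H (n+1) (by omega)
  have hl : 0 < log (n+1:ℕ) := log_pos (by exact_mod_cast (by omega : 1 < n+1))
  have hE := ep_pos hl
  change |Dm (n+1) - M0| ≤ C * ep (log (n+1:ℕ)) at h1
  unfold Dm at h1
  have h2 := logE8 (N := n+1) (by omega)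
  have h3 : Λ (n+1) / ((n+1:ℕ) * log (n+1:ℕ)) ≤ 4 * ep (log (n+1:ℕ)) := by
    unfold ep
    rw [← mul_div_assoc, div_le_div_iff₀ (by positivity) hl]
    have : Λ (n+1) ≤ log (n+1:ℕ) := ArithmeticFunction.vonMangoldt_le_log
    calc Λ (n+1) * log (n+1:ℕ) ≤ (4 * (n+1:ℕ) * E8 (log (n+1:ℕ))) * log (n+1:ℕ) := by gcongr; linarith
      _ = _ := by ring
  have h4 : 0 ≤ Λ (n+1) / ((n+1:ℕ) * log (n+1:ℕ)) :=
    div_nonneg ArithmeticFunction.vonMangoldt_nonneg (by positivity)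
  have h5 := Mm_succ n
  rw [abs_le] at h1
  constructor
  · rw [abs_le]; constructor <;> linarith
  · rw [abs_le]; constructor <;> linarith

lemma coup_dist : ∃ C : ℝ, 0 < C ∧ ∀ lam : ℝ, 1 ≤ lam → ∀ i j : ℕ, 1 ≤ i → 1 ≤ j →
    Mm i < Mm (j+1) - log lam → Mm j - log lam < Mm (i+1) →
    |log (i+1:ℕ) - log (j+1:ℕ) / lam| ≤ C * E8 (log (i+1:ℕ)) := by
  obtain ⟨M0, K, hK, H⟩ := Mm_near
  refine ⟨exp (4*K) * (K * (1 + exp (4*K)^2)), by positivity, fun lam hlam i j hi hj h1 h2 => ?_⟩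
  have hlam0 : 0 < lam := by linarith
  obtain ⟨a, ha⟩ : ∃ a, a = log (i+1:ℕ) := ⟨_, rfl⟩
  obtain ⟨b, hb⟩ : ∃ b, b = log (j+1:ℕ) := ⟨_, rfl⟩
  obtain ⟨Hi1, Hi2⟩ := H i hi
  obtain ⟨Hj1, Hj2⟩ := H j hj
  have ha2 : log 2 ≤ a := by rw [ha]; exact log_le_log (by norm_num) (by exact_mod_cast (by omega : 2 ≤ i+1))
  have hb2 : log 2 ≤ b := by rw [hb]; exact log_le_log (by norm_num) (by exact_mod_cast (by omega : 2 ≤ j+1))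
  have h20 : 0 < log 2 := log_pos (by norm_num)
  have ha0 : 0 < a := by linarith
  have hb0 : 0 < b := by linarith
  rw [← ha] at Hi1 Hi2 ⊢
  rw [← hb] at Hj1 Hj2 ⊢
  rw [abs_le] at Hi1 Hi2 Hj1 Hj2
  have hlb : log (b/lam) = log b - log lam := log_div hb0.ne' hlam0.ne'
  have d1 : |log a - log (b/lam)| ≤ K * ep a + K * ep b := by
    rw [hlb, abs_le]; constructor <;> linarith
  have ea := ep_two ha2
  have eb := ep_two hb2
  have d2 : |log a - log (b/lam)| ≤ 4*K := by
    refine d1.trans ?_; nlinarith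
  obtain ⟨q, hq⟩ : ∃ q, q = exp (4*K) := ⟨_, rfl⟩
  have hq0 : 0 < q := by rw [hq]; positivity
  have hq1 : 1 ≤ q := by rw [hq]; exact one_le_exp (by positivity)
  have hlq : log q = 4*K := by rw [hq, log_exp]
  have hbl : 0 < b/lam := by positivity
  rw [abs_le] at d2
  have r1 : b/lam ≤ a * q := by
    rw [← log_le_log_iff hbl (by positivity), log_mul ha0.ne' hq0.ne', hlq]; linarith
  have r2 : a / q ≤ b/lam := by
    rw [← log_le_log_iff (by positivity) hbl, log_div ha0.ne' hq0.ne', hlq]; linarith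
  have r3 : a / q ≤ b := r2.trans (div_le_self hb0.le hlam)
  have r4 : ep b ≤ q^2 * ep a := (ep_anti (by positivity) r3).trans (ep_scale ha0 hq1)
  have d3 : |log a - log (b/lam)| ≤ K * (1+q^2) * ep a := by
    refine d1.trans ?_
    have : K * ep b ≤ K * (q^2 * ep a) := by gcongr
    linarith
  have := abs_sub_le_log ha0 hbl hq1 r1 d3
  rw [← hq]
  refine this.trans (le_of_eq ?_)
  unfold ep
  field_simp

lemma coup_null : ∃ C : ℝ, 0 < C ∧ ∀ lam : ℝ, 1 ≤ lam → ∀ j : ℕ, 1 ≤ j →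
    Mm j - log lam < 0 → log (j+1:ℕ) / lam ≤ C := by
  obtain ⟨M0, K, hK, H⟩ := Mm_near
  refine ⟨exp (|M0| + 2*K), by positivity, fun lam hlam j hj h => ?_⟩
  have hlam0 : 0 < lam := by linarith
  obtain ⟨b, hb⟩ : ∃ b, b = log (j+1:ℕ) := ⟨_, rfl⟩
  obtain ⟨Hj1, Hj2⟩ := H j hj
  have hb2 : log 2 ≤ b := by rw [hb]; exact log_le_log (by norm_num) (by exact_mod_cast (by omega : 2 ≤ j+1))
  have h20 : 0 < log 2 := log_pos (by norm_num)
  have hb0 : 0 < b := by linarith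
  rw [← hb] at Hj2 ⊢
  rw [abs_le] at Hj2
  have hlb : log (b/lam) = log b - log lam := log_div hb0.ne' hlam0.ne'
  have eb := ep_two hb2
  rw [← log_le_iff_le_exp (by positivity), hlb]
  have := neg_abs_le M0
  nlinarith

/-- Coupling of the prime-power Poisson processes at scales `1` and `lam`. -/
structure Coup (C0 lam : ℝ) (R : ℕ) {ι : Type} [Fintype ι] [DecidableEq ι] (α β : ι → ℕ) (w : ι → ℝ) : Prop where
  w0 : ∀ a, 0 ≤ w a
  ap : ∀ a, α a = 1 ∨ IsPrimePow (α a)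
  bp : ∀ a, IsPrimePow (β a)
  nul : ∑ a with α a = 1, w a = log lam
  ae : ∀ i, 2 ≤ i → i ≤ R → ∑ a with α a = i, w a = Λ i / (i * log i)
  al : ∀ i, 2 ≤ i → ∑ a with α a = i, w a ≤ Λ i / (i * log i)
  be : ∀ i, 2 ≤ i → i ≤ R → ∑ a with β a = i, w a = Λ i / (i * log i)
  ds : ∀ a, α a ≠ 1 → |log (α a) - log (β a) / lam| ≤ C0 * E8 (log (α a))
  dn : ∀ a, α a = 1 → log (β a) / lam ≤ C0
  sn : ∑ a with α a = 1, w a * (log (β a) / lam) ≤ C0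

lemma sum_Ioc_zero (f : ℕ → ℝ) (N : ℕ) : ∑ n ∈ Ioc 0 N, f n = ∑ j ∈ range N, f (j+1) := by
  induction N with
  | zero => simp
  | succ n ih => rw [← Finset.insert_Ioc_right_eq_Ioc_add_one (by omega), sum_insert (by simp), ih, sum_range_succ]; ring

lemma sub_sum {N M : ℕ} (f : ℕ × ℕ → ℝ) (P : ℕ × ℕ → Prop) [DecidablePred P] (g : ℕ × ℕ → ℝ) :
    ∑ a : {p // p ∈ (range N ×ˢ range M).filter (fun p => f p ≠ 0)} with P a.1, f a.1 * g a.1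
      = ∑ i ∈ range N, ∑ j ∈ range M, if P (i,j) then f (i,j) * g (i,j) else 0 := by
  rw [sum_filter]
  refine (Finset.sum_coe_sort _ (fun p => if P p then f p * g p else 0)).trans ?_
  rw [sum_filter_of_ne, sum_product]
  intro x _ h h0
  apply h
  simp [h0]

lemma step_pp {n : ℕ} (h : Mm n < Mm (n+1)) : IsPrimePow (n+1) := by
  rw [Mm_succ] at h
  have : Λ (n+1) ≠ 0 := by
    intro h0; rw [h0] at h; simp at h
  exact ArithmeticFunction.vonMangoldt_ne_zero_iff.1 this

lemma null_sum : ∃ C : ℝ, 0 < C ∧ ∀ lam : ℝ, 1 ≤ lam → ∀ D : ℝ, 1 ≤ D → ∀ M : ℕ,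
    ∑ j ∈ range M, (if log (j+1:ℕ) / lam ≤ D then (Mm (j+1) - Mm j) * (log (j+1:ℕ) / lam) else 0) ≤ C + D := by
  obtain ⟨C, hC, H⟩ := Lm_bound
  refine ⟨C, hC, fun lam hlam D hD M => ?_⟩
  have hl : 0 < lam := by linarith
  have hD0 : 0 ≤ lam * D := by positivity
  obtain ⟨N, hN⟩ : ∃ N, N = ⌊exp (lam * D)⌋₊ := ⟨_, rfl⟩
  have hN1 : 1 ≤ N := by rw [hN, Nat.one_le_floor_iff]; exact one_le_exp hD0
  have h1 : ∑ j ∈ range M, (if log (j+1:ℕ) / lam ≤ D then (Mm (j+1) - Mm j) * (log (j+1:ℕ) / lam) else 0)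
      ≤ ∑ j ∈ range N, Λ (j+1) / (j+1:ℕ) / lam := by
    rw [← sum_filter]
    refine le_trans (sum_le_sum (g := fun j => Λ (j+1) / (j+1:ℕ) / lam) ?_) (sum_le_sum_of_subset_of_nonneg ?_ ?_)
    · intro j _
      rw [Mm_succ, add_sub_cancel_left]
      rcases Nat.eq_zero_or_pos j with rfl | hj
      · simp
      · have : 0 < log (j+1:ℕ) := log_pos (by exact_mod_cast (by omega : 1 < j+1))
        apply le_of_eq; field_simp
    · intro j hj
      rw [mem_filter] at hj
      rw [mem_range, hN]
      have h2 : log (j+1:ℕ) ≤ lam * D := by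
        have := hj.2; rw [div_le_iff₀ hl] at this; linarith
      have : j + 1 ≤ ⌊exp (lam * D)⌋₊ := by
        apply Nat.le_floor
        rwa [log_le_iff_le_exp (by positivity)] at h2
      omega
    · intro j _ _
      have := ArithmeticFunction.vonMangoldt_nonneg (n := j+1)
      positivity
  have h2 : ∑ j ∈ range N, Λ (j+1) / (j+1:ℕ) / lam = Lm N / lam := by
    rw [← sum_div, Lm]; congr 1; exact (sum_Ioc_zero (fun n => Λ n / (n:ℝ)) N).symm
  refine h1.trans ?_
  rw [h2, div_le_iff₀ hl]
  have h3 := (abs_le.1 (H N hN1)).2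
  have h4 : log N ≤ lam * D := by
    rw [log_le_iff_le_exp (by exact_mod_cast hN1), hN]; exact Nat.floor_le (by positivity)
  nlinarith

theorem coupling : ∃ C0 : ℝ, 0 < C0 ∧ ∀ lam : ℝ, 1 ≤ lam → ∀ R : ℕ, 2 ≤ R →
    ∃ (ι : Type) (_ : Fintype ι) (_ : DecidableEq ι) (α β : ι → ℕ) (w : ι → ℝ), Coup C0 lam R α β w := by
  obtain ⟨C1, hC1, H1⟩ := coup_dist
  obtain ⟨C2, hC2, H2⟩ := coup_null
  obtain ⟨C3, hC3, H3⟩ := null_sum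
  refine ⟨C1 + (C2 + 1) + C3, by positivity, fun lam hlam R hR => ?_⟩
  have hl0 : 0 < lam := by linarith
  have hL0 : 0 ≤ log lam := log_nonneg hlam
  obtain ⟨L, hL⟩ : ∃ L, L = log lam := ⟨_, rfl⟩
  rw [← hL] at hL0
  obtain ⟨N0, hN0⟩ := Mm_unbdd (Mm R + L)
  obtain ⟨M, hM⟩ : ∃ M, M = max R N0 := ⟨_, rfl⟩
  have hMR : R ≤ M := by omega
  have hMM : Mm R + L ≤ Mm M := hN0.trans (Mm_mono (by omega))
  obtain ⟨A, hA⟩ : ∃ A : ℕ → ℝ, A = fun n => if n = 0 then -L else Mm n := ⟨_, rfl⟩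
  obtain ⟨B, hB⟩ : ∃ B : ℕ → ℝ, B = fun n => Mm n - L := ⟨_, rfl⟩
  have hA0 : A 0 = -L := by simp [hA]
  have hAs : ∀ n, 1 ≤ n → A n = Mm n := fun n hn => by simp [hA]; omega
  have hBs : ∀ n, B n = Mm n - L := fun n => by simp [hB]
  have hAm : Monotone A := by
    apply monotone_nat_of_le_succ
    intro n
    rw [hAs (n+1) (by omega)]
    rcases Nat.eq_zero_or_pos n with rfl | hn
    · rw [hA0, zero_add, Mm_one]; linarith
    · rw [hAs n hn]; exact Mm_mono (Nat.le_succ n)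
  have hBm : Monotone B := fun m n h => by rw [hBs, hBs]; linarith [Mm_mono h]
  have hB0 : B 0 = -L := by rw [hBs, Mm_zero]; ring
  have hAge : ∀ n, -L ≤ A n := fun n => by rw [← hA0]; exact hAm (Nat.zero_le n)
  have hBge : ∀ n, -L ≤ B n := fun n => by rw [← hB0]; exact hBm (Nat.zero_le n)
  obtain ⟨f, hf⟩ : ∃ f : ℕ × ℕ → ℝ, f = fun p => ov (A p.1) (A (p.1+1)) (B p.2) (B (p.2+1)) := ⟨_, rfl⟩
  have hfe : ∀ i j, f (i,j) = ov (A i) (A (i+1)) (B j) (B (j+1)) := fun i j => by rw [hf]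
  have hf0 : ∀ p, 0 ≤ f p := fun p => by rw [hf]; exact ov_nonneg _ _ _ _
  have sj : ∀ i, i < R → ∑ j ∈ range M, f (i,j) = A (i+1) - A i := by
    intro i hi
    rw [← sum_ov_eq hBm (hAm (Nat.le_succ i)) M (by rw [hB0]; exact hAge i)
      (by rw [hAs _ (by omega), hBs]; linarith [Mm_mono (by omega : i+1 ≤ R)])]
    exact sum_congr rfl (fun j _ => by rw [hfe, ov_comm])
  have si : ∀ j, j < R → ∑ i ∈ range R, f (i,j) = B (j+1) - B j := by
    intro j hj
    rw [← sum_ov_eq hAm (hBm (Nat.le_succ j)) R (by rw [hA0]; exact hBge j)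
      (by rw [hAs _ (by omega), hBs]; linarith [Mm_mono (by omega : j+1 ≤ R)])]
    exact sum_congr rfl (fun i _ => by rw [hfe])
  have key : ∀ (P : ℕ × ℕ → Prop) [DecidablePred P],
      ∑ a : {p // p ∈ (range R ×ˢ range M).filter (fun p => f p ≠ 0)} with P a.1, f a.1
      = ∑ i ∈ range R, ∑ j ∈ range M, if P (i,j) then f (i,j) else 0 := by
    intro P _
    have := sub_sum (N := R) (M := M) f P (fun _ => 1)
    simpa only [mul_one] using this
  have sumA : ∀ i, i < R → ∑ a : {p // p ∈ (range R ×ˢ range M).filter (fun p => f p ≠ 0)} with a.1.1+1 = i+1, f a.1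
      = A (i+1) - A i := by
    intro i hi
    rw [key (fun p => p.1+1 = i+1), ← sj i hi, sum_eq_single_of_mem i (mem_range.2 hi)]
    · simp
    · intro b _ hb
      simp [hb]
  have sumB : ∀ j, j < R → ∑ a : {p // p ∈ (range R ×ˢ range M).filter (fun p => f p ≠ 0)} with a.1.2+1 = j+1, f a.1
      = B (j+1) - B j := by
    intro j hj
    rw [key (fun p => p.2+1 = j+1), ← si j hj]
    refine sum_congr rfl (fun i _ => ?_)
    rw [sum_eq_single_of_mem j (mem_range.2 (by omega))]
    · simp
    · intro b _ hb
      simp [hb]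
  have fact : ∀ p : {p // p ∈ (range R ×ˢ range M).filter (fun p => f p ≠ 0)},
      A p.1.1 < B (p.1.2+1) ∧ B p.1.2 < A (p.1.1+1) ∧ A p.1.1 < A (p.1.1+1) ∧ B p.1.2 < B (p.1.2+1) := by
    rintro ⟨⟨i,j⟩, hp⟩
    have := (mem_filter.1 hp).2
    rw [hfe] at this
    exact ov_ne this
  have bpp : ∀ p : {p // p ∈ (range R ×ˢ range M).filter (fun p => f p ≠ 0)}, IsPrimePow (p.1.2+1) := by
    intro p
    have := (fact p).2.2.2
    rw [hBs, hBs] at this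
    exact step_pp (by linarith)
  have bj1 : ∀ p : {p // p ∈ (range R ×ˢ range M).filter (fun p => f p ≠ 0)}, 1 ≤ p.1.2 := by
    intro p
    have := (bpp p).two_le
    omega
  have nulb : ∀ p : {p // p ∈ (range R ×ˢ range M).filter (fun p => f p ≠ 0)}, p.1.1 + 1 = 1 →
      log (p.1.2+1:ℕ) / lam ≤ C2 := by
    intro p h
    have h1 := (fact p).2.1
    rw [h, hAs 1 le_rfl, Mm_one, hBs, hL] at h1
    exact H2 lam hlam _ (bj1 p) h1
  have hi2 : ∀ i, 2 ≤ i → A i - A (i-1) = Λ i / (i * log i) := by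
    intro i hi
    obtain ⟨k, rfl⟩ : ∃ k, i = k+1 := ⟨i-1, by omega⟩
    rw [hAs _ (by omega), Nat.add_sub_cancel, hAs _ (by omega), Mm_succ]; ring
  refine ⟨{p // p ∈ (range R ×ˢ range M).filter (fun p => f p ≠ 0)}, inferInstance, inferInstance,
    fun p => p.1.1+1, fun p => p.1.2+1, fun p => f p, ⟨fun a => hf0 _, ?_, bpp, ?_, ?_, ?_, ?_, ?_, ?_, ?_⟩⟩
  · intro p
    rcases Nat.eq_zero_or_pos p.1.1 with h | h
    · left; omega
    · right
      have := (fact p).2.2.1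
      rw [hAs _ h, hAs _ (by omega)] at this
      exact step_pp this
  · refine (sumA 0 (by omega)).trans ?_
    rw [hAs _ (by omega), hA0, zero_add, Mm_one, hL]; ring
  · intro i hi hiR
    obtain ⟨k, rfl⟩ : ∃ k, i = k+1 := ⟨i-1, by omega⟩
    rw [← hi2 _ hi]
    exact sumA k (by omega)
  · intro i hi
    rcases le_or_gt i R with hiR | hiR
    · obtain ⟨k, rfl⟩ : ∃ k, i = k+1 := ⟨i-1, by omega⟩
      rw [← hi2 _ hi]
      exact (sumA k (by omega)).le
    · rw [sum_eq_zero]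
      · exact div_nonneg ArithmeticFunction.vonMangoldt_nonneg (mul_nonneg (by positivity) (log_natCast_nonneg _))
      · intro p hp
        have h1 := (mem_filter.1 hp).2
        have h2 := (mem_product.1 (mem_filter.1 p.2).1).1
        rw [mem_range] at h2
        omega
  · intro i hi hiR
    obtain ⟨k, rfl⟩ : ∃ k, i = k+1 := ⟨i-1, by omega⟩
    refine (sumB k (by omega)).trans ?_
    rw [hBs, hBs, Mm_succ]; push_cast; ring
  · intro p hp
    have h1 : 1 ≤ p.1.1 := by simp at hp; omega
    have h2 := fact p
    rw [hAs _ h1, hAs _ (by omega), hBs, hBs, hL] at h2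
    refine (H1 lam hlam _ _ h1 (bj1 p) h2.1 h2.2.1).trans ?_
    have := E8_pos (log_natCast_nonneg (p.1.1+1))
    have : 0 ≤ (C2 + 1 + C3) * E8 (log (p.1.1+1:ℕ)) := by positivity
    linarith
  · intro p hp
    exact (nulb p hp).trans (by linarith)
  · have hs := sub_sum (N := R) (M := M) f (fun p => p.1 + 1 = 1) (fun p => log (p.2+1:ℕ) / lam)
    refine hs.le.trans ?_
    rw [sum_eq_single_of_mem 0 (mem_range.2 (by omega)) (by intro b _ hb; simp [hb])]
    refine le_trans (sum_le_sum ?_) ((H3 lam hlam (C2+1) (by linarith) M).trans (by linarith))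
    intro j hj
    rw [if_pos rfl]
    rcases eq_or_ne (f (0,j)) 0 with h0 | h0
    · rw [h0, zero_mul]
      split_ifs
      · have := Mm_mono (Nat.le_succ j)
        exact mul_nonneg (by linarith) (div_nonneg (log_natCast_nonneg _) hl0.le)
      · exact le_rfl
    · have h1 := nulb ⟨(0,j), mem_filter.2 ⟨mem_product.2 ⟨mem_range.2 (by omega), hj⟩, h0⟩⟩ rfl
      rw [if_pos (by simp only at h1; linarith)]
      refine mul_le_mul_of_nonneg_right ?_ (div_nonneg (log_natCast_nonneg _) hl0.le)
      have := sum_ov_le hAm (hBm (Nat.le_succ j)) 1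
      rw [sum_range_one] at this
      rw [hfe]
      refine this.trans ?_
      rw [hBs, hBs]; linarith

lemma fact_prod_mul {M : Type*} [CommMonoid M] (f : ℕ → ℕ → M) {m n : ℕ} (h : Nat.Coprime m n) :
    (m*n).factorization.prod f = m.factorization.prod f * n.factorization.prod f := by
  rw [Nat.factorization_mul_of_coprime h, Finsupp.prod_add_index_of_disjoint]
  simpa using h.disjoint_primeFactors

lemma fact_prod_pow {M : Type*} [CommMonoid M] (f : ℕ → ℕ → M) {p v : ℕ} (hp : p.Prime) (h : f p 0 = 1) :
    (p^v).factorization.prod f = f p v := by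
  rw [hp.factorization_pow, Finsupp.prod_single_index h]

/-- squarefull part -/
def sqf (n : ℕ) : ℕ := n.factorization.prod (fun p v => if v = 1 then 1 else p^v)

lemma sqf_pos (n : ℕ) : 0 < sqf n := by
  unfold sqf
  refine Finset.prod_pos (fun p hp => ?_)
  have : 0 < p := (Nat.prime_of_mem_primeFactors hp).pos
  dsimp only
  split_ifs
  · norm_num
  · positivity

lemma Wt_sqf : Wt (fun n => (sqf n : ℝ)^((1:ℝ)/8)) where
  nn := fun n => by positivity
  one := by simp [sqf]
  mul := fun m n h => by
    have : sqf (m*n) = sqf m * sqf n := fact_prod_mul _ h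
    rw [this]; push_cast
    exact mul_rpow (by positivity) (by positivity)
  pl := fun p hp => by
    refine one_le_rpow ?_ (by norm_num)
    exact_mod_cast sqf_pos p
  pu := fun p hp => by
    have := fact_prod_pow (fun p v => if v = 1 then 1 else p^v) (v := 1) hp (by simp)
    have h2 : sqf p = 1 := by simpa [sqf] using this
    rw [h2]; norm_num
  pv := fun p v hp hv => by
    have := fact_prod_pow (fun p v => if v = 1 then 1 else p^v) (v := v) hp (by simp)
    have h2 : sqf (p^v) = p^v := by
      unfold sqf; rw [this, if_neg (by omega)]
    have hp1 : (1:ℝ) ≤ p := by exact_mod_cast hp.one_lt.le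
    rw [h2]; push_cast
    rw [← rpow_natCast, ← rpow_mul (by positivity)]
    refine rpow_le_rpow_of_exponent_le hp1 ?_
    have : (0:ℝ) ≤ v := by positivity
    linarith
  sm := ⟨0, le_rfl, fun N => by
    apply Finset.sum_nonpos
    intro p hp
    have hp := (mem_filter.1 hp).2
    have := fact_prod_pow (fun p v => if v = 1 then 1 else p^v) (v := 1) hp (by simp)
    have h2 : sqf p = 1 := by simpa [sqf] using this
    rw [h2]; norm_num⟩

/-- completely multiplicative weight `exp (a * E8 (log p))` -/
noncomputable def kap (a : ℝ) (n : ℕ) : ℝ :=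
  if n = 0 then 0 else n.factorization.prod (fun p v => exp (a * E8 (log p)) ^ v)

lemma kap_one (a : ℝ) : kap a 1 = 1 := by simp [kap]
lemma kap_nn (a : ℝ) (n : ℕ) : 0 ≤ kap a n := by
  unfold kap
  split_ifs
  · exact le_rfl
  · exact Finset.prod_nonneg (fun p _ => by positivity)
lemma kap_mul (a : ℝ) (m n : ℕ) : kap a (m*n) = kap a m * kap a n := by
  rcases eq_or_ne m 0 with rfl | hm
  · simp [kap]
  rcases eq_or_ne n 0 with rfl | hn
  · simp [kap]
  unfold kap
  rw [if_neg (mul_ne_zero hm hn), if_neg hm, if_neg hn, Nat.factorization_mul hm hn, Finsupp.prod_add_index']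
  · simp
  · intro p x y; rw [pow_add]
lemma kap_pow (a : ℝ) {p : ℕ} (hp : p.Prime) (v : ℕ) : kap a (p^v) = exp (a * E8 (log p)) ^ v := by
  unfold kap
  rw [if_neg (pow_ne_zero _ hp.ne_zero), fact_prod_pow _ hp (by simp)]
lemma kap_p (a : ℝ) {p : ℕ} (hp : p.Prime) : kap a p = exp (a * E8 (log p)) := by
  simpa using kap_pow a hp 1
lemma kap_sq (a : ℝ) (n : ℕ) : kap a n ^ 2 = kap (2*a) n := by
  unfold kap
  split_ifs
  · norm_num
  · unfold Finsupp.prod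
    rw [← Finset.prod_pow]
    refine Finset.prod_congr rfl (fun p _ => ?_)
    rw [← pow_mul, mul_comm _ 2, pow_mul, ← exp_nat_mul]; push_cast; ring_nf
lemma kap_pp {a : ℝ} (ha : 0 ≤ a) {n : ℕ} (hn : IsPrimePow n) : exp (a * E8 (log n)) ≤ kap a n := by
  obtain ⟨p, k, hp, hk, rfl⟩ := (isPrimePow_nat_iff n).1 hn
  rw [kap_pow a hp, ← exp_nat_mul]
  have h0 : 0 ≤ log p := log_natCast_nonneg p
  have h1 : E8 (log (p^k:ℕ)) ≤ E8 (log p) := by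
    refine E8_anti h0 (log_le_log (by exact_mod_cast hp.pos) ?_)
    exact_mod_cast Nat.le_self_pow (by omega) p
  have h2 := E8_pos h0
  refine exp_le_exp.2 ?_
  calc a * E8 (log (p^k:ℕ)) ≤ 1 * (a * E8 (log p)) := by rw [one_mul]; gcongr
    _ ≤ _ := by gcongr; exact_mod_cast hk

lemma E8_prime_sum : ∃ C : ℝ, 0 ≤ C ∧ ∀ N : ℕ, ∑ p ∈ (Ioc 0 N).filter Nat.Prime, E8 (log p) / p ≤ C := by
  have hs : Summable (fun k : ℕ => ((k+1:ℕ):ℝ)^(-(9/8):ℝ)) :=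
    (summable_nat_add_iff 1).2 (summable_nat_rpow.2 (by norm_num))
  obtain ⟨D, hD⟩ : ∃ D, D = 8 * (log 4 + 4) := ⟨_, rfl⟩
  have hl4 : 0 ≤ log 4 := log_nonneg (by norm_num)
  have hD0 : 0 ≤ D := by rw [hD]; positivity
  have hl2 := log_two_gt_d9
  refine ⟨4 * D * ∑' k : ℕ, ((k+1:ℕ):ℝ)^(-(9/8):ℝ), mul_nonneg (by positivity) (tsum_nonneg fun k => by positivity), fun N => ?_⟩
  rw [← sum_fiberwise_of_maps_to (s := (Ioc 0 N).filter Nat.Prime) (t := range N) (g := fun p => Nat.log 8 (p-1))]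
  · have hb : ∀ k ∈ range N, ∑ p ∈ ((Ioc 0 N).filter Nat.Prime).filter (fun p => Nat.log 8 (p-1) = k), E8 (log p) / p
        ≤ 4 * D * ((k+1:ℕ):ℝ)^(-(9/8):ℝ) := by
      intro k _
      have hm : ∀ p ∈ ((Ioc 0 N).filter Nat.Prime).filter (fun p => Nat.log 8 (p-1) = k), p.Prime ∧ 8^k < p ∧ p ≤ 8^(k+1) := by
        intro p hp
        simp only [mem_filter, mem_Ioc] at hp
        obtain ⟨⟨_, hp⟩, hk⟩ := hp
        have h2 := hp.two_le
        have h1 := Nat.lt_pow_succ_log_self (b := 8) (by norm_num) (p-1)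
        have h3 := Nat.pow_log_le_self 8 (x := p-1) (by omega)
        rw [hk] at h1 h3
        refine ⟨hp, by omega, ?_⟩
        have : k.succ = k+1 := rfl
        rw [this] at h1; omega
      have hc := cheb_block (8^k) (by positivity) _ (fun p hp => by
        obtain ⟨_, h1, h2⟩ := hm p hp
        refine ⟨by exact_mod_cast h1, ?_⟩
        rw [← pow_succ']; exact_mod_cast h2)
      rw [← hD] at hc
      calc _ ≤ ∑ p ∈ ((Ioc 0 N).filter Nat.Prime).filter (fun p => Nat.log 8 (p-1) = k), 4 * ((k+1:ℕ):ℝ)^(-(9/8):ℝ) * (Λ p / p) := by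
            refine sum_le_sum (fun p hp => ?_)
            obtain ⟨hpp, h1, h2⟩ := hm p hp
            clear hp
            have hp := hpp
            rw [ArithmeticFunction.vonMangoldt_apply_prime hp]
            have hp0 : (0:ℝ) < p := by exact_mod_cast hp.pos
            have hlow : ((k:ℝ)+1)/2 ≤ log p := by
              rcases Nat.eq_zero_or_pos k with rfl | hk
              · have : log 2 ≤ log p := log_le_log (by norm_num) (by exact_mod_cast hp.two_le)
                push_cast; linarith
              · have h8 : log (8^k:ℕ) ≤ log p := log_le_log (by positivity) (by exact_mod_cast h1.le)
                push_cast at h8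
                rw [log_pow, show (8:ℝ) = 2^3 by norm_num, log_pow] at h8
                have : (1:ℝ) ≤ k := by exact_mod_cast hk
                push_cast at h8
                nlinarith
            have hk0 : (0:ℝ) ≤ k := by positivity
            have hl0 : 0 < log p := by linarith
            have e1 : E8 (log p) ≤ (((k+1:ℕ):ℝ)/2)^(-(1/8):ℝ) := by
              unfold E8
              refine rpow_le_rpow_of_nonpos (by positivity) ?_ (by norm_num)
              push_cast; linarith
            have hq : (0:ℝ) < (k+1:ℕ) := by positivity
            obtain ⟨q, hqq⟩ : ∃ q : ℝ, q = ((k+1:ℕ):ℝ) := ⟨_, rfl⟩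
            rw [← hqq] at hq e1 ⊢
            have hlow' : q/2 ≤ log p := by rw [hqq]; push_cast; linarith
            have e2 : (q/2)^(-(1/8):ℝ) ≤ 2 * q^(-(1/8):ℝ) := by
              rw [div_rpow hq.le (by norm_num), div_eq_mul_inv, ← rpow_neg (by norm_num), mul_comm, neg_neg]
              refine mul_le_mul_of_nonneg_right ?_ (by positivity)
              calc (2:ℝ)^((1/8):ℝ) ≤ 2^(1:ℝ) := rpow_le_rpow_of_exponent_le (by norm_num) (by norm_num)
                _ = 2 := by norm_num
            have e3 : q^(-(9/8):ℝ) * q = q^(-(1/8):ℝ) := by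
              rw [← rpow_add_one hq.ne']; norm_num
            rw [← mul_div_assoc]
            refine div_le_div_of_nonneg_right ?_ hp0.le
            have h9 : 0 < q^(-(9/8):ℝ) := by positivity
            calc E8 (log p) ≤ 2 * (q^(-(9/8):ℝ) * q) := by rw [e3]; linarith
              _ ≤ 4 * q^(-(9/8):ℝ) * log p := by nlinarith
        _ = 4 * ((k+1:ℕ):ℝ)^(-(9/8):ℝ) * ∑ p ∈ ((Ioc 0 N).filter Nat.Prime).filter (fun p => Nat.log 8 (p-1) = k), (Λ p / p) := by rw [mul_sum]
        _ ≤ 4 * ((k+1:ℕ):ℝ)^(-(9/8):ℝ) * D := by gcongr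
        _ = _ := by ring
    refine (sum_le_sum hb).trans ?_
    rw [← mul_sum]
    refine mul_le_mul_of_nonneg_left ?_ (by positivity)
    exact hs.sum_le_tsum _ (fun k _ => by positivity)
  · intro p hp
    simp only [mem_filter, mem_Ioc] at hp
    have h2 := hp.2.two_le
    have := Nat.log_lt_self 8 (x := p-1) (by omega)
    rw [mem_range]; omega

lemma Wt_kap {a : ℝ} (ha : 0 ≤ a) (ha8 : a ≤ 1/8) : Wt (kap a) where
  nn := kap_nn a
  one := kap_one a
  mul := fun m n _ => kap_mul a m n
  pl := fun p hp => by
    rw [kap_p a hp]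
    have := E8_pos (log_natCast_nonneg p)
    exact one_le_exp (by positivity)
  pu := fun p hp => by
    rw [kap_p a hp]
    have := E8_le_one (log_natCast_nonneg p)
    have h0 := E8_pos (log_natCast_nonneg p)
    have hl2 := log_two_gt_d9
    rw [← le_log_iff_exp_le (by norm_num)]
    nlinarith
  pv := fun p v hp hv => by
    rw [kap_pow a hp, ← exp_nat_mul, rpow_def_of_pos (by exact_mod_cast hp.pos)]
    have := E8_le_one (log_natCast_nonneg p)
    have h0 := E8_pos (log_natCast_nonneg p)
    have hl2 := log_two_gt_d9
    have hlp : log 2 ≤ log p := log_le_log (by norm_num) (by exact_mod_cast hp.two_le)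
    refine exp_le_exp.2 ?_
    have h1 : a * E8 (log p) ≤ log p / 4 := by nlinarith
    have hv0 : (0:ℝ) ≤ v := by positivity
    nlinarith
  sm := by
    obtain ⟨C, hC, H⟩ := E8_prime_sum
    refine ⟨C, hC, fun N => le_trans (sum_le_sum ?_) (H N)⟩
    intro p hp
    have hp := (mem_filter.1 hp).2
    rw [kap_p a hp]
    have h1 := E8_le_one (log_natCast_nonneg p)
    have h0 := E8_pos (log_natCast_nonneg p)
    refine div_le_div_of_nonneg_right ?_ (by positivity)
    have hx : 0 ≤ a * E8 (log p) := by positivity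
    have hx1 : a * E8 (log p) ≤ 1/8 * E8 (log p) := by gcongr
    have := abs_exp_sub_one_le (x := a * E8 (log p)) (by rw [abs_of_nonneg hx]; linarith)
    rw [abs_of_nonneg hx] at this
    have := (le_abs_self _).trans this
    linarith

lemma exp_lin {c : ℝ} (hc : 0 < c) : ∃ C : ℝ, 0 < C ∧ ∀ (X : ℝ) (k : ℕ), 0 ≤ X →
    ((k:ℝ)+1) * exp (-(c*|(k:ℝ) * log 2 - X|)) ≤ C * (1+X) * exp (-(c/2*|(k:ℝ) * log 2 - X|)) := by
  refine ⟨2 * (1 + 2/c), by positivity, fun X k hX => ?_⟩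
  obtain ⟨s, hs⟩ : ∃ s, s = |(k:ℝ) * log 2 - X| := ⟨_, rfl⟩
  have hs0 : 0 ≤ s := by rw [hs]; positivity
  have h1 : (k:ℝ) * log 2 ≤ X + s := by
    have := le_abs_self ((k:ℝ) * log 2 - X); rw [← hs] at this; linarith
  have hl2 := log_two_gt_d9
  have hk : (k:ℝ) ≤ 2 * (X + s) := by
    have : (0:ℝ) ≤ k := by positivity
    nlinarith
  rw [← hs]
  have h2 : exp (-(c*s)) = exp (-(c/2*s)) * exp (-(c/2*s)) := by rw [← exp_add]; ring_nf
  have h3 : (1 + s) * exp (-(c/2*s)) ≤ 1 + 2/c := by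
    have h4 : 1 + c/2*s ≤ exp (c/2*s) := by have := add_one_le_exp (c/2*s); linarith
    rw [exp_neg, ← div_eq_mul_inv, div_le_iff₀ (by positivity)]
    have h5 : 1 + s ≤ (1+2/c) * (1 + c/2*s) := by
      have : (1+2/c) * (1 + c/2*s) = 1 + c/2*s + 2/c + s := by field_simp; ring
      rw [this]
      have : 0 ≤ 2/c := by positivity
      have : 0 ≤ c/2*s := by positivity
      linarith
    refine h5.trans ?_
    gcongr
  rw [h2, ← mul_assoc]
  refine mul_le_mul_of_nonneg_right ?_ (by positivity)
  calc ((k:ℝ)+1) * exp (-(c/2*s)) ≤ (2*(1+X)*(1+s)) * exp (-(c/2*s)) := by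
        refine mul_le_mul_of_nonneg_right ?_ (by positivity)
        nlinarith
    _ = 2*(1+X)*((1+s) * exp (-(c/2*s))) := by ring
    _ ≤ 2*(1+X)*(1+2/c) := by gcongr
    _ = _ := by ring

theorem cutoff {a c : ℝ} (ha : 0 ≤ a) (ha8 : a ≤ 1/16) (hc : 0 < c) : ∃ C : ℝ, 0 < C ∧ ∀ (X : ℝ) (N : ℕ), 0 ≤ X →
    ∑ n ∈ Ioc 0 N, kap a n / n * exp (-(c*|log n - X|)) ≤ C * (1+X)^((1:ℝ)/2) := by
  obtain ⟨C1, hC1, H1⟩ := sum_g_log (Wt_kap (a := 2*a) (by linarith) (by linarith))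
  obtain ⟨C2, hC2, H2⟩ := geo (c := c/2) (by positivity)
  obtain ⟨C3, hC3, H3⟩ := exp_lin hc
  have ht : 0 < log 2 := log_pos (by norm_num)
  refine ⟨exp (c*log 2) * (1 + C1*C3) * C2, by positivity, fun X N hX => ?_⟩
  obtain ⟨T, hT⟩ : ∃ T, T = (1+X)^((1:ℝ)/2) := ⟨_, rfl⟩
  have hT0 : 0 < T := by rw [hT]; positivity
  have hTT : T * T = 1 + X := by rw [hT, ← rpow_add (by positivity)]; norm_num
  rw [← hT]
  rw [← sum_fiberwise_of_maps_to (s := Ioc 0 N) (t := range (N+1)) (g := fun n => Nat.log 2 n)]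
  · have hb : ∀ k ∈ range (N+1), ∑ n ∈ (Ioc 0 N).filter (fun n => Nat.log 2 n = k), kap a n / n * exp (-(c*|log n - X|))
        ≤ exp (c*log 2) * (1 + C1*C3) * T * exp (-(c/2*|(k:ℝ) * log 2 - X|)) := by
      intro k _
      have hm : ∀ n ∈ (Ioc 0 N).filter (fun n => Nat.log 2 n = k), 2^k ≤ n ∧ n < 2^(k+1) := by
        intro n hn
        simp only [mem_filter, mem_Ioc] at hn
        have h1 := Nat.lt_pow_succ_log_self (b := 2) (by norm_num) n
        have h3 := Nat.pow_log_le_self 2 (x := n) (by omega)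
        rw [hn.2] at h1 h3
        exact ⟨h3, h1⟩
      obtain ⟨E, hE⟩ : ∃ E, E = exp (-(c*|(k:ℝ) * log 2 - X|)) := ⟨_, rfl⟩
      have hE0 : 0 < E := by rw [hE]; positivity
      have e1 : ∀ n ∈ (Ioc 0 N).filter (fun n => Nat.log 2 n = k), exp (-(c*|log n - X|)) ≤ exp (c*log 2) * E := by
        intro n hn
        obtain ⟨h1, h2⟩ := hm n hn
        have hn0 : (0:ℝ) < n := by
          have : 0 < 2^k := by positivity
          exact_mod_cast (by omega : 0 < n)
        have l1 : (k:ℝ) * log 2 ≤ log n := by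
          rw [← log_pow]; exact log_le_log (by positivity) (by exact_mod_cast h1)
        have l2 : log n ≤ (k:ℝ) * log 2 + log 2 := by
          have : log n ≤ log (2^(k+1)) := log_le_log hn0 (by exact_mod_cast h2.le)
          rw [log_pow] at this; push_cast at this; linarith
        rw [hE, ← exp_add, exp_le_exp]
        have : |(k:ℝ) * log 2 - X| ≤ |log n - X| + log 2 := by
          have := abs_add_le (log n - X) ((k:ℝ) * log 2 - log n)
          rw [show log n - X + ((k:ℝ) * log 2 - log n) = (k:ℝ) * log 2 - X by ring] at this
          have h4 : |(k:ℝ) * log 2 - log n| ≤ log 2 := by rw [abs_le]; constructor <;> linarith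
          linarith
        nlinarith
      have e2 : ∑ n ∈ (Ioc 0 N).filter (fun n => Nat.log 2 n = k), kap a n / n ≤ T + C1 * ((k:ℝ)+1) / T := by
        calc _ ≤ ∑ n ∈ (Ioc 0 N).filter (fun n => Nat.log 2 n = k), (T * (1/(n:ℝ)) + (kap (2*a) n / n) / T) := by
              refine sum_le_sum (fun n hn => ?_)
              rw [← kap_sq]
              have : kap a n ≤ T + kap a n ^2 / T := by
                rw [← sub_nonneg]
                have : T + kap a n ^2 / T - kap a n = ((T - kap a n)^2 + T * kap a n) / T := by field_simp; ring
                rw [this]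
                have := kap_nn a n
                positivity
              calc kap a n / n ≤ (T + kap a n ^2 / T) / n := by gcongr
                _ = _ := by ring
          _ = T * (∑ n ∈ (Ioc 0 N).filter (fun n => Nat.log 2 n = k), 1/(n:ℝ)) + (∑ n ∈ (Ioc 0 N).filter (fun n => Nat.log 2 n = k), kap (2*a) n / n) / T := by
              rw [sum_add_distrib, mul_sum, sum_div]
          _ ≤ T * 1 + (C1 * ((k:ℝ)+1)) / T := by
              refine add_le_add (mul_le_mul_of_nonneg_left ?_ hT0.le) (div_le_div_of_nonneg_right ?_ hT0.le)
              · calc _ ≤ ∑ n ∈ Ico ((2:ℕ)^k) (2^(k+1)), 1/(n:ℝ) :=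
                      sum_le_sum_of_subset_of_nonneg (fun n hn => mem_Ico.2 (hm n hn)) (fun n _ _ => by positivity)
                  _ ≤ ∑ n ∈ Ico ((2:ℕ)^k) (2^(k+1)), 1/(2:ℝ)^k := by
                      refine sum_le_sum (fun n hn => ?_)
                      have := (mem_Ico.1 hn).1
                      refine one_div_le_one_div_of_le (by positivity) (by exact_mod_cast this)
                  _ = 1 := by
                      rw [sum_const, Nat.card_Ico, pow_succ, show 2^k*2 - 2^k = 2^k by omega]; simp
              · have h5 := H1 (2^(k+1)) (by rw [pow_succ]; have : 0 < 2^k := by positivity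
                                            omega)
                have h6 : log ((2^(k+1):ℕ):ℝ) ≤ (k:ℝ)+1 := by
                  push_cast; rw [log_pow]; push_cast
                  have := log_two_lt_d9
                  have : (0:ℝ) ≤ k := by positivity
                  nlinarith
                refine le_trans (sum_le_sum_of_subset_of_nonneg ?_ ?_) (h5.trans (mul_le_mul_of_nonneg_left h6 hC1))
                · intro n hn
                  have := (hm n hn)
                  have h7 : 0 < 2^k := by positivity
                  rw [mem_Ioc]; omega
                · intro n _ _; have := kap_nn (2*a) n; positivity
          _ = _ := by ring
      calc _ ≤ ∑ n ∈ (Ioc 0 N).filter (fun n => Nat.log 2 n = k), kap a n / n * (exp (c*log 2) * E) := by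
            refine sum_le_sum (fun n hn => mul_le_mul_of_nonneg_left (e1 n hn) ?_)
            have := kap_nn a n; positivity
        _ = (∑ n ∈ (Ioc 0 N).filter (fun n => Nat.log 2 n = k), kap a n / n) * (exp (c*log 2) * E) := by rw [sum_mul]
        _ ≤ (T + C1 * ((k:ℝ)+1) / T) * (exp (c*log 2) * E) := mul_le_mul_of_nonneg_right e2 (by positivity)
        _ = exp (c*log 2) * (T * E + C1 / T * (((k:ℝ)+1) * E)) := by ring
        _ ≤ exp (c*log 2) * (T * exp (-(c/2*|(k:ℝ) * log 2 - X|)) + C1 / T * (C3 * (1+X) * exp (-(c/2*|(k:ℝ) * log 2 - X|)))) := by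
            refine mul_le_mul_of_nonneg_left (add_le_add (mul_le_mul_of_nonneg_left ?_ hT0.le) (mul_le_mul_of_nonneg_left ?_ (by positivity))) (by positivity)
            · rw [hE, exp_le_exp]
              have := abs_nonneg ((k:ℝ) * log 2 - X)
              nlinarith
            · rw [hE]; exact H3 X k hX
        _ = _ := by rw [← hTT]; field_simp
    refine (sum_le_sum hb).trans ?_
    rw [← mul_sum]
    calc _ ≤ exp (c*log 2) * (1 + C1*C3) * T * C2 := mul_le_mul_of_nonneg_left (H2 X hX _) (by positivity)
      _ = _ := by ring
  · intro n hn
    simp only [mem_Ioc] at hn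
    rw [mem_range]
    have := Nat.log_lt_self 2 (x := n) (by omega)
    omega

section
variable {ι : Type} [Fintype ι] [DecidableEq ι]

lemma np_dvd (α : ι → ℕ) {b c : ι → ℕ} (h : ∀ a, b a ≤ c a) : np α b ∣ np α c :=
  Finset.prod_dvd_prod_of_dvd _ _ (fun a _ => pow_dvd_pow _ (h a))

lemma np_fact {α : ι → ℕ} (h : ∀ a, 1 ≤ α a) (c : ι → ℕ) (p : ℕ) :
    (np α c).factorization p = ∑ a, c a * (α a).factorization p := by
  unfold np
  rw [Nat.factorization_prod (fun a _ => pow_ne_zero _ (by have := h a; omega))]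
  simp [Finsupp.finsetSum_apply]

lemma sqf_fact {n p : ℕ} (h : 2 ≤ n.factorization p) : (sqf n).factorization p = n.factorization p := by
  unfold sqf
  rw [Finsupp.prod, Nat.factorization_prod]
  · rw [Finsupp.finsetSum_apply, sum_eq_single p]
    · have hp : p.Prime := by
        by_contra hp
        rw [Nat.factorization_eq_zero_of_not_prime n hp] at h; omega
      rw [if_neg (by omega), hp.factorization_pow]; simp
    · intro q hq hqp
      have hq := Nat.prime_of_mem_primeFactors hq
      split_ifs
      · simp
      · rw [hq.factorization_pow, Finsupp.single_eq_of_ne hqp.symm]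
    · intro hp
      rw [Finsupp.notMem_support_iff] at hp; omega
  · intro q hq
    have hq := (Nat.prime_of_mem_primeFactors hq).pos
    split_ifs
    · norm_num
    · positivity

lemma np_dense {α : ι → ℕ} (hα : ∀ a, α a = 1 ∨ IsPrimePow (α a)) (c : ι → ℕ) {d : ℕ} (hd : d ∣ np α c) :
    ∃ b : ι → ℕ, (∀ a, b a ≤ c a) ∧ np α b ∣ d ∧ d ∣ np α b * sqf (np α c) := by
  classical
  have h1 : ∀ a, 1 ≤ α a := fun a => by
    rcases hα a with h | h
    · omega
    · exact h.pos
  obtain ⟨n, hn⟩ : ∃ n, n = np α c := ⟨_, rfl⟩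
  have hn0 : n ≠ 0 := by rw [hn]; exact Nat.one_le_iff_ne_zero.1 (np_pos h1 c)
  rw [← hn] at hd ⊢
  have hd0 : d ≠ 0 := fun h => hn0 (by rw [h] at hd; exact zero_dvd_iff.1 hd)
  have hdn := (Nat.factorization_le_iff_dvd hd0 hn0).2 hd
  obtain ⟨b, hb⟩ : ∃ b : ι → ℕ, b = fun a => if (α a).Prime ∧ n.factorization (α a) = 1 ∧ α a ∣ d then c a else 0 := ⟨_, rfl⟩
  have hbc : ∀ a, b a ≤ c a := fun a => by rw [hb]; dsimp only; split_ifs <;> omega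
  have hb0 : np α b ≠ 0 := Nat.one_le_iff_ne_zero.1 (np_pos h1 b)
  have hs0 : sqf n ≠ 0 := (sqf_pos n).ne'
  -- key valuation facts
  have z : ∀ p, ¬ (n.factorization p = 1 ∧ p ∣ d) → (np α b).factorization p = 0 := by
    intro p hp
    rw [np_fact h1]
    refine sum_eq_zero (fun a _ => ?_)
    rw [hb]; dsimp only
    split_ifs with h
    · by_cases he : p = α a
      · exact absurd ⟨he ▸ h.2.1, he ▸ h.2.2⟩ hp
      · rw [h.1.factorization, Finsupp.single_eq_of_ne he, mul_zero]
    · simp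
  have o : ∀ p, n.factorization p = 1 → p ∣ d → (np α b).factorization p = 1 := by
    intro p hp hpd
    have hpp : p.Prime := by
      by_contra h; rw [Nat.factorization_eq_zero_of_not_prime n h] at hp; omega
    have e : (np α c).factorization p = 1 := by rw [← hn]; exact hp
    rw [← e, np_fact h1, np_fact h1]
    refine sum_congr rfl (fun a _ => ?_)
    rw [np_fact h1] at e
    have hle : c a * (α a).factorization p ≤ 1 := by
      rw [← e]; exact single_le_sum (f := fun a => c a * (α a).factorization p) (fun _ _ => Nat.zero_le _) (mem_univ a)
    rcases Nat.eq_zero_or_pos (c a * (α a).factorization p) with h0 | h0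
    · have : b a * (α a).factorization p ≤ c a * (α a).factorization p := Nat.mul_le_mul_right _ (hbc a)
      omega
    · have hf : (α a).factorization p = 1 := by
        have := Nat.pos_of_mul_pos_left h0
        have := Nat.pos_of_mul_pos_right h0
        nlinarith
      have ha : α a = p := by
        rcases hα a with h | h
        · rw [h] at hf; simp at hf
        · obtain ⟨q, k, hq, hk, he⟩ := (isPrimePow_nat_iff _).1 h
          rw [← he, hq.factorization_pow] at hf
          by_cases hqp : p = q
          · subst hqp; rw [Finsupp.single_eq_same] at hf; rw [← he, hf, pow_one]
          · rw [Finsupp.single_eq_of_ne hqp] at hf; omega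
      congr 1
      rw [hb]; dsimp only
      rw [if_pos ⟨by rw [ha]; exact hpp, by rw [ha]; exact hp, by rw [ha]; exact hpd⟩]
  refine ⟨b, hbc, ?_, ?_⟩
  · rw [← Nat.factorization_le_iff_dvd hb0 hd0]
    intro p
    by_cases h : n.factorization p = 1 ∧ p ∣ d
    · rw [o p h.1 h.2]
      have hpp : p.Prime := by
        by_contra h'; rw [Nat.factorization_eq_zero_of_not_prime n h'] at h; omega
      exact (hpp.dvd_iff_one_le_factorization hd0).1 h.2
    · rw [z p h]; omega
  · rw [← Nat.factorization_le_iff_dvd hd0 (mul_ne_zero hb0 hs0)]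
    intro p
    rw [Nat.factorization_mul hb0 hs0, Finsupp.add_apply]
    have := hdn p
    rcases Nat.lt_or_ge (n.factorization p) 2 with h2 | h2
    · by_cases h : n.factorization p = 1 ∧ p ∣ d
      · rw [o p h.1 h.2]; omega
      · have : d.factorization p = 0 := by
          by_cases h3 : p ∣ d
          · have : n.factorization p ≠ 1 := fun h4 => h ⟨h4, h3⟩
            omega
          · exact Nat.factorization_eq_zero_of_not_dvd h3
        omega
    · rw [sqf_fact h2]; omega

end

noncomputable def cut (N : ℕ) (φ : ℕ → ℝ) (n : ℕ) : ℝ := if n ∈ Ioc 0 N then φ n else 0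

lemma cut_nn {N : ℕ} {φ : ℕ → ℝ} (h : ∀ n, 0 ≤ φ n) (n : ℕ) : 0 ≤ cut N φ n := by
  unfold cut; split_ifs
  · exact h n
  · exact le_rfl

open Classical in
noncomputable def ind (U : Set ℝ) (n : ℕ) : ℝ := if PU U n then 1 else 0
lemma ind_nn (U : Set ℝ) (n : ℕ) : 0 ≤ ind U n := by unfold ind; split_ifs <;> norm_num
noncomputable def Ds (E : Finset ℝ) (c : ℝ) (n : ℕ) : ℝ := ∑ e ∈ E, Dw c e n
lemma Ds_nn (E : Finset ℝ) (c : ℝ) (n : ℕ) : 0 ≤ Ds E c n := sum_nonneg (fun e _ => Dw_nonneg c e n)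
noncomputable def Sq (n : ℕ) : ℝ := (sqf n : ℝ)^((1:ℝ)/8)
lemma Sq_nn (n : ℕ) : 0 ≤ Sq n := by unfold Sq; positivity

lemma one_le_Ds {E : Finset ℝ} {c e K : ℝ} (hc : 0 < c) (he : e ∈ E) {n d : ℕ} (hn : n ≠ 0) (hd : d ∣ n) (h : |log d - e| ≤ K) :
    1 ≤ exp (c*K) * Ds E c n := by
  have h1 : Dw c e n ≤ Ds E c n := single_le_sum (f := fun e => Dw c e n) (fun e _ => Dw_nonneg c e n) he
  have h2 := le_Dw c e hn hd
  calc (1:ℝ) ≤ exp (c*K) * exp (-(c*|log d - e|)) := by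
        rw [← exp_add]; exact one_le_exp (by nlinarith)
    _ ≤ _ := by gcongr; exact h2.trans h1

lemma one_le_SqDs {E : Finset ℝ} {e : ℝ} (he : e ∈ E) {n d : ℕ} (hn : n ≠ 0) (hd : d ∣ n) (h : |log d - e| ≤ log (sqf n)) :
    1 ≤ Sq n * Ds E (1/8) n := by
  have h1 := one_le_Ds (c := 1/8) (by norm_num) he hn hd h
  have h2 : exp (1/8 * log (sqf n)) = Sq n := by
    unfold Sq; rw [rpow_def_of_pos (by exact_mod_cast sqf_pos n)]; ring_nf
  rwa [h2] at h1

section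
variable {ι : Type} [Fintype ι] [DecidableEq ι]

lemma log_dvd_close {α : ι → ℕ} (h1 : ∀ a, 1 ≤ α a) {b : ι → ℕ} {d s : ℕ} (hs : 0 < s) (h : np α b ∣ d) (h' : d ∣ np α b * s) :
    |log d - log (np α b)| ≤ log s := by
  have hb := np_pos h1 b
  have hd : 0 < d := Nat.pos_of_dvd_of_pos h' (by positivity)
  have l1 : log (np α b) ≤ log d := log_le_log (by exact_mod_cast hb) (by exact_mod_cast Nat.le_of_dvd hd h)
  have l2 : log d ≤ log (np α b * s : ℕ) := log_le_log (by exact_mod_cast hd) (by exact_mod_cast Nat.le_of_dvd (by positivity) h')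
  push_cast at l2
  rw [log_mul (by positivity) (by positivity)] at l2
  rw [abs_of_nonneg (by linarith)]; linarith

/-- one-sided pointwise comparison -/
lemma point1 {α β : ι → ℕ} (hα : ∀ a, α a = 1 ∨ IsPrimePow (α a)) (hβ : ∀ a, 1 ≤ β a)
    {U : Set ℝ} {E : Finset ℝ} (hU : ∀ s t, s ∈ U → t ∉ U → ∃ e ∈ E, |s - e| ≤ |s - t| ∧ |t - e| ≤ |s - t|)
    {c' K X lam : ℝ} (hc : 0 < c') {N N2 : ℕ} (c : ι → ℕ)
    (hK : ∀ b : ι → ℕ, (∀ a, b a ≤ c a) → |log (np α b) - log (np β b) / lam| ≤ K)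
    (hN : ∀ n : ℕ, 1 ≤ n → (n ∈ Ioc 0 N ↔ log n ≤ X)) (hN2 : ∀ n : ℕ, 1 ≤ n → (n ∈ Ioc 0 N2 ↔ log n / lam ≤ X)) :
    cut N (ind U) (np α c) ≤ cut N2 (ind {t | t / lam ∈ U}) (np β c) + cut N (fun n => Sq n * Ds E (1/8) n) (np α c)
      + exp (c'*K) * (exp (-(c' * |log (np α c) - X|)) + cut N (Ds E c') (np α c)) := by
  have hα1 : ∀ a, 1 ≤ α a := fun a => by
    rcases hα a with h | h
    · omega
    · exact h.pos
  have p1 := cut_nn (N := N2) (ind_nn {t | t / lam ∈ U}) (np β c)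
  have p2 := cut_nn (N := N) (φ := fun n => Sq n * Ds E (1/8) n) (fun n => mul_nonneg (Sq_nn n) (Ds_nn _ _ _)) (np α c)
  have p3 := cut_nn (N := N) (Ds_nn E c') (np α c)
  have p4 : 0 ≤ exp (c'*K) * exp (-(c' * |log (np α c) - X|)) := by positivity
  have p5 : 0 ≤ exp (c'*K) * cut N (Ds E c') (np α c) := by positivity
  rw [mul_add]
  by_cases h1 : np α c ∈ Ioc 0 N
  swap
  · rw [show cut N (ind U) (np α c) = 0 by unfold cut; rw [if_neg h1]]; linarith
  by_cases h2 : PU U (np α c)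
  swap
  · rw [show cut N (ind U) (np α c) = 0 by unfold cut ind; rw [if_neg h2, ite_self]]; linarith
  rw [show cut N (ind U) (np α c) = 1 by unfold cut ind; rw [if_pos h1, if_pos h2]]
  rw [show cut N (Ds E c') (np α c) = Ds E c' (np α c) by unfold cut; rw [if_pos h1]] at p5 ⊢
  rw [show cut N (fun n => Sq n * Ds E (1/8) n) (np α c) = Sq (np α c) * Ds E (1/8) (np α c) by unfold cut; rw [if_pos h1]] at p2 ⊢
  obtain ⟨d, hd, hdU⟩ := h2
  obtain ⟨b, hb, hb1, hb2⟩ := np_dense hα c hd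
  have n0 : np α c ≠ 0 := Nat.one_le_iff_ne_zero.1 (np_pos hα1 c)
  by_cases hbU : log (np α b) ∈ U
  swap
  · obtain ⟨e, he, h3, _⟩ := hU _ _ hdU hbU
    have := one_le_SqDs he n0 hd (h3.trans (log_dvd_close hα1 (sqf_pos _) hb1 hb2))
    linarith
  by_cases htU : log (np β b) / lam ∈ U
  swap
  · obtain ⟨e, he, h3, _⟩ := hU _ _ hbU htU
    have := one_le_Ds hc he n0 (np_dvd α hb) (h3.trans (hK b hb))
    linarith
  by_cases h3 : np β c ∈ Ioc 0 N2
  · have h4 : PU {t | t / lam ∈ U} (np β c) := ⟨np β b, np_dvd β hb, htU⟩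
    rw [show cut N2 (ind {t | t / lam ∈ U}) (np β c) = 1 by unfold cut ind; rw [if_pos h3, if_pos h4]]
    linarith
  · rw [hN2 _ (np_pos hβ c), not_le] at h3
    rw [hN _ (np_pos hα1 c)] at h1
    have h4 := hK c (fun _ => le_rfl)
    have h5 : |log (np α c) - X| ≤ K := by
      rw [abs_le] at h4 ⊢; constructor <;> linarith
    have : 1 ≤ exp (c'*K) * exp (-(c' * |log (np α c) - X|)) := by
      rw [← exp_add]; exact one_le_exp (by nlinarith)
    linarith

lemma point2 {α β : ι → ℕ} (hα : ∀ a, 1 ≤ α a) (hβ : ∀ a, IsPrimePow (β a))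
    {U : Set ℝ} {E E2 : Finset ℝ} (hU : ∀ s t, s ∈ U → t ∉ U → ∃ e ∈ E, |s - e| ≤ |s - t| ∧ |t - e| ≤ |s - t|)
    {c' K X lam : ℝ} (hc : 0 < c') (hlam : 0 < lam) (hE2 : ∀ e ∈ E, lam * e ∈ E2) {N N2 : ℕ} (c : ι → ℕ)
    (hK : ∀ b : ι → ℕ, (∀ a, b a ≤ c a) → |log (np α b) - log (np β b) / lam| ≤ K)
    (hN : ∀ n : ℕ, 1 ≤ n → (n ∈ Ioc 0 N ↔ log n ≤ X)) (hN2 : ∀ n : ℕ, 1 ≤ n → (n ∈ Ioc 0 N2 ↔ log n / lam ≤ X)) :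
    cut N2 (ind {t | t / lam ∈ U}) (np β c) ≤ cut N (ind U) (np α c) + cut N2 (fun n => Sq n * Ds E2 (1/8) n) (np β c)
      + exp (c'*K) * (exp (-(c' * |log (np α c) - X|)) + cut N (Ds E c') (np α c)) := by
  have hβ1 : ∀ a, 1 ≤ β a := fun a => (hβ a).pos
  have p1 := cut_nn (N := N) (ind_nn U) (np α c)
  have p2 := cut_nn (N := N2) (φ := fun n => Sq n * Ds E2 (1/8) n) (fun n => mul_nonneg (Sq_nn n) (Ds_nn _ _ _)) (np β c)
  have p3 := cut_nn (N := N) (Ds_nn E c') (np α c)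
  have p4 : 0 ≤ exp (c'*K) * exp (-(c' * |log (np α c) - X|)) := by positivity
  have p5 : 0 ≤ exp (c'*K) * cut N (Ds E c') (np α c) := by positivity
  rw [mul_add]
  by_cases h1 : np β c ∈ Ioc 0 N2
  swap
  · rw [show cut N2 (ind {t | t / lam ∈ U}) (np β c) = 0 by unfold cut; rw [if_neg h1]]; linarith
  by_cases h2 : PU {t | t / lam ∈ U} (np β c)
  swap
  · rw [show cut N2 (ind {t | t / lam ∈ U}) (np β c) = 0 by unfold cut ind; rw [if_neg h2, ite_self]]; linarith
  rw [show cut N2 (ind {t | t / lam ∈ U}) (np β c) = 1 by unfold cut ind; rw [if_pos h1, if_pos h2]]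
  rw [show cut N2 (fun n => Sq n * Ds E2 (1/8) n) (np β c) = Sq (np β c) * Ds E2 (1/8) (np β c) by unfold cut; rw [if_pos h1]] at p2 ⊢
  obtain ⟨d, hd, hdU⟩ := h2
  obtain ⟨b, hb, hb1, hb2⟩ := np_dense (fun a => Or.inr (hβ a)) c hd
  have n0 : np β c ≠ 0 := Nat.one_le_iff_ne_zero.1 (np_pos hβ1 c)
  by_cases htU : log (np β b) / lam ∈ U
  swap
  · obtain ⟨e, he, h3, _⟩ := hU _ _ hdU htU
    have h4 := log_dvd_close hβ1 (sqf_pos _) hb1 hb2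
    rw [div_sub_div_same, abs_div, abs_of_pos hlam,
      show log d / lam - e = (log d - lam * e) / lam by field_simp, abs_div, abs_of_pos hlam,
      div_le_div_iff_of_pos_right hlam] at h3
    have := one_le_SqDs (hE2 e he) n0 hd (h3.trans h4)
    linarith
  by_cases h3 : np α c ∈ Ioc 0 N
  · rw [show cut N (Ds E c') (np α c) = Ds E c' (np α c) by unfold cut; rw [if_pos h3]] at p5 ⊢
    by_cases hbU : log (np α b) ∈ U
    · have h4 : PU U (np α c) := ⟨np α b, np_dvd α hb, hbU⟩
      rw [show cut N (ind U) (np α c) = 1 by unfold cut ind; rw [if_pos h3, if_pos h4]]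
      linarith
    · obtain ⟨e, he, _, h5⟩ := hU _ _ htU hbU
      rw [abs_sub_comm (log (np β b) / lam)] at h5
      have := one_le_Ds hc he (Nat.one_le_iff_ne_zero.1 (np_pos hα c)) (np_dvd α hb) (h5.trans (hK b hb))
      linarith
  · rw [hN _ (np_pos hα c), not_le] at h3
    rw [hN2 _ (np_pos hβ1 c)] at h1
    have h4 := hK c (fun _ => le_rfl)
    have h5 : |log (np α c) - X| ≤ K := by
      rw [abs_le] at h4 ⊢; constructor <;> linarith
    have : 1 ≤ exp (c'*K) * exp (-(c' * |log (np α c) - X|)) := by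
      rw [← exp_add]; exact one_le_exp (by nlinarith)
    linarith

lemma tsum_cut (w : ι → ℝ≥0∞) (α : ι → ℕ) (N : ℕ) (φ : ℕ → ℝ) :
    ∑' c, pois w c * ENNReal.ofReal (cut N φ (np α c)) = ∑ n ∈ Ioc 0 N, ENNReal.ofReal (φ n) * EE w α n := by
  rw [tsum_np w α (fun n => ENNReal.ofReal (cut N φ n)), tsum_eq_sum (s := Ioc 0 N)]
  · refine sum_congr rfl (fun n hn => ?_)
    unfold cut; rw [if_pos hn]
  · intro n hn
    unfold cut; rw [if_neg hn]; simp

lemma tsum_cut_eq (w : ι → ℝ≥0∞) (α : ι → ℕ) (N : ℕ) {φ ψ : ℕ → ℝ} (hφ : ∀ n, 0 ≤ φ n) (hψ : ∀ n, 0 ≤ ψ n)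
    (hE : ∀ n, 1 ≤ n → n ≤ N → EE w α n = ENNReal.ofReal (ψ n)) :
    ∑' c, pois w c * ENNReal.ofReal (cut N φ (np α c)) = ENNReal.ofReal (∑ n ∈ Ioc 0 N, φ n * ψ n) := by
  rw [tsum_cut, ENNReal.ofReal_sum_of_nonneg (fun n _ => mul_nonneg (hφ n) (hψ n))]
  refine sum_congr rfl (fun n hn => ?_)
  rw [mem_Ioc] at hn
  rw [hE n hn.1 hn.2, ENNReal.ofReal_mul (hφ n)]

lemma tsum_all_le (w : ι → ℝ≥0∞) {α : ι → ℕ} (h : ∀ a, 1 ≤ α a) {φ ψ : ℕ → ℝ} (hφ : ∀ n, 0 ≤ φ n) (hψ : ∀ n, 0 ≤ ψ n)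
    (hE : ∀ n, 1 ≤ n → EE w α n ≤ ENNReal.ofReal (ψ n)) {S : ℝ} (hS : ∀ N, ∑ n ∈ Ioc 0 N, φ n * ψ n ≤ S) :
    ∑' c, pois w c * ENNReal.ofReal (φ (np α c)) ≤ ENNReal.ofReal S := by
  rw [tsum_np w α (fun n => ENNReal.ofReal (φ n))]
  have h0 : EE w α 0 = 0 := by
    unfold EE
    rw [ENNReal.tsum_eq_zero]
    intro c
    rw [if_neg (Nat.one_le_iff_ne_zero.1 (np_pos h c)), mul_zero]
  refine ENNReal.tsum_le_of_sum_range_le (fun N => ?_)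
  refine le_trans ?_ (ENNReal.ofReal_le_ofReal (hS N))
  rw [ENNReal.ofReal_sum_of_nonneg (fun n _ => mul_nonneg (hφ n) (hψ n))]
  have : ∑ n ∈ range N, ENNReal.ofReal (φ n) * EE w α n ≤ ∑ n ∈ insert 0 (Ioc 0 N), ENNReal.ofReal (φ n) * EE w α n := by
    refine sum_le_sum_of_subset (fun n hn => ?_)
    rw [mem_range] at hn
    rw [mem_insert, mem_Ioc]; omega
  refine this.trans ?_
  rw [sum_insert (by simp), h0, mul_zero, zero_add]
  refine sum_le_sum (fun n hn => ?_)
  rw [ENNReal.ofReal_mul (hφ n)]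
  exact mul_le_mul' le_rfl (hE n (mem_Ioc.1 hn).1)

end

lemma sumDs {g} (hg : Wt g) {c : ℝ} (hc : 0 < c) : ∃ C : ℝ, 0 ≤ C ∧ ∀ (N : ℕ) (E : Finset ℝ), 2 ≤ N → (∀ e ∈ E, 0 ≤ e) →
    ∑ m ∈ Ioc 0 N, g m * Ds E c m * (1 / m) ≤ C * log N * ∑ e ∈ E, Fh e := by
  obtain ⟨C, hC, H⟩ := WLD hg hc
  refine ⟨C, hC, fun N E hN hE => ?_⟩
  calc _ = ∑ e ∈ E, ∑ m ∈ Ioc 0 N, g m / m * Dw c e m := by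
        rw [sum_comm]
        refine sum_congr rfl (fun m _ => ?_)
        unfold Ds
        rw [mul_sum, sum_mul]
        exact sum_congr rfl (fun e _ => by ring)
    _ ≤ ∑ e ∈ E, C * log N * Fh e := sum_le_sum (fun e he => H N e hN (hE e he))
    _ = _ := by rw [mul_sum]

section
variable {ι : Type} [Fintype ι] [DecidableEq ι]

lemma pois_exp {w : ι → ℝ} (hw : ∀ a, 0 ≤ w a) (η : ι → ℝ) (c : ι → ℕ) :
    pois (fun a => ENNReal.ofReal (w a)) c * ENNReal.ofReal (exp (∑ a, c a * η a))
      = pois (fun a => ENNReal.ofReal (w a * exp (η a))) c := by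
  unfold pois
  rw [exp_sum, ENNReal.ofReal_prod_of_nonneg (fun a _ => by positivity), ← prod_mul_distrib]
  refine prod_congr rfl (fun a _ => ?_)
  dsimp only
  rw [exp_nat_mul, ENNReal.ofReal_pow (by positivity), ENNReal.ofReal_mul (hw a), mul_pow, ENNReal.mul_div_right_comm]

noncomputable def eta (C0 lam : ℝ) (α β : ι → ℕ) (a : ι) : ℝ :=
  if α a = 1 then log (β a) / lam else C0 * E8 (log (α a))

variable {C0 lam : ℝ} {R : ℕ} {α β : ι → ℕ} {w : ι → ℝ}

lemma Coup.a1 (h : Coup C0 lam R α β w) (a : ι) : 1 ≤ α a := by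
  rcases h.ap a with h | h
  · omega
  · exact h.pos

lemma Coup.eta_ge (h : Coup C0 lam R α β w) (hlam : 0 < lam) (a : ι) :
    |log (α a) - log (β a) / lam| ≤ eta C0 lam α β a := by
  unfold eta
  split_ifs with h1
  · rw [h1, Nat.cast_one, log_one, zero_sub, abs_neg, abs_of_nonneg]
    exact div_nonneg (log_natCast_nonneg _) hlam.le
  · exact h.ds a h1

lemma Coup.close (h : Coup C0 lam R α β w) (hlam : 0 < lam) (c b : ι → ℕ) (hb : ∀ a, b a ≤ c a) :
    |log (np α b) - log (np β b) / lam| ≤ ∑ a, c a * eta C0 lam α β a := by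
  rw [np_log h.a1, np_log (fun a => (h.bp a).pos), sum_div, ← sum_sub_distrib]
  refine (abs_sum_le_sum_abs _ _).trans (sum_le_sum (fun a _ => ?_))
  rw [mul_div_assoc, ← mul_sub, abs_mul, Nat.abs_cast]
  exact mul_le_mul (by exact_mod_cast hb a) (h.eta_ge hlam a) (abs_nonneg _) (by positivity)

lemma Coup.EEa (h : Coup C0 lam R α β w) (hlam : 0 < lam) (n : ℕ) (hn : 1 ≤ n) (hR : n ≤ R) :
    EE (fun a => ENNReal.ofReal (w a)) α n = ENNReal.ofReal (lam * (1 / n)) := by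
  refine EE_eq _ h.a1 lam hlam.le R (fun i hi hiR => ?_) ?_ n hn hR
  · rw [← h.ae i hi hiR, ENNReal.ofReal_sum_of_nonneg (fun a _ => h.w0 a)]
  · rw [EE_one _ h.a1 (fun a => ENNReal.ofReal_ne_top)]
    simp_rw [ENNReal.toReal_ofReal (h.w0 _)]
    rw [h.nul, exp_log hlam]

lemma Coup.EEb (h : Coup C0 lam R α β w) (n : ℕ) (hn : 1 ≤ n) (hR : n ≤ R) :
    EE (fun a => ENNReal.ofReal (w a)) β n = ENNReal.ofReal (1 / n) := by
  have hb1 : ∀ a, 1 ≤ β a := fun a => (h.bp a).pos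
  rw [← one_mul (1 / (n:ℝ))]
  refine EE_eq _ hb1 1 zero_le_one R (fun i hi hiR => ?_) ?_ n hn hR
  · rw [← h.be i hi hiR, ENNReal.ofReal_sum_of_nonneg (fun a _ => h.w0 a)]
  · rw [EE_one _ hb1 (fun a => ENNReal.ofReal_ne_top)]
    have : (univ.filter (fun a => β a = 1)) = ∅ := by
      refine filter_eq_empty_iff.2 (fun a _ ha => ?_)
      have := (h.bp a).two_le; omega
    rw [this]; simp

lemma Coup.EEc (h : Coup C0 lam R α β w) (hC0 : 0 ≤ C0) (hlam : 0 < lam) {c : ℝ} (hc : 0 ≤ c) (n : ℕ) (hn : 1 ≤ n) :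
    EE (fun a => ENNReal.ofReal (w a * exp (c * eta C0 lam α β a))) α n
      ≤ ENNReal.ofReal (lam * exp (c * exp (c*C0) * C0) * (kap (c*C0) n / n)) := by
  refine EE_le _ h.a1 (kap (c*C0)) _ (by positivity) (kap_one _) (kap_nn _) (kap_mul _) (fun i hi => ?_) ?_ n hn
  · rw [← ENNReal.ofReal_sum_of_nonneg (fun a _ => mul_nonneg (h.w0 a) (by positivity))]
    refine ENNReal.ofReal_le_ofReal ?_
    have e : ∑ a with α a = i, w a * exp (c * eta C0 lam α β a) = (∑ a with α a = i, w a) * exp (c*C0*E8 (log i)) := by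
      rw [sum_mul]
      refine sum_congr rfl (fun a ha => ?_)
      have ha := (mem_filter.1 ha).2
      unfold eta
      rw [if_neg (by omega), ha, mul_assoc c]
    rw [e]
    by_cases hi' : IsPrimePow i
    · have hnn : 0 ≤ Λ i / (i * log i) :=
        div_nonneg ArithmeticFunction.vonMangoldt_nonneg (mul_nonneg (by positivity) (log_natCast_nonneg _))
      exact mul_le_mul (h.al i hi) (kap_pp (by positivity) hi') (by positivity) hnn
    · have h1 := h.al i hi
      have h0 : Λ i = 0 := by
        by_contra h2; exact hi' (ArithmeticFunction.vonMangoldt_ne_zero_iff.1 h2)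
      rw [h0, zero_div] at h1 ⊢
      rw [zero_mul]
      exact mul_nonpos_of_nonpos_of_nonneg h1 (by positivity)
  · rw [EE_one _ h.a1 (fun a => ENNReal.ofReal_ne_top)]
    refine ENNReal.ofReal_le_ofReal ?_
    have hnn : ∀ a, 0 ≤ w a * exp (c * eta C0 lam α β a) := fun a => mul_nonneg (h.w0 a) (by positivity)
    simp_rw [ENNReal.toReal_ofReal (hnn _)]
    rw [← exp_log hlam, ← exp_add, exp_le_exp, exp_log hlam, ← h.nul]
    have hs := mul_le_mul_of_nonneg_left h.sn (show 0 ≤ c * exp (c*C0) by positivity)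
    refine le_trans ?_ (add_le_add_right hs _)
    rw [mul_sum, ← sum_add_distrib]
    refine sum_le_sum (fun a ha => ?_)
    have ha := (mem_filter.1 ha).2
    have e1 : eta C0 lam α β a = log (β a) / lam := by unfold eta; rw [if_pos ha]
    rw [e1]
    obtain ⟨y, hy⟩ : ∃ y, y = log (β a) / lam := ⟨_, rfl⟩
    have hy0 : 0 ≤ y := by rw [hy]; exact div_nonneg (log_natCast_nonneg _) hlam.le
    have hy1 : y ≤ C0 := by rw [hy]; exact h.dn a ha
    rw [← hy]
    have h2 : exp (c*y) ≤ 1 + c*y*exp (c*y) := by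
      have h3 := add_one_le_exp (-(c*y))
      have h4 : exp (-(c*y)) * exp (c*y) = 1 := by rw [← exp_add]; simp
      nlinarith [exp_pos (c*y)]
    have h3 : c*y*exp (c*y) ≤ c*y*exp (c*C0) := by gcongr
    have h4 := mul_le_mul_of_nonneg_left (h2.trans (add_le_add_right h3 1)) (h.w0 a)
    linarith

end

lemma Bs_eq (U : Set ℝ) (x : ℝ) : Bs U x = ∑ n ∈ Ioc 0 ⌊x⌋₊, ind U n * (1 / n) := by
  classical
  unfold Bs ind
  refine sum_congr rfl (fun n _ => ?_)
  by_cases h : PU U n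
  · rw [if_pos h, if_pos h, one_mul]
  · rw [if_neg h, if_neg h, zero_mul]

lemma Bs_nn (U : Set ℝ) (x : ℝ) : 0 ≤ Bs U x := by
  rw [Bs_eq]; exact sum_nonneg (fun n _ => mul_nonneg (ind_nn U n) (by positivity))

lemma mem_floor {x : ℝ} (hx : 1 ≤ x) (n : ℕ) (hn : 1 ≤ n) : n ∈ Ioc 0 ⌊x⌋₊ ↔ log n ≤ log x := by
  rw [mem_Ioc, Nat.le_floor_iff (by linarith), log_le_log_iff (by exact_mod_cast hn) (by linarith)]
  exact ⟨fun h => h.2, fun h => ⟨hn, h⟩⟩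

theorem KT : ∃ C : ℝ, 0 < C ∧ ∀ (lam x : ℝ) (U : Set ℝ) (E : Finset ℝ), 1 ≤ lam → 2 ≤ x → (∀ e ∈ E, 0 ≤ e) →
    (∀ s t, s ∈ U → t ∉ U → ∃ e ∈ E, |s - e| ≤ |s - t| ∧ |t - e| ≤ |s - t|) →
    |lam * Bs U x - Bs {t | t / lam ∈ U} (x^lam)| ≤ lam * C * (log x * ∑ e ∈ E, Fh e + (1 + log x)^((1:ℝ)/2)) := by
  obtain ⟨C0, hC0, HC⟩ := coupling
  obtain ⟨c, hc⟩ : ∃ c, c = 1/(16*(C0+1)) := ⟨_, rfl⟩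
  have hc0 : 0 < c := by rw [hc]; positivity
  have hcC : c * C0 ≤ 1/16 := by
    rw [hc, div_mul_eq_mul_div, div_le_div_iff₀ (by positivity) (by norm_num)]; linarith
  have hcC0 : 0 ≤ c * C0 := by positivity
  obtain ⟨C1, hC1, H1⟩ := sumDs Wt_sqf (c := 1/8) (by norm_num)
  obtain ⟨C2, hC2, H2⟩ := sumDs (Wt_kap hcC0 (by linarith)) hc0
  obtain ⟨C3, hC3, H3⟩ := cutoff hcC0 hcC hc0
  obtain ⟨M, hM⟩ : ∃ M, M = exp (c * exp (c*C0) * C0) := ⟨_, rfl⟩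
  have hM0 : 0 < M := by rw [hM]; positivity
  refine ⟨C1 + M * (C2 + C3), by positivity, fun lam x U E hlam hx hE hU => ?_⟩
  have hl0 : 0 < lam := by linarith
  have hx1 : 1 ≤ x := by linarith
  have hX0 : 0 < log x := log_pos (by linarith)
  have hxl : x ≤ x^lam := by
    calc x = x^(1:ℝ) := (rpow_one x).symm
      _ ≤ _ := rpow_le_rpow_of_exponent_le hx1 hlam
  have hlx : log (x^lam) = lam * log x := log_rpow (by linarith) _
  obtain ⟨N, hN⟩ : ∃ N, N = ⌊x⌋₊ := ⟨_, rfl⟩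
  obtain ⟨N2, hN2⟩ : ∃ N2, N2 = ⌊x^lam⌋₊ := ⟨_, rfl⟩
  have hN2' : 2 ≤ N := by rw [hN]; exact Nat.le_floor (by exact_mod_cast hx)
  have hNN : N ≤ N2 := by rw [hN, hN2]; exact Nat.floor_le_floor hxl
  have lN : log N ≤ log x := log_le_log (by positivity) (by rw [hN]; exact Nat.floor_le (by linarith))
  have lN2 : log N2 ≤ lam * log x := by
    rw [← hlx]
    exact log_le_log (by exact_mod_cast (by omega : 0 < N2)) (by rw [hN2]; exact Nat.floor_le (by linarith))
  have mN : ∀ n : ℕ, 1 ≤ n → (n ∈ Ioc 0 N ↔ log n ≤ log x) := by rw [hN]; exact mem_floor hx1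
  have mN2 : ∀ n : ℕ, 1 ≤ n → (n ∈ Ioc 0 N2 ↔ log n / lam ≤ log x) := by
    intro n hn
    rw [hN2, mem_floor (by linarith) n hn, hlx, div_le_iff₀' hl0]
  obtain ⟨ι, _, _, α, β, w, hcp⟩ := HC lam hlam N2 (by omega)
  obtain ⟨W, hW⟩ : ∃ W : ι → ℝ≥0∞, W = fun a => ENNReal.ofReal (w a) := ⟨_, rfl⟩
  obtain ⟨E2, hE2⟩ : ∃ E2, E2 = E.image (fun e => lam * e) := ⟨_, rfl⟩
  have hE20 : ∀ e ∈ E2, 0 ≤ e := by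
    rw [hE2]; intro e he
    obtain ⟨e', he', rfl⟩ := mem_image.1 he
    exact mul_nonneg hl0.le (hE e' he')
  obtain ⟨F, hF⟩ : ∃ F, F = ∑ e ∈ E, Fh e := ⟨_, rfl⟩
  have hF0 : 0 ≤ F := by rw [hF]; exact sum_nonneg (fun e he => (Fh_pos (hE e he)).le)
  have hF2 : ∑ e ∈ E2, Fh e ≤ F := by
    rw [hE2, sum_image (fun a _ b _ h => mul_left_cancel₀ hl0.ne' h), hF]
    exact sum_le_sum (fun e he => Fh_anti (hE e he) (le_mul_of_one_le_left (hE e he) hlam))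
  have hF20 : 0 ≤ ∑ e ∈ E2, Fh e := sum_nonneg (fun e he => (Fh_pos (hE20 e he)).le)
  obtain ⟨G, hG⟩ : ∃ G, G = (1 + log x)^((1:ℝ)/2) := ⟨_, rfl⟩
  have hG0 : 0 ≤ G := by rw [hG]; positivity
  rw [← hF, ← hG]
  have sqn : ∀ (E' : Finset ℝ) (n : ℕ), 0 ≤ Sq n * Ds E' (1/8) n := fun E' n => mul_nonneg (Sq_nn n) (Ds_nn _ _ _)
  have EA : ∀ n : ℕ, 1 ≤ n → n ≤ N → EE W α n = ENNReal.ofReal (lam * (1 / n)) := fun n h1 h2 => by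
    rw [hW]; exact hcp.EEa hl0 n h1 (by omega)
  have EB : ∀ n : ℕ, 1 ≤ n → n ≤ N2 → EE W β n = ENNReal.ofReal (1 / n) := fun n h1 h2 => by
    rw [hW]; exact hcp.EEb n h1 h2
  have t1 : ∑' c, pois W c * ENNReal.ofReal (cut N (ind U) (np α c)) = ENNReal.ofReal (lam * Bs U x) := by
    rw [tsum_cut_eq W α N (ind_nn U) (ψ := fun n : ℕ => lam * (1 / n)) (fun n => by positivity) EA, Bs_eq, ← hN, mul_sum]
    congr 1; exact sum_congr rfl (fun n _ => by ring)
  have t2 : ∑' c, pois W c * ENNReal.ofReal (cut N2 (ind {t | t / lam ∈ U}) (np β c)) = ENNReal.ofReal (Bs {t | t / lam ∈ U} (x^lam)) := by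
    rw [tsum_cut_eq W β N2 (ind_nn _) (ψ := fun n : ℕ => (1 / n)) (fun n => by positivity) EB, Bs_eq, ← hN2]
  have t3 : ∑' c, pois W c * ENNReal.ofReal (cut N (fun n => Sq n * Ds E (1/8) n) (np α c)) ≤ ENNReal.ofReal (lam * (C1 * log x * F)) := by
    rw [tsum_cut_eq W α N (sqn E) (ψ := fun n : ℕ => lam * (1 / n)) (fun n => by positivity) EA]
    refine ENNReal.ofReal_le_ofReal ?_
    calc _ = lam * ∑ n ∈ Ioc 0 N, Sq n * Ds E (1/8) n * (1/n) := by rw [mul_sum]; exact sum_congr rfl (fun n _ => by ring)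
      _ ≤ lam * (C1 * log N * F) := by rw [hF]; exact mul_le_mul_of_nonneg_left (H1 N E hN2' hE) hl0.le
      _ ≤ _ := by gcongr
  have t4 : ∑' c, pois W c * ENNReal.ofReal (cut N2 (fun n => Sq n * Ds E2 (1/8) n) (np β c)) ≤ ENNReal.ofReal (lam * (C1 * log x * F)) := by
    rw [tsum_cut_eq W β N2 (sqn E2) (ψ := fun n : ℕ => (1 / n)) (fun n => by positivity) EB]
    refine ENNReal.ofReal_le_ofReal ?_
    calc _ ≤ C1 * log N2 * ∑ e ∈ E2, Fh e := H1 N2 E2 (by omega) hE20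
      _ ≤ C1 * (lam * log x) * F := by
          refine mul_le_mul (mul_le_mul_of_nonneg_left lN2 hC1) hF2 hF20 (by positivity)
      _ = _ := by ring
  obtain ⟨K, hK⟩ : ∃ K : (ι → ℕ) → ℝ, K = fun c => ∑ a, c a * eta C0 lam α β a := ⟨_, rfl⟩
  have hKc : ∀ c : ι → ℕ, ∀ b : ι → ℕ, (∀ a, b a ≤ c a) → |log (np α b) - log (np β b) / lam| ≤ K c := by
    intro c b hb; rw [hK]; exact hcp.close hl0 c b hb
  obtain ⟨φ, hφ⟩ : ∃ φ : ℕ → ℝ, φ = fun n : ℕ => exp (-(c * |log (n:ℝ) - log x|)) + cut N (Ds E c) n := ⟨_, rfl⟩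
  have hφ0 : ∀ n, 0 ≤ φ n := fun n => by
    rw [hφ]; have := cut_nn (N := N) (Ds_nn E c) n; positivity
  have t5 : ∑' k, pois W k * ENNReal.ofReal (exp (c * K k) * φ (np α k)) ≤ ENNReal.ofReal (lam * (M * (C3 * G + C2 * log x * F))) := by
    have e : ∀ k, pois W k * ENNReal.ofReal (exp (c * K k) * φ (np α k)) =
        pois (fun a => ENNReal.ofReal (w a * exp (c * eta C0 lam α β a))) k * ENNReal.ofReal (φ (np α k)) := by
      intro k
      rw [ENNReal.ofReal_mul (by positivity), ← mul_assoc, hW, ← pois_exp hcp.w0]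
      congr 3
      rw [hK]; dsimp only
      rw [mul_sum]
      congr 1
      exact sum_congr rfl (fun a _ => by ring)
    simp_rw [e]
    refine tsum_all_le _ hcp.a1 hφ0 (ψ := fun n : ℕ => lam * M * (kap (c*C0) n / n)) (fun n => ?_) (fun n hn => ?_) (fun N' => ?_)
    · have := kap_nn (c*C0) n; positivity
    · rw [hM]; exact hcp.EEc hC0.le hl0 hc0.le n hn
    · have s1 : ∑ n ∈ Ioc 0 N', kap (c*C0) n / n * exp (-(c*|log (n:ℝ) - log x|)) ≤ C3 * G := by
        rw [hG]; exact H3 _ _ hX0.le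
      have s2 : ∑ n ∈ Ioc 0 N', cut N (Ds E c) n * (kap (c*C0) n / n) ≤ C2 * log x * F := by
        calc _ ≤ ∑ n ∈ Ioc 0 N, kap (c*C0) n * Ds E c n * (1 / n) := by
              unfold cut
              simp_rw [ite_mul, zero_mul]
              rw [← sum_filter]
              refine le_trans (le_of_eq (sum_congr rfl (fun n _ => ?_))) (sum_le_sum_of_subset_of_nonneg (f := fun n : ℕ => kap (c*C0) n * Ds E c n * (1 / n)) ?_ ?_)
              · ring
              · intro n hn; exact (mem_filter.1 hn).2
              · intro n _ _
                have := kap_nn (c*C0) n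
                have := Ds_nn E c n
                positivity
          _ ≤ C2 * log N * F := by rw [hF]; exact H2 N E hN2' hE
          _ ≤ _ := by gcongr
      calc _ = lam * (M * (∑ n ∈ Ioc 0 N', kap (c*C0) n / n * exp (-(c*|log (n:ℝ) - log x|)) + ∑ n ∈ Ioc 0 N', cut N (Ds E c) n * (kap (c*C0) n / n))) := by
            rw [← sum_add_distrib, mul_sum, mul_sum]
            refine sum_congr rfl (fun n _ => ?_)
            rw [hφ]; ring
        _ ≤ _ := by gcongr
  have comb : ∀ (f g h : (ι → ℕ) → ℝ) (a b : ℝ), (∀ k, 0 ≤ g k) → (∀ k, 0 ≤ h k) →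
      (∀ k, f k ≤ g k + h k + exp (c * K k) * φ (np α k)) →
      ∑' k, pois W k * ENNReal.ofReal (f k) = ENNReal.ofReal a → ∑' k, pois W k * ENNReal.ofReal (g k) = ENNReal.ofReal b →
      0 ≤ b → ∑' k, pois W k * ENNReal.ofReal (h k) ≤ ENNReal.ofReal (lam * (C1 * log x * F)) →
      a ≤ b + lam * (C1 * log x * F) + lam * (M * (C3 * G + C2 * log x * F)) := by
    intro f g h a b hg hh hp ha hb hb0 hh2
    have q1 : 0 ≤ lam * (C1 * log x * F) := by positivity
    have q2 : 0 ≤ lam * (M * (C3 * G + C2 * log x * F)) := by positivity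
    rw [← ENNReal.ofReal_le_ofReal_iff (by positivity), ENNReal.ofReal_add (by positivity) q2, ENNReal.ofReal_add hb0 q1, ← ha, ← hb]
    refine le_trans ?_ (add_le_add (add_le_add le_rfl hh2) t5)
    rw [← ENNReal.tsum_add, ← ENNReal.tsum_add]
    refine ENNReal.tsum_le_tsum (fun k => ?_)
    rw [← mul_add, ← mul_add, ← ENNReal.ofReal_add (hg k) (hh k), ← ENNReal.ofReal_add (add_nonneg (hg k) (hh k)) (mul_nonneg (by positivity) (hφ0 _))]
    exact mul_le_mul' le_rfl (ENNReal.ofReal_le_ofReal (hp k))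
  have r1 := comb _ _ _ _ _ (fun k => cut_nn (ind_nn _) _) (fun k => cut_nn (sqn E) _)
    (fun k => by rw [hφ]; exact point1 hcp.ap (fun a => (hcp.bp a).pos) hU hc0 k (hKc k) mN mN2) t1 t2 (Bs_nn _ _) t3
  have r2 := comb _ _ _ _ _ (fun k => cut_nn (ind_nn _) _) (fun k => cut_nn (sqn E2) _)
    (fun k => by rw [hφ]; exact point2 hcp.a1 hcp.bp hU hc0 hl0 (fun e he => by rw [hE2]; exact mem_image_of_mem _ he) k (hKc k) mN mN2)
    t2 t1 (mul_nonneg hl0.le (Bs_nn _ _)) t4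
  have key : lam * (C1 * log x * F) + lam * (M * (C3 * G + C2 * log x * F)) ≤ lam * (C1 + M * (C2 + C3)) * (log x * F + G) := by
    have z1 : 0 ≤ lam * C1 * G := by positivity
    have z2 : 0 ≤ lam * M * C2 * G := by positivity
    have z3 : 0 ≤ lam * M * C3 * (log x * F) := by positivity
    linarith
  rw [abs_le]
  constructor <;> linarith

lemma sum_ins (f : ℝ → ℝ) (a : ℝ) (s : Finset ℝ) (h : 0 ≤ f a) : ∑ e ∈ insert a s, f e ≤ f a + ∑ e ∈ s, f e := by
  by_cases ha : a ∈ s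
  · rw [insert_eq_of_mem ha]; linarith
  · rw [sum_insert ha]

lemma US_end (X a b : ℝ) : ∀ s t, s ∈ US X a b → t ∉ US X a b →
    ∃ e ∈ ({a, b, X - b, X - a} : Finset ℝ), |s - e| ≤ |s - t| ∧ |t - e| ≤ |s - t| := by
  have base : ∀ a b s t : ℝ, a < s → s < b → ¬ (a < t ∧ t < b) → (|s - a| ≤ |s - t| ∧ |t - a| ≤ |s - t|) ∨ (|s - b| ≤ |s - t| ∧ |t - b| ≤ |s - t|) := by
    intro a b s t h1 h2 h3
    by_cases h : a < t
    · right
      have : b ≤ t := by by_contra h4; exact h3 ⟨h, not_le.1 h4⟩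
      rw [abs_of_nonpos (by linarith : s - b ≤ 0), abs_of_nonpos (by linarith : s - t ≤ 0), abs_of_nonneg (by linarith : 0 ≤ t - b)]
      constructor <;> linarith
    · left
      rw [abs_of_nonneg (by linarith : 0 ≤ s - a), abs_of_nonneg (by linarith : 0 ≤ s - t), abs_of_nonpos (by linarith : t - a ≤ 0)]
      constructor <;> linarith
  intro s t hs ht
  have ht' := not_or.1 ht
  rcases hs with hs | hs
  · rcases base a b s t hs.1 hs.2 ht'.1 with h | h
    · exact ⟨a, by simp, h⟩
    · exact ⟨b, by simp, h⟩
  · rcases base _ _ s t hs.1 hs.2 ht'.2 with h | h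
    · exact ⟨X - b, by simp, h⟩
    · exact ⟨X - a, by simp, h⟩

lemma US_scale {lam : ℝ} (hl : 0 < lam) (X a b : ℝ) : {t | t / lam ∈ US X a b} = US (lam * X) (lam * a) (lam * b) := by
  ext t
  simp only [US, Set.mem_setOf_eq, lt_div_iff₀ hl, div_lt_iff₀ hl, sub_mul, mul_comm lam]

lemma pow_E8 {X p : ℝ} (hX : 1/2 ≤ X) (hp : p ≤ 7/8) : (1 + X)^p ≤ X * (3 * E8 X) := by
  calc (1 + X)^p ≤ (1 + X)^((7:ℝ)/8) := rpow_le_rpow_of_exponent_le (by linarith) hp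
    _ = (1 + X) * E8 X := by
        unfold E8
        rw [show (7:ℝ)/8 = 1 + -(1/8) by norm_num, rpow_add (by linarith), rpow_one]
    _ ≤ (X * 3) * E8 X := mul_le_mul_of_nonneg_right (by linarith) (E8_pos (by linarith)).le
    _ = _ := by ring

theorem S1d : ∃ C : ℝ, 0 ≤ C ∧ ∀ x y z : ℝ, 2 ≤ x → 1 ≤ y → y < z → z ≤ x →
    |(Hcnt x y z : ℝ) / x - Bs (US (log x) (log y) (log z)) x / log x| ≤
      C * (Fh (log x - log z) + Fh (log x - log y) + 3 * E8 (log x)) := by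
  obtain ⟨C, hC, H⟩ := S1
  refine ⟨C, hC, fun x y z hx hy hyz hzx => ?_⟩
  have hX : 1/2 ≤ log x := by
    have := log_le_log (by norm_num) hx; linarith [log_two_gt_d9]
  have hx0 : 0 < x := by linarith
  have hX0 : 0 < log x := by linarith
  have h := H x y z hx hy hyz hzx
  have e : (Hcnt x y z : ℝ) / x - Bs (US (log x) (log y) (log z)) x / log x =
      ((Hcnt x y z : ℝ) * log x - x * Bs (US (log x) (log y) (log z)) x) / (x * log x) := by
    field_simp
  rw [e, abs_div, abs_of_pos (by positivity : 0 < x * log x), div_le_iff₀ (by positivity)]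
  refine h.trans ?_
  have := mul_le_mul_of_nonneg_left (pow_E8 hX le_rfl) (by positivity : 0 ≤ C * x)
  linarith

theorem keyT : ∃ C : ℝ, 0 < C ∧ ∀ lam x y z : ℝ, 1 ≤ lam → 2 ≤ x → 1 ≤ y → y < z → z ≤ x →
    |(Hcnt x y z : ℝ) / x - (Hcnt (x^lam) (y^lam) (z^lam) : ℝ) / x^lam| ≤
      C * (Fh (log y) + Fh (log z) + Fh (log x - log z) + Fh (log x - log y) + E8 (log x)) := by
  obtain ⟨C1, hC1, H1⟩ := S1d
  obtain ⟨C2, hC2, H2⟩ := KT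
  refine ⟨3 * (2 * C1 + C2), by positivity, fun lam x y z hl hx hy hyz hzx => ?_⟩
  have hl0 : 0 < lam := by linarith
  have hX : 1/2 ≤ log x := by
    have := log_le_log (by norm_num) hx; linarith [log_two_gt_d9]
  have hxl : x ≤ x^lam := by
    calc x = x^(1:ℝ) := (rpow_one x).symm
      _ ≤ _ := rpow_le_rpow_of_exponent_le (by linarith) hl
  have h1 := H1 x y z hx hy hyz hzx
  have h2 := H1 (x^lam) (y^lam) (z^lam) (hx.trans hxl) (one_le_rpow hy hl0.le)
    (rpow_lt_rpow (by linarith) hyz hl0) (rpow_le_rpow (by linarith) hzx hl0.le)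
  rw [log_rpow (by linarith), log_rpow (by linarith), log_rpow (by linarith)] at h2
  have ha : 0 ≤ log y := log_nonneg hy
  have hab : log y ≤ log z := log_le_log (by linarith) hyz.le
  have hbX : log z ≤ log x := log_le_log (by linarith) hzx
  have h3 := H2 lam x (US (log x) (log y) (log z)) _ hl hx (fun e he => by
    simp only [mem_insert, mem_singleton] at he
    rcases he with h | h | h | h <;> linarith) (US_end _ _ _)
  rw [US_scale hl0] at h3
  generalize Bs (US (log x) (log y) (log z)) x = B at *
  generalize Bs (US (lam * log x) (lam * log y) (lam * log z)) (x^lam) = B' at *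
  generalize (Hcnt x y z : ℝ) / x = p at *
  generalize (Hcnt (x^lam) (y^lam) (z^lam) : ℝ) / x^lam = q at *
  generalize log x = X at *
  generalize log y = a at *
  generalize log z = b at *
  have hX0 : 0 < X := by linarith
  have fa := (Fh_pos ha).le
  have fb := (Fh_pos (ha.trans hab)).le
  have fc := (Fh_pos (sub_nonneg.2 hbX)).le
  have fd := (Fh_pos (sub_nonneg.2 (hab.trans hbX))).le
  have fe := (E8_pos hX0.le).le
  have g1 : Fh (lam * X - lam * b) ≤ Fh (X - b) := by
    rw [← mul_sub]; exact Fh_anti (by linarith) (le_mul_of_one_le_left (by linarith) hl)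
  have g2 : Fh (lam * X - lam * a) ≤ Fh (X - a) := by
    rw [← mul_sub]; exact Fh_anti (by linarith) (le_mul_of_one_le_left (by linarith) hl)
  have g3 : E8 (lam * X) ≤ E8 X := E8_anti hX0.le (le_mul_of_one_le_left hX0.le hl)
  have k2 : |q - B' / (lam * X)| ≤ C1 * (Fh (X - b) + Fh (X - a) + 3 * E8 X) :=
    h2.trans (mul_le_mul_of_nonneg_left (by linarith) hC1)
  have sE : ∑ e ∈ ({a, b, X - b, X - a} : Finset ℝ), Fh e ≤ Fh a + Fh b + Fh (X - b) + Fh (X - a) := by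
    have s1 := sum_ins Fh a {b, X - b, X - a} fa
    have s2 := sum_ins Fh b {X - b, X - a} fb
    have s3 := sum_ins Fh (X - b) {X - a} fc
    rw [sum_singleton] at s3
    linarith
  have k3 : |B / X - B' / (lam * X)| ≤ C2 * (Fh a + Fh b + Fh (X - b) + Fh (X - a) + 3 * E8 X) := by
    rw [show B / X - B' / (lam * X) = (lam * B - B') / (lam * X) by field_simp, abs_div, abs_of_pos (by positivity : 0 < lam * X),
      div_le_iff₀ (by positivity)]
    refine h3.trans ?_
    calc _ ≤ lam * C2 * (X * (Fh a + Fh b + Fh (X - b) + Fh (X - a)) + X * (3 * E8 X)) :=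
          mul_le_mul_of_nonneg_left (add_le_add (mul_le_mul_of_nonneg_left sE hX0.le) (pow_E8 hX (by norm_num))) (by positivity)
      _ = _ := by ring
  have k4 : |p - q| ≤ |p - B / X| + |B / X - B' / (lam * X)| + |q - B' / (lam * X)| := by
    rw [abs_sub_comm q]
    exact (abs_sub_le p (B / X) q).trans (by linarith [abs_sub_le (B / X) (B' / (lam * X)) q])
  have m : ∀ C : ℝ, 0 ≤ C → 0 ≤ C * Fh a ∧ 0 ≤ C * Fh b ∧ 0 ≤ C * Fh (X - b) ∧ 0 ≤ C * Fh (X - a) := fun C h =>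
    ⟨by positivity, by positivity, by positivity, by positivity⟩
  have m1 := m C1 hC1
  have m2 := m C2 hC2.le
  linarith

lemma E8_le_Fh : ∃ C : ℝ, 0 < C ∧ ∀ l : ℝ, 0 ≤ l → E8 l ≤ C * Fh l := by
  obtain ⟨s, hs⟩ : ∃ s, s = (2:ℝ)/3 * (1/8 - erdosDelta) := ⟨_, rfl⟩
  have hs0 : 0 < s := by rw [hs]; have := delta_lt; linarith
  refine ⟨(1 + 1/s)^((3:ℝ)/2), by positivity, fun l hl => ?_⟩
  have t1 : 1 ≤ 1 + l := by linarith
  have hl0 := log_nonneg t1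
  have h1 : 1 + log (1 + l) ≤ (1 + 1/s) * (1 + l)^s := by
    have a := log_le_rpow_div (by linarith : 0 ≤ 1 + l) hs0
    have b := one_le_rpow t1 hs0.le
    have : (1 + 1/s) * (1 + l)^s = (1 + l)^s + (1+l)^s/s := by ring
    linarith
  have h2 : (1 + log (1 + l))^((3:ℝ)/2) ≤ (1 + 1/s)^((3:ℝ)/2) * (1 + l)^(1/8 - erdosDelta) := by
    calc _ ≤ ((1 + 1/s) * (1 + l)^s)^((3:ℝ)/2) := by gcongr
      _ = _ := by
        rw [mul_rpow (by positivity) (by positivity), ← rpow_mul (by linarith), hs]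
        congr 2; ring
  unfold E8 Fh
  have e1 : (1+l)^(-(1/8):ℝ) = (1+l)^(-erdosDelta) / (1+l)^(1/8 - erdosDelta) := by
    rw [← rpow_sub (by linarith)]; congr 1; ring
  rw [e1, show (-(3/2):ℝ) = -((3:ℝ)/2) by norm_num, rpow_neg (by positivity) ((3:ℝ)/2)]
  rw [div_le_iff₀ (by positivity)]
  have h3 : 1 ≤ (1 + 1/s)^((3:ℝ)/2) * (1 + l)^(1/8 - erdosDelta) * ((1 + log (1 + l))^((3:ℝ)/2))⁻¹ := by
    rw [← div_eq_mul_inv, le_div_iff₀ (by positivity), one_mul]; exact h2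
  have h4 : 0 ≤ (1+l)^(-erdosDelta) := by positivity
  nlinarith [mul_le_mul_of_nonneg_left h3 h4]

lemma Fh_bound {l : ℝ} (hl : 1 < l) : Fh l ≤ 1 / (l^erdosDelta * log l^((3:ℝ)/2)) := by
  have h0 := log_pos hl
  have h1 : log l ≤ 1 + log (1 + l) := by
    have := log_le_log (by linarith : 0 < l) (by linarith : l ≤ 1 + l); linarith
  unfold Fh
  rw [show (-(3/2):ℝ) = -((3:ℝ)/2) by norm_num, rpow_neg (by linarith), rpow_neg (by linarith), ← mul_inv, one_div]
  have d := delta_pos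
  gcongr
  linarith

lemma Fh_tend : Tendsto Fh atTop (nhds 0) := by
  have h1 : Tendsto (fun l : ℝ => (1 + l)^(-erdosDelta)) atTop (nhds 0) :=
    (tendsto_rpow_neg_atTop delta_pos).comp (tendsto_atTop_add_const_left _ 1 tendsto_id)
  refine tendsto_of_tendsto_of_tendsto_of_le_of_le' tendsto_const_nhds h1 ?_ ?_
  · filter_upwards [eventually_ge_atTop 0] with l hl using (Fh_pos hl).le
  · filter_upwards [eventually_ge_atTop 0] with l hl
    have := log_nonneg (by linarith : 1 ≤ 1 + l)
    exact mul_le_of_le_one_right (by positivity) (rpow_le_one_of_one_le_of_nonpos (by linarith) (by norm_num))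

lemma E8_tend : Tendsto E8 atTop (nhds 0) := by
  have h := (tendsto_rpow_neg_atTop (by norm_num : (0:ℝ) < 1/8)).comp (tendsto_atTop_add_const_left (atTop : Filter ℝ) 1 tendsto_id)
  exact h

noncomputable def gq (u v x : ℝ) : ℝ := (Hcnt x (x^u) (x^v) : ℝ) / x

theorem gq_key : ∃ C : ℝ, 0 < C ∧ ∀ u v x x' : ℝ, 0 < u → u < v → v < 1 → 2 ≤ x → x ≤ x' →
    |gq u v x - gq u v x'| ≤ C * (Fh (u * log x) + Fh (v * log x) + Fh ((1 - v) * log x) + Fh ((1 - u) * log x) + E8 (log x)) := by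
  obtain ⟨C, hC, H⟩ := keyT
  refine ⟨C, hC, fun u v x x' hu huv hv hx hxx => ?_⟩
  have x0 : 0 < x := by linarith
  have hX : 0 < log x := log_pos (by linarith)
  have hX' : log x ≤ log x' := log_le_log x0 hxx
  have e : x^(log x' / log x) = x' := by
    rw [rpow_def_of_pos x0, mul_div_cancel₀ _ hX.ne', exp_log (by linarith)]
  have h := H (log x' / log x) x (x^u) (x^v) ((one_le_div hX).2 hX') hx (one_le_rpow (by linarith) hu.le)
    (rpow_lt_rpow_of_exponent_lt (by linarith) huv)
    (by simpa using rpow_le_rpow_of_exponent_le (by linarith : 1 ≤ x) hv.le)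
  rw [← rpow_mul x0.le, ← rpow_mul x0.le, mul_comm u, mul_comm v, rpow_mul x0.le, rpow_mul x0.le, e,
    log_rpow x0, log_rpow x0] at h
  unfold gq
  rw [sub_mul, sub_mul, one_mul]
  exact h

lemma gq_lim {u v : ℝ} (hu : 0 < u) (huv : u < v) (hv : v < 1) : ∃ L, Tendsto (gq u v) atTop (nhds L) := by
  obtain ⟨C, hC, H⟩ := gq_key
  refine cauchySeq_tendsto_of_complete (Metric.cauchySeq_iff'.2 (fun ε hε => ?_))
  have F : ∀ c : ℝ, 0 < c → Tendsto (fun x : ℝ => Fh (c * log x)) atTop (nhds 0) := fun c hc =>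
    Fh_tend.comp (tendsto_log_atTop.const_mul_atTop hc)
  have T := ((((F u hu).add (F v (by linarith))).add (F (1 - v) (by linarith))).add (F (1 - u) (by linarith))).add (E8_tend.comp tendsto_log_atTop)
  have T := T.const_mul C
  simp only [add_zero, mul_zero] at T
  obtain ⟨N, hN⟩ := ((T.eventually (gt_mem_nhds hε)).and (eventually_ge_atTop 2)).exists
  refine ⟨N, fun n hn => ?_⟩
  rw [dist_comm, dist_eq]
  exact (H u v N n hu huv hv hN.2 hn).trans_lt hN.1

lemma Hcnt_le {x : ℝ} (hx : 0 ≤ x) (y z : ℝ) : (Hcnt x y z : ℝ) ≤ x := by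
  rw [Hcnt_eq hx]
  calc _ ≤ ∑ n ∈ Ioc 0 ⌊x⌋₊, (1:ℝ) := sum_le_sum (fun n _ => by split_ifs <;> norm_num)
    _ = ⌊x⌋₊ := by simp
    _ ≤ x := Nat.floor_le hx

lemma Hcnt_ge {x y z : ℝ} (hx : 0 ≤ x) (S : Finset ℕ) (h : ∀ n ∈ Ioc 0 ⌊x⌋₊, n ∉ S → ∃ d : ℕ, d ∣ n ∧ y < (d:ℝ) ∧ (d:ℝ) < z) :
    x - 1 - #S ≤ (Hcnt x y z : ℝ) := by
  classical
  rw [Hcnt_eq hx]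
  have h1 : ∑ n ∈ Ioc 0 ⌊x⌋₊, (1:ℝ) = ⌊x⌋₊ := by simp
  have h2 : ∑ n ∈ Ioc 0 ⌊x⌋₊, (if n ∈ S then (1:ℝ) else 0) ≤ #S := by
    rw [sum_boole]
    exact_mod_cast card_le_card (fun n hn => (mem_filter.1 hn).2)
  have h3 := Nat.lt_floor_add_one x
  have h4 : ∑ n ∈ Ioc 0 ⌊x⌋₊, (1:ℝ) ≤ ∑ n ∈ Ioc 0 ⌊x⌋₊, ((if (∃ d : ℕ, d ∣ n ∧ y < (d:ℝ) ∧ (d:ℝ) < z) then (1:ℝ) else 0) + (if n ∈ S then (1:ℝ) else 0)) := by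
    refine sum_le_sum (fun n hn => ?_)
    by_cases hS : n ∈ S
    · rw [if_pos hS]; split_ifs <;> norm_num
    · rw [if_pos (h n hn hS)]; split_ifs <;> norm_num
  rw [sum_add_distrib] at h4
  linarith

lemma gq_le {u v x : ℝ} (hx : 0 < x) : gq u v x ≤ 1 := (div_le_one hx).2 (Hcnt_le hx.le _ _)

lemma gq_one {u : ℝ} (hu : u < 1) : Tendsto (gq u 1) atTop (nhds 1) := by
  have T1 : Tendsto (fun x : ℝ => 1 - 3 * x⁻¹ - x^(-(1-u))) atTop (nhds (1 - 3 * 0 - 0)) :=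
    (tendsto_const_nhds.sub (tendsto_inv_atTop_zero.const_mul 3)).sub (tendsto_rpow_neg_atTop (by linarith))
  rw [show (1:ℝ) - 3 * 0 - 0 = 1 by norm_num] at T1
  refine tendsto_of_tendsto_of_tendsto_of_le_of_le' T1 tendsto_const_nhds ?_ ?_
  · filter_upwards [eventually_gt_atTop 0] with x hx
    have h := Hcnt_ge (y := x^u) (z := x^(1:ℝ)) hx.le (insert ⌊x⌋₊ (Ioc 0 ⌊x^u⌋₊)) (fun n hn hS => by
      rw [mem_insert, not_or, mem_Ioc] at hS
      rw [mem_Ioc] at hn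
      refine ⟨n, dvd_rfl, ?_, ?_⟩
      · by_contra h; exact hS.2 ⟨hn.1, Nat.le_floor (not_lt.1 h)⟩
      · rw [rpow_one]
        exact lt_of_lt_of_le (by exact_mod_cast (by omega : n < ⌊x⌋₊)) (Nat.floor_le hx.le))
    have hc : ((#(insert ⌊x⌋₊ (Ioc 0 ⌊x^u⌋₊)) : ℕ) : ℝ) ≤ x^u + 1 := by
      have h1 := card_insert_le ⌊x⌋₊ (Ioc 0 ⌊x^u⌋₊)
      rw [Nat.card_Ioc] at h1
      have h2 : ((#(insert ⌊x⌋₊ (Ioc 0 ⌊x^u⌋₊)) : ℕ) : ℝ) ≤ (⌊x^u⌋₊ : ℝ) + 1 := by exact_mod_cast h1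
      have := Nat.floor_le (by positivity : 0 ≤ x^u)
      linarith
    unfold gq
    rw [le_div_iff₀ hx]
    have e : x^(-(1-u)) * x = x^u := by
      nth_rewrite 2 [← rpow_one x]
      rw [← rpow_add hx]; congr 1; ring
    have e2 : x⁻¹ * x = 1 := inv_mul_cancel₀ hx.ne'
    calc _ = x - 3 * (x⁻¹ * x) - x^(-(1-u)) * x := by ring
      _ ≤ _ := by rw [e, e2]; linarith
  · filter_upwards [eventually_gt_atTop 0] with x hx using gq_le hx

lemma exists_P {ε : ℝ} (hε : 0 < ε) : ∃ P : ℕ, 0 < P ∧ (P.totient : ℝ) ≤ ε * P := by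
  obtain ⟨C, _, H⟩ := sum_inv_prime
  have T : Tendsto (fun N : ℕ => log (log N) - C) atTop atTop :=
    tendsto_atTop_add_const_right _ (-C) (tendsto_log_atTop.comp (tendsto_log_atTop.comp tendsto_natCast_atTop_atTop))
  obtain ⟨N, hN1, hN2⟩ := ((T.eventually_ge_atTop (-log ε)).and (eventually_ge_atTop 2)).exists
  refine ⟨primorial N, primorial_pos N, ?_⟩
  have h := (abs_le.1 (H N hN2)).1
  have e : ((primorial N).totient : ℝ) = primorial N * ∏ p ∈ (Ioc 0 N).filter Nat.Prime, (1 - (p:ℝ)⁻¹) := by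
    have h1 := Nat.totient_eq_mul_prod_factors (primorial N)
    have h2 : (primorial N).primeFactors = (Ioc 0 N).filter Nat.Prime := by
      ext p
      rw [primeFactors_primorial, Nat.mem_primesLE, mem_filter, mem_Ioc]
      exact ⟨fun h => ⟨⟨h.2.pos, h.1⟩, h.2⟩, fun h => ⟨h.1.2, h.2⟩⟩
    rw [h2] at h1
    have h3 : (((primorial N).totient : ℚ) : ℝ) = ((primorial N * ∏ p ∈ (Ioc 0 N).filter Nat.Prime, (1 - (p:ℚ)⁻¹) : ℚ) : ℝ) := by rw [h1]
    push_cast at h3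
    exact h3
  rw [e, mul_comm]
  refine mul_le_mul_of_nonneg_right ?_ (by positivity)
  calc _ ≤ ∏ p ∈ (Ioc 0 N).filter Nat.Prime, exp (-(1/(p:ℝ))) := by
        refine prod_le_prod (fun p hp => ?_) (fun p _ => ?_)
        · have : (1:ℝ) ≤ p := by exact_mod_cast (mem_filter.1 hp).2.pos
          rw [sub_nonneg]; exact inv_le_one_of_one_le₀ this
        · have := add_one_le_exp (-(1/(p:ℝ)))
          rw [one_div] at *; linarith
    _ = exp (-∑ p ∈ (Ioc 0 N).filter Nat.Prime, (1/(p:ℝ))) := by rw [← exp_sum, sum_neg_distrib]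
    _ ≤ exp (log ε) := exp_le_exp.2 (by linarith)
    _ = ε := exp_log hε

lemma gq_zero {v : ℝ} (hv : 0 < v) : Tendsto (gq 0 v) atTop (nhds 1) := by
  rw [Metric.tendsto_atTop']
  intro ε hε
  obtain ⟨P, hP, hPε⟩ := exists_P (half_pos hε)
  have T1 : Tendsto (fun x : ℝ => ((P.totient : ℝ) + 1) * x⁻¹) atTop (nhds (((P.totient : ℝ) + 1) * 0)) := tendsto_inv_atTop_zero.const_mul _
  rw [mul_zero] at T1
  have := ((T1.eventually (gt_mem_nhds (half_pos hε))).and (((tendsto_rpow_atTop hv).eventually_gt_atTop (P:ℝ)).and (eventually_gt_atTop 0)))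
  obtain ⟨M, hM⟩ := eventually_atTop.1 this
  refine ⟨M, fun x hx => ?_⟩
  obtain ⟨h1, h2, h3⟩ := hM x (le_of_lt hx)
  have h := Hcnt_ge (y := x^(0:ℝ)) (z := x^v) h3.le ((Ico 1 (1 + ⌊x⌋₊)).filter (P.Coprime)) (fun n hn hS => by
    rw [mem_Ioc] at hn
    have : ¬ P.Coprime n := fun hc => hS (mem_filter.2 ⟨mem_Ico.2 ⟨by omega, by omega⟩, hc⟩)
    have h0 : 0 < P.gcd n := Nat.gcd_pos_of_pos_left _ hP
    have hne : P.gcd n ≠ 1 := this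
    refine ⟨P.gcd n, Nat.gcd_dvd_right _ _, ?_, lt_of_le_of_lt ?_ h2⟩
    · rw [rpow_zero]; exact_mod_cast (by omega : 1 < P.gcd n)
    · exact_mod_cast Nat.le_of_dvd hP (Nat.gcd_dvd_left _ _))
  have hc : ((#((Ico 1 (1 + ⌊x⌋₊)).filter (P.Coprime)) : ℕ) : ℝ) ≤ ε/2 * x + P.totient := by
    have c1 : ((#((Ico 1 (1 + ⌊x⌋₊)).filter (P.Coprime)) : ℕ) : ℝ) ≤ P.totient * (((⌊x⌋₊ / P : ℕ) : ℝ) + 1) := by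
      exact_mod_cast Nat.Ico_filter_coprime_le 1 ⌊x⌋₊ hP.ne'
    have c2 : ((⌊x⌋₊ / P : ℕ) : ℝ) ≤ x / P := Nat.cast_div_le.trans (by gcongr; exact Nat.floor_le h3.le)
    have c3 : (P.totient : ℝ) * (x / P) ≤ ε/2 * x := by
      rw [mul_div_assoc', div_le_iff₀ (by exact_mod_cast hP)]
      nlinarith
    have c4 := mul_le_mul_of_nonneg_left c2 (Nat.cast_nonneg (α := ℝ) P.totient)
    linarith
  have hg : 1 - ε < gq 0 v x := by
    unfold gq
    rw [lt_div_iff₀ h3]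
    rw [← div_eq_mul_inv, div_lt_iff₀ h3] at h1
    linarith
  rw [dist_eq, abs_lt]
  have := gq_le (u := 0) (v := v) h3
  constructor <;> linarith

theorem main : ∃ h : ℝ → ℝ → ℝ,
    (∀ u v : ℝ, 0 ≤ u → u < v → v ≤ 1 → Tendsto (gq u v) atTop (nhds (h u v))) ∧
    (∃ C : ℝ, 0 < C ∧ ∀ x y z : ℝ, 3 ≤ y → y < z → z ≤ sqrt x →
      |(Hcnt x y z : ℝ) - x * h (log y / log x) (log z / log x)| ≤
        C * x / (log y ^ erdosDelta * log (log y) ^ ((3:ℝ)/2))) := by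
  have hex : ∀ u v : ℝ, 0 ≤ u → u < v → v ≤ 1 → Tendsto (gq u v) atTop (nhds (limUnder atTop (gq u v))) := by
    intro u v hu huv hv
    refine tendsto_nhds_limUnder ?_
    rcases hv.lt_or_eq with hv | rfl
    · rcases hu.lt_or_eq with hu | rfl
      · exact gq_lim hu huv hv
      · exact ⟨1, gq_zero huv⟩
    · exact ⟨1, gq_one huv⟩
  refine ⟨fun u v => limUnder atTop (gq u v), hex, ?_⟩
  obtain ⟨C1, hC1, H1⟩ := gq_key
  obtain ⟨C2, hC2, H2⟩ := E8_le_Fh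
  refine ⟨C1 * (4 + C2), by positivity, fun x y z hy hyz hz => ?_⟩
  have hx0 : 0 < x := by
    by_contra h
    rw [sqrt_eq_zero_of_nonpos (not_lt.1 h)] at hz; linarith
  have hz2 : z^2 ≤ x := by
    have := sq_sqrt hx0.le
    nlinarith [sqrt_nonneg x]
  have hx2 : 2 ≤ x := by nlinarith
  have hly : 1 < log y := by
    rw [lt_log_iff_exp_lt (by linarith)]; linarith [exp_one_lt_d9]
  have hlz : log y < log z := log_lt_log (by linarith) hyz
  have hlx : 2 * log z ≤ log x := by
    have := log_le_log (pow_pos (by linarith) 2 : 0 < z^2) hz2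
    rwa [log_pow] at this
  obtain ⟨X, hX⟩ : ∃ X, X = log x := ⟨_, rfl⟩
  rw [← hX] at hlx ⊢
  have hX0 : 0 < X := by linarith
  obtain ⟨u, hu⟩ : ∃ u, u = log y / X := ⟨_, rfl⟩
  obtain ⟨v, hv⟩ : ∃ v, v = log z / X := ⟨_, rfl⟩
  have huX : u * X = log y := by rw [hu]; field_simp
  have hvX : v * X = log z := by rw [hv]; field_simp
  have hu0 : 0 < u := by rw [hu]; exact div_pos (by linarith) hX0
  have huv : u < v := by rw [hu, hv]; exact div_lt_div_of_pos_right hlz hX0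
  have hv1 : v < 1 := by rw [hv, div_lt_one hX0]; linarith
  have exu : x^u = y := by rw [rpow_def_of_pos hx0, ← hX, mul_comm, huX, exp_log (by linarith)]
  have exv : x^v = z := by rw [rpow_def_of_pos hx0, ← hX, mul_comm, hvX, exp_log (by linarith)]
  rw [← hu, ← hv]
  obtain ⟨L, hL⟩ : ∃ L, L = limUnder atTop (gq u v) := ⟨_, rfl⟩
  have T := hex u v hu0.le huv hv1.le
  simp only [← hL] at T ⊢
  have F : ∀ t, log y ≤ t → Fh t ≤ Fh (log y) := fun t ht => Fh_anti (by linarith) ht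
  have B : |gq u v x - L| ≤ C1 * (4 + C2) * Fh (log y) := by
    refine le_of_tendsto ((tendsto_const_nhds.sub T).abs) ?_
    filter_upwards [eventually_ge_atTop x] with x' hx'
    refine (H1 u v x x' hu0 huv hv1 hx2 hx').trans ?_
    rw [← hX, mul_assoc]
    refine mul_le_mul_of_nonneg_left ?_ hC1.le
    rw [sub_mul, sub_mul, huX, hvX, one_mul]
    have b1 := F (log z) hlz.le
    have b2 := F (X - log z) (by linarith)
    have b3 := F (X - log y) (by linarith)
    have b4 := (E8_anti (by linarith : 0 ≤ log y) (by linarith : log y ≤ X)).trans (H2 (log y) (by linarith))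
    linarith
  have e : (Hcnt x y z : ℝ) - x * L = x * (gq u v x - L) := by
    unfold gq; rw [exu, exv]; field_simp
  rw [e, abs_mul, abs_of_pos hx0]
  calc x * |gq u v x - L| ≤ x * (C1 * (4 + C2) * (1 / (log y ^ erdosDelta * log (log y) ^ ((3:ℝ)/2)))) :=
        mul_le_mul_of_nonneg_left (B.trans (mul_le_mul_of_nonneg_left (Fh_bound hly) (by positivity))) hx0.le
    _ = _ := by ring

end FF

theorem stmt_0 :
    ∃ h : ℝ → ℝ → ℝ,
      (∀ u v : ℝ, 0 ≤ u → u < v → v ≤ 1 →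
        Tendsto (fun x : ℝ => (Hcnt x (x ^ u) (x ^ v) : ℝ) / x) atTop (nhds (h u v))) ∧
      (∃ C : ℝ, 0 < C ∧ ∀ x y z : ℝ, 3 ≤ y → y < z → z ≤ Real.sqrt x →
        |(Hcnt x y z : ℝ) - x * h (Real.log y / Real.log x) (Real.log z / Real.log x)| ≤
          C * x / (Real.log y ^ erdosDelta * Real.log (Real.log y) ^ ((3 : ℝ) / 2))) := by
  exact FF.main
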